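/- Let d ≥ 1, 0 < s < ∞ and 1 ≤ r, p, q ≤ ∞ satisfy 1/q − 1/p < s/d (with 1/∞ = 0). Then there exist a constant C > 0 and natural numbers W₀, L₀ (all depending only on s, r, p, q, d) such that for every W ≥ W₀, every L ≥ L₀ and every measurable f : [0,1]^d → ℝ with ‖f‖_{B^s_{q,r}([0,1]^d)} < ∞, there exists g ∈ NN_{d,1}(W,L) with ‖f − g‖_{L^p([0,1]^d)} ≤ C · ‖f‖_{B^s_{q,r}([0,1]^d)} · (WL)^{−2s/d}. -/

import Mathlib

open MeasureTheory ENNReal Finset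

noncomputable section

/-- The ReLU activation function. -/
def relu (t : ℝ) : ℝ := max t 0

/-- `A` is an affine map `ℝ^n → ℝ^m`. -/
def IsAffineMap {n m : ℕ} (A : (Fin n → ℝ) → (Fin m → ℝ)) : Prop :=
  ∃ (M : Matrix (Fin m) (Fin n) ℝ) (c : Fin m → ℝ),
    ∀ x i, A x i = (∑ j, M i j * x j) + c i

/-- Auxiliary definition of the ReLU network class, by recursion on the number
of hidden layers. -/
def NNaux (k W : ℕ) : ℕ → (d : ℕ) → Set ((Fin d → ℝ) → (Fin k → ℝ))
  | 0, _ => {g | IsAffineMap g}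
  | (L + 1), d => {g | ∃ N : ℕ, 1 ≤ N ∧ N ≤ W ∧
      ∃ (A : (Fin d → ℝ) → (Fin N → ℝ)) (h : (Fin N → ℝ) → (Fin k → ℝ)),
        IsAffineMap A ∧ h ∈ NNaux k W L N ∧
        g = fun x => h (fun i => relu (A x i))}

/-- The class `NN_{d,k}(W,L)` of functions `ℝ^d → ℝ^k` computed by fully connected
ReLU networks with width at most `W` and `L` hidden layers. -/
def NN (d k W L : ℕ) : Set ((Fin d → ℝ) → (Fin k → ℝ)) := NNaux k W L d


/-- The unit cube `[0,1]^d`. -/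
def unitCube (d : ℕ) : Set (Fin d → ℝ) := Set.Icc 0 1

/-- The `k`-th order difference `Δ_h^k f (x) = ∑_{j=0}^k (−1)^j C(k,j) f (x + j h)`. -/
def kthDiff (d k : ℕ) (h : Fin d → ℝ) (f : (Fin d → ℝ) → ℝ) (x : Fin d → ℝ) : ℝ :=
  ∑ j ∈ Finset.range (k + 1), (-1 : ℝ) ^ j * (k.choose j : ℝ) * f (x + (j : ℝ) • h)

/-- The `k`-th order modulus of smoothness
`ω_k(f,t)_q = sup_{|h| < t} ‖Δ_h^k f‖_{L^q(Ω_{kh})}` on `Ω = [0,1]^d`,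
where `Ω_{kh} = {x ∈ Ω : x + k h ∈ Ω}` and `|h|` is the Euclidean norm. -/
def modulus (d k : ℕ) (q : ℝ≥0∞) (f : (Fin d → ℝ) → ℝ) (t : ℝ) : ℝ≥0∞ :=
  ⨆ (h : Fin d → ℝ) (_ : Real.sqrt (∑ j, h j ^ 2) < t),
    eLpNorm (kthDiff d k h f) q
      (volume.restrict {x | x ∈ unitCube d ∧ x + (k : ℝ) • h ∈ unitCube d})

/-- The Besov norm `‖f‖_{B^s_{q,r}([0,1]^d)} = ‖f‖_{L^q} + |f|_{B^s_{q,r}}`, where the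
Besov seminorm is defined through the modulus of smoothness of order `k = ⌊s⌋ + 1`:
`|f|_{B^s_{q,r}} = (∫_0^∞ (t^{−s} ω_k(f,t)_q)^r t^{−1} dt)^{1/r}` for `r < ∞`, and
`|f|_{B^s_{q,∞}} = sup_{t > 0} t^{−s} ω_k(f,t)_q`. -/
def besovNorm (d : ℕ) (s : ℝ) (q r : ℝ≥0∞) (f : (Fin d → ℝ) → ℝ) : ℝ≥0∞ :=
  eLpNorm f q (volume.restrict (unitCube d)) +
    (if r = ⊤ then
      ⨆ (t : ℝ) (_ : 0 < t), ENNReal.ofReal (t ^ (-s)) * modulus d (⌊s⌋₊ + 1) q f t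
    else
      (∫⁻ t in Set.Ioi (0 : ℝ),
        (ENNReal.ofReal (t ^ (-s)) * modulus d (⌊s⌋₊ + 1) q f t) ^ r.toReal *
          ENNReal.ofReal t⁻¹) ^ (1 / r.toReal))

section NetCalculus

variable {X : Type}

/-- Functions that are affine combinations of the functions in `s`. -/
def aff (s : Set (X → ℝ)) : Submodule ℝ (X → ℝ) := Submodule.span ℝ (insert 1 s)

/-- The composition of the activation function with `f`. -/
def rel (f : X → ℝ) : X → ℝ := fun x => relu (f x)

/-- `Net W L U V`: all functions of `V` are computable from those of `U` by `L` hidden layers of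
width at most `W`. -/
def Net (W : ℕ) : ℕ → Submodule ℝ (X → ℝ) → Submodule ℝ (X → ℝ) → Prop
  | 0, U, V => V ≤ U
  | L + 1, U, V => ∃ s : Finset (X → ℝ), s.card ≤ W ∧ (∀ f ∈ s, f ∈ U) ∧
      Net W L (aff (rel '' (s : Set (X → ℝ)))) V

lemma one_mem_aff (s : Set (X → ℝ)) : (1 : X → ℝ) ∈ aff s :=
  Submodule.subset_span (Set.mem_insert _ _)

lemma mem_aff {s : Set (X → ℝ)} {f : X → ℝ} (h : f ∈ s) : f ∈ aff s :=
  Submodule.subset_span (Set.mem_insert_of_mem _ h)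

lemma const_mem {U : Submodule ℝ (X → ℝ)} (h1 : (1 : X → ℝ) ∈ U) (c : ℝ) :
    (fun _ => c : X → ℝ) ∈ U := by
  have := U.smul_mem c h1
  convert this using 1
  ext x; simp

lemma aff_le {s : Set (X → ℝ)} {U : Submodule ℝ (X → ℝ)} (h1 : (1 : X → ℝ) ∈ U)
    (h : ∀ f ∈ s, f ∈ U) : aff s ≤ U := by
  refine Submodule.span_le.2 ?_
  rintro f (rfl | hf)
  · exact h1
  · exact h f hf

lemma aff_mono {s t : Set (X → ℝ)} (h : s ⊆ t) : aff s ≤ aff t :=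
  Submodule.span_mono (Set.insert_subset_insert h)

lemma Net.mono {W W' L : ℕ} {U U' V V' : Submodule ℝ (X → ℝ)} (h : Net W L U V)
    (hW : W ≤ W') (hU : U ≤ U') (hV : V' ≤ V) : Net W' L U' V' := by
  induction L generalizing U U' with
  | zero => exact hV.trans (h.trans hU)
  | succ L ih =>
    obtain ⟨s, hs, hsU, hn⟩ := h
    exact ⟨s, hs.trans hW, fun f hf => hU (hsU f hf), ih hn le_rfl⟩

lemma Net.trans {W L L' : ℕ} {U V V' : Submodule ℝ (X → ℝ)} (h : Net W L U V)
    (h' : Net W L' V V') : Net W (L + L') U V' := by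
  induction L generalizing U with
  | zero => rw [Nat.zero_add]; exact h'.mono le_rfl h le_rfl
  | succ L ih =>
    obtain ⟨s, hs, hsU, hn⟩ := h
    rw [Nat.succ_add]
    exact ⟨s, hs, hsU, ih hn⟩

lemma Net.par {W W' L : ℕ} {U V V' : Submodule ℝ (X → ℝ)} (h : Net W L U V)
    (h' : Net W' L U V') : Net (W + W') L U (V ⊔ V') := by
  classical
  suffices H : ∀ U U' U'' : Submodule ℝ (X → ℝ), U ≤ U'' → U' ≤ U'' → Net W L U V →
      Net W' L U' V' → Net (W + W') L U'' (V ⊔ V') from H U U U le_rfl le_rfl h h'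
  clear h h' U
  induction L with
  | zero => intro U U' U'' h1 h2 h h'; exact sup_le (le_trans h h1) (le_trans h' h2)
  | succ L ih =>
    rintro U U' U'' h1 h2 ⟨s, hs, hsU, hn⟩ ⟨s', hs', hsU', hn'⟩
    refine ⟨s ∪ s', (card_union_le _ _).trans (add_le_add hs hs'), ?_, ?_⟩
    · intro f hf
      rcases Finset.mem_union.1 hf with hf | hf
      · exact h1 (hsU f hf)
      · exact h2 (hsU' f hf)
    · refine ih _ _ _ ?_ ?_ hn hn' <;> refine aff_mono (Set.image_mono ?_) <;> simp

lemma rel_sub_rel_neg (f : X → ℝ) : rel f - rel (-f) = f := by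
  ext x
  simp only [rel, relu, Pi.sub_apply, Pi.neg_apply]
  rcases le_total 0 (f x) with h | h
  · rw [max_eq_left h, max_eq_right (by linarith)]; ring
  · rw [max_eq_right h, max_eq_left (by linarith)]; ring

lemma Net.carry (L : ℕ) {U : Submodule ℝ (X → ℝ)} (h1 : (1 : X → ℝ) ∈ U)
    (T : Finset (X → ℝ)) (hT : ∀ f ∈ T, f ∈ U) : Net (2 * T.card) L U (aff (T : Set (X → ℝ))) := by
  classical
  induction L generalizing U with
  | zero => exact aff_le h1 hT
  | succ L ih =>
    refine ⟨T ∪ T.image Neg.neg, ?_, ?_, ih (one_mem_aff _) ?_⟩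
    · refine (card_union_le _ _).trans ?_
      have := card_image_le (s := T) (f := (Neg.neg : (X → ℝ) → X → ℝ))
      omega
    · intro f hf
      rcases Finset.mem_union.1 hf with hf | hf
      · exact hT f hf
      · obtain ⟨g, hg, rfl⟩ := Finset.mem_image.1 hf
        exact U.neg_mem (hT g hg)
    · intro f hf
      rw [← rel_sub_rel_neg f]
      refine Submodule.sub_mem _ (mem_aff ⟨f, by simp [hf], rfl⟩) (mem_aff ⟨-f, ?_, rfl⟩)
      simp [hf]

lemma Net.layer {ι : Type*} [Fintype ι] {W : ℕ} {U V : Submodule ℝ (X → ℝ)} (g : ι → X → ℝ)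
    (hW : Fintype.card ι ≤ W) (hg : ∀ i, g i ∈ U)
    (hV : V ≤ aff (Set.range fun i => rel (g i))) : Net W 1 U V := by
  classical
  refine ⟨univ.image g, card_image_le.trans hW, ?_, ?_⟩
  · intro f hf
    obtain ⟨i, -, rfl⟩ := Finset.mem_image.1 hf
    exact hg i
  · refine hV.trans (aff_mono ?_)
    rintro _ ⟨i, rfl⟩
    exact ⟨g i, by simp, rfl⟩

lemma Net.pad {W L L' : ℕ} {U : Submodule ℝ (X → ℝ)} {T : Finset (X → ℝ)}
    (h : Net W L U (aff (T : Set (X → ℝ)))) (hT : 2 * T.card ≤ W) (hL : L ≤ L') :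
    Net W L' U (aff (T : Set (X → ℝ))) := by
  obtain ⟨e, rfl⟩ := Nat.exists_eq_add_of_le hL
  exact h.trans ((Net.carry e (one_mem_aff _) T fun f hf => mem_aff hf).mono hT le_rfl le_rfl)

/-- Compute while keeping a finite set of functions. -/
lemma Net.keep {W L : ℕ} {U V : Submodule ℝ (X → ℝ)} (h : Net W L U V) (h1 : (1 : X → ℝ) ∈ U)
    (T : Finset (X → ℝ)) (hT : ∀ f ∈ T, f ∈ U) :
    Net (W + 2 * T.card) L U (V ⊔ aff (T : Set (X → ℝ))) :=
  h.par (Net.carry L h1 T hT)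

lemma Net.sum {ι : Type*} {W : ℕ} (s : Finset ι) (Ls : ι → ℕ) (T : Finset (X → ℝ))
    (f : ι → X → ℝ) (h : ∀ i ∈ s, Net W (Ls i) (aff (T : Set (X → ℝ))) (aff {f i})) :
    Net (W + 2 * T.card + 2) (∑ i ∈ s, Ls i) (aff (T : Set (X → ℝ)))
      (aff (insert (∑ i ∈ s, f i) (T : Set (X → ℝ)))) := by
  classical
  induction s using Finset.induction_on with
  | empty =>
    refine aff_le (one_mem_aff _) ?_
    rintro g (rfl | hg)
    · simp
    · exact mem_aff hg
  | insert a s ha ih =>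
    rw [sum_insert ha, add_comm (Ls a)]
    refine (ih fun i hi => h i (by simp [hi])).trans ?_
    have h1 := h a (by simp)
    have h2 := (h1.mono le_rfl (U' := aff (insert (∑ i ∈ s, f i) (T : Set (X → ℝ))))
      (aff_mono (Set.subset_insert _ _)) le_rfl).keep (one_mem_aff _)
      (insert (∑ i ∈ s, f i) T) (by intro g hg; exact mem_aff (by simpa using hg))
    refine h2.mono ?_ le_rfl ?_
    · have := card_insert_le (∑ i ∈ s, f i) T
      omega
    · refine aff_le (Submodule.mem_sup_right (one_mem_aff _)) ?_
      rintro g (rfl | hg)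
      · rw [sum_insert ha]
        exact Submodule.add_mem _ (Submodule.mem_sup_left (mem_aff rfl))
          (Submodule.mem_sup_right (mem_aff (by simp)))
      · exact Submodule.mem_sup_right (mem_aff (by simpa using Or.inr hg))

/-- Compute finitely many functions in parallel. -/
lemma Net.parFin {ι : Type*} {W L : ℕ} (s : Finset ι) {U : Submodule ℝ (X → ℝ)}
    (h1 : (1 : X → ℝ) ∈ U)
    (V : ι → Submodule ℝ (X → ℝ)) (h : ∀ i ∈ s, Net W L U (V i)) :
    Net (s.card * W) L U (aff (⋃ i ∈ s, (V i : Set (X → ℝ)))) := by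
  classical
  induction s using Finset.induction_on with
  | empty =>
    have := Net.carry L h1 ∅ (by simp)
    simpa using this
  | insert a s ha ih =>
    rw [card_insert_of_notMem ha, add_mul, one_mul]
    refine ((ih fun i hi => h i (by simp [hi])).par (h a (by simp))).mono le_rfl le_rfl ?_
    refine aff_le (Submodule.mem_sup_left (one_mem_aff _)) ?_
    intro f hf
    simp only [Finset.mem_insert, Set.iUnion_iUnion_eq_or_left, Set.mem_union,
      SetLike.mem_coe] at hf
    rcases hf with hf | hf
    · exact Submodule.mem_sup_right hf
    · exact Submodule.mem_sup_left (mem_aff hf)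

lemma mem_aff_range {ι : Type*} [Fintype ι] {e : ι → X → ℝ} {f : X → ℝ}
    (h : f ∈ aff (Set.range e)) : ∃ (M : ι → ℝ) (c : ℝ), ∀ x, f x = (∑ j, M j * e j x) + c := by
  classical
  obtain ⟨c, z, hz, rfl⟩ := Submodule.mem_span_insert.1 h
  obtain ⟨M, rfl⟩ := (Submodule.mem_span_range_iff_exists_fun ℝ).1 hz
  refine ⟨M, c, fun x => ?_⟩
  simp [add_comm]

lemma Net.exists_NNaux {k W L : ℕ} (hW : 1 ≤ W) {d : ℕ} (e : X → Fin d → ℝ)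
    {V : Submodule ℝ (X → ℝ)} (h : Net W L (aff (Set.range fun i x => e x i)) V)
    (f : Fin k → X → ℝ) (hf : ∀ i, f i ∈ V) :
    ∃ g ∈ NNaux k W L d, ∀ x i, g (e x) i = f i x := by
  classical
  induction L generalizing d e with
  | zero =>
    choose M c hM using fun i => mem_aff_range (h (hf i))
    refine ⟨fun y i => (∑ j, M i j * y j) + c i, ⟨Matrix.of M, c, fun y i => rfl⟩, ?_⟩
    intro x i
    exact (hM i x).symm
  | succ L ih =>
    obtain ⟨s, hs, hsU, hn⟩ := h
    obtain ⟨s', hs', hs'0, hsU', hn'⟩ : ∃ s' : Finset (X → ℝ), s'.card ≤ W ∧ 1 ≤ s'.card ∧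
        (∀ f ∈ s', f ∈ aff (Set.range fun i x => e x i)) ∧
        Net W L (aff (rel '' (s' : Set (X → ℝ)))) V := by
      rcases s.eq_empty_or_nonempty with rfl | hne
      · refine ⟨{0}, by simpa using hW, by simp, by simp, hn.mono le_rfl (aff_mono ?_) le_rfl⟩
        simp
      · exact ⟨s, hs, hne.card_pos, hsU, hn⟩
    let eq := s'.equivFin.symm
    choose M c hM using fun i => mem_aff_range (hsU' (eq i) (eq i).2)
    obtain ⟨g, hg, hgf⟩ := ih (fun x (i : Fin s'.card) => relu ((eq i).1 x)) (by
      refine hn'.mono le_rfl (aff_mono ?_) le_rfl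
      rintro _ ⟨f, hf, rfl⟩
      exact ⟨eq.symm ⟨f, hf⟩, by ext x; simp [rel]⟩)
    refine ⟨fun y => g (fun i => relu ((∑ j, M i j * y j) + c i)), ⟨s'.card, hs'0, hs',
      fun y i => (∑ j, M i j * y j) + c i, g, ⟨Matrix.of M, c, fun y i => rfl⟩, hg, rfl⟩, ?_⟩
    intro x i
    rw [← hgf]
    simp only [hM]

lemma Net.of_NNaux {k W L d : ℕ} (e : X → Fin d → ℝ) (g : (Fin d → ℝ) → Fin k → ℝ)
    (hg : g ∈ NNaux k W L d) :
    Net W L (aff (Set.range fun i x => e x i)) (aff (Set.range fun i x => g (e x) i)) := by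
  have key : ∀ {d N : ℕ} (e : X → Fin d → ℝ) (A : (Fin d → ℝ) → Fin N → ℝ), IsAffineMap A →
      ∀ i, (fun x => A (e x) i) ∈ aff (Set.range fun i x => e x i) := by
    rintro d N e A ⟨M, c, hA⟩ i
    have : (fun x => A (e x) i) = (∑ j, M i j • (fun x => e x j)) + fun _ => c i := by
      ext x; simp [hA]
    rw [this]
    exact Submodule.add_mem _ (Submodule.sum_mem _ fun j _ => Submodule.smul_mem _ _
      (mem_aff ⟨j, rfl⟩)) (const_mem (one_mem_aff _) _)
  induction L generalizing d with
  | zero =>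
    refine aff_le (one_mem_aff _) ?_
    rintro _ ⟨i, rfl⟩
    exact key e g hg i
  | succ L ih =>
    obtain ⟨N, hN1, hN, A, h, hA, hh, rfl⟩ := hg
    have h2 := ih (fun x i => relu (A (e x) i)) h hh
    rw [add_comm]
    refine Net.trans (Net.layer (fun i x => A (e x) i) (by simpa using hN) (key e A hA) le_rfl) ?_
    exact h2

end NetCalculus

section StepTable

variable {X : Type}

/-- The indicator function of `t ≤ n`, as a real number. -/
def stp (t n : ℕ) : ℝ := if t ≤ n then 1 else 0

lemma relu_sub_relu_nat (t n : ℕ) :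
    relu ((n : ℝ) - t + 1) - relu ((n : ℝ) - t) = stp t n := by
  unfold relu stp
  split_ifs with h
  · have : (t : ℝ) ≤ n := by exact_mod_cast h
    rw [max_eq_left (by linarith), max_eq_left (by linarith)]; ring
  · have : (n : ℝ) + 1 ≤ t := by exact_mod_cast not_le.1 h
    rw [max_eq_right (by linarith), max_eq_right (by linarith)]; ring

lemma sum_stp_telescope (u : ℕ → ℝ) (M m : ℕ) (h : m ≤ M) :
    u m = u 0 + ∑ c ∈ range M, (u (c + 1) - u c) * stp (c + 1) m := by
  have h1 : ∑ c ∈ range M, (u (c + 1) - u c) * stp (c + 1) m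
      = ∑ c ∈ range m, (u (c + 1) - u c) := by
    rw [← sum_subset (range_mono h)]
    · refine sum_congr rfl fun c hc => ?_
      have := mem_range.1 hc
      rw [stp, if_pos (by omega), mul_one]
    · intro c _ hc
      have := mt mem_range.2 hc
      rw [stp, if_neg (by omega), mul_zero]
  rw [h1, sum_range_sub]; ring

lemma exists_threshold (κ : ℕ → ℕ) (hκ : Monotone κ) (N c : ℕ) :
    ∃ t, ∀ n ≤ N, t ≤ n ↔ c ≤ κ n := by
  classical
  by_cases h : ∃ n, c ≤ κ n
  · refine ⟨Nat.find h, fun n _ => ⟨fun h' => (Nat.find_spec h).trans (hκ h'), fun h' =>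
      Nat.find_min' h h'⟩⟩
  · refine ⟨N + 1, fun n hn => ⟨fun h' => by omega, fun h' => (h ⟨n, h'⟩).elim⟩⟩

lemma gate_eq {D K : ℝ} (h : |D| ≤ K) (t n : ℕ) :
    relu (D + K - 2 * K * (1 - stp t n)) - K * stp t n = D * stp t n := by
  have := abs_le.1 h
  unfold relu stp
  split_ifs with h
  · rw [max_eq_left (by linarith)]; ring
  · rw [max_eq_right (by linarith)]; ring

lemma rel_mem {ι : Type*} (g : ι → X → ℝ) (i : ι) :
    rel (g i) ∈ aff (Set.range fun i => rel (g i)) :=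
  mem_aff ⟨i, rfl⟩

lemma Net.table_sq (W : ℕ) (ν : X → ℕ) (N : ℕ) (hν : ∀ x, ν x ≤ N) (κ : ℕ → ℕ)
    (hκ : Monotone κ) (hκW : ∀ n ≤ N, κ n < W * W) (u : ℕ → ℝ) :
    Net (3 * W + 2) 3 (aff {fun x => (ν x : ℝ)}) (aff {fun x => u (κ (ν x))}) := by
  classical
  rcases isEmpty_or_nonempty X with hX | ⟨⟨x₀⟩⟩
  · have : ∀ V V' : Submodule ℝ (X → ℝ), V ≤ V' := fun V V' f _ => by
      rw [Subsingleton.elim f 0]; exact V'.zero_mem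
    exact (Net.carry 3 (one_mem_aff _) ∅ (by simp)).mono (by simp) le_rfl (this _ _)
  have hW : 0 < W := by
    have := hκW _ (hν x₀)
    exact Nat.pos_of_mul_pos_right (Nat.zero_lt_of_lt this)
  choose thr hthr using exists_threshold κ hκ N
  let a : X → ℕ := fun x => κ (ν x) / W
  have haW : ∀ x, a x < W := fun x => Nat.div_lt_of_lt_mul (hκW _ (hν x))
  set n : X → ℝ := fun x => (ν x : ℝ) with hn
  -- any function of `a` together with `n` after the first layer
  let s1 : Fin W ⊕ Fin W ⊕ Unit → X → ℝ := fun i => match i with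
    | Sum.inl i => fun x => (ν x : ℝ) - thr ((i + 1) * W) + 1
    | Sum.inr (Sum.inl i) => fun x => (ν x : ℝ) - thr ((i + 1) * W)
    | Sum.inr (Sum.inr _) => n
  let U1 := aff (Set.range fun i => rel (s1 i))
  have h1 : Net (3 * W + 2) 1 (aff {n}) U1 := by
    refine Net.layer s1 ?_ ?_ le_rfl
    · simp; omega
    · have hn' : n ∈ aff {n} := mem_aff rfl
      have hc := fun c => const_mem (one_mem_aff {n}) c
      rintro (i | i | i)
      · have := Submodule.add_mem _ (Submodule.sub_mem _ hn' (hc (thr ((i + 1) * W)))) (hc 1)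
        exact this
      · exact Submodule.sub_mem _ hn' (hc (thr ((i + 1) * W)))
      · exact hn'
  have hnU1 : n ∈ U1 := mem_aff ⟨Sum.inr (Sum.inr ()), by ext x; simp [s1, rel, relu, hn]⟩
  have hcU1 := fun c => const_mem (one_mem_aff _ : (1 : X → ℝ) ∈ U1) c
  have hstep : ∀ c < W, (fun x => stp (c + 1) (a x)) ∈ U1 := by
    intro c hc
    have h2 : (fun x => stp (c + 1) (a x)) =
        rel (s1 (Sum.inl ⟨c, hc⟩)) - rel (s1 (Sum.inr (Sum.inl ⟨c, hc⟩))) := by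
      ext x
      simp only [Pi.sub_apply, rel, s1, relu_sub_relu_nat, stp, a]
      simp only [hthr _ _ (hν x), Nat.le_div_iff_mul_le hW]
    rw [h2]
    exact Submodule.sub_mem _ (rel_mem s1 (Sum.inl ⟨c, hc⟩))
      (rel_mem s1 (Sum.inr (Sum.inl ⟨c, hc⟩)))
  have hfun : ∀ F : ℕ → ℝ, (fun x => F (a x)) ∈ U1 := by
    intro F
    have h2 : (fun x => F (a x)) =
        (fun _ => F 0) + ∑ c ∈ range W, (F (c + 1) - F c) • fun x => stp (c + 1) (a x) := by
      ext x
      rw [sum_stp_telescope F W (a x) (haW x).le]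
      simp
    rw [h2]
    exact Submodule.add_mem _ (hcU1 _) (Submodule.sum_mem _ fun c hc =>
      Submodule.smul_mem _ _ (hstep c (mem_range.1 hc)))
  -- second layer
  let D : ℕ → ℕ → ℝ := fun i m => u (m * W + i + 1) - u (m * W + i)
  obtain ⟨K, hK⟩ : ∃ K : ℝ, ∀ i < W, ∀ m < W, |D i m| ≤ K ∧ |u (m * W)| ≤ K := by
    refine ⟨∑ i ∈ range W, ∑ m ∈ range W, (|D i m| + |u (m * W)|), fun i hi m hm => ?_⟩
    have h3 : |D i m| + |u (m * W)| ≤ ∑ i ∈ range W, ∑ m ∈ range W, (|D i m| + |u (m * W)|) :=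
      (single_le_sum (f := fun m => |D i m| + |u (m * W)|) (fun m _ => by positivity)
        (mem_range.2 hm)).trans
      (single_le_sum (f := fun i => ∑ m ∈ range W, (|D i m| + |u (m * W)|))
        (fun i _ => by positivity) (mem_range.2 hi))
    have h4 := abs_nonneg (D i m)
    have h5 := abs_nonneg (u (m * W))
    constructor <;> linarith
  let s2 : Fin W ⊕ Fin W ⊕ Fin W ⊕ Unit → X → ℝ := fun i => match i with
    | Sum.inl i => fun x => (ν x : ℝ) - thr (a x * W + i + 1) + 1
    | Sum.inr (Sum.inl i) => fun x => (ν x : ℝ) - thr (a x * W + i + 1)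
    | Sum.inr (Sum.inr (Sum.inl i)) => fun x => D i (a x) + K
    | Sum.inr (Sum.inr (Sum.inr _)) => fun x => u (a x * W) + K
  let U2 := aff (Set.range fun i => rel (s2 i))
  have h2 : Net (3 * W + 2) 1 U1 U2 := by
    refine Net.layer s2 ?_ ?_ le_rfl
    · simp; omega
    · rintro (i | i | i | i)
      · exact Submodule.add_mem _ (Submodule.sub_mem _ hnU1
          (hfun fun m => thr (m * W + i + 1))) (hcU1 1)
      · exact Submodule.sub_mem _ hnU1 (hfun fun m => thr (m * W + i + 1))
      · exact Submodule.add_mem _ (hfun (D i)) (hcU1 K)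
      · exact Submodule.add_mem _ (hfun fun m => u (m * W)) (hcU1 K)
  have hcU2 := fun c => const_mem (one_mem_aff _ : (1 : X → ℝ) ∈ U2) c
  let σ : ℕ → X → ℝ := fun i x => stp (i + 1 + a x * W) (κ (ν x))
  have hσ : ∀ i < W, σ i ∈ U2 := by
    intro i hi
    have h3 : σ i = rel (s2 (Sum.inl ⟨i, hi⟩)) - rel (s2 (Sum.inr (Sum.inl ⟨i, hi⟩))) := by
      ext x
      simp only [Pi.sub_apply, rel, s2, relu_sub_relu_nat, stp, σ]
      simp only [hthr _ _ (hν x)]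
      congr 2; ring
    rw [h3]
    exact Submodule.sub_mem _ (rel_mem s2 (Sum.inl ⟨i, hi⟩))
      (rel_mem s2 (Sum.inr (Sum.inl ⟨i, hi⟩)))
  have hD : ∀ i < W, (fun x => D i (a x)) ∈ U2 := by
    intro i hi
    have h3 : (fun x => D i (a x)) =
        rel (s2 (Sum.inr (Sum.inr (Sum.inl ⟨i, hi⟩)))) - fun _ => K := by
      ext x
      have := (abs_le.1 (hK i hi (a x) (haW x)).1).1
      simp only [Pi.sub_apply, rel, s2, relu]
      rw [max_eq_left (by linarith)]; ring
    rw [h3]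
    exact Submodule.sub_mem _ (rel_mem s2 (Sum.inr (Sum.inr (Sum.inl ⟨i, hi⟩)))) (hcU2 K)
  have hu : (fun x => u (a x * W)) ∈ U2 := by
    have h3 : (fun x => u (a x * W)) =
        rel (s2 (Sum.inr (Sum.inr (Sum.inr ())))) - fun _ => K := by
      ext x
      have := (abs_le.1 (hK 0 hW (a x) (haW x)).2).1
      simp only [Pi.sub_apply, rel, s2, relu]
      rw [max_eq_left (by linarith)]; ring
    rw [h3]
    exact Submodule.sub_mem _ (rel_mem s2 (Sum.inr (Sum.inr (Sum.inr ())))) (hcU2 K)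
  -- third layer
  let B : X → ℝ := (fun x => u (a x * W)) - ∑ i ∈ range W, K • σ i
  have hB : B ∈ U2 := Submodule.sub_mem _ hu (Submodule.sum_mem _ fun i hi =>
    Submodule.smul_mem _ _ (hσ i (mem_range.1 hi)))
  let s3 : Fin W → X → ℝ := fun i x => D i (a x) + K - 2 * K * (1 - σ i x)
  have h3 : Net W 1 U2 (aff (Set.range fun i => rel (s3 i))) := by
    refine Net.layer s3 (by simp) ?_ le_rfl
    intro i
    have := Submodule.sub_mem _ (Submodule.add_mem _ (hD i i.2) (hcU2 K))
      (Submodule.smul_mem _ (2 * K) (Submodule.sub_mem _ (hcU2 1) (hσ i i.2)))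
    exact this
  have h3' := h3.keep (one_mem_aff _) {B} (by simpa using hB)
  refine (h1.trans h2).trans (h3'.mono (by simp; omega) le_rfl ?_)
  refine aff_le (Submodule.mem_sup_right (one_mem_aff _)) ?_
  rintro f rfl
  have h4 : (fun x => u (κ (ν x))) = B + ∑ i : Fin W, rel (s3 i) := by
    ext x
    have h5 : ∀ i : Fin W, rel (s3 i) x = D i (a x) * σ i x + K * σ i x := by
      intro i
      have := gate_eq (hK i i.2 (a x) (haW x)).1 (i + 1 + a x * W) (κ (ν x))
      simp only [rel, s3, σ]
      linarith
    have h6 := sum_stp_telescope (fun m => u (a x * W + m)) W (κ (ν x) % W) (Nat.mod_lt _ hW).le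
    simp only [a, Nat.div_add_mod', add_zero] at h6
    simp only [Pi.add_apply, Finset.sum_apply, h5, B, Pi.sub_apply, Pi.smul_apply, smul_eq_mul]
    rw [Finset.sum_add_distrib, ← Fin.sum_univ_eq_sum_range (fun i => K * σ i x) W]
    rw [← Fin.sum_univ_eq_sum_range] at h6
    have h7 : ∀ i : Fin W, (u (κ (ν x) / W * W + (↑i + 1)) - u (κ (ν x) / W * W + ↑i)) *
        stp (↑i + 1) (κ (ν x) % W) = D i (a x) * σ i x := by
      intro i
      simp only [D, a, σ, stp, add_assoc]
      congr 2
      have := Nat.div_add_mod' (κ (ν x)) W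
      generalize κ (ν x) / W * W = y at *
      exact propext ⟨fun h => by omega, fun h => by omega⟩
    rw [sum_congr rfl fun i _ => h7 i] at h6
    linarith
  rw [h4]
  exact Submodule.add_mem _ (Submodule.mem_sup_right (mem_aff (by simp)))
    (Submodule.sum_mem _ fun i _ => Submodule.mem_sup_left (mem_aff ⟨i, rfl⟩))

lemma Net.table (W K : ℕ) (ν : X → ℕ) (N : ℕ) (hν : ∀ x, ν x ≤ N) (κ : ℕ → ℕ)
    (hκ : Monotone κ) (hκW : ∀ n ≤ N, κ n ≤ K * (W * W)) (u : ℕ → ℝ) :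
    Net (3 * W + 9) (3 * K) (aff {fun x => (ν x : ℝ)}) (aff {fun x => u (κ (ν x))}) := by
  classical
  set M := W * W
  have key : ∀ c ∈ range K, Net (3 * W + 5) 3
      (aff (({fun x => (ν x : ℝ)} : Finset (X → ℝ)) : Set (X → ℝ)))
      (aff {fun x => u (c * M + min (κ (ν x) - c * M) M) - u (c * M)}) := by
    intro c _
    have h := Net.table_sq (W + 1) ν N hν (fun n => min (κ n - c * M) M) (by
      intro m n h
      have := hκ h
      show min _ _ ≤ min _ _
      omega) (by
      intro n _
      have : min (κ n - c * M) M ≤ M := min_le_right _ _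
      have : M < (W + 1) * (W + 1) := by
        simp only [M]; nlinarith
      show min _ _ < _
      omega) (fun m => u (c * M + m) - u (c * M))
    refine h.mono (by omega) (by simp) le_rfl
  have h := Net.sum (range K) (fun _ => 3) {fun x => (ν x : ℝ)} _ key
  simp only [sum_const, card_range, smul_eq_mul] at h
  rw [mul_comm 3 K]
  refine h.mono (by simp) (by simp) ?_
  refine aff_le (one_mem_aff _) ?_
  rintro f rfl
  have h1 : ∀ K m : ℕ, m ≤ K * M →
      u m = u 0 + ∑ c ∈ range K, (u (c * M + min (m - c * M) M) - u (c * M)) := by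
    intro K m h
    induction K generalizing m with
    | zero =>
      have : m = 0 := by omega
      simp [this]
    | succ K ih =>
      rw [sum_range_succ]
      rcases le_total m (K * M) with h2 | h2
      · rw [← add_assoc, ← ih m h2]
        rw [Nat.sub_eq_zero_of_le h2]
        simp
      · have h3 := ih (K * M) le_rfl
        have h4 : ∑ c ∈ range K, (u (c * M + min (m - c * M) M) - u (c * M)) =
            ∑ c ∈ range K, (u (c * M + min (K * M - c * M) M) - u (c * M)) := by
          refine sum_congr rfl fun c hc => ?_
          have hc' : (c + 1) * M ≤ K * M := Nat.mul_le_mul_right _ (mem_range.1 hc)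
          rw [add_mul, one_mul] at hc'
          congr 3
          omega
        rw [h4, ← add_assoc, ← h3]
        rw [add_mul, one_mul] at h
        have : K * M + min (m - K * M) M = m := by omega
        rw [this]; ring
  have h2 : (fun x => u (κ (ν x))) = (fun _ => u 0) +
      ∑ c ∈ range K, fun x => u (c * M + min (κ (ν x) - c * M) M) - u (c * M) := by
    ext x
    rw [h1 K _ (hκW _ (hν x))]
    simp
  rw [h2]
  exact Submodule.add_mem _ (const_mem (one_mem_aff _) _) (mem_aff (by simp))

end StepTable

section BitDecoder

variable {X : Type}

/-- The value of a bit, as a real number. -/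
def bval (b : Bool) : ℝ := if b then 1 else 0

/-- The binary fraction with the given digits. -/
def bcode : List Bool → ℝ
  | [] => 0
  | b :: bs => (bval b + bcode bs) / 2

lemma bcode_nonneg (l : List Bool) : 0 ≤ bcode l := by
  induction l with
  | nil => exact le_rfl
  | cons b bs ih =>
    have : 0 ≤ bval b := by unfold bval; split_ifs <;> norm_num
    unfold bcode; positivity

lemma bcode_le (l : List Bool) : bcode l ≤ 1 - 1 / 2 ^ l.length := by
  induction l with
  | nil => simp [bcode]
  | cons b bs ih =>
    have : bval b ≤ 1 := by unfold bval; split_ifs <;> norm_num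
    have h2 : (1 : ℝ) / 2 ^ (bs.length + 1) = 1 / 2 ^ bs.length / 2 := by
      rw [pow_succ]; field_simp
    rw [List.length_cons, h2]
    unfold bcode; linarith

/-- Read the bits `bs` one after the other: a set bit with weights `(w, w')` adds `w'` to the
output if the current position is `n`, and moves the position by `w`. -/
def bitRun : ℕ → List (ℕ × ℕ) → List Bool → ℕ → ℕ
  | θ, w :: ws, b :: bs, n =>
    (if b = true ∧ θ = n then w.2 else 0) + bitRun (θ + if b then w.1 else 0) ws bs n
  | _, _, _, _ => 0

lemma relu_extract_bit (b : Bool) (bs : List Bool) (k : ℕ) (hk : bs.length ≤ k) :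
    relu (2 ^ k * (2 * bcode (b :: bs) - 1) + 1) - relu (2 ^ k * (2 * bcode (b :: bs) - 1))
      = bval b := by
  have h1 := bcode_nonneg bs
  have h2 := bcode_le bs
  have h3 : (1 : ℝ) / 2 ^ k ≤ 1 / 2 ^ bs.length :=
    one_div_le_one_div_of_le (by positivity) (pow_le_pow_right₀ (by norm_num) hk)
  have h4 : (0 : ℝ) < 2 ^ k := by positivity
  have h5 : 2 ^ k * bcode bs ≤ 2 ^ k - 1 := by
    calc 2 ^ k * bcode bs ≤ 2 ^ k * (1 - 1 / 2 ^ k) :=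
          mul_le_mul_of_nonneg_left (by linarith) h4.le
      _ = 2 ^ k - 1 := by field_simp
  have h6 : 2 ^ k * (2 * bcode (b :: bs) - 1) = 2 ^ k * (bval b - 1) + 2 ^ k * bcode bs := by
    simp only [bcode]; ring
  rw [h6]
  unfold relu bval
  have h7 : 0 ≤ 2 ^ k * bcode bs := by positivity
  cases b
  · simp only [Bool.false_eq_true, if_false]
    rw [max_eq_right (by linarith), max_eq_right (by linarith)]; ring
  · simp only [if_true]
    rw [max_eq_left (by linarith), max_eq_left (by linarith)]; ring

lemma relu_hit (b : Bool) (θ n : ℕ) :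
    relu (bval b - (relu ((θ : ℝ) - n) + relu ((n : ℝ) - θ))) =
      if b = true ∧ θ = n then 1 else 0 := by
  unfold relu bval
  rcases lt_trichotomy θ n with h | h | h
  · have h' : (θ : ℝ) + 1 ≤ n := by exact_mod_cast h
    rw [max_eq_right (a := (θ : ℝ) - n) (by linarith), max_eq_left (a := (n : ℝ) - θ) (by linarith),
      if_neg (c := b = true ∧ θ = n) (by rintro ⟨-, h2⟩; omega), max_eq_right]
    split_ifs <;> linarith
  · subst h
    cases b <;> simp
  · have h' : (n : ℝ) + 1 ≤ θ := by exact_mod_cast h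
    rw [max_eq_left (a := (θ : ℝ) - n) (by linarith), max_eq_right (a := (n : ℝ) - θ) (by linarith),
      if_neg (c := b = true ∧ θ = n) (by rintro ⟨-, h2⟩; omega), max_eq_right]
    split_ifs <;> linarith

lemma Net.bitRun (n : X → ℕ) (ws : List (ℕ × ℕ)) (bits : X → List Bool)
    (hbits : ∀ x, (bits x).length = ws.length) (θ : X → ℕ) (acc : X → ℝ)
    (U : Submodule ℝ (X → ℝ)) (h1 : (1 : X → ℝ) ∈ U) (hn : (fun x => (n x : ℝ)) ∈ U)
    (hb : (fun x => bcode (bits x)) ∈ U) (hθ : (fun x => (θ x : ℝ)) ∈ U) (hacc : acc ∈ U) :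
    Net 12 (2 * ws.length) U
      (aff {fun x => acc x + (bitRun (θ x) ws (bits x) (n x) : ℕ)}) := by
  classical
  induction ws generalizing bits θ acc U with
  | nil =>
    refine aff_le h1 ?_
    rintro f rfl
    simpa [_root_.bitRun] using hacc
  | cons w ws ih =>
    have : ∀ x, ∃ b bs, bits x = b :: bs := fun x => by
      refine List.exists_cons_of_length_pos ?_
      rw [hbits]; simp
    choose b bs hbs using this
    have hlen : ∀ x, (bs x).length = ws.length := fun x => by
      have := hbits x
      rw [hbs] at this
      simpa using this
    set k := ws.length with hk
    set C : X → ℝ := fun x => bcode (bits x)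
    set Θ : X → ℝ := fun x => (θ x : ℝ)
    set n' : X → ℝ := fun x => (n x : ℝ)
    let s1 : Fin 4 → X → ℝ := ![fun x => 2 ^ k * (2 * C x - 1) + 1,
      fun x => 2 ^ k * (2 * C x - 1), fun x => Θ x - n' x, fun x => n' x - Θ x]
    have hc := fun c => const_mem h1 c
    have hs : (fun x => 2 ^ k * (2 * C x - 1)) ∈ U := by
      have := U.smul_mem (2 ^ k) (U.sub_mem (U.smul_mem 2 hb) (hc 1))
      exact this
    have l1 : Net 4 1 U (aff (Set.range fun i => rel (s1 i))) := by
      refine Net.layer s1 (by simp) ?_ le_rfl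
      intro i
      fin_cases i
      · exact U.add_mem hs (hc 1)
      · exact hs
      · exact U.sub_mem hθ hn
      · exact U.sub_mem hn hθ
    have l1' := l1.keep h1 {C, Θ, acc, n'} (by
      intro f hf
      simp only [Finset.mem_insert, Finset.mem_singleton] at hf
      rcases hf with rfl | rfl | rfl | rfl <;> assumption)
    set U1 := aff (Set.range fun i => rel (s1 i)) ⊔
      aff (({C, Θ, acc, n'} : Finset (X → ℝ)) : Set (X → ℝ)) with hU1
    have h11 : (1 : X → ℝ) ∈ U1 := Submodule.mem_sup_left (one_mem_aff _)
    have hB : (fun x => bval (b x)) ∈ U1 := by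
      have : (fun x => bval (b x)) = rel (s1 0) - rel (s1 1) := by
        ext x
        have := relu_extract_bit (b x) (bs x) k (hlen x).le
        simp only [rel, s1, Pi.sub_apply, C, hbs]
        exact this.symm
      rw [this]
      exact Submodule.mem_sup_left (Submodule.sub_mem _ (rel_mem s1 0) (rel_mem s1 1))
    have hcar : ∀ f ∈ ({C, Θ, acc, n'} : Finset (X → ℝ)), f ∈ U1 := fun f hf =>
      Submodule.mem_sup_right (mem_aff hf)
    have hC1 : C ∈ U1 := hcar _ (by simp)
    have hΘ1 : Θ ∈ U1 := hcar _ (by simp)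
    have hacc1 : acc ∈ U1 := hcar _ (by simp)
    have hn1 : n' ∈ U1 := hcar _ (by simp)
    let hit : Fin 1 → X → ℝ := fun _ => (fun x => bval (b x)) - (rel (s1 2) + rel (s1 3))
    have l2 : Net 1 1 U1 (aff (Set.range fun i => rel (hit i))) := by
      refine Net.layer hit (by simp) ?_ le_rfl
      intro i
      exact U1.sub_mem hB (Submodule.mem_sup_left (Submodule.add_mem _ (rel_mem s1 2)
        (rel_mem s1 3)))
    set C' : X → ℝ := fun x => bcode (bs x)
    set Θ' : X → ℝ := fun x => ((θ x + if b x then w.1 else 0 : ℕ) : ℝ)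
    have hC' : C' ∈ U1 := by
      have : C' = (2 : ℝ) • C - fun x => bval (b x) := by
        ext x; simp [C', C, hbs, bcode]; ring
      rw [this]
      exact U1.sub_mem (U1.smul_mem _ hC1) hB
    have hΘ' : Θ' ∈ U1 := by
      have : Θ' = Θ + (w.1 : ℝ) • fun x => bval (b x) := by
        ext x; simp [Θ', Θ, bval]
      rw [this]
      exact U1.add_mem hΘ1 (U1.smul_mem _ hB)
    have l2' := l2.keep h11 {C', Θ', acc, n'} (by
      intro f hf
      simp only [Finset.mem_insert, Finset.mem_singleton] at hf
      rcases hf with rfl | rfl | rfl | rfl <;> assumption)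
    set U2 := aff (Set.range fun i => rel (hit i)) ⊔
      aff (({C', Θ', acc, n'} : Finset (X → ℝ)) : Set (X → ℝ)) with hU2
    have h12 : (1 : X → ℝ) ∈ U2 := Submodule.mem_sup_left (one_mem_aff _)
    have hcar2 : ∀ f ∈ ({C', Θ', acc, n'} : Finset (X → ℝ)), f ∈ U2 := fun f hf =>
      Submodule.mem_sup_right (mem_aff hf)
    have hacc2 : acc + (w.2 : ℝ) • rel (hit 0) ∈ U2 :=
      U2.add_mem (hcar2 _ (by simp)) (U2.smul_mem _ (Submodule.mem_sup_left (rel_mem hit 0)))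
    have l3 := ih bs hlen (fun x => θ x + if b x then w.1 else 0) _ U2 h12
      (hcar2 n' (by simp)) (hcar2 C' (by simp)) (hcar2 Θ' (by simp)) hacc2
    have hcard : ∀ f g h i : X → ℝ, ({f, g, h, i} : Finset (X → ℝ)).card ≤ 4 :=
      fun _ _ _ _ => card_le_four
    have e : 2 * (w :: ws).length = 1 + 1 + 2 * k := by simp [hk]; ring
    rw [e]
    have c1 := hcard C Θ acc n'
    have c2 := hcard C' Θ' acc n'
    refine ((l1'.mono (by omega) le_rfl le_rfl).trans
      (l2'.mono (by omega) le_rfl le_rfl)).trans (l3.mono le_rfl le_rfl ?_)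
    refine le_of_eq ?_
    congr 2
    ext x
    have h8 := relu_hit (b x) (θ x) (n x)
    simp only [Pi.add_apply, Pi.smul_apply, rel, hit, s1, hbs, _root_.bitRun, smul_eq_mul]
    have h9 : relu (((fun x => bval (b x)) - (rel (s1 2) + rel (s1 3))) x) =
        if b x = true ∧ θ x = n x then 1 else 0 := h8
    rw [add_assoc]
    congr 1
    push_cast
    congr 1
    erw [h9]
    simp

/-- The binary digits of `m`, least significant first. -/
def lowBits : ℕ → ℕ → List Bool
  | 0, _ => []
  | R + 1, m => decide (m % 2 = 1) :: lowBits R (m / 2)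

/-- Weights of the bits that move the position. -/
def moveWeights : ℕ → ℕ → List (ℕ × ℕ)
  | 0, _ => []
  | R + 1, w => (w, 0) :: moveWeights R (2 * w)

/-- Weights of the bits that write to the output. -/
def writeWeights : ℕ → ℕ → List (ℕ × ℕ)
  | 0, _ => []
  | R + 1, w => (0, w) :: writeWeights R (2 * w)

lemma length_lowBits (R m : ℕ) : (lowBits R m).length = R := by
  induction R generalizing m with
  | zero => rfl
  | succ R ih => simp [lowBits, ih]

lemma length_moveWeights (R w : ℕ) : (moveWeights R w).length = R := by
  induction R generalizing w with
  | zero => rfl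
  | succ R ih => simp [moveWeights, ih]

lemma length_writeWeights (R w : ℕ) : (writeWeights R w).length = R := by
  induction R generalizing w with
  | zero => rfl
  | succ R ih => simp [writeWeights, ih]

lemma bitRun_move (R w m θ n : ℕ) (hm : m < 2 ^ R) (ws : List (ℕ × ℕ)) (bs : List Bool) :
    bitRun θ (moveWeights R w ++ ws) (lowBits R m ++ bs) n = bitRun (θ + w * m) ws bs n := by
  induction R generalizing w m θ with
  | zero =>
    have : m = 0 := by simpa using hm
    simp [moveWeights, lowBits, this]
  | succ R ih =>
    simp only [moveWeights, lowBits, List.cons_append, bitRun, ite_self, zero_add]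
    rw [ih _ _ _ (by rw [pow_succ] at hm; omega)]
    congr 1
    have h1 := Nat.div_add_mod m 2
    rcases Nat.mod_two_eq_zero_or_one m with h | h
    · simp only [h, decide_eq_true_eq]
      rw [h] at h1
      norm_num
      calc 2 * w * (m / 2) = w * (2 * (m / 2) + 0) := by ring
        _ = w * m := by rw [h1]
    · simp only [h, decide_eq_true_eq]
      rw [h] at h1
      norm_num
      rw [add_assoc]
      congr 1
      calc w + 2 * w * (m / 2) = w * (2 * (m / 2) + 1) := by ring
        _ = w * m := by rw [h1]

lemma bitRun_write (R w m θ n : ℕ) (hm : m < 2 ^ R) (ws : List (ℕ × ℕ)) (bs : List Bool) :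
    bitRun θ (writeWeights R w ++ ws) (lowBits R m ++ bs) n =
      (if θ = n then w * m else 0) + bitRun θ ws bs n := by
  induction R generalizing w m with
  | zero =>
    have : m = 0 := by simpa using hm
    simp [writeWeights, lowBits, this]
  | succ R ih =>
    simp only [writeWeights, lowBits, List.cons_append, bitRun, ite_self, add_zero]
    rw [ih _ _ (by rw [pow_succ] at hm; omega), ← add_assoc]
    congr 1
    have h1 := Nat.div_add_mod m 2
    by_cases hθ : θ = n
    · simp only [hθ, and_true, if_true]
      rcases Nat.mod_two_eq_zero_or_one m with h | h
      · simp only [h, decide_eq_true_eq]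
        rw [h] at h1
        norm_num
        calc 2 * w * (m / 2) = w * (2 * (m / 2) + 0) := by ring
          _ = w * m := by rw [h1]
      · simp only [h, decide_eq_true_eq]
        rw [h] at h1
        norm_num
        calc w + 2 * w * (m / 2) = w * (2 * (m / 2) + 1) := by ring
          _ = w * m := by rw [h1]
    · simp [hθ]

/-- The sequence described by a list of records `(α, υ)`: move by `α`, then add `υ` at the
current position. -/
def recVal : ℕ → List (ℕ × ℕ) → ℕ → ℕ
  | _, [], _ => 0
  | θ, r :: l, n => (if θ + r.1 = n then r.2 else 0) + recVal (θ + r.1) l n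

/-- Bits encoding a list of records. -/
def recBits (R : ℕ) : List (ℕ × ℕ) → List Bool
  | [] => []
  | r :: l => lowBits R r.1 ++ (lowBits R r.2 ++ recBits R l)

/-- Weights for decoding a list of records. -/
def recWeights (R : ℕ) : ℕ → List (ℕ × ℕ)
  | 0 => []
  | k + 1 => moveWeights R 1 ++ (writeWeights R 1 ++ recWeights R k)

lemma length_recBits (R : ℕ) (l : List (ℕ × ℕ)) : (recBits R l).length = 2 * R * l.length := by
  induction l with
  | nil => rfl
  | cons r l ih =>
    simp only [recBits, List.length_append, ih, length_lowBits, List.length_cons]; ring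

lemma length_recWeights (R k : ℕ) : (recWeights R k).length = 2 * R * k := by
  induction k with
  | zero => rfl
  | succ k ih =>
    simp only [recWeights, List.length_append, ih, length_moveWeights, length_writeWeights]; ring

lemma bitRun_rec (R : ℕ) (l : List (ℕ × ℕ)) (hl : ∀ r ∈ l, r.1 < 2 ^ R ∧ r.2 < 2 ^ R)
    (θ n : ℕ) : bitRun θ (recWeights R l.length) (recBits R l) n = recVal θ l n := by
  induction l generalizing θ with
  | nil => rfl
  | cons r l ih =>
    have := hl r (by simp)
    simp only [recBits, List.length_cons, recWeights, recVal]
    rw [bitRun_move _ _ _ _ _ this.1, bitRun_write _ _ _ _ _ this.2,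
      ih fun r hr => hl r (by simp [hr])]
    simp

lemma recVal_append (l l' : List (ℕ × ℕ)) (θ n : ℕ) :
    recVal θ (l ++ l') n = recVal θ l n + recVal (θ + (l.map Prod.fst).sum) l' n := by
  induction l generalizing θ with
  | nil => simp [recVal]
  | cons r l ih => simp [recVal, ih, add_assoc]

end BitDecoder

section ChunkCoding

variable {X : Type}

lemma exists_records_at (V : ℕ) (hV : 1 ≤ V) (z : ℕ) (hz : 0 < z) (α θ : ℕ) (hα : α ≤ V) :
    ∃ l : List (ℕ × ℕ), (∀ r ∈ l, r.1 ≤ V ∧ r.2 ≤ V) ∧ (l.map Prod.fst).sum = α ∧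
      l.length = (z + (V - 1)) / V ∧ ∀ n, recVal θ l n = if θ + α = n then z else 0 := by
  induction z using Nat.strong_induction_on generalizing α θ with
  | _ z ih =>
    rcases le_or_gt z V with h | h
    · refine ⟨[(α, z)], by simp [h, hα], by simp, ?_, by simp [recVal]⟩
      rw [List.length_singleton]
      exact (Nat.div_eq_of_lt_le (by omega) (by omega)).symm
    · obtain ⟨l, h1, h2, h3, h4⟩ := ih (z - V) (by omega) (by omega) 0 (θ + α) (by omega)
      refine ⟨(α, V) :: l, ?_, by simp [h2], ?_, ?_⟩
      · intro r hr
        rcases List.mem_cons.1 hr with rfl | hr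
        · exact ⟨hα, le_rfl⟩
        · exact h1 r hr
      · rw [List.length_cons, h3, ← Nat.add_div_right _ (by omega)]
        congr 1; omega
      · intro n
        simp only [recVal, h4, add_zero]
        split_ifs <;> omega

lemma exists_records (V : ℕ) (hV : 1 ≤ V) (z : ℕ → ℕ) (θ e : ℕ) (h : θ ≤ e) :
    ∃ l : List (ℕ × ℕ), (∀ r ∈ l, r.1 ≤ V ∧ r.2 ≤ V) ∧ θ + (l.map Prod.fst).sum ≤ e ∧
      e < θ + (l.map Prod.fst).sum + V ∧
      (∀ n, recVal θ l n = if θ < n ∧ n ≤ e then z n else 0) ∧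
      l.length * V ≤ V * (∑ i ∈ Ioc θ e, (z i + (V - 1)) / V) + (l.map Prod.fst).sum := by
  induction e, h using Nat.le_induction with
  | base =>
    refine ⟨[], by simp, by simp, by simp; omega, ?_, by simp⟩
    intro n
    rw [if_neg (by omega)]; rfl
  | succ e he ih =>
    obtain ⟨l, h1, h2, h3, h4, h5⟩ := ih
    rw [sum_Ioc_succ_top (by omega)]
    rcases Nat.eq_zero_or_pos (z (e + 1)) with h0 | h0
    · have h4' : ∀ n, recVal θ l n = if θ < n ∧ n ≤ e + 1 then z n else 0 := by
        intro n
        rw [h4]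
        by_cases hn : n = e + 1
        · subst hn; simp [h0]
        · congr 1
          exact propext ⟨fun h => by omega, fun h => by omega⟩
      rcases Nat.lt_or_ge (e + 1) (θ + (l.map Prod.fst).sum + V) with h6 | h6
      · refine ⟨l, h1, by omega, h6, h4', ?_⟩
        rw [mul_add]; omega
      · refine ⟨l ++ [(V, 0)], ?_, ?_, ?_, ?_, ?_⟩
        · intro r hr
          rcases List.mem_append.1 hr with hr | hr
          · exact h1 r hr
          · simp at hr; subst hr; simp
        · simp; omega
        · simp; omega
        · intro n
          rw [recVal_append, h4']
          simp [recVal]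
        · simp only [List.length_append, List.length_singleton, List.map_append, List.map_cons,
            List.map_nil, List.sum_append, List.sum_singleton]
          rw [mul_add, add_mul]; omega
    · obtain ⟨l', g1, g2, g3, g4⟩ := exists_records_at V hV (z (e + 1)) h0
        (e + 1 - (θ + (l.map Prod.fst).sum)) (θ + (l.map Prod.fst).sum) (by omega)
      refine ⟨l ++ l', ?_, ?_, ?_, ?_, ?_⟩
      · intro r hr
        rcases List.mem_append.1 hr with hr | hr
        · exact h1 r hr
        · exact g1 r hr
      · simp [g2]; omega
      · simp [g2]; omega
      · intro n
        rw [recVal_append, h4, g4, Nat.add_sub_cancel' (by omega)]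
        by_cases hn : e + 1 = n
        · subst hn
          rw [if_neg (by omega), if_pos rfl, if_pos (by omega), zero_add]
        · rw [if_neg hn, add_zero]
          congr 1
          exact propext ⟨fun h => by omega, fun h => by omega⟩
      · simp only [List.length_append, List.map_append, List.sum_append, g3]
        rw [mul_add, add_mul, mul_comm _ V, mul_comm _ V]
        rw [mul_comm _ V] at h5
        omega

lemma recVal_replicate (θ k n : ℕ) : recVal θ (List.replicate k (0, 0)) n = 0 := by
  induction k with
  | zero => rfl
  | succ k ih => simp [List.replicate_succ, recVal, ih]

/-- Amount of code used by the sequence `z` up to `n`. -/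
def codeLen (V : ℕ) (z : ℕ → ℕ) (n : ℕ) : ℕ :=
  V * (∑ i ∈ range (n + 1), (z i + (V - 1)) / V) + n

lemma codeLen_mono (V : ℕ) (z : ℕ → ℕ) : Monotone (codeLen V z) := by
  refine monotone_nat_of_le_succ fun n => ?_
  unfold codeLen
  rw [sum_range_succ _ (n + 1), mul_add]
  omega

lemma exists_chunk (V Y : ℕ) (hV : 1 ≤ V) (hY : 1 ≤ Y) (z : ℕ → ℕ) (N c : ℕ) :
    ∃ (θ : ℕ) (l : List (ℕ × ℕ)), l.length = Y ∧ (∀ r ∈ l, r.1 ≤ V ∧ r.2 ≤ V) ∧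
      ∀ n ≤ N, codeLen V z n / (V * Y) = c → z n = (if θ = n then z θ else 0) + recVal θ l n := by
  classical
  by_cases hex : ∃ n, n ≤ N ∧ codeLen V z n / (V * Y) = c
  · let θ := Nat.find hex
    have hθ : θ ≤ N ∧ codeLen V z θ / (V * Y) = c := Nat.find_spec hex
    let e := Nat.findGreatest (fun n => codeLen V z n / (V * Y) = c) N
    have he : codeLen V z e / (V * Y) = c := by
      have := Nat.findGreatest_spec (P := fun n => codeLen V z n / (V * Y) = c) hθ.1 hθ.2
      exact this
    have hθe : θ ≤ e := Nat.le_findGreatest hθ.1 hθ.2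
    obtain ⟨l, h1, h2, h3, h4, h5⟩ := exists_records V hV z θ e hθe
    have hlen : l.length ≤ Y := by
      have hVY : 0 < V * Y := by positivity
      have h6 : codeLen V z e < codeLen V z θ + V * Y := by
        have a1 := Nat.div_add_mod (codeLen V z e) (V * Y)
        have a2 := Nat.div_add_mod (codeLen V z θ) (V * Y)
        have a3 := Nat.mod_lt (codeLen V z e) hVY
        rw [he] at a1
        rw [hθ.2] at a2
        omega
      have h7 : codeLen V z e = codeLen V z θ + V * (∑ i ∈ Ioc θ e, (z i + (V - 1)) / V)
          + (e - θ) := by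
        unfold codeLen
        have : ∑ i ∈ range (e + 1), (z i + (V - 1)) / V = ∑ i ∈ range (θ + 1), (z i + (V - 1)) / V
            + ∑ i ∈ Ioc θ e, (z i + (V - 1)) / V := by
          rw [← sum_range_add_sum_Ico _ (show θ + 1 ≤ e + 1 by omega)]
          congr 1
          refine sum_congr ?_ fun _ _ => rfl
          ext i
          simp only [Finset.mem_Ico, Finset.mem_Ioc]
          omega
        rw [this, mul_add]
        omega
      have h8 : V * l.length < V * Y := by
        rw [mul_comm]; omega
      exact (Nat.lt_of_mul_lt_mul_left h8).le
    refine ⟨θ, l ++ List.replicate (Y - l.length) (0, 0), by simp; omega, ?_, ?_⟩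
    · intro r hr
      rcases List.mem_append.1 hr with hr | hr
      · exact h1 r hr
      · rw [(List.mem_replicate.1 hr).2]; simp
    · intro n hn hnc
      have a1 : θ ≤ n := Nat.find_min' hex ⟨hn, hnc⟩
      have a2 : n ≤ e := Nat.le_findGreatest hn hnc
      rw [recVal_append, recVal_replicate, add_zero, h4]
      by_cases h : θ = n
      · subst h; simp
      · rw [if_neg h, if_pos (by omega), zero_add]
  · refine ⟨0, List.replicate Y (0, 0), by simp, ?_, fun n hn hc => (hex ⟨n, hn, hc⟩).elim⟩
    intro r hr
    rw [(List.mem_replicate.1 hr).2]; simp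

lemma relu_gate_eq (a A θ n : ℕ) (h : a ≤ A) :
    relu ((a : ℝ) - A * (relu ((θ : ℝ) - n) + relu ((n : ℝ) - θ))) =
      ((if θ = n then a else 0 : ℕ) : ℝ) := by
  have hA : (a : ℝ) ≤ A := by exact_mod_cast h
  have hA0 : (0 : ℝ) ≤ A := by positivity
  unfold relu
  rcases lt_trichotomy θ n with h | h | h
  · have h' : (θ : ℝ) + 1 ≤ n := by exact_mod_cast h
    rw [max_eq_right (a := (θ : ℝ) - n) (by linarith), max_eq_left (a := (n : ℝ) - θ) (by linarith),
      if_neg (by omega), max_eq_right]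
    · simp
    · nlinarith
  · subst h; simp
  · have h' : (n : ℝ) + 1 ≤ θ := by exact_mod_cast h
    rw [max_eq_left (a := (θ : ℝ) - n) (by linarith), max_eq_right (a := (n : ℝ) - θ) (by linarith),
      if_neg (by omega), max_eq_right]
    · simp
    · nlinarith

/-- A sequence of natural numbers is computed by a network whose size is governed by the length
of the code of the sequence. -/
lemma Net.sequence (W K R V Y : ℕ) (hV : 1 ≤ V) (hVR : V + 1 = 2 ^ R) (hY : 1 ≤ Y) (ν : X → ℕ)
    (N : ℕ) (hν : ∀ x, ν x ≤ N) (z : ℕ → ℕ) (hz : codeLen V z N ≤ V * Y * (K * (W * W))) :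
    Net (9 * W + 40) (3 * K + 2 + 4 * R * Y) (aff {fun x => (ν x : ℝ)})
      (aff {fun x => (z (ν x) : ℝ)}) := by
  classical
  have hVY : 0 < V * Y := by positivity
  obtain ⟨κ, hκ⟩ : ∃ κ : ℕ → ℕ, ∀ n, κ n = codeLen V z n / (V * Y) := ⟨_, fun _ => rfl⟩
  have hκm : Monotone κ := fun m n h => by
    rw [hκ, hκ]; exact Nat.div_le_div_right (codeLen_mono V z h)
  choose θ l hlen hlV hzl using exists_chunk V Y hV hY z N
  set n : X → ℝ := fun x => (ν x : ℝ) with hn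
  have hκW : ∀ m ≤ N, κ m ≤ K * (W * W) := fun m hm => by
    rw [hκ]
    exact (Nat.div_le_div_right (codeLen_mono V z hm)).trans
      ((Nat.div_le_div_right hz).trans (Nat.mul_div_cancel_left _ hVY).le)
  set C : X → ℝ := fun x => bcode (recBits R (l (κ (ν x)))) with hC
  set Θ : X → ℝ := fun x => (θ (κ (ν x)) : ℝ) with hΘ
  set a : X → ℝ := fun x => (z (θ (κ (ν x))) : ℝ) with ha
  have tC : Net (3 * W + 9) (3 * K) (aff {n}) (aff {C}) :=
    Net.table W K ν N hν κ hκm hκW fun c => bcode (recBits R (l c))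
  have tΘ : Net (3 * W + 9) (3 * K) (aff {n}) (aff {Θ}) :=
    Net.table W K ν N hν κ hκm hκW fun c => (θ c : ℝ)
  have ta : Net (3 * W + 9) (3 * K) (aff {n}) (aff {a}) :=
    Net.table W K ν N hν κ hκm hκW fun c => (z (θ c) : ℝ)
  have hnn : n ∈ aff {n} := mem_aff rfl
  have t1 := ((tC.par tΘ).par ta).keep (one_mem_aff _) {n} (by simpa using hnn)
  set U : Submodule ℝ (X → ℝ) := aff {C} ⊔ aff {Θ} ⊔ aff {a} ⊔
    aff (({n} : Finset (X → ℝ)) : Set (X → ℝ)) with hU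
  have h1 : (1 : X → ℝ) ∈ U := Submodule.mem_sup_right (one_mem_aff _)
  have hnU : n ∈ U := Submodule.mem_sup_right (mem_aff (by simp))
  have haU : a ∈ U := Submodule.mem_sup_left (Submodule.mem_sup_right (mem_aff rfl))
  have hΘU : Θ ∈ U := Submodule.mem_sup_left (Submodule.mem_sup_left
    (Submodule.mem_sup_right (mem_aff rfl)))
  have hCU : C ∈ U := Submodule.mem_sup_left (Submodule.mem_sup_left
    (Submodule.mem_sup_left (mem_aff rfl)))
  obtain ⟨A, hA⟩ : ∃ A, ∀ x, z (θ (κ (ν x))) ≤ A := by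
    refine ⟨∑ c ∈ range (κ N + 1), z (θ c), fun x => ?_⟩
    refine single_le_sum (f := fun c => z (θ c)) (fun _ _ => Nat.zero_le _) (mem_range.2 ?_)
    have := hκm (hν x)
    omega
  let s1 : Fin 2 → X → ℝ := ![Θ - n, n - Θ]
  have l1 : Net 2 1 U (aff (Set.range fun i => rel (s1 i))) := by
    refine Net.layer s1 (by simp) ?_ le_rfl
    intro i
    fin_cases i
    · exact U.sub_mem hΘU hnU
    · exact U.sub_mem hnU hΘU
  have hmem : ∀ f ∈ ({n, Θ, C, a} : Finset (X → ℝ)), f ∈ U := by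
    intro f hf
    simp only [Finset.mem_insert, Finset.mem_singleton] at hf
    rcases hf with rfl | rfl | rfl | rfl <;> assumption
  have l1' := l1.keep h1 {n, Θ, C, a} hmem
  set U1 := aff (Set.range fun i => rel (s1 i)) ⊔
    aff (({n, Θ, C, a} : Finset (X → ℝ)) : Set (X → ℝ)) with hU1
  have hU1m : ∀ f ∈ ({n, Θ, C, a} : Finset (X → ℝ)), f ∈ U1 := fun f hf =>
    Submodule.mem_sup_right (mem_aff hf)
  let s2 : Fin 1 → X → ℝ := fun _ => a - (A : ℝ) • (rel (s1 0) + rel (s1 1))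
  have l2 : Net 1 1 U1 (aff (Set.range fun i => rel (s2 i))) := by
    refine Net.layer s2 (by simp) ?_ le_rfl
    intro i
    exact U1.sub_mem (hU1m a (by simp)) (U1.smul_mem _ (Submodule.mem_sup_left
      (Submodule.add_mem _ (rel_mem s1 0) (rel_mem s1 1))))
  have l2' := l2.keep (Submodule.mem_sup_left (one_mem_aff _)) {n, Θ, C} (by
    intro f hf
    refine hU1m f ?_
    simp only [Finset.mem_insert, Finset.mem_singleton] at hf ⊢
    tauto)
  set U2 := aff (Set.range fun i => rel (s2 i)) ⊔
    aff (({n, Θ, C} : Finset (X → ℝ)) : Set (X → ℝ)) with hU2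
  have hU2m : ∀ f ∈ ({n, Θ, C} : Finset (X → ℝ)), f ∈ U2 := fun f hf =>
    Submodule.mem_sup_right (mem_aff hf)
  have l3 := Net.bitRun ν (recWeights R Y) (fun x => recBits R (l (κ (ν x))))
    (fun x => by rw [length_recBits, length_recWeights, hlen]) (fun x => θ (κ (ν x)))
    (rel (s2 0)) U2 (Submodule.mem_sup_left (one_mem_aff _)) (hU2m n (by simp))
    (hU2m C (by simp)) (hU2m Θ (by simp)) (Submodule.mem_sup_left (rel_mem s2 0))
  have c1 : ({n, Θ, C, a} : Finset (X → ℝ)).card ≤ 4 := card_le_four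
  have c2 : ({n, Θ, C} : Finset (X → ℝ)).card ≤ 3 := card_le_three
  rw [length_recWeights] at l3
  have e : 3 * K + 2 + 4 * R * Y = 3 * K + (1 + (1 + 2 * (2 * R * Y))) := by ring
  rw [e]
  refine (t1.mono (by simp; omega) le_rfl le_rfl).trans ((l1'.mono (by omega) le_rfl le_rfl).trans
    ((l2'.mono (by omega) le_rfl le_rfl).trans (l3.mono (by omega) le_rfl (le_of_eq ?_))))
  congr 2
  ext x
  have h9 := relu_gate_eq _ A (θ (κ (ν x))) (ν x) (hA x)
  have h10 : rel (s2 0) x = ((if θ (κ (ν x)) = ν x then z (θ (κ (ν x))) else 0 : ℕ) : ℝ) := h9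
  rw [h10]
  have h11 := bitRun_rec R (l (κ (ν x))) (fun r hr => by
    have := hlV _ r hr
    omega) (θ (κ (ν x))) (ν x)
  rw [hlen] at h11
  rw [h11]
  exact_mod_cast hzl (κ (ν x)) (ν x) (hν x) (hκ _).symm

end ChunkCoding

section Digits

variable {X : Type}

lemma Net.sequenceInt (W K R V Y : ℕ) (hV : 1 ≤ V) (hVR : V + 1 = 2 ^ R) (hY : 1 ≤ Y) (ν : X → ℕ)
    (N : ℕ) (hν : ∀ x, ν x ≤ N) (z : ℕ → ℤ)
    (hz : codeLen V (fun n => (z n).natAbs) N ≤ V * Y * (K * (W * W))) :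
    Net (18 * W + 80) (3 * K + 2 + 4 * R * Y) (aff {fun x => (ν x : ℝ)})
      (aff {fun x => (z (ν x) : ℝ)}) := by
  have key : ∀ z' : ℕ → ℕ, (∀ n, z' n ≤ (z n).natAbs) →
      codeLen V z' N ≤ V * Y * (K * (W * W)) := by
    intro z' h
    refine le_trans ?_ hz
    unfold codeLen
    gcongr with i _
    exact h i
  have h1 := Net.sequence W K R V Y hV hVR hY ν N hν (fun n => (z n).toNat)
    (key _ fun n => by omega)
  have h2 := Net.sequence W K R V Y hV hVR hY ν N hν (fun n => (-z n).toNat)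
    (key _ fun n => by omega)
  refine (h1.par h2).mono (by omega) le_rfl ?_
  refine aff_le (Submodule.mem_sup_left (one_mem_aff _)) ?_
  rintro f rfl
  have : (fun x => (z (ν x) : ℝ)) = (fun x => ((z (ν x)).toNat : ℝ)) -
      fun x => ((-z (ν x)).toNat : ℝ) := by
    ext x
    simp only [Pi.sub_apply]
    have : z (ν x) = ((z (ν x)).toNat : ℤ) - ((-z (ν x)).toNat : ℤ) := by omega
    exact_mod_cast this
  rw [this]
  exact Submodule.sub_mem _ (Submodule.mem_sup_left (mem_aff rfl))
    (Submodule.mem_sup_right (mem_aff rfl))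

/-- The index of the interval `[i / K, (i + 1) / K)` containing `y`. -/
def cidx (K : ℕ) (y : ℝ) : ℕ := ⌊(K : ℝ) * y⌋₊

/-- `y ∈ [0, 1)` is not within distance `δ` to the left of an interior grid point `i / K`. -/
def Good (K : ℕ) (δ y : ℝ) : Prop :=
  0 ≤ y ∧ y < 1 ∧ ∀ i : ℕ, 0 < i → i < K → (i : ℝ) ≤ K * y ∨ (K : ℝ) * y ≤ i - K * δ

lemma cidx_lt {K : ℕ} (hK : 0 < K) {y : ℝ} (h0 : 0 ≤ y) (h1 : y < 1) : cidx K y < K := by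
  have : (0 : ℝ) < K := by exact_mod_cast hK
  exact (Nat.floor_lt (by positivity)).2 (by nlinarith)

lemma cidx_le_mul (K : ℕ) {y : ℝ} (h0 : 0 ≤ y) : (cidx K y : ℝ) ≤ K * y :=
  Nat.floor_le (by positivity)

lemma mul_lt_cidx_add_one (K : ℕ) (y : ℝ) : (K : ℝ) * y < cidx K y + 1 :=
  Nat.lt_floor_add_one _

lemma Good.left {K K' : ℕ} (hK' : 0 < K') {δ y : ℝ} (h : Good (K * K') δ y) : Good K δ y := by
  refine ⟨h.1, h.2.1, fun i hi hiK => ?_⟩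
  have hK'r : (0 : ℝ) < K' := by exact_mod_cast hK'
  have := h.2.2 (i * K') (by positivity) (Nat.mul_lt_mul_of_pos_right hiK hK')
  push_cast at this
  rcases this with h | h
  · left
    exact le_of_mul_le_mul_right (by linarith) hK'r
  · right
    exact le_of_mul_le_mul_right (by linarith) hK'r

lemma Good.residual {K K' : ℕ} (hK : 0 < K) {δ y : ℝ} (h : Good (K * K') δ y) :
    Good K' (K * δ) (K * y - cidx K y) := by
  refine ⟨by linarith [cidx_le_mul K h.1], by linarith [mul_lt_cidx_add_one K y],
    fun i hi hiK => ?_⟩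
  have hc := cidx_lt hK h.1 h.2.1
  have := h.2.2 (cidx K y * K' + i) (by omega) (by
    calc cidx K y * K' + i < (cidx K y + 1) * K' := by rw [add_mul]; omega
      _ ≤ K * K' := Nat.mul_le_mul_right _ hc)
  push_cast at this
  rcases this with h | h
  · left; linarith
  · right; linarith

lemma cidx_mul (K K' : ℕ) {y : ℝ} (h0 : 0 ≤ y) :
    cidx (K * K') y = K' * cidx K y + cidx K' (K * y - cidx K y) := by
  have h1 := cidx_le_mul K h0
  have h2 : ((K * K' : ℕ) : ℝ) * y = (K' : ℝ) * (K * y - cidx K y) + ((K' * cidx K y : ℕ) : ℝ) := by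
    push_cast; ring
  unfold cidx at *
  rw [h2, Nat.floor_add_natCast (mul_nonneg (by positivity) (by linarith)), add_comm]

lemma relu_step_eq {K : ℕ} (hK : 0 < K) {δ y : ℝ} (hδ : 0 < δ) (h : Good K δ y) (i : ℕ)
    (hi : 0 < i) (hiK : i < K) :
    relu (((K : ℝ) * y - i) / (K * δ) + 1) - relu (((K : ℝ) * y - i) / (K * δ)) =
      stp i (cidx K y) := by
  have hKδ : 0 < (K : ℝ) * δ := by positivity
  have h3 : i ≤ cidx K y ↔ (i : ℝ) ≤ K * y := Nat.le_floor_iff (mul_nonneg (by positivity) h.1)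
  unfold relu stp
  split_ifs with h4 <;> rw [h3] at h4
  · have : 0 ≤ ((K : ℝ) * y - i) / (K * δ) := div_nonneg (by linarith) hKδ.le
    rw [max_eq_left (by linarith), max_eq_left this]; ring
  · have h5 := (h.2.2 i hi hiK).resolve_left h4
    have : ((K : ℝ) * y - i) / (K * δ) ≤ -1 := by
      rw [div_le_iff₀ hKδ]; linarith
    rw [max_eq_right (by linarith), max_eq_right (by linarith)]; ring

/-- One layer extracts one digit (in base `K`) of finitely many features. -/
lemma Net.digit {ι : Type} [Fintype ι] {K : ℕ} (hK : 0 < K) {δ : ℝ} (hδ : 0 < δ) (y : ι → X → ℝ)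
    (hy : ∀ i x, Good K δ (y i x)) {U : Submodule ℝ (X → ℝ)} (h1 : (1 : X → ℝ) ∈ U)
    (hU : ∀ i, y i ∈ U) :
    ∃ V : Submodule ℝ (X → ℝ), Net (2 * Fintype.card ι * K) 1 U V ∧ (1 : X → ℝ) ∈ V ∧
      ∀ i (F : ℕ → ℝ), (fun x => F (cidx K (y i x))) ∈ V := by
  classical
  let s : (ι × Fin K) ⊕ (ι × Fin K) → X → ℝ := fun p => match p with
    | Sum.inl p => fun x => ((K : ℝ) * y p.1 x - ((p.2 : ℕ) : ℝ)) / (K * δ) + 1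
    | Sum.inr p => fun x => ((K : ℝ) * y p.1 x - ((p.2 : ℕ) : ℝ)) / (K * δ)
  refine ⟨aff (Set.range fun i => rel (s i)), Net.layer s (by simp; ring_nf; rfl) ?_ le_rfl,
    one_mem_aff _, ?_⟩
  · have h2 : ∀ p : ι × Fin K,
        (fun x => ((K : ℝ) * y p.1 x - ((p.2 : ℕ) : ℝ)) / (K * δ)) ∈ U := by
      intro p
      have := U.smul_mem (1 / (K * δ)) (U.sub_mem (U.smul_mem (K : ℝ) (hU p.1))
        (const_mem h1 ((p.2 : ℕ) : ℝ)))
      convert this using 1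
      ext x; simp; ring
    rintro (p | p)
    · exact U.add_mem (h2 p) (const_mem h1 1)
    · exact h2 p
  · intro i F
    have h2 : (fun x => F (cidx K (y i x))) = (fun _ => F 0) +
        ∑ c ∈ range (K - 1), (F (c + 1) - F c) • fun x => stp (c + 1) (cidx K (y i x)) := by
      ext x
      have hlt := cidx_lt hK (hy i x).1 (hy i x).2.1
      rw [sum_stp_telescope F (K - 1) (cidx K (y i x)) (by omega)]
      simp
    rw [h2]
    refine Submodule.add_mem _ (const_mem (one_mem_aff _) _) (Submodule.sum_mem _ fun c hc =>
      Submodule.smul_mem _ _ ?_)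
    have hc' := mem_range.1 hc
    have h3 : (fun x => stp (c + 1) (cidx K (y i x))) =
        rel (s (Sum.inl (i, ⟨c + 1, by omega⟩))) - rel (s (Sum.inr (i, ⟨c + 1, by omega⟩))) := by
      ext x
      exact (relu_step_eq hK hδ (hy i x) (c + 1) (by omega) (by omega)).symm
    rw [h3]
    exact Submodule.sub_mem _ (rel_mem s (Sum.inl (i, ⟨c + 1, by omega⟩)))
      (rel_mem s (Sum.inr (i, ⟨c + 1, by omega⟩)))

/-- The digits of `n` in base `b`, spread out with gaps of length `d`. -/
def spread (b d j n : ℕ) : ℕ := ∑ r ∈ range j, b ^ (d * r) * (n / b ^ r % b)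

/-- The Morton index of a cell of level `j`. -/
def morton {d : ℕ} (b j : ℕ) (n : Fin d → ℕ) : ℕ := ∑ i : Fin d, b ^ (i : ℕ) * spread b d j (n i)

lemma spread_add (b d j t n : ℕ) :
    spread b d (t + j) n = spread b d t n + b ^ (d * t) * spread b d j (n / b ^ t) := by
  unfold spread
  rw [sum_range_add, mul_sum]
  congr 1
  refine sum_congr rfl fun r _ => ?_
  rw [mul_add, pow_add, pow_add, Nat.div_div_eq_div_mul]; ring

lemma spread_mul_add {b : ℕ} (hb : 0 < b) (d t m n : ℕ) :
    spread b d t (b ^ t * m + n) = spread b d t n := by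
  unfold spread
  refine sum_congr rfl fun r hr => ?_
  have hr' := mem_range.1 hr
  obtain ⟨e, rfl⟩ := Nat.exists_eq_add_of_lt hr'
  have : b ^ (r + e + 1) * m + n = n + b ^ r * (b * (b ^ e * m)) := by ring
  rw [this, Nat.add_mul_div_left _ _ (by positivity), Nat.add_mul_mod_self_left]

lemma morton_add {d : ℕ} (b j t : ℕ) (n : Fin d → ℕ) :
    morton b (t + j) n = morton b t n + b ^ (d * t) * morton b j (fun i => n i / b ^ t) := by
  unfold morton
  rw [mul_sum, ← sum_add_distrib]
  refine sum_congr rfl fun i _ => ?_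
  rw [spread_add]; ring

lemma morton_one {d : ℕ} {b : ℕ} (hb : 0 < b) (n : Fin d → ℕ) :
    morton b 1 n = (finFunctionFinEquiv fun i => (⟨n i % b, Nat.mod_lt _ hb⟩ : Fin b) : ℕ) := by
  rw [finFunctionFinEquiv_apply]
  unfold morton spread
  refine sum_congr rfl fun i _ => ?_
  simp [mul_comm]

lemma morton_lt {d : ℕ} {b : ℕ} (hb : 0 < b) (j : ℕ) (n : Fin d → ℕ) :
    morton b j n < b ^ (d * j) := by
  induction j generalizing n with
  | zero => simp [morton, spread]
  | succ j ih =>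
    rw [add_comm, morton_add, morton_one hb]
    have h1 := (finFunctionFinEquiv fun i => (⟨n i % b, Nat.mod_lt _ hb⟩ : Fin b)).2
    have h2 := ih fun i => n i / b ^ 1
    rw [mul_add, pow_add, mul_one]
    calc _ < b ^ d + b ^ d * morton b j (fun i => n i / b ^ 1) := by omega
      _ = b ^ d * (morton b j (fun i => n i / b ^ 1) + 1) := by ring
      _ ≤ _ := Nat.mul_le_mul_left _ h2

lemma morton_div {d : ℕ} {b : ℕ} (hb : 0 < b) (j t : ℕ) (n : Fin d → ℕ) :
    morton b (t + j) n / b ^ (d * t) = morton b j (fun i => n i / b ^ t) := by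
  rw [morton_add, Nat.add_mul_div_left _ _ (by positivity), Nat.div_eq_of_lt (morton_lt hb t n),
    zero_add]

/-- The cells of level `j`. -/
def cells (d b j : ℕ) : Finset (Fin d → ℕ) := Fintype.piFinset fun _ => range (b ^ j)

lemma mem_cells {d b j : ℕ} {n : Fin d → ℕ} : n ∈ cells d b j ↔ ∀ i, n i < b ^ j := by
  simp [cells]

lemma morton_injOn {d : ℕ} {b : ℕ} (hb : 0 < b) (j : ℕ) :
    Set.InjOn (morton b j) (cells d b j : Set (Fin d → ℕ)) := by
  induction j with
  | zero =>
    intro n hn n' hn' _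
    rw [mem_coe, mem_cells] at hn hn'
    ext i
    have := hn i
    have := hn' i
    simp at *; omega
  | succ j ih =>
    intro n hn n' hn' h
    rw [mem_coe, mem_cells] at hn hn'
    rw [add_comm j 1] at h
    have h1 : morton b j (fun i => n i / b ^ 1) = morton b j (fun i => n' i / b ^ 1) := by
      rw [← morton_div hb, ← morton_div hb, h]
    have h2 := ih (by
      rw [mem_coe, mem_cells]
      intro i
      refine Nat.div_lt_of_lt_mul ?_
      have := hn i
      rwa [pow_one, ← pow_succ']) (by
      rw [mem_coe, mem_cells]
      intro i
      refine Nat.div_lt_of_lt_mul ?_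
      have := hn' i
      rwa [pow_one, ← pow_succ']) h1
    rw [morton_add, morton_add, h1] at h
    have h3 := Nat.add_right_cancel h
    rw [morton_one hb, morton_one hb] at h3
    have h4 := finFunctionFinEquiv.injective (Fin.ext h3)
    ext i
    have h5 := congrFun h2 i
    have h6 := congrArg Fin.val (congrFun h4 i)
    simp only [pow_one] at h5 h6
    rw [← Nat.div_add_mod (n i) b, ← Nat.div_add_mod (n' i) b, h5, h6]

end Digits

section LevelsAndProducts

variable {X : Type}

/-- The cell of level `j` containing `e`. -/
def cellAt {d : ℕ} (b j : ℕ) (e : Fin d → ℝ) : Fin d → ℕ := fun i => cidx (b ^ j) (e i)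

open Classical in
/-- The coordinate functions. -/
def coordSet {d : ℕ} (e : X → Fin d → ℝ) : Finset (X → ℝ) := univ.image fun i x => e x i

open Classical in
/-- The coordinates together with the indices of the cell of level `j`. -/
def levelSet {d : ℕ} (b j : ℕ) (e : X → Fin d → ℝ) : Finset (X → ℝ) :=
  coordSet e ∪ ((univ.image fun i x => (cellAt b j (e x) i : ℝ)) ∪
    {fun x => (morton b j (cellAt b j (e x)) : ℝ)})

lemma card_coordSet {d : ℕ} (e : X → Fin d → ℝ) : (coordSet e).card ≤ d := by
  classical
  exact card_image_le.trans (by simp)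

lemma card_levelSet {d : ℕ} (b j : ℕ) (e : X → Fin d → ℝ) : (levelSet b j e).card ≤ 2 * d + 1 := by
  classical
  unfold levelSet
  refine (card_union_le _ _).trans ?_
  have h1 := card_coordSet e
  have h2 := card_union_le (univ.image fun (i : Fin d) (x : X) => (cellAt b j (e x) i : ℝ))
    {fun x => (morton b j (cellAt b j (e x)) : ℝ)}
  have h3 : (univ.image fun (i : Fin d) (x : X) => (cellAt b j (e x) i : ℝ)).card ≤ d :=
    card_image_le.trans (by simp)
  rw [card_singleton] at h2
  omega

lemma coord_mem_coordSet {d : ℕ} (e : X → Fin d → ℝ) (i : Fin d) :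
    (fun x => e x i) ∈ coordSet e := by
  classical
  exact mem_image_of_mem _ (mem_univ i)

lemma coord_mem_levelSet {d : ℕ} (b j : ℕ) (e : X → Fin d → ℝ) (i : Fin d) :
    (fun x => e x i) ∈ levelSet b j e := by
  classical
  exact mem_union_left _ (coord_mem_coordSet e i)

lemma cell_mem_levelSet {d : ℕ} (b j : ℕ) (e : X → Fin d → ℝ) (i : Fin d) :
    (fun x => (cellAt b j (e x) i : ℝ)) ∈ levelSet b j e := by
  classical
  exact mem_union_right _ (mem_union_left _ (mem_image_of_mem _ (mem_univ i)))

lemma morton_mem_levelSet {d : ℕ} (b j : ℕ) (e : X → Fin d → ℝ) :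
    (fun x => (morton b j (cellAt b j (e x)) : ℝ)) ∈ levelSet b j e := by
  classical
  exact mem_union_right _ (mem_union_right _ (mem_singleton_self _))

lemma cellAt_div {d : ℕ} {b : ℕ} (hb : 0 < b) (j t : ℕ) {e : Fin d → ℝ} (h0 : ∀ i, 0 ≤ e i) :
    (fun i => cellAt b (t + j) e i / b ^ t) = cellAt b j e := by
  ext i
  unfold cellAt
  rw [add_comm, pow_add, cidx_mul _ _ (h0 i), Nat.mul_add_div (by positivity),
    Nat.div_eq_of_lt, add_zero]
  refine cidx_lt (by positivity) ?_ ?_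
  · linarith [cidx_le_mul (b ^ j) (h0 i)]
  · linarith [mul_lt_cidx_add_one (b ^ j) (e i)]

lemma morton_cellAt_div {d : ℕ} {b : ℕ} (hb : 0 < b) (j t : ℕ) {e : Fin d → ℝ}
    (h0 : ∀ i, 0 ≤ e i) :
    morton b (t + j) (cellAt b (t + j) e) / b ^ (d * t) = morton b j (cellAt b j e) := by
  rw [morton_div hb, cellAt_div hb j t h0]

lemma Net.level_step {d : ℕ} {b : ℕ} (hb : 0 < b) (j t : ℕ) {δ : ℝ} (hδ : 0 < δ)
    (e : X → Fin d → ℝ) (he : ∀ x i, Good (b ^ (j + t)) δ (e x i)) :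
    Net (2 * d * b ^ t + 4 * d + 2) 1 (aff (levelSet b j e : Set (X → ℝ)))
      (aff (levelSet b (j + t) e : Set (X → ℝ))) := by
  classical
  have hbj : 0 < b ^ j := by positivity
  have hbt : 0 < b ^ t := by positivity
  set y : Fin d → X → ℝ := fun i x => ((b ^ j : ℕ) : ℝ) * e x i - cidx (b ^ j) (e x i) with hy
  have hyg : ∀ i x, Good (b ^ t) ((b ^ j : ℕ) * δ) (y i x) := fun i x =>
    Good.residual hbj (by rw [← pow_add]; exact he x i)
  set U := aff (levelSet b j e : Set (X → ℝ))
  have hco : ∀ i, (fun x => e x i) ∈ U := fun i => mem_aff (coord_mem_levelSet b j e i)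
  have hce : ∀ i, (fun x => (cellAt b j (e x) i : ℝ)) ∈ U := fun i =>
    mem_aff (cell_mem_levelSet b j e i)
  have hyU : ∀ i, y i ∈ U := fun i =>
    U.sub_mem (U.smul_mem ((b ^ j : ℕ) : ℝ) (hco i)) (hce i)
  obtain ⟨V, hV, h1V, hF⟩ := Net.digit hbt (δ := ((b ^ j : ℕ) : ℝ) * δ) (by positivity) y hyg
    (one_mem_aff _ : (1 : X → ℝ) ∈ U) hyU
  have hK := hV.keep (one_mem_aff _) (levelSet b j e) fun f hf => mem_aff hf
  have hcard := card_levelSet b j e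
  refine hK.mono (by simp; omega) le_rfl ?_
  set V' := V ⊔ aff (levelSet b j e : Set (X → ℝ))
  have hUV : U ≤ V' := le_sup_right
  have hcell : ∀ x i, cellAt b (j + t) (e x) i =
      b ^ t * cellAt b j (e x) i + cidx (b ^ t) (y i x) :=
    fun x i => by
      unfold cellAt
      rw [pow_add, cidx_mul _ _ (he x i).1]
  refine aff_le (Submodule.mem_sup_left h1V) ?_
  intro f hf
  rw [mem_coe] at hf
  unfold levelSet at hf
  simp only [coordSet, Finset.mem_union, Finset.mem_image, Finset.mem_univ, true_and,
    Finset.mem_singleton] at hf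
  rcases hf with ⟨i, rfl⟩ | ⟨i, rfl⟩ | rfl
  · exact hUV (hco i)
  · have : (fun x => (cellAt b (j + t) (e x) i : ℝ)) =
        ((b ^ t : ℕ) : ℝ) • (fun x => (cellAt b j (e x) i : ℝ)) +
          fun x => (cidx (b ^ t) (y i x) : ℝ) := by
      ext x
      simp [hcell]
    rw [this]
    exact Submodule.add_mem _ (Submodule.smul_mem _ _ (hUV (hce i)))
      (Submodule.mem_sup_left (hF i fun n => (n : ℝ)))
  · have : (fun x => (morton b (j + t) (cellAt b (j + t) (e x)) : ℝ)) =
        (∑ i : Fin d, fun x => ((b ^ (i : ℕ) * spread b d t (cidx (b ^ t) (y i x)) : ℕ) : ℝ)) +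
        ((b ^ (d * t) : ℕ) : ℝ) • fun x => (morton b j (cellAt b j (e x)) : ℝ) := by
      ext x
      have h1 := morton_add b j t (cellAt b (t + j) (e x))
      rw [cellAt_div hb j t (fun i => (he x i).1)] at h1
      rw [add_comm j t, h1]
      simp only [Pi.add_apply, Finset.sum_apply, Pi.smul_apply, smul_eq_mul]
      push_cast
      congr 1
      unfold morton
      push_cast
      refine sum_congr rfl fun i _ => ?_
      rw [add_comm t j, hcell, spread_mul_add hb]
    rw [this]
    refine Submodule.add_mem _ (Submodule.sum_mem _ fun i _ => Submodule.mem_sup_left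
      (hF i fun n => ((b ^ (i : ℕ) * spread b d t n : ℕ) : ℝ))) (Submodule.smul_mem _ _ (hUV ?_))
    exact mem_aff (morton_mem_levelSet b j e)

lemma Net.level {d : ℕ} {b : ℕ} (hb : 0 < b) {β : ℕ} (hβ : 0 < β) (Jg j : ℕ) (hj : j ≤ Jg)
    {δ : ℝ} (hδ : 0 < δ) (e : X → Fin d → ℝ) (he : ∀ x i, Good (b ^ Jg) δ (e x i)) :
    Net (2 * d * b ^ β + 4 * d + 2) (j / β + 1) (aff (coordSet e : Set (X → ℝ)))
      (aff (levelSet b j e : Set (X → ℝ))) := by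
  classical
  have hgood : ∀ i ≤ Jg, ∀ x k, Good (b ^ i) δ (e x k) := fun i hi x k => by
    obtain ⟨r, rfl⟩ := Nat.exists_eq_add_of_le hi
    have := he x k
    rw [pow_add] at this
    exact this.left (by positivity)
  have h0 : aff (levelSet b 0 e : Set (X → ℝ)) ≤ aff (coordSet e : Set (X → ℝ)) := by
    have hz : ∀ x, cellAt b 0 (e x) = 0 := fun x => by
      ext i
      have := cidx_lt (K := 1) one_pos (he x i).1 (he x i).2.1
      simp only [cellAt, pow_zero, Pi.zero_apply]
      omega
    refine aff_le (one_mem_aff _) ?_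
    intro f hf
    rw [mem_coe] at hf
    unfold levelSet at hf
    simp only [Finset.mem_union, Finset.mem_image, Finset.mem_univ, true_and,
      Finset.mem_singleton, hz] at hf
    rcases hf with hf | ⟨i, rfl⟩ | rfl
    · exact mem_aff hf
    · exact const_mem (one_mem_aff _) _
    · exact const_mem (one_mem_aff _) _
  have hit : ∀ m, m * β ≤ Jg → Net (2 * d * b ^ β + 4 * d + 2) m
      (aff (coordSet e : Set (X → ℝ))) (aff (levelSet b (m * β) e : Set (X → ℝ))) := by
    intro m hm
    induction m with
    | zero => rw [zero_mul]; exact h0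
    | succ m ih =>
      rw [add_mul, one_mul] at hm ⊢
      exact (ih (by omega)).trans (Net.level_step hb _ β hδ e (hgood _ hm))
  have hdm := Nat.div_add_mod' j β
  have h1 := hit (j / β) (by omega)
  have h2 := Net.level_step hb (j / β * β) (j % β) hδ e (by rw [hdm]; exact hgood j hj)
  rw [hdm] at h2
  refine h1.trans (h2.mono ?_ le_rfl le_rfl)
  have := Nat.pow_le_pow_right hb (Nat.mod_lt j hβ).le
  have := Nat.mul_le_mul_left (2 * d) this
  omega

/-- The truncation of `y` to `D` digits in base `K`. -/
def trunc (K D : ℕ) (y : ℝ) : ℝ := cidx (K ^ D) y / (K : ℝ) ^ D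

lemma Net.mulTrunc {K : ℕ} (hK : 0 < K) (D : ℕ) {δ : ℝ} (hδ : 0 < δ) (c y acc : X → ℝ) (R lam : ℝ)
    (hc : ∀ x, |c x| ≤ R) (hy : ∀ x, Good (K ^ D) δ (y x)) {U : Submodule ℝ (X → ℝ)}
    (h1 : (1 : X → ℝ) ∈ U) (hcU : c ∈ U) (hyU : y ∈ U) (haU : acc ∈ U) :
    Net (2 * K + 6) (2 * D) U (aff {fun x => acc x + lam * (c x * trunc K D (y x))}) := by
  classical
  induction D generalizing y acc lam δ U with
  | zero =>
    refine aff_le h1 ?_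
    rintro f rfl
    have : (fun x => acc x + lam * (c x * trunc K 0 (y x))) = acc := by
      ext x
      have := cidx_lt (K := 1) one_pos (hy x).1 (hy x).2.1
      have h2 : cidx 1 (y x) = 0 := by omega
      simp [trunc, h2]
    rw [this]; exact haU
  | succ D ih =>
    have hy1 : ∀ x, Good K δ (y x) := fun x => by
      have := hy x
      rw [pow_succ'] at this
      exact this.left (by positivity)
    obtain ⟨V, hV, h1V, hF⟩ := Net.digit hK hδ (fun _ : Unit => y) (fun _ => hy1) h1
      (fun _ => hyU)
    have hF' := hF ()
    have l1 := hV.keep h1 {c, y, acc} (by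
      intro f hf
      simp only [Finset.mem_insert, Finset.mem_singleton] at hf
      rcases hf with rfl | rfl | rfl <;> assumption)
    set U1 := V ⊔ aff (({c, y, acc} : Finset (X → ℝ)) : Set (X → ℝ)) with hU1
    have hm1 : ∀ f ∈ ({c, y, acc} : Finset (X → ℝ)), f ∈ U1 := fun f hf =>
      Submodule.mem_sup_right (mem_aff hf)
    have h11 : (1 : X → ℝ) ∈ U1 := Submodule.mem_sup_left h1V
    set σ : ℕ → X → ℝ := fun i x => stp (i + 1) (cidx K (y x)) with hσ
    have hσU : ∀ i, σ i ∈ U1 := fun i => Submodule.mem_sup_left (hF' fun n => stp (i + 1) n)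
    set y' : X → ℝ := fun x => (K : ℝ) * y x - cidx K (y x) with hy'
    have hy'U : y' ∈ U1 := U1.sub_mem (U1.smul_mem _ (hm1 y (by simp)))
      (Submodule.mem_sup_left (hF' fun n => (n : ℝ)))
    set acc1 : X → ℝ := acc - (lam / K * R) • ∑ i ∈ range K, σ i with hacc1
    have hacc1U : acc1 ∈ U1 := U1.sub_mem (hm1 acc (by simp)) (U1.smul_mem _
      (U1.sum_mem fun i _ => hσU i))
    let g : Fin K → X → ℝ := fun i x => c x + R - 2 * R * (1 - σ i x)
    have l2 : Net K 1 U1 (aff (Set.range fun i => rel (g i))) := by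
      refine Net.layer g (by simp) ?_ le_rfl
      intro i
      exact U1.sub_mem (U1.add_mem (hm1 c (by simp)) (const_mem h11 R))
        (U1.smul_mem (2 * R) (U1.sub_mem (const_mem h11 1) (hσU i)))
    have l2' := l2.keep h11 {c, y', acc1} (by
      intro f hf
      simp only [Finset.mem_insert, Finset.mem_singleton] at hf
      rcases hf with rfl | rfl | rfl
      · exact hm1 f (by simp)
      · exact hy'U
      · exact hacc1U)
    set U2 := aff (Set.range fun i => rel (g i)) ⊔
      aff (({c, y', acc1} : Finset (X → ℝ)) : Set (X → ℝ)) with hU2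
    have hm2 : ∀ f ∈ ({c, y', acc1} : Finset (X → ℝ)), f ∈ U2 := fun f hf =>
      Submodule.mem_sup_right (mem_aff hf)
    set acc2 : X → ℝ := acc1 + (lam / K) • ∑ i : Fin K, rel (g i) with hacc2
    have hacc2U : acc2 ∈ U2 := U2.add_mem (hm2 acc1 (by simp)) (U2.smul_mem _
      (U2.sum_mem fun i _ => Submodule.mem_sup_left (rel_mem g i)))
    have l3 := ih (δ := K * δ) (by positivity) y' acc2 (lam / K) (fun x => by
      have := hy x
      rw [pow_succ'] at this
      exact this.residual hK) (U := U2) (Submodule.mem_sup_right (one_mem_aff _))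
      (hm2 c (by simp)) (hm2 y' (by simp)) hacc2U
    have c1 : ({c, y, acc} : Finset (X → ℝ)).card ≤ 3 := card_le_three
    have c2 : ({c, y', acc1} : Finset (X → ℝ)).card ≤ 3 := card_le_three
    have e : 2 * (D + 1) = 1 + (1 + 2 * D) := by ring
    rw [e]
    refine (l1.mono (by simp; omega) le_rfl le_rfl).trans
      ((l2'.mono (by omega) le_rfl le_rfl).trans (l3.mono le_rfl le_rfl (le_of_eq ?_)))
    congr 2
    ext x
    have hKr : (K : ℝ) ≠ 0 := by positivity
    have h5 : ∀ i : Fin K, rel (g i) x = c x * σ i x + R * σ i x := by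
      intro i
      have := gate_eq (hc x) (i + 1) (cidx K (y x))
      simp only [rel, g, σ]
      linarith
    have h6 := sum_stp_telescope (fun n => (n : ℝ)) K (cidx K (y x))
      (cidx_lt hK (hy x).1 (hy x).2.1).le
    simp only [Nat.cast_add, Nat.cast_one, add_sub_cancel_left, one_mul, Nat.cast_zero,
      zero_add] at h6
    have h7 : acc2 x = acc x + lam / K * (c x * cidx K (y x)) := by
      simp only [hacc2, hacc1, Pi.add_apply, Pi.sub_apply, Pi.smul_apply, Finset.sum_apply, h5,
        smul_eq_mul]
      rw [Finset.sum_add_distrib, ← mul_sum, ← mul_sum,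
        Fin.sum_univ_eq_sum_range (fun i => σ i x) K,
        h6]
      simp only [hσ]; ring
    rw [h7, add_assoc]
    congr 1
    unfold trunc
    rw [pow_succ', cidx_mul _ _ (hy x).1]
    push_cast
    field_simp
    ring

lemma trunc_nonneg (K D : ℕ) (y : ℝ) : 0 ≤ trunc K D y := by unfold trunc; positivity

lemma trunc_le {K : ℕ} (hK : 0 < K) (D : ℕ) {y : ℝ} (h0 : 0 ≤ y) : trunc K D y ≤ y := by
  unfold trunc
  rw [div_le_iff₀ (by positivity)]
  have := cidx_le_mul (K ^ D) h0
  push_cast at this; linarith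

lemma le_trunc_add {K : ℕ} (hK : 0 < K) (D : ℕ) (y : ℝ) :
    y ≤ trunc K D y + 1 / (K : ℝ) ^ D := by
  unfold trunc
  rw [← add_div, le_div_iff₀ (by positivity)]
  have := mul_lt_cidx_add_one (K ^ D) y
  push_cast at this; linarith

lemma Net.monomial {ι : Type} [Fintype ι] {K : ℕ} (hK : 0 < K) (D : ℕ) {δ : ℝ} (hδ : 0 < δ)
    (y : ι → X → ℝ) (hy : ∀ i x, Good (K ^ D) δ (y i x)) (is : List ι) (c : X → ℝ) (R : ℝ)
    (hc : ∀ x, |c x| ≤ R) {U : Submodule ℝ (X → ℝ)}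
    (h1 : (1 : X → ℝ) ∈ U) (hcU : c ∈ U) (hyU : ∀ i, y i ∈ U) :
    Net (2 * K + 6 + 2 * Fintype.card ι) (2 * D * is.length) U
      (aff {fun x => c x * (is.map fun i => trunc K D (y i x)).prod}) := by
  classical
  induction is generalizing c U with
  | nil =>
    refine aff_le h1 ?_
    rintro f rfl
    simpa using hcU
  | cons i is ih =>
    have l1 := Net.mulTrunc hK D hδ c (y i) 0 R 1 hc (hy i) h1 hcU (hyU i) U.zero_mem
    simp only [Pi.zero_apply, one_mul, zero_add] at l1
    have l1' := l1.keep h1 (univ.image y) (by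
      intro f hf
      obtain ⟨i, -, rfl⟩ := Finset.mem_image.1 hf
      exact hyU i)
    have l2 := ih (U := aff {fun x => c x * trunc K D (y i x)} ⊔
        aff ((univ.image y : Finset (X → ℝ)) : Set (X → ℝ)))
      (fun x => c x * trunc K D (y i x)) (fun x => by
      rw [abs_mul, abs_of_nonneg (trunc_nonneg _ _ _)]
      have h3 : trunc K D (y i x) ≤ 1 := (trunc_le hK D (hy i x).1).trans (hy i x).2.1.le
      calc |c x| * trunc K D (y i x) ≤ |c x| * 1 := by gcongr
        _ ≤ R := by rw [mul_one]; exact hc x)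
      (Submodule.mem_sup_left (one_mem_aff _))
      (Submodule.mem_sup_left (mem_aff (Set.mem_singleton _)))
      (fun i => Submodule.mem_sup_right
        (mem_aff (by exact_mod_cast Finset.mem_image_of_mem y (Finset.mem_univ i))))
    have e : 2 * D * (i :: is).length = 2 * D + 2 * D * is.length := by
      rw [List.length_cons]; ring
    rw [e]
    have hcard : (univ.image y).card ≤ Fintype.card ι := card_image_le
    refine (l1'.mono (by omega) le_rfl le_rfl).trans (l2.mono le_rfl le_rfl (le_of_eq ?_))
    simp only [List.map_cons, List.prod_cons, mul_assoc]

lemma list_prod_trunc_error {ι : Type} {K : ℕ} (hK : 0 < K) (D : ℕ) (y : ι → ℝ)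
    (h0 : ∀ i, 0 ≤ y i) (h1 : ∀ i, y i ≤ 1) (is : List ι) :
    |(is.map fun i => trunc K D (y i)).prod - (is.map y).prod| ≤ is.length / (K : ℝ) ^ D ∧
      0 ≤ (is.map y).prod ∧ (is.map y).prod ≤ 1 := by
  induction is with
  | nil => simp
  | cons i is ih =>
    obtain ⟨a, b, c⟩ := ih
    simp only [List.map_cons, List.prod_cons, List.length_cons, Nat.cast_add, Nat.cast_one]
    refine ⟨?_, mul_nonneg (h0 i) b, mul_le_one₀ (h1 i) b c⟩
    have t0 := trunc_nonneg K D (y i)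
    have t1 := trunc_le hK D (h0 i)
    have t2 := le_trunc_add hK D (y i)
    set P := (is.map fun i => trunc K D (y i)).prod
    set Q := (is.map y).prod
    have e : trunc K D (y i) * P - y i * Q =
        trunc K D (y i) * (P - Q) + (trunc K D (y i) - y i) * Q := by
      ring
    rw [e, add_div]
    refine (abs_add_le _ _).trans (add_le_add ?_ ?_)
    · rw [abs_mul, abs_of_nonneg t0]
      calc _ ≤ 1 * |P - Q| := by gcongr; linarith [h1 i]
        _ ≤ _ := by rwa [one_mul]
    · rw [abs_mul, abs_of_nonneg b]
      calc _ ≤ |trunc K D (y i) - y i| * 1 := by gcongr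
        _ ≤ _ := by rw [mul_one, abs_le]; constructor <;> linarith

lemma exists_list_of_exponents {ι : Type} [Fintype ι] (a : ι → ℕ) :
    ∃ is : List ι, is.length = ∑ i, a i ∧ ∀ y : ι → ℝ, (is.map y).prod = ∏ i, y i ^ a i := by
  classical
  suffices H : ∀ s : Finset ι, ∃ is : List ι, is.length = ∑ i ∈ s, a i ∧
      ∀ y : ι → ℝ, (is.map y).prod = ∏ i ∈ s, y i ^ a i from H univ
  intro s
  induction s using Finset.induction_on with
  | empty => exact ⟨[], by simp, by simp⟩
  | insert i s hi ih =>
    obtain ⟨is, h1, h2⟩ := ih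
    refine ⟨List.replicate (a i) i ++ is, ?_, fun y => ?_⟩
    · rw [sum_insert hi]; simp [h1]
    · rw [prod_insert hi]; simp [h2]

end LevelsAndProducts

section SequenceRealization

variable {X : Type}

/-- The polynomial with coefficients `P`, of degree less than `k` in each coordinate. -/
def tpoly {d k : ℕ} (P : (Fin d → Fin k) → ℝ) (y : Fin d → ℝ) : ℝ :=
  ∑ a, P a * ∏ i, y i ^ (a i : ℕ)

lemma affine_pow_eq {k a : ℕ} (ha : a < k) (α β y : ℝ) :
    (α * y + β) ^ a = ∑ e : Fin k, α ^ (e : ℕ) * β ^ (a - e) * a.choose e * y ^ (e : ℕ) := by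
  rw [Fin.sum_univ_eq_sum_range (fun e => α ^ e * β ^ (a - e) * a.choose e * y ^ e) k, add_pow]
  rw [← sum_subset (range_subset_range.2 ha : range (a + 1) ⊆ range k)]
  · refine sum_congr rfl fun e _ => ?_
    rw [mul_pow]; ring
  · intro e _ he
    rw [mem_range, not_lt] at he
    simp [Nat.choose_eq_zero_of_lt (show a < e by omega)]

lemma affine_coeff_bound {k a e : ℕ} (ha : a < k) {α β M : ℝ} (hM : 1 ≤ M) (hα : |α| ≤ M)
    (hβ : |β| ≤ M) : |α ^ e * β ^ (a - e) * a.choose e| ≤ (2 * M) ^ k := by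
  rcases lt_or_ge a e with h | h
  · simp [Nat.choose_eq_zero_of_lt h]; positivity
  · rw [abs_mul, abs_mul, abs_pow, abs_pow, Nat.abs_cast]
    have h1 : ((a.choose e : ℕ) : ℝ) ≤ 2 ^ a := by exact_mod_cast Nat.choose_le_two_pow a e
    calc |α| ^ e * |β| ^ (a - e) * a.choose e ≤ M ^ e * M ^ (a - e) * 2 ^ a := by gcongr
      _ = (2 * M) ^ a := by rw [← pow_add, Nat.add_sub_cancel' h, mul_pow]; ring
      _ ≤ (2 * M) ^ k := pow_le_pow_right₀ (by linarith) ha.le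

lemma tpoly_affine {d k : ℕ} (P : (Fin d → Fin k) → ℝ) (α : ℝ) (β : Fin d → ℝ) {M : ℝ}
    (hM : 1 ≤ M) (hα : |α| ≤ M) (hβ : ∀ i, |β i| ≤ M) :
    ∃ P' : (Fin d → Fin k) → ℝ, (∀ y, tpoly P' y = tpoly P fun i => α * y i + β i) ∧
      ∀ a, |P' a| ≤ ((2 * M) ^ k) ^ d * ∑ a, |P a| := by
  refine ⟨fun e => ∑ a, P a * ∏ i, (α ^ (e i : ℕ) * β i ^ ((a i : ℕ) - e i) *
    (a i : ℕ).choose (e i)), fun y => ?_, fun e => ?_⟩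
  · unfold tpoly
    simp only [affine_pow_eq (Fin.is_lt _), prod_univ_sum, Fintype.piFinset_univ, sum_mul, mul_sum]
    rw [sum_comm]
    refine sum_congr rfl fun a _ => sum_congr rfl fun e _ => ?_
    rw [mul_assoc, ← prod_mul_distrib]
  · rw [mul_sum]
    refine (abs_sum_le_sum_abs _ _).trans (sum_le_sum fun a _ => ?_)
    rw [abs_mul, mul_comm, abs_prod]
    refine mul_le_mul_of_nonneg_right ?_ (abs_nonneg _)
    calc _ ≤ ∏ _i : Fin d, (2 * M) ^ k := prod_le_prod (fun _ _ => abs_nonneg _)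
          fun i _ => affine_coeff_bound (Fin.is_lt _) hM hα (hβ i)
      _ = _ := by simp

/-- The inverse of the Morton index. -/
def unmorton (d b j q : ℕ) : Fin d → ℕ := Function.invFunOn (morton b j) (cells d b j : Set _) q

lemma unmorton_morton {d b j : ℕ} (hb : 0 < b) {n : Fin d → ℕ} (hn : n ∈ cells d b j) :
    unmorton d b j (morton b j n) = n :=
  (morton_injOn hb j).leftInvOn_invFunOn hn

lemma image_morton {d b : ℕ} (hb : 0 < b) (j : ℕ) :
    (cells d b j).image (morton b j) = range (b ^ (d * j)) := by
  refine eq_of_subset_of_card_le ?_ ?_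
  · intro q hq
    obtain ⟨n, -, rfl⟩ := mem_image.1 hq
    exact mem_range.2 (morton_lt hb j n)
  · rw [card_image_of_injOn (morton_injOn hb j)]
    simp [cells, mul_comm d j, pow_mul]

lemma sum_unmorton {d b : ℕ} (hb : 0 < b) (j : ℕ) {M : Type*} [AddCommMonoid M]
    (F : (Fin d → ℕ) → M) :
    ∑ q ∈ range (b ^ (d * j)), F (unmorton d b j q) = ∑ n ∈ cells d b j, F n := by
  rw [← image_morton hb j, sum_image (morton_injOn hb j)]
  exact sum_congr rfl fun n hn => by rw [unmorton_morton hb hn]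

lemma cellAt_mem {d b : ℕ} (hb : 0 < b) (j : ℕ) {e : Fin d → ℝ} (h0 : ∀ i, 0 ≤ e i)
    (h1 : ∀ i, e i < 1) : cellAt b j e ∈ cells d b j :=
  mem_cells.2 fun i => cidx_lt (by positivity) (h0 i) (h1 i)

/-- A list of indices in which each `i` occurs `a i` times. -/
def expList {d k : ℕ} (a : Fin d → Fin k) : List (Fin d) :=
  (exists_list_of_exponents fun i => (a i : ℕ)).choose

lemma length_expList {d k : ℕ} (a : Fin d → Fin k) : (expList a).length ≤ d * k := by
  rw [expList, (exists_list_of_exponents fun i => (a i : ℕ)).choose_spec.1]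
  calc _ ≤ ∑ _i : Fin d, k := sum_le_sum fun i _ => (a i).is_lt.le
    _ = _ := by simp

lemma map_expList_prod {d k : ℕ} (a : Fin d → Fin k) (y : Fin d → ℝ) :
    ((expList a).map y).prod = ∏ i, y i ^ (a i : ℕ) :=
  (exists_list_of_exponents fun i => (a i : ℕ)).choose_spec.2 y

/-- The monomial of exponents `a` evaluated at truncated arguments. -/
def monTrunc {d k : ℕ} (K D : ℕ) (a : Fin d → Fin k) (y : Fin d → ℝ) : ℝ :=
  ((expList a).map fun i => trunc K D (y i)).prod

lemma monTrunc_error {d k K : ℕ} (hK : 0 < K) (D : ℕ) (a : Fin d → Fin k) {y : Fin d → ℝ}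
    (h0 : ∀ i, 0 ≤ y i) (h1 : ∀ i, y i ≤ 1) :
    |monTrunc K D a y - ∏ i, y i ^ (a i : ℕ)| ≤ d * k / (K : ℝ) ^ D := by
  rw [← map_expList_prod]
  refine (list_prod_trunc_error hK D y h0 h1 (expList a)).1.trans ?_
  gcongr
  exact_mod_cast length_expList a

lemma tpoly_trunc_error {d k K : ℕ} (hK : 0 < K) (D : ℕ) (P : (Fin d → Fin k) → ℝ) {R : ℝ}
    (hP : ∀ a, |P a| ≤ R) {y : Fin d → ℝ} (h0 : ∀ i, 0 ≤ y i) (h1 : ∀ i, y i ≤ 1) :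
    |(∑ a, P a * monTrunc K D a y) - tpoly P y| ≤ k ^ d * (R * (d * k / (K : ℝ) ^ D)) := by
  unfold tpoly
  rw [← sum_sub_distrib]
  refine (abs_sum_le_sum_abs _ _).trans ?_
  calc _ ≤ ∑ _a : Fin d → Fin k, R * (d * k / (K : ℝ) ^ D) := by
        refine sum_le_sum fun a _ => ?_
        rw [← mul_sub, abs_mul]
        exact mul_le_mul (hP a) (monTrunc_error hK D a h0 h1) (abs_nonneg _)
          ((abs_nonneg _).trans (hP a))
    _ = _ := by simp

/-- The number of jumps of `A` before `n`. -/
def jumpCount {E : Type*} [DecidableEq E] (A : ℕ → E) (n : ℕ) : ℕ :=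
  #{i ∈ range n | A (i + 1) ≠ A i}

lemma jumpCount_mono {E : Type*} [DecidableEq E] (A : ℕ → E) : Monotone (jumpCount A) :=
  fun _ _ h => card_le_card (filter_subset_filter _ (range_subset_range.2 h))

lemma eq_of_jumpCount_eq {E : Type*} [DecidableEq E] (A : ℕ → E) {m n : ℕ}
    (h : jumpCount A m = jumpCount A n) : A m = A n := by
  wlog hmn : m ≤ n generalizing m n with H
  · exact (H h.symm (le_of_not_ge hmn)).symm
  induction n, hmn using Nat.le_induction with
  | base => rfl
  | succ n hmn ih =>
    have h1 : jumpCount A m ≤ jumpCount A n := jumpCount_mono A hmn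
    have h2 : jumpCount A n ≤ jumpCount A (n + 1) := jumpCount_mono A n.le_succ
    rw [ih (by omega)]
    by_contra hne
    have : jumpCount A (n + 1) = jumpCount A n + 1 := by
      unfold jumpCount
      rw [range_add_one, filter_insert, if_pos (fun h => hne h.symm), card_insert_of_notMem]
      simp
    omega

lemma jumpCount_sum_le {E ι : Type*} [DecidableEq E] [AddCommMonoid E] (s : Finset ι)
    (B m : ι → ℕ) (hB : ∀ j ∈ s, 0 < B j) (F : ι → ℕ → E) {n : ℕ}
    (hn : ∀ j ∈ s, n < B j * m j) :
    jumpCount (fun i => ∑ j ∈ s, F j (i / B j)) n ≤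
      ∑ j ∈ s, 2 * #{q ∈ range (m j) | F j q ≠ 0} := by
  classical
  let S1 : ι → Finset ℕ := fun j => {i ∈ range n | B j ∣ i + 1 ∧ F j ((i + 1) / B j) ≠ 0}
  let S2 : ι → Finset ℕ := fun j => {i ∈ range n | B j ∣ i + 1 ∧ F j (i / B j) ≠ 0}
  have hsub : {i ∈ range n | (∑ j ∈ s, F j ((i + 1) / B j)) ≠ ∑ j ∈ s, F j (i / B j)} ⊆
      s.biUnion fun j => S1 j ∪ S2 j := by
    intro i hi
    rw [mem_filter] at hi
    by_contra hcon
    refine hi.2 (sum_congr rfl fun j hj => ?_)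
    rcases em (B j ∣ i + 1) with hd | hd
    · have : ¬ (i ∈ S1 j ∪ S2 j) := fun h => hcon (mem_biUnion.2 ⟨j, hj, h⟩)
      simp only [S1, S2, mem_union, mem_filter, hi.1, hd, true_and, not_or, not_not] at this
      rw [this.1, this.2]
    · rw [Nat.succ_div_of_not_dvd hd]
  refine (card_le_card hsub).trans (card_biUnion_le.trans (sum_le_sum fun j hj => ?_))
  have hBj := hB j hj
  have hnj := hn j hj
  have c1 : #(S1 j) ≤ #{q ∈ range (m j) | F j q ≠ 0} := by
    refine card_le_card_of_injOn (fun i => (i + 1) / B j) (fun i hi => ?_) ?_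
    · simp only [S1, coe_filter, Set.mem_ofPred_eq, mem_range] at hi ⊢
      refine ⟨Nat.div_lt_of_lt_mul ?_, hi.2.2⟩
      omega
    · intro i hi i' hi' h
      simp only [S1, coe_filter, Set.mem_ofPred_eq] at hi hi' h
      have := Nat.div_mul_cancel hi.2.1
      have := Nat.div_mul_cancel hi'.2.1
      rw [h] at *
      omega
  have c2 : #(S2 j) ≤ #{q ∈ range (m j) | F j q ≠ 0} := by
    refine card_le_card_of_injOn (fun i => i / B j) (fun i hi => ?_) ?_
    · simp only [S2, coe_filter, Set.mem_ofPred_eq, mem_range] at hi ⊢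
      refine ⟨Nat.div_lt_of_lt_mul ?_, hi.2.2⟩
      omega
    · intro i hi i' hi' h
      simp only [S2, coe_filter, Set.mem_ofPred_eq] at hi hi' h
      have e1 := Nat.succ_div_of_dvd hi.2.1
      have e2 := Nat.succ_div_of_dvd hi'.2.1
      have := Nat.div_mul_cancel hi.2.1
      have := Nat.div_mul_cancel hi'.2.1
      rw [← h] at e2
      rw [e1] at *
      rw [e2] at *
      omega
  have := card_union_le (S1 j) (S2 j)
  omega

end SequenceRealization

section Terms

variable {X : Type}

/-- The position within the cell of level `j`. -/
def localAt {d : ℕ} (b j : ℕ) (e : Fin d → ℝ) (i : Fin d) : ℝ := (b : ℝ) ^ j * e i - cellAt b j e i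

lemma localAt_nonneg {d b : ℕ} (j : ℕ) {e : Fin d → ℝ} (h0 : ∀ i, 0 ≤ e i) (i : Fin d) :
    0 ≤ localAt b j e i := by
  have := cidx_le_mul (b ^ j) (h0 i)
  push_cast at this
  unfold localAt cellAt; linarith

lemma localAt_le_one {d b : ℕ} (j : ℕ) (e : Fin d → ℝ) (i : Fin d) : localAt b j e i ≤ 1 := by
  have := mul_lt_cidx_add_one (b ^ j) (e i)
  push_cast at this
  unfold localAt cellAt; linarith

lemma Net.nearTerm {d b k : ℕ} (hb : 0 < b) {β : ℕ} (hβ : 0 < β) (D Jm j : ℕ) (hj : j ≤ Jm)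
    {δ : ℝ} (hδ : 0 < δ) (e : X → Fin d → ℝ) (he : ∀ x i, Good (b ^ (Jm + β * D)) δ (e x i))
    (K R V Y : ℕ) (hV : 1 ≤ V) (hVR : V + 1 = 2 ^ R) (hY : 1 ≤ Y) (z : (Fin d → ℕ) → ℤ)
    (hz : V * (∑ n ∈ cells d b j, ((z n).natAbs + (V - 1)) / V) + b ^ (d * j) ≤
      V * Y * (K * (b ^ β * b ^ β))) (τ r : ℝ) (hr : ∀ n ∈ cells d b j, |τ * z n| ≤ r)
    (a : Fin d → Fin k) :
    Net (18 * b ^ β + 8 * d + 90 + 2 * d * b ^ β)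
      ((Jm / β + 1) + ((3 * K + 2 + 4 * R * Y) + 2 * D * (d * k)))
      (aff (coordSet e : Set (X → ℝ)))
      (aff {fun x => τ * z (cellAt b j (e x)) * monTrunc (b ^ β) D a (localAt b j (e x))}) := by
  classical
  have hW : 0 < b ^ β := by positivity
  have hcell : ∀ x, cellAt b j (e x) ∈ cells d b j := fun x =>
    cellAt_mem hb j (fun i => (he x i).1) fun i => (he x i).2.1
  have l1 := (Net.level hb hβ (Jm + β * D) j (by omega) hδ e he).pad (L' := Jm / β + 1)
    (by have := card_levelSet b j e; omega)
    (by have := Nat.div_le_div_right (c := β) hj; omega)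
  have hpos : 0 < b ^ (d * j) := by positivity
  have l2 := Net.sequenceInt (b ^ β) K R V Y hV hVR hY
    (fun x => morton b j (cellAt b j (e x))) (b ^ (d * j) - 1)
    (fun x => by have := morton_lt hb j (cellAt b j (e x)); omega)
    (fun q => z (unmorton d b j q)) (by
      unfold codeLen
      rw [Nat.sub_add_cancel hpos,
        sum_unmorton hb j fun n => ((z n).natAbs + (V - 1)) / V]
      omega)
  have l2' := (l2.mono le_rfl (aff_le (one_mem_aff _) (by
    intro f hf
    rw [Set.mem_singleton_iff.1 hf]
    exact mem_aff (morton_mem_levelSet b j e))) le_rfl).keep (one_mem_aff _) (levelSet b j e)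
    fun f hf => mem_aff hf
  have hgood : ∀ i x, Good ((b ^ β) ^ D) (b ^ j * δ) (localAt b j (e x) i) := by
    intro i x
    have h1 := he x i
    have h2 : b ^ (Jm + β * D) = b ^ j * ((b ^ β) ^ D) * b ^ (Jm - j) := by
      rw [← pow_mul, ← pow_add, ← pow_add]; congr 1; omega
    rw [h2] at h1
    have h3 := (h1.left (by positivity)).residual (by positivity)
    unfold localAt cellAt
    push_cast at h3 ⊢
    exact h3
  set U := aff {fun x => ((z (unmorton d b j (morton b j (cellAt b j (e x)))) : ℤ) : ℝ)} ⊔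
    aff (levelSet b j e : Set (X → ℝ)) with hU
  have hbr : (0 : ℝ) < b := by exact_mod_cast hb
  have l3 := Net.monomial (ι := Fin d) hW D (δ := b ^ j * δ) (by positivity)
    (fun i x => localAt b j (e x) i) hgood (expList a)
    (fun x => τ * z (cellAt b j (e x))) r (fun x => hr _ (hcell x)) (U := U)
    (Submodule.mem_sup_left (one_mem_aff _)) (by
      have : (fun x => τ * (z (cellAt b j (e x)) : ℝ)) =
          τ • fun x => ((z (unmorton d b j (morton b j (cellAt b j (e x)))) : ℤ) : ℝ) := by
        ext x
        rw [Pi.smul_apply, smul_eq_mul, unmorton_morton hb (hcell x)]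
      rw [this]
      exact U.smul_mem _ (Submodule.mem_sup_left (mem_aff (Set.mem_singleton _))))
    (fun i => by
      have : (fun x => localAt b j (e x) i) =
          ((b : ℝ) ^ j) • (fun x => e x i) - fun x => (cellAt b j (e x) i : ℝ) := by
        ext x; simp [localAt]
      rw [this]
      exact Submodule.mem_sup_right (Submodule.sub_mem _
        (Submodule.smul_mem _ _ (mem_aff (coord_mem_levelSet b j e i)))
        (mem_aff (cell_mem_levelSet b j e i))))
  have hcl := card_levelSet b j e
  have hT : Net (18 * b ^ β + 8 * d + 90 + 2 * d * b ^ β) (2 * D * (d * k)) U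
      (aff (({fun x => τ * z (cellAt b j (e x)) *
        monTrunc (b ^ β) D a (localAt b j (e x))} : Finset (X → ℝ)) : Set (X → ℝ))) := by
    refine Net.pad (L := 2 * D * (expList a).length) ?_ (by rw [card_singleton]; omega)
      (by gcongr; exact length_expList a)
    rw [coe_singleton]
    exact l3.mono (by rw [Fintype.card_fin]; omega) le_rfl le_rfl
  rw [coe_singleton] at hT
  exact (l1.mono (by omega) le_rfl le_rfl).trans ((l2'.mono (by omega) le_rfl le_rfl).trans hT)

lemma Net.farTerm {d b k : ℕ} (hb : 0 < b) {β : ℕ} (hβ : 0 < β) (D Jm : ℕ)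
    {δ : ℝ} (hδ : 0 < δ) (e : X → Fin d → ℝ) (he : ∀ x i, Good (b ^ (Jm + β * D)) δ (e x i))
    (far : Finset ℕ) (hfar : ∀ j ∈ far, j ≤ Jm) (K : ℕ)
    (Q : ℕ → (Fin d → ℕ) → (Fin d → Fin k) → ℝ)
    (hQ : ∑ j ∈ far, 2 * #{n ∈ cells d b j | Q j n ≠ 0} ≤ K * (b ^ β * b ^ β)) (r : ℝ)
    (hr : ∀ n : (j : ℕ) → Fin d → ℕ, (∀ j, n j ∈ cells d b j) → ∀ a, |∑ j ∈ far, Q j (n j) a| ≤ r)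
    (a : Fin d → Fin k) :
    Net (18 * b ^ β + 8 * d + 90 + 2 * d * b ^ β)
      ((Jm / β + 1) + (3 * K + 2 * D * (d * k)))
      (aff (coordSet e : Set (X → ℝ)))
      (aff {fun x => (∑ j ∈ far, Q j (cellAt b j (e x)) a) * monTrunc (b ^ β) D a (e x)}) := by
  classical
  have hW : 0 < b ^ β := by positivity
  have hcell : ∀ j x, cellAt b j (e x) ∈ cells d b j := fun j x =>
    cellAt_mem hb j (fun i => (he x i).1) fun i => (he x i).2.1
  have l1 := (Net.level hb hβ (Jm + β * D) Jm (by omega) hδ e he)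
  have hpos : 0 < b ^ (d * Jm) := by positivity
  set A : ℕ → (Fin d → Fin k) → ℝ := fun i =>
    ∑ j ∈ far, (fun q => Q j (unmorton d b j q)) (i / b ^ (d * (Jm - j))) with hA
  have hBm : ∀ j ∈ far, b ^ (d * (Jm - j)) * b ^ (d * j) = b ^ (d * Jm) := fun j hj => by
    rw [← pow_add, ← mul_add, Nat.sub_add_cancel (hfar j hj)]
  have hjump : ∀ n ≤ b ^ (d * Jm) - 1, jumpCount A n ≤ K * (b ^ β * b ^ β) := by
    intro n hn
    refine le_trans ?_ hQ
    refine (jumpCount_sum_le far (fun j => b ^ (d * (Jm - j))) (fun j => b ^ (d * j))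
      (fun j _ => by positivity) (fun j q => Q j (unmorton d b j q))
      (fun j hj => by rw [hBm j hj]; omega)).trans (le_of_eq (sum_congr rfl fun j _ => ?_))
    congr 1
    rw [card_filter, card_filter]
    exact sum_unmorton hb j fun n => if Q j n ≠ 0 then 1 else 0
  have hu : ∀ a, ∃ u : ℕ → ℝ, ∀ n, u (jumpCount A n) = A n a := by
    intro a
    refine ⟨fun m => if h : ∃ n, jumpCount A n = m then A h.choose a else 0, fun n => ?_⟩
    have h : ∃ n', jumpCount A n' = jumpCount A n := ⟨n, rfl⟩
    show (if h : ∃ n', jumpCount A n' = jumpCount A n then A h.choose a else 0) = A n a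
    rw [dif_pos h, eq_of_jumpCount_eq A h.choose_spec]
  have hAx : ∀ x, A (morton b Jm (cellAt b Jm (e x))) a = ∑ j ∈ far, Q j (cellAt b j (e x)) a := by
    intro x
    rw [hA]
    simp only [Finset.sum_apply]
    refine sum_congr rfl fun j hj => ?_
    have := morton_cellAt_div hb j (Jm - j) (e := e x) (fun i => (he x i).1)
    rw [Nat.sub_add_cancel (hfar j hj)] at this
    rw [this, unmorton_morton hb (hcell j x)]
  obtain ⟨u, hu⟩ := hu a
  have l2 := Net.table (b ^ β) K (fun x => morton b Jm (cellAt b Jm (e x))) (b ^ (d * Jm) - 1)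
    (fun x => by have := morton_lt hb Jm (cellAt b Jm (e x)); omega) (jumpCount A)
    (jumpCount_mono A) hjump u
  have l2' := (l2.mono le_rfl (aff_le (one_mem_aff _) (by
    intro f hf
    rw [Set.mem_singleton_iff.1 hf]
    exact mem_aff (morton_mem_levelSet b Jm e))) le_rfl).keep (one_mem_aff _) (levelSet b Jm e)
    fun f hf => mem_aff hf
  have hgood : ∀ i x, Good ((b ^ β) ^ D) δ (e x i) := by
    intro i x
    have h1 := he x i
    have h2 : b ^ (Jm + β * D) = ((b ^ β) ^ D) * b ^ Jm := by
      rw [← pow_mul, ← pow_add]; congr 1; omega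
    rw [h2] at h1
    exact h1.left (by positivity)
  set U := aff {fun x => u (jumpCount A (morton b Jm (cellAt b Jm (e x))))} ⊔
    aff (levelSet b Jm e : Set (X → ℝ)) with hU
  have l3 := Net.monomial (ι := Fin d) hW D hδ
    (fun i x => e x i) hgood (expList a)
    (fun x => ∑ j ∈ far, Q j (cellAt b j (e x)) a) r
    (fun x => hr (fun j => cellAt b j (e x)) (fun j => hcell j x) a) (U := U)
    (Submodule.mem_sup_left (one_mem_aff _)) (by
      have : (fun x => ∑ j ∈ far, Q j (cellAt b j (e x)) a) =
          fun x => u (jumpCount A (morton b Jm (cellAt b Jm (e x)))) := by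
        ext x
        rw [hu, hAx]
      rw [this]
      exact Submodule.mem_sup_left (mem_aff (Set.mem_singleton _)))
    (fun i => Submodule.mem_sup_right (mem_aff (coord_mem_levelSet b Jm e i)))
  have hcl := card_levelSet b Jm e
  have hT : Net (18 * b ^ β + 8 * d + 90 + 2 * d * b ^ β) (2 * D * (d * k)) U
      (aff (({fun x => (∑ j ∈ far, Q j (cellAt b j (e x)) a) *
        monTrunc (b ^ β) D a (e x)} : Finset (X → ℝ)) : Set (X → ℝ))) := by
    refine Net.pad (L := 2 * D * (expList a).length) ?_ (by rw [card_singleton]; omega)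
      (by gcongr; exact length_expList a)
    rw [coe_singleton]
    exact l3.mono (by rw [Fintype.card_fin]; omega) le_rfl le_rfl
  rw [coe_singleton] at hT
  exact (l1.mono (by omega) le_rfl le_rfl).trans ((l2'.mono (by omega) le_rfl le_rfl).trans hT)

lemma Net.assemble {d b k : ℕ} (hb : 0 < b) {β : ℕ} (hβ : 0 < β) (D Jm : ℕ)
    {δ : ℝ} (hδ : 0 < δ) (e : X → Fin d → ℝ) (he : ∀ x i, Good (b ^ (Jm + β * D)) δ (e x i))
    (near far : Finset ℕ) (hnear : ∀ j ∈ near, j ≤ Jm) (hfar : ∀ j ∈ far, j ≤ Jm)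
    (K R V Y : ℕ → ℕ) (hV : ∀ j, 1 ≤ V j) (hVR : ∀ j, V j + 1 = 2 ^ R j) (hY : ∀ j, 1 ≤ Y j)
    (z : ℕ → (Fin d → Fin k) → (Fin d → ℕ) → ℤ)
    (hz : ∀ j ∈ near, ∀ a, V j * (∑ n ∈ cells d b j, ((z j a n).natAbs + (V j - 1)) / V j) +
      b ^ (d * j) ≤ V j * Y j * (K j * (b ^ β * b ^ β)))
    (τ : ℕ → ℝ) {r : ℝ} (hr : ∀ j ∈ near, ∀ a, ∀ n ∈ cells d b j, |τ j * z j a n| ≤ r)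
    (K' : ℕ) (Q : ℕ → (Fin d → ℕ) → (Fin d → Fin k) → ℝ)
    (hQ : ∑ j ∈ far, 2 * #{n ∈ cells d b j | Q j n ≠ 0} ≤ K' * (b ^ β * b ^ β))
    (hQr : ∀ n : (j : ℕ) → Fin d → ℕ, (∀ j, n j ∈ cells d b j) → ∀ a,
      |∑ j ∈ far, Q j (n j) a| ≤ r) :
    ∃ f : X → ℝ, Net (18 * b ^ β + 8 * d + 90 + 2 * d * b ^ β + 2 * d + 2)
      ((∑ j ∈ near, k ^ d * ((Jm / β + 1) + ((3 * K j + 2 + 4 * R j * Y j) + 2 * D * (d * k)))) +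
        k ^ d * ((Jm / β + 1) + (3 * K' + 2 * D * (d * k))))
      (aff (coordSet e : Set (X → ℝ))) (aff {f}) ∧
      ∀ x, |f x - ((∑ j ∈ near, tpoly (fun a => τ j * z j a (cellAt b j (e x)))
          (localAt b j (e x))) +
        ∑ j ∈ far, tpoly (Q j (cellAt b j (e x))) (e x))| ≤
        (#near + 1) * (k ^ d * (r * (d * k / ((b : ℝ) ^ β) ^ D))) := by
  classical
  set s : Finset ((ℕ × (Fin d → Fin k)) ⊕ (Fin d → Fin k)) :=
    (near ×ˢ univ).disjSum univ with hs
  set Ls : (ℕ × (Fin d → Fin k)) ⊕ (Fin d → Fin k) → ℕ := Sum.elim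
    (fun p => (Jm / β + 1) + ((3 * K p.1 + 2 + 4 * R p.1 * Y p.1) + 2 * D * (d * k)))
    (fun _ => (Jm / β + 1) + (3 * K' + 2 * D * (d * k))) with hLs
  set F : (ℕ × (Fin d → Fin k)) ⊕ (Fin d → Fin k) → X → ℝ := Sum.elim
    (fun p x => τ p.1 * z p.1 p.2 (cellAt b p.1 (e x)) *
      monTrunc (b ^ β) D p.2 (localAt b p.1 (e x)))
    (fun a x => (∑ j ∈ far, Q j (cellAt b j (e x)) a) * monTrunc (b ^ β) D a (e x)) with hF
  have hnet := Net.sum (W := 18 * b ^ β + 8 * d + 90 + 2 * d * b ^ β) s Ls (coordSet e) F (by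
    intro p hp
    rcases p with ⟨j, a⟩ | a
    · rw [hs, inl_mem_disjSum, mem_product] at hp
      exact Net.nearTerm hb hβ D Jm j (hnear j hp.1) hδ e he (K j) (R j) (V j) (Y j) (hV j) (hVR j)
        (hY j) (z j a) (hz j hp.1 a) (τ j) r (hr j hp.1 a) a
    · exact Net.farTerm hb hβ D Jm hδ e he far hfar K' Q hQ r hQr a)
  have hsum : ∑ p ∈ s, Ls p = (∑ j ∈ near, k ^ d * ((Jm / β + 1) +
      ((3 * K j + 2 + 4 * R j * Y j) + 2 * D * (d * k)))) +
        k ^ d * ((Jm / β + 1) + (3 * K' + 2 * D * (d * k))) := by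
    rw [hs, sum_disjSum, sum_product]
    simp [hLs, Sum.elim_inl, Sum.elim_inr]
  refine ⟨∑ p ∈ s, F p, ?_, fun x => ?_⟩
  · rw [← hsum]
    have hc := card_coordSet e
    exact hnet.mono (by omega) le_rfl (aff_mono (by simp))
  · have hW : 0 < b ^ β := by positivity
    have h0 : ∀ i, 0 ≤ e x i := fun i => (he x i).1
    have h1 : ∀ i, e x i ≤ 1 := fun i => (he x i).2.1.le
    have hcell : ∀ j, cellAt b j (e x) ∈ cells d b j := fun j =>
      cellAt_mem hb j h0 fun i => (he x i).2.1
    have hx : (∑ p ∈ s, F p) x = (∑ j ∈ near, ∑ a : Fin d → Fin k,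
        (τ j * z j a (cellAt b j (e x))) * monTrunc (b ^ β) D a (localAt b j (e x))) +
        ∑ a : Fin d → Fin k,
          (∑ j ∈ far, Q j (cellAt b j (e x)) a) * monTrunc (b ^ β) D a (e x) := by
      rw [Finset.sum_apply, hs, sum_disjSum, sum_product]
      simp only [hF, Sum.elim_inl, Sum.elim_inr]
    have hfs : ∑ j ∈ far, tpoly (Q j (cellAt b j (e x))) (e x) =
        tpoly (fun a => ∑ j ∈ far, Q j (cellAt b j (e x)) a) (e x) := by
      unfold tpoly
      rw [sum_comm]
      exact sum_congr rfl fun a _ => by rw [sum_mul]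
    rw [hx, hfs, add_sub_add_comm, ← sum_sub_distrib, add_mul, one_mul]
    refine (abs_add_le _ _).trans (add_le_add ?_ ?_)
    · refine (abs_sum_le_sum_abs _ _).trans ?_
      rw [← nsmul_eq_mul]
      refine sum_le_card_nsmul _ _ _ fun j hj => ?_
      have := tpoly_trunc_error hW D (fun a => τ j * (z j a (cellAt b j (e x)) : ℝ)) (R := r)
        (y := localAt b j (e x)) (fun a => hr j hj a _ (hcell j)) (localAt_nonneg j h0)
          (localAt_le_one j (e x))
      push_cast at this
      exact this
    · have := tpoly_trunc_error hW D (fun a => ∑ j ∈ far, Q j (cellAt b j (e x)) a) (R := r)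
        (fun a => hQr (fun j => cellAt b j (e x)) (fun j => hcell j) a) h0 h1
      push_cast at this
      exact this

end Terms

section Budget

/-- The distance of two natural numbers. -/
def ndist (J j : ℕ) : ℕ := (j - J) + (J - j)

lemma sum_ndist_le {M : Type*} [AddCommMonoid M] [PartialOrder M] [IsOrderedAddMonoid M]
    (s : Finset ℕ) (J n : ℕ) (hs : ∀ j ∈ s, ndist J j < n)
    (φ : ℕ → M) (hφ : ∀ m, 0 ≤ φ m) : ∑ j ∈ s, φ (ndist J j) ≤ 2 • ∑ m ∈ range n, φ m := by
  classical
  rw [← sum_fiberwise_of_maps_to (g := ndist J) (t := range n) (fun j hj => mem_range.2 (hs j hj)),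
    smul_sum]
  refine sum_le_sum fun m _ => ?_
  have h1 : ∑ j ∈ s with ndist J j = m, φ (ndist J j) = #{j ∈ s | ndist J j = m} • φ m := by
    rw [← sum_const]
    exact sum_congr rfl fun j hj => by rw [(mem_filter.1 hj).2]
  rw [h1]
  refine nsmul_le_nsmul_left (hφ m) ?_
  have : {j ∈ s | ndist J j = m} ⊆ {J + m, J - m} := by
    intro j hj
    have := (mem_filter.1 hj).2
    unfold ndist at this
    simp only [mem_insert, mem_singleton]
    omega
  exact (card_le_card this).trans card_le_two

lemma exists_weight_bound {ρ : ℝ} (h0 : 0 < ρ) (h1 : ρ < 1) :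
    ∃ A : ℕ, ∀ n, ∑ m ∈ range n, ((m : ℝ) + 1) ^ 2 * ρ ^ m ≤ (A : ℝ) := by
  have hn : ‖ρ‖ < 1 := by rwa [Real.norm_of_nonneg h0.le]
  have s0 := summable_pow_mul_geometric_of_norm_lt_one 0 hn
  have s1 := summable_pow_mul_geometric_of_norm_lt_one 1 hn
  have s2 := summable_pow_mul_geometric_of_norm_lt_one 2 hn
  have hs : Summable fun m : ℕ => ((m : ℝ) + 1) ^ 2 * ρ ^ m := by
    refine ((s2.add (s1.mul_left 2)).add s0).congr fun m => ?_
    ring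
  obtain ⟨A, hA⟩ := exists_nat_ge (∑' m : ℕ, ((m : ℝ) + 1) ^ 2 * ρ ^ m)
  exact ⟨A, fun n => (hs.sum_le_tsum _ fun m _ => by positivity).trans hA⟩

lemma lt_four_pow_sqrt (L : ℕ) : L < 4 ^ (Nat.sqrt L + 1) := by
  have h1 := Nat.lt_succ_sqrt L
  have h2 : Nat.sqrt L + 1 < 2 ^ (Nat.sqrt L + 1) := Nat.lt_two_pow_self
  have h3 : (4 : ℕ) ^ (Nat.sqrt L + 1) = 2 ^ (Nat.sqrt L + 1) * 2 ^ (Nat.sqrt L + 1) := by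
    rw [← mul_pow]; norm_num
  rw [h3]
  exact h1.trans (Nat.mul_lt_mul'' h2 h2)

lemma near_depth_le {ρ : ℝ} (h0 : 0 < ρ) {A : ℕ}
    (hA : ∀ n, ∑ m ∈ range n, ((m : ℝ) + 1) ^ 2 * ρ ^ m ≤ (A : ℝ)) {L : ℕ} (hL : 1 ≤ L)
    (s : Finset ℕ) (J : ℕ) (hs : ∀ j ∈ s, ndist J j < Nat.sqrt L + 2) :
    ∑ j ∈ s, (ndist J j + 1) * (⌊(L : ℝ) * ρ ^ ndist J j⌋₊ + 1) ≤ 2 * (A + 9) * L ∧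
      #s * (Nat.sqrt L + 1) ≤ 16 * L := by
  have hq := Nat.sqrt_le L
  have hq1 : 1 ≤ Nat.sqrt L := Nat.sqrt_pos.2 hL
  set q := Nat.sqrt L
  constructor
  · have h := sum_ndist_le s J (q + 2) hs (fun m => (m + 1) * (⌊(L : ℝ) * ρ ^ m⌋₊ + 1))
      (fun _ => Nat.zero_le _)
    refine h.trans ?_
    rw [smul_eq_mul, mul_assoc]
    refine Nat.mul_le_mul_left _ ?_
    have h2 : ∑ m ∈ range (q + 2), (m + 1) ≤ 9 * L := by
      calc _ ≤ ∑ m ∈ range (q + 2), (q + 2) :=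
            sum_le_sum fun m hm => by have := mem_range.1 hm; omega
        _ = (q + 2) * (q + 2) := by simp
        _ ≤ 9 * L := by nlinarith
    have h3 : ((∑ m ∈ range (q + 2), (m + 1) * (⌊(L : ℝ) * ρ ^ m⌋₊ + 1) : ℕ) : ℝ) ≤
        ((A + 9) * L : ℕ) := by
      have h2' : ((∑ m ∈ range (q + 2), (m + 1) : ℕ) : ℝ) ≤ ((9 * L : ℕ) : ℝ) := by
        exact_mod_cast h2
      push_cast at h2' ⊢
      calc ∑ m ∈ range (q + 2), ((m : ℝ) + 1) * ((⌊(L : ℝ) * ρ ^ m⌋₊ : ℝ) + 1) ≤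
          ∑ m ∈ range (q + 2), ((L : ℝ) * (((m : ℝ) + 1) ^ 2 * ρ ^ m) + ((m : ℝ) + 1)) := by
            refine sum_le_sum fun m _ => ?_
            have h4 : (⌊(L : ℝ) * ρ ^ m⌋₊ : ℝ) ≤ L * ρ ^ m := Nat.floor_le (by positivity)
            have h5 : (0 : ℝ) ≤ m := Nat.cast_nonneg m
            have h6 : 0 ≤ L * ρ ^ m := by positivity
            calc ((m : ℝ) + 1) * (⌊(L : ℝ) * ρ ^ m⌋₊ + 1) ≤ (m + 1) * (L * ρ ^ m + 1) := by gcongr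
              _ ≤ _ := by
                nlinarith [mul_nonneg (mul_nonneg h5 h6) (by positivity : (0 : ℝ) ≤ m + 1)]
        _ ≤ (L : ℝ) * A + 9 * L := by
            rw [sum_add_distrib, ← mul_sum]
            gcongr
            exact hA _
        _ = ((A : ℝ) + 9) * L := by ring
    exact_mod_cast h3
  · have h := sum_ndist_le s J (q + 2) hs (fun _ => 1) (fun _ => Nat.zero_le _)
    simp only [sum_const, smul_eq_mul, mul_one, card_range] at h
    calc #s * (q + 1) ≤ 2 * (q + 2) * (q + 1) := by gcongr
      _ ≤ 16 * L := by nlinarith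

lemma far_weight_le {ρ : ℝ} (h0 : 0 < ρ) (h1 : ρ < 1) {A : ℕ}
    (hA : ∀ n, ∑ m ∈ range n, ((m : ℝ) + 1) ^ 2 * ρ ^ m ≤ (A : ℝ)) (L : ℕ)
    (s : Finset ℕ) (J : ℕ) (hs : ∀ j ∈ s, Nat.sqrt L + 2 ≤ ndist J j) :
    L * ∑ j ∈ s, ρ ^ (2 * ndist J j) ≤ 2 * (A : ℝ) ^ 2 := by
  set q := Nat.sqrt L
  have hq : (L : ℝ) ≤ ((q : ℝ) + 1) ^ 2 := by
    have := Nat.lt_succ_sqrt L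
    have h : L ≤ (q + 1) ^ 2 := by rw [pow_two]; exact this.le
    exact_mod_cast h
  have hLA : L * ρ ^ q ≤ A := by
    refine le_trans ?_ (hA (q + 1))
    refine le_trans ?_ (single_le_sum (f := fun m : ℕ => ((m : ℝ) + 1) ^ 2 * ρ ^ m)
      (fun m _ => by positivity) (mem_range.2 (Nat.lt_succ_self q)))
    show _ ≤ ((q : ℝ) + 1) ^ 2 * ρ ^ q
    gcongr
  have hS : ∑ j ∈ s, ρ ^ ndist J j ≤ 2 * A := by
    obtain ⟨n, hn⟩ : ∃ n, ∀ j ∈ s, ndist J j < n :=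
      ⟨s.sup (ndist J) + 1, fun j hj => Nat.lt_succ_of_le (le_sup (f := ndist J) hj)⟩
    refine (sum_ndist_le s J n hn (fun m => ρ ^ m) (fun _ => by positivity)).trans ?_
    rw [two_nsmul, two_mul]
    have : ∑ m ∈ range n, ρ ^ m ≤ A := by
      refine le_trans (sum_le_sum fun m _ => ?_) (hA n)
      have : (1 : ℝ) ≤ ((m : ℝ) + 1) ^ 2 :=
          one_le_pow₀ (by linarith [(Nat.cast_nonneg m : (0:ℝ) ≤ m)])
      nlinarith [pow_pos h0 m]
    linarith
  calc L * ∑ j ∈ s, ρ ^ (2 * ndist J j) ≤ L * ∑ j ∈ s, ρ ^ q * ρ ^ ndist J j := by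
        gcongr with j hj
        rw [two_mul, pow_add]
        exact mul_le_mul_of_nonneg_right
          (pow_le_pow_of_le_one h0.le h1.le (by have := hs j hj; omega)) (by positivity)
    _ = (L * ρ ^ q) * ∑ j ∈ s, ρ ^ ndist J j := by rw [← mul_sum]; ring
    _ ≤ A * (2 * A) := by gcongr
    _ = _ := by ring

end Budget

section Realization

lemma exists_monomial_expansion {d b k : ℕ} (hb : 0 < b) (j : ℕ) (P : (Fin d → Fin k) → ℝ)
    {n : Fin d → ℕ} (hn : n ∈ cells d b j) :
    ∃ Q : (Fin d → Fin k) → ℝ, (∀ y, tpoly Q y = tpoly P fun i => (b : ℝ) ^ j * y i - n i) ∧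
      ∀ a, |Q a| ≤ ((2 * (b : ℝ) ^ j) ^ k) ^ d * ∑ a, |P a| := by
  have h1 : (1 : ℝ) ≤ (b : ℝ) ^ j := one_le_pow₀ (by exact_mod_cast hb)
  obtain ⟨Q, h2, h3⟩ := tpoly_affine P ((b : ℝ) ^ j) (fun i => -(n i : ℝ)) h1
    (by rw [abs_of_nonneg (by positivity)]) (fun i => by
      rw [abs_neg, Nat.abs_cast]
      have := (mem_cells.1 hn i).le
      exact_mod_cast this)
  exact ⟨Q, fun y => by rw [h2]; simp only [sub_eq_add_neg], h3⟩

lemma level_le_of_pow_le {b β L κ Jm : ℕ} (hb : 2 ≤ b) (hβ : 1 ≤ β)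
    (h : b ^ Jm ≤ (b ^ β * L) ^ κ) :
    b ^ β * L ≤ (b ^ β) ^ (3 * (Nat.sqrt L + 1)) ∧ Jm / β ≤ 3 * (Nat.sqrt L + 1) * κ := by
  set q := Nat.sqrt L
  have h2 : 2 ≤ b ^ β := hb.trans (Nat.le_self_pow (by omega) b)
  have h1 : b ^ β * L ≤ (b ^ β) ^ (3 * (q + 1)) := by
    have e : (b ^ β) ^ (3 * (q + 1)) = (b ^ β) ^ (q + 1) * ((b ^ β) ^ 2) ^ (q + 1) := by
      rw [← pow_mul (b ^ β) 2, ← pow_add]; congr 1; ring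
    rw [e]
    refine Nat.mul_le_mul (Nat.le_self_pow (by omega) _) ((lt_four_pow_sqrt L).le.trans ?_)
    exact Nat.pow_le_pow_left (by nlinarith) _
  refine ⟨h1, ?_⟩
  have h3 : b ^ Jm ≤ b ^ (β * (3 * (q + 1) * κ)) := by
    refine h.trans ((Nat.pow_le_pow_left h1 κ).trans (le_of_eq ?_))
    rw [← pow_mul, ← pow_mul, mul_assoc]
  have h4 := (Nat.pow_le_pow_iff_right (by omega)).1 h3
  exact (Nat.div_le_div_right h4).trans (le_of_eq (Nat.mul_div_cancel_left _ (by omega)))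

lemma ceil_pos {V z : ℕ} (hV : 1 ≤ V) (hz : z ≠ 0) : 1 ≤ (z + (V - 1)) / V :=
  (Nat.one_le_div_iff hV).2 (by omega)

set_option maxHeartbeats 1000000 in
/-- Sums of quantized local polynomials are computed accurately by networks, up to the left
neighbourhoods of the grid points. -/
theorem exists_realization (d k b c₁ A₀ : ℕ) (hk : 1 ≤ k) (hb : 2 ≤ b) (hc₁ : 1 ≤ c₁) {ρ : ℝ}
    (hρ0 : 0 < ρ) (hρ1 : ρ < 1) (κ κ' : ℕ) :
    ∃ C₀ : ℕ, 1 ≤ C₀ ∧ ∀ β L : ℕ, 1 ≤ β → 1 ≤ L → ∀ (J Jm : ℕ)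
      (z : ℕ → (Fin d → Fin k) → (Fin d → ℕ) → ℤ) (τ : ℕ → ℝ),
      b ^ Jm ≤ (b ^ β * L) ^ κ →
      (∀ j ≤ Jm, ∀ a, ∀ n ∈ cells d b j, |τ j * z j a n| ≤ ((b ^ β * L : ℕ) : ℝ) ^ κ) →
      (∀ j ≤ Jm, ∀ a, (((2 ^ (c₁ * (ndist J j + 1)) - 1) *
          (∑ n ∈ cells d b j, ((z j a n).natAbs + ((2 ^ (c₁ * (ndist J j + 1)) - 1) - 1)) /
            (2 ^ (c₁ * (ndist J j + 1)) - 1)) + b ^ (d * j) : ℕ) : ℝ) ≤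
        ((2 ^ (c₁ * (ndist J j + 1)) - 1 : ℕ) : ℝ) *
          (A₀ * ((b ^ β * L : ℕ) : ℝ) ^ 2 * ρ ^ (2 * ndist J j))) →
      ∃ Jg : ℕ, ∀ δ : ℝ, 0 < δ → ∃ g ∈ NN d 1 (C₀ * b ^ β) (C₀ * L), ∀ x : Fin d → ℝ,
        (∀ i, Good (b ^ Jg) δ (x i)) →
        |g x 0 - ∑ j ∈ range (Jm + 1), tpoly (fun a => τ j * z j a (cellAt b j x))
          (localAt b j x)| ≤ 1 / ((b ^ β * L : ℕ) : ℝ) ^ κ' := by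
  classical
  obtain ⟨A, hA⟩ := exists_weight_bound hρ0 hρ1
  set e₀ : ℕ := 1 + 3 * κ + k * d + κ * k * d + 2 * k ^ d + d * k with he₀
  set κ₃ : ℕ := e₀ + κ' with hκ₃
  set E : ℕ := k ^ d * (3 * κ + 3 + 6 * κ₃ * (d * k)) with hE
  set Cf : ℕ := 4 * A ^ 2 * k ^ d * A₀ with hCf
  set C₀ : ℕ := 16 * E + k ^ d * ((3 * A₀ + 4 * c₁) * (2 * (A + 9))) +
    (2 * E + k ^ d * (3 * Cf)) + (112 + 12 * d) with hC₀
  refine ⟨C₀, by omega, fun β L hβ hL J Jm z τ hJm hbd hcost => ?_⟩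
  set q := Nat.sqrt L with hq
  set N : ℕ := b ^ β * L with hN
  set D : ℕ := 3 * (q + 1) * κ₃ with hD
  have hb0 : 0 < b := by omega
  have hW2 : 2 ≤ b ^ β := hb.trans (Nat.le_self_pow (by omega) b)
  have hN2 : 2 ≤ N := hW2.trans (Nat.le_mul_of_pos_right _ hL)
  have hNr : (2 : ℝ) ≤ N := by exact_mod_cast hN2
  have hN1 : (1 : ℝ) ≤ N := by linarith
  obtain ⟨hNW, hJβ⟩ := level_le_of_pow_le hb hβ hJm
  have hND : (N : ℝ) ^ κ₃ ≤ ((b : ℝ) ^ β) ^ D := by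
    have : N ^ κ₃ ≤ (b ^ β) ^ D := by
      rw [hD, pow_mul]
      exact Nat.pow_le_pow_left hNW _
    exact_mod_cast this
  have hJm1 : ((Jm : ℝ) + 1) ≤ (N : ℝ) ^ κ := by
    have : Jm + 1 ≤ N ^ κ := by
      have h1 : Jm < 2 ^ Jm := Nat.lt_two_pow_self
      have h2 : 2 ^ Jm ≤ b ^ Jm := Nat.pow_le_pow_left hb _
      omega
    exact_mod_cast this
  have hnat : ∀ c : ℕ, (c : ℝ) ≤ (N : ℝ) ^ c := fun c => by
    have : c ≤ N ^ c := (Nat.lt_two_pow_self).le.trans (Nat.pow_le_pow_left hN2 c)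
    exact_mod_cast this
  set near : Finset ℕ := {j ∈ range (Jm + 1) | ndist J j < q + 2} with hnear
  set far : Finset ℕ := {j ∈ range (Jm + 1) | ¬ ndist J j < q + 2} with hfar
  have hnearJ : ∀ j ∈ near, j ≤ Jm := fun j hj => by
    have := mem_range.1 (mem_filter.1 hj).1; omega
  have hfarJ : ∀ j ∈ far, j ≤ Jm := fun j hj => by
    have := mem_range.1 (mem_filter.1 hj).1; omega
  have hcard_near : (#near : ℝ) ≤ (N : ℝ) ^ κ := by
    have : #near ≤ Jm + 1 := (card_filter_le _ _).trans (by simp)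
    refine le_trans ?_ hJm1
    exact_mod_cast this
  have hcard_far : (#far : ℝ) ≤ (N : ℝ) ^ κ := by
    have : #far ≤ Jm + 1 := (card_filter_le _ _).trans (by simp)
    refine le_trans ?_ hJm1
    exact_mod_cast this
  -- the bit budgets
  set R : ℕ → ℕ := fun j => c₁ * (ndist J j + 1) with hR
  set V : ℕ → ℕ := fun j => 2 ^ R j - 1 with hV
  have hR1 : ∀ j, 1 ≤ R j := fun j => Nat.mul_pos hc₁ (Nat.succ_pos _)
  have hVR : ∀ j, V j + 1 = 2 ^ R j := fun j => Nat.sub_add_cancel (Nat.one_le_two_pow)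
  have hV1 : ∀ j, 1 ≤ V j := fun j => by
    have : 2 ^ 1 ≤ 2 ^ R j := Nat.pow_le_pow_right (by norm_num) (hR1 j)
    have := hVR j
    omega
  set Y : ℕ → ℕ := fun j => ⌊(L : ℝ) * ρ ^ ndist J j⌋₊ + 1 with hY
  have hYr : ∀ j, (L : ℝ) * ρ ^ ndist J j ≤ Y j := fun j => by
    have := Nat.lt_floor_add_one ((L : ℝ) * ρ ^ ndist J j)
    rw [hY]; push_cast; exact this.le
  have hz : ∀ j ∈ near, ∀ a, V j * (∑ n ∈ cells d b j, ((z j a n).natAbs + (V j - 1)) / V j) +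
      b ^ (d * j) ≤ V j * Y j * (A₀ * Y j * (b ^ β * b ^ β)) := by
    intro j hj a
    have h1 := hcost j (hnearJ j hj) a
    have h2 : ((V j : ℕ) : ℝ) * (A₀ * (N : ℝ) ^ 2 * ρ ^ (2 * ndist J j)) ≤
        ((V j * Y j * (A₀ * Y j * (b ^ β * b ^ β)) : ℕ) : ℝ) := by
      have h3 : (N : ℝ) ^ 2 * ρ ^ (2 * ndist J j) =
          ((L : ℝ) * ρ ^ ndist J j) ^ 2 * ((b : ℝ) ^ β * (b : ℝ) ^ β) := by
        rw [hN, mul_comm 2, pow_mul]; push_cast; ring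
      have h4 : ((L : ℝ) * ρ ^ ndist J j) ^ 2 ≤ (Y j : ℝ) ^ 2 :=
        pow_le_pow_left₀ (by positivity) (hYr j) 2
      rw [mul_assoc (A₀ : ℝ), h3]
      calc _ ≤ (V j : ℝ) * (A₀ * ((Y j : ℝ) ^ 2 * ((b : ℝ) ^ β * (b : ℝ) ^ β))) := by gcongr
        _ = _ := by push_cast; ring
    exact_mod_cast h1.trans h2
  -- the expansions of the far levels
  have hQex : ∀ (j : ℕ) (n : Fin d → ℕ), ∃ Q : (Fin d → Fin k) → ℝ,
      n ∈ cells d b j → (∀ y, tpoly Q y = tpoly (fun a => τ j * z j a n)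
        fun i => (b : ℝ) ^ j * y i - n i) ∧
      ∀ a, |Q a| ≤ ((2 * (b : ℝ) ^ j) ^ k) ^ d * ∑ a, |τ j * z j a n| := by
    intro j n
    by_cases hn : n ∈ cells d b j
    · obtain ⟨Q, hQ⟩ := exists_monomial_expansion hb0 j (fun a => τ j * (z j a n : ℝ)) hn
      exact ⟨Q, fun _ => hQ⟩
    · exact ⟨0, fun h => absurd h hn⟩
  choose Q hQ using hQex
  set r₁ : ℝ := ((2 * (N : ℝ) ^ κ) ^ k) ^ d * (k ^ d * (N : ℝ) ^ κ) with hr₁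
  have hQb : ∀ j ∈ far, ∀ n ∈ cells d b j, ∀ a, |Q j n a| ≤ r₁ := by
    intro j hj n hn a
    refine ((hQ j n hn).2 a).trans ?_
    have h1 : (b : ℝ) ^ j ≤ (N : ℝ) ^ κ := by
      have : b ^ j ≤ N ^ κ := (Nat.pow_le_pow_right hb0 (hfarJ j hj)).trans hJm
      exact_mod_cast this
    have h2 : ∑ a, |τ j * (z j a n : ℝ)| ≤ k ^ d * (N : ℝ) ^ κ := by
      calc _ ≤ ∑ _a : Fin d → Fin k, (N : ℝ) ^ κ :=
            sum_le_sum fun a _ => hbd j (hfarJ j hj) a n hn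
        _ = _ := by simp
    rw [hr₁]
    gcongr
  set r : ℝ := (N : ℝ) ^ κ * r₁ with hr
  have hr₁1 : (N : ℝ) ^ κ ≤ r₁ := by
    have h1 : (1 : ℝ) ≤ ((2 * (N : ℝ) ^ κ) ^ k) ^ d := by
      refine one_le_pow₀ (one_le_pow₀ ?_)
      have : (1 : ℝ) ≤ (N : ℝ) ^ κ := one_le_pow₀ hN1
      linarith
    have h2 : (1 : ℝ) ≤ (k : ℝ) ^ d := one_le_pow₀ (by exact_mod_cast hk)
    calc (N : ℝ) ^ κ = 1 * (1 * (N : ℝ) ^ κ) := by ring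
      _ ≤ r₁ := by rw [hr₁]; gcongr
  have hr₁0 : 0 ≤ r₁ := le_trans (by positivity) hr₁1
  have hrr : r₁ ≤ r := by
    have : (1 : ℝ) ≤ (N : ℝ) ^ κ := one_le_pow₀ hN1
    rw [hr]; nlinarith
  have hnz : ∀ j ∈ far, #{n ∈ cells d b j | Q j n ≠ 0} ≤
      ∑ a, ∑ n ∈ cells d b j, ((z j a n).natAbs + (V j - 1)) / V j := by
    intro j hj
    rw [sum_comm, card_filter]
    refine sum_le_sum fun n hn => ?_
    split_ifs with h
    · by_contra hcon
      refine h ?_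
      have h0 : ∀ a, z j a n = 0 := by
        intro a
        by_contra hza
        have h1 := ceil_pos (hV1 j) (Int.natAbs_ne_zero.2 hza)
        have h2 := single_le_sum (f := fun a => ((z j a n).natAbs + (V j - 1)) / V j)
          (fun _ _ => Nat.zero_le _) (mem_univ a)
        exact hcon (h1.trans h2)
      ext a
      have := (hQ j n hn).2 a
      simp only [h0, Int.cast_zero, mul_zero, abs_zero, sum_const_zero] at this
      exact abs_nonpos_iff.1 this
    · exact Nat.zero_le _
  have hfarcost : ∑ j ∈ far, 2 * #{n ∈ cells d b j | Q j n ≠ 0} ≤ Cf * L * (b ^ β * b ^ β) := by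
    have h1 : ∀ j ∈ far, ((2 * #{n ∈ cells d b j | Q j n ≠ 0} : ℕ) : ℝ) ≤
        2 * (k ^ d * (A₀ * (N : ℝ) ^ 2 * ρ ^ (2 * ndist J j))) := by
      intro j hj
      have h2 : ((∑ a, ∑ n ∈ cells d b j, ((z j a n).natAbs + (V j - 1)) / V j : ℕ) : ℝ) ≤
          ∑ _a : Fin d → Fin k, (A₀ * (N : ℝ) ^ 2 * ρ ^ (2 * ndist J j)) := by
        rw [Nat.cast_sum]
        refine sum_le_sum fun a _ => ?_
        have h3 := hcost j (hfarJ j hj) a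
        have hVp : (0 : ℝ) < V j := by exact_mod_cast hV1 j
        refine le_of_mul_le_mul_left (le_trans ?_ h3) hVp
        rw [Nat.cast_add, Nat.cast_mul]
        exact le_add_of_nonneg_right (Nat.cast_nonneg _)
      have h4 : ((#{n ∈ cells d b j | Q j n ≠ 0} : ℕ) : ℝ) ≤ _ :=
          (Nat.cast_le.2 (hnz j hj)).trans h2
      rw [sum_const, card_univ, nsmul_eq_mul] at h4
      simp only [Fintype.card_pi, Fintype.card_fin, prod_const, card_univ, Nat.cast_pow] at h4
      push_cast
      linarith
    have h5 := far_weight_le hρ0 hρ1 hA L far J (fun j hj => not_lt.1 (mem_filter.1 hj).2)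
    have h6 : ((∑ j ∈ far, 2 * #{n ∈ cells d b j | Q j n ≠ 0} : ℕ) : ℝ) ≤
        ((Cf * L * (b ^ β * b ^ β) : ℕ) : ℝ) := by
      rw [Nat.cast_sum]
      refine (sum_le_sum h1).trans ?_
      rw [← mul_sum, ← mul_sum, ← mul_sum]
      calc _ = 2 * (k : ℝ) ^ d * A₀ * L * ((b : ℝ) ^ β * (b : ℝ) ^ β) *
            (L * ∑ j ∈ far, ρ ^ (2 * ndist J j)) := by rw [hN]; push_cast; ring
        _ ≤ 2 * (k : ℝ) ^ d * A₀ * L * ((b : ℝ) ^ β * (b : ℝ) ^ β) * (2 * (A : ℝ) ^ 2) := by gcongr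
        _ = _ := by rw [hCf]; push_cast; ring
    exact_mod_cast h6
  -- the network
  refine ⟨Jm + β * D, fun δ hδ => ?_⟩
  let X := {x : Fin d → ℝ // ∀ i, Good (b ^ (Jm + β * D)) δ (x i)}
  obtain ⟨f, hnet, hf⟩ := Net.assemble (X := X) (k := k) hb0 hβ D Jm hδ (fun x => x.1)
    (fun x => x.2) near far hnearJ hfarJ (fun j => A₀ * Y j) R V Y hV1 hVR
    (fun j => Nat.succ_pos _) z hz τ (r := r)
    (fun j hj a n hn => (hbd j (hnearJ j hj) a n hn).trans (hr₁1.trans hrr))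
    (Cf * L) Q hfarcost (by
      intro n hn a
      refine (abs_sum_le_sum_abs _ _).trans ?_
      calc _ ≤ ∑ j ∈ far, r₁ := sum_le_sum fun j hj => hQb j hj _ (hn j) a
        _ = #far * r₁ := by rw [sum_const, nsmul_eq_mul]
        _ ≤ r := by rw [hr]; gcongr)
  obtain ⟨hnd1, hnd2⟩ := near_depth_le hρ0 hA hL near J (fun j hj => (mem_filter.1 hj).2)
  have hqL : q + 1 ≤ 2 * L := by have := Nat.sqrt_le_self L; omega
  have hlev : k ^ d * (Jm / β + 1 + (2 + 2 * D * (d * k))) ≤ E * (q + 1) := by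
    rw [hE, mul_assoc (k ^ d) _ (q + 1)]
    refine Nat.mul_le_mul_left _ ?_
    calc Jm / β + 1 + (2 + 2 * D * (d * k)) ≤ 3 * (q + 1) * κ + 3 * (q + 1) + 2 * D * (d * k) := by
          have h1 : Jm / β ≤ 3 * (q + 1) * κ := hJβ
          generalize Jm / β = u at h1 ⊢
          generalize 3 * (q + 1) * κ = v at h1 ⊢
          generalize 2 * D * (d * k) = w
          omega
      _ = _ := by rw [hD]; ring
  have hdepth : (∑ j ∈ near, k ^ d * ((Jm / β + 1) +
      ((3 * (A₀ * Y j) + 2 + 4 * R j * Y j) + 2 * D * (d * k)))) +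
        k ^ d * ((Jm / β + 1) + (3 * (Cf * L) + 2 * D * (d * k))) ≤ C₀ * L := by
    have h1 : ∀ j ∈ near, k ^ d * ((Jm / β + 1) +
        ((3 * (A₀ * Y j) + 2 + 4 * R j * Y j) + 2 * D * (d * k))) ≤
        E * (q + 1) + k ^ d * ((3 * A₀ + 4 * c₁) * ((ndist J j + 1) * Y j)) := by
      intro j _
      have h2 : 3 * (A₀ * Y j) + 4 * R j * Y j ≤ (3 * A₀ + 4 * c₁) * ((ndist J j + 1) * Y j) := by
        rw [hR]
        calc _ = 3 * A₀ * (1 * Y j) + 4 * c₁ * ((ndist J j + 1) * Y j) := by ring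
          _ ≤ 3 * A₀ * ((ndist J j + 1) * Y j) + 4 * c₁ * ((ndist J j + 1) * Y j) := by
            gcongr; omega
          _ = _ := by ring
      calc _ = k ^ d * (Jm / β + 1 + (2 + 2 * D * (d * k))) +
            k ^ d * (3 * (A₀ * Y j) + 4 * R j * Y j) := by ring
        _ ≤ _ := by gcongr
    have h3 : ∑ j ∈ near, (E * (q + 1) + k ^ d * ((3 * A₀ + 4 * c₁) * ((ndist J j + 1) * Y j))) =
        E * (#near * (q + 1)) +
          k ^ d * ((3 * A₀ + 4 * c₁) * ∑ j ∈ near, (ndist J j + 1) * Y j) := by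
      rw [sum_add_distrib, sum_const, smul_eq_mul, ← mul_sum, ← mul_sum]; ring
    have h4 : k ^ d * ((Jm / β + 1) + (3 * (Cf * L) + 2 * D * (d * k))) ≤
        E * (2 * L) + k ^ d * (3 * (Cf * L)) := by
      calc _ ≤ k ^ d * (Jm / β + 1 + (2 + 2 * D * (d * k))) + k ^ d * (3 * (Cf * L)) := by
            rw [← mul_add]; exact Nat.mul_le_mul_left _ (by omega)
        _ ≤ E * (q + 1) + k ^ d * (3 * (Cf * L)) := by gcongr
        _ ≤ _ := by gcongr
    calc _ ≤ (E * (16 * L) + k ^ d * ((3 * A₀ + 4 * c₁) * (2 * (A + 9) * L))) +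
          (E * (2 * L) + k ^ d * (3 * (Cf * L))) := by
          refine add_le_add ((sum_le_sum h1).trans ?_) h4
          rw [h3]
          gcongr
      _ = (16 * E + k ^ d * ((3 * A₀ + 4 * c₁) * (2 * (A + 9))) +
          (2 * E + k ^ d * (3 * Cf))) * L := by ring
      _ ≤ C₀ * L := Nat.mul_le_mul_right _ (by rw [hC₀]; exact Nat.le_add_right _ _)
  have hwidth : 18 * b ^ β + 8 * d + 90 + 2 * d * b ^ β + 2 * d + 2 ≤ C₀ * b ^ β := by
    calc _ ≤ (112 + 12 * d) * b ^ β := by nlinarith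
      _ ≤ C₀ * b ^ β := Nat.mul_le_mul_right _ (by rw [hC₀]; exact Nat.le_add_left _ _)
  have hcs : aff (coordSet (fun x : X => x.1) : Set (X → ℝ)) ≤
      aff (Set.range fun i (x : X) => x.1 i) := by
    refine aff_mono ?_
    intro f hf
    obtain ⟨i, -, rfl⟩ := mem_image.1 (mem_coe.1 hf)
    exact ⟨i, rfl⟩
  have hnet' : Net (C₀ * b ^ β) (C₀ * L) (aff (Set.range fun i (x : X) => x.1 i))
      (aff (({f} : Finset (X → ℝ)) : Set (X → ℝ))) := by
    refine Net.pad ?_ (by rw [card_singleton]; omega) hdepth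
    rw [coe_singleton]
    exact hnet.mono hwidth hcs le_rfl
  obtain ⟨g, hg, hgx⟩ := Net.exists_NNaux (k := 1) (by omega) (fun x : X => x.1) hnet'
    (fun _ => f) (fun _ => mem_aff (by simp))
  refine ⟨g, hg, fun x hx => ?_⟩
  have h1 := hgx ⟨x, hx⟩ 0
  have h2 := hf ⟨x, hx⟩
  have h0 : ∀ i, 0 ≤ x i := fun i => (hx i).1
  have hcell : ∀ j, cellAt b j x ∈ cells d b j := fun j =>
    cellAt_mem hb0 j h0 fun i => (hx i).2.1
  have h3 : ∑ j ∈ range (Jm + 1), tpoly (fun a => τ j * (z j a (cellAt b j x) : ℝ))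
      (localAt b j x) =
      (∑ j ∈ near, tpoly (fun a => τ j * (z j a (cellAt b j x) : ℝ)) (localAt b j x)) +
        ∑ j ∈ far, tpoly (Q j (cellAt b j x)) x := by
    rw [← sum_filter_add_sum_filter_not (range (Jm + 1)) (fun j => ndist J j < q + 2)]
    congr 1
    refine sum_congr rfl fun j _ => ?_
    rw [(hQ j _ (hcell j)).1]
    rfl
  change g x 0 = _ at h1
  rw [h3, h1]
  refine h2.trans ?_
  have hNκ : (0 : ℝ) < (N : ℝ) ^ κ₃ := by positivity
  have hκs : (N : ℝ) ^ κ₃ = (N : ℝ) ^ e₀ * (N : ℝ) ^ κ' := by rw [hκ₃, pow_add]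
  have hWD : (0 : ℝ) < ((b : ℝ) ^ β) ^ D := lt_of_lt_of_le hNκ hND
  have hr0 : 0 ≤ r := hr₁0.trans hrr
  have hmain : ((#near : ℝ) + 1) * (k ^ d * (r * (d * k))) ≤ (N : ℝ) ^ e₀ := by
    have g1 : (#near : ℝ) + 1 ≤ N * (N : ℝ) ^ κ := by
      have : (1 : ℝ) ≤ (N : ℝ) ^ κ := one_le_pow₀ hN1
      nlinarith
    have g2 : (k : ℝ) ^ d ≤ (N : ℝ) ^ (k ^ d) := by
      have := hnat (k ^ d); push_cast at this; exact this
    have g3 : (d : ℝ) * k ≤ (N : ℝ) ^ (d * k) := by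
      have := hnat (d * k); push_cast at this; exact this
    have g4 : (2 * (N : ℝ) ^ κ) ^ k ≤ (N * (N : ℝ) ^ κ) ^ k := by gcongr
    calc _ ≤ (N * (N : ℝ) ^ κ) * ((N : ℝ) ^ (k ^ d) * (((N : ℝ) ^ κ * (((N * (N : ℝ) ^ κ) ^ k) ^ d *
          ((N : ℝ) ^ (k ^ d) * (N : ℝ) ^ κ))) * (N : ℝ) ^ (d * k))) := by
          rw [hr, hr₁]; gcongr
      _ = (N : ℝ) ^ e₀ := by rw [he₀]; ring
  calc _ = (((#near : ℝ) + 1) * (k ^ d * (r * (d * k)))) / ((b : ℝ) ^ β) ^ D := by ring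
    _ ≤ (N : ℝ) ^ e₀ / (N : ℝ) ^ κ₃ := by gcongr
    _ = 1 / (N : ℝ) ^ κ' := by
      rw [hκs, div_mul_eq_div_div, div_self (by positivity)]

end Realization

section Median

lemma Net.max {X : Type} {w w' l l' : ℕ} {U : Submodule ℝ (X → ℝ)} {f g : X → ℝ}
    (hf : Net w l U (aff {f})) (hg : Net w' l' U (aff {g})) :
    ∃ w'' l'', Net w'' l'' U (aff {f ⊔ g}) := by
  have hf' : Net (w + 2) (l + l') U (aff {f}) := by
    have h : Net (w + 2) l U (aff (({f} : Finset (X → ℝ)) : Set (X → ℝ))) := by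
      rw [coe_singleton]; exact hf.mono (by omega) le_rfl le_rfl
    simpa using h.pad (by rw [card_singleton]; omega) (L' := l + l') (by omega)
  have hg' : Net (w' + 2) (l + l') U (aff {g}) := by
    have h : Net (w' + 2) l' U (aff (({g} : Finset (X → ℝ)) : Set (X → ℝ))) := by
      rw [coe_singleton]; exact hg.mono (by omega) le_rfl le_rfl
    simpa using h.pad (by rw [card_singleton]; omega) (L' := l + l') (by omega)
  have h := hf'.par hg'
  have hfU : f ∈ aff {f} ⊔ aff {g} := Submodule.mem_sup_left (mem_aff rfl)
  have hgU : g ∈ aff {f} ⊔ aff {g} := Submodule.mem_sup_right (mem_aff rfl)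
  have h2 : Net (w + 2 + (w' + 2) + 3) 1 (aff {f} ⊔ aff {g}) (aff {f ⊔ g}) := by
    refine Net.layer ![f - g, g, -g] (by simp) ?_ ?_
    · intro i
      fin_cases i
      · exact Submodule.sub_mem _ hfU hgU
      · exact hgU
      · exact Submodule.neg_mem _ hgU
    · refine aff_le (one_mem_aff _) ?_
      rintro _ rfl
      have e : f ⊔ g = rel (f - g) + (rel g - rel (-g)) := by
        rw [rel_sub_rel_neg]
        ext x
        simp only [rel, relu, Pi.sup_apply, Pi.add_apply, Pi.sub_apply]
        rcases le_total (f x) (g x) with h | h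
        · rw [sup_eq_right.2 h, max_eq_right (by linarith)]; ring
        · rw [sup_eq_left.2 h, max_eq_left (by linarith)]; ring
      rw [e]
      exact Submodule.add_mem _ (mem_aff ⟨0, rfl⟩)
        (Submodule.sub_mem _ (mem_aff ⟨1, rfl⟩) (mem_aff ⟨2, rfl⟩))
  exact ⟨_, _, (h.mono (Nat.le_add_right _ 3) le_rfl le_rfl).trans h2⟩

lemma aff_singleton_neg {X : Type} (f : X → ℝ) : aff {-f} ≤ aff {f} := by
  refine aff_le (one_mem_aff _) ?_
  rintro _ rfl
  exact Submodule.neg_mem _ (mem_aff rfl)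

lemma Net.min {X : Type} {w w' l l' : ℕ} {U : Submodule ℝ (X → ℝ)} {f g : X → ℝ}
    (hf : Net w l U (aff {f})) (hg : Net w' l' U (aff {g})) :
    ∃ w'' l'', Net w'' l'' U (aff {f ⊓ g}) := by
  obtain ⟨w'', l'', h⟩ := Net.max (hf.mono le_rfl le_rfl (aff_singleton_neg f))
    (hg.mono le_rfl le_rfl (aff_singleton_neg g))
  refine ⟨w'', l'', h.mono le_rfl le_rfl ?_⟩
  have : f ⊓ g = -(-f ⊔ -g) := by
    rw [neg_sup, neg_neg, neg_neg]
  rw [this]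
  exact aff_singleton_neg _

/-- Some network returns a value which is at most `e` away from `y` as soon as a majority of its
arguments is. -/
lemma exists_median (d : ℕ) : ∃ w l : ℕ, ∃ m ∈ NN (2 * d + 1) 1 w l,
    ∀ (v : Fin (2 * d + 1) → ℝ) (y e : ℝ) (B : Finset (Fin (2 * d + 1))), #B ≤ d →
      (∀ u, u ∉ B → |y - v u| ≤ e) → |y - m v 0| ≤ e := by
  classical
  let F : Finset (Finset (Fin (2 * d + 1))) := powersetCard (d + 1) univ
  have hF : F.Nonempty := powersetCard_nonempty.2 (by rw [card_univ, Fintype.card_fin]; omega)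
  have hne : ∀ S : F, S.1.Nonempty := fun S => by
    rw [← card_pos, (mem_powersetCard.1 S.2).2]; omega
  have hFa : F.attach.Nonempty := hF.attach
  let c : Fin (2 * d + 1) → (Fin (2 * d + 1) → ℝ) → ℝ := fun u v => v u
  let f : (Fin (2 * d + 1) → ℝ) → ℝ := F.attach.sup' hFa fun S => S.1.inf' (hne S) c
  have hnet : ∃ w l,
      Net w l (aff (Set.range fun i (v : Fin (2 * d + 1) → ℝ) => v i)) (aff {f}) := by
    refine sup'_induction (p := fun f => ∃ w l, Net w l
      (aff (Set.range fun i (v : Fin (2 * d + 1) → ℝ) => v i)) (aff {f})) hFa _ ?_ ?_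
    · rintro f₁ ⟨w₁, l₁, h₁⟩ f₂ ⟨w₂, l₂, h₂⟩
      exact h₁.max h₂
    · intro S _
      refine inf'_induction (p := fun f => ∃ w l, Net w l
        (aff (Set.range fun i (v : Fin (2 * d + 1) → ℝ) => v i)) (aff {f})) (hne S) _ ?_ ?_
      · rintro f₁ ⟨w₁, l₁, h₁⟩ f₂ ⟨w₂, l₂, h₂⟩
        exact h₁.min h₂
      · intro u _
        refine ⟨0, 0, aff_mono ?_⟩
        rintro _ rfl
        exact ⟨u, rfl⟩
  obtain ⟨w, l, hnet⟩ := hnet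
  obtain ⟨m, hm, hmf⟩ := Net.exists_NNaux (k := 1) (Nat.le_add_left 1 w)
    (fun v : Fin (2 * d + 1) → ℝ => v) (hnet.mono (Nat.le_add_right w 1) le_rfl le_rfl)
    (fun _ => f) (fun _ => mem_aff rfl)
  refine ⟨_, _, m, hm, fun v y e B hB hv => ?_⟩
  rw [hmf v 0]
  have hfv : f v = F.attach.sup' hFa fun S => S.1.inf' (hne S) v := by
    simp only [f, Finset.sup'_apply, Finset.inf'_apply, c]
  rw [hfv, abs_le]
  constructor
  · have : (F.attach.sup' hFa fun S => S.1.inf' (hne S) v) ≤ y + e := by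
      refine sup'_le _ _ fun S _ => ?_
      obtain ⟨u, hu, huB⟩ : ∃ u ∈ S.1, u ∉ B := by
        by_contra! h
        have := card_le_card (show S.1 ⊆ B from h)
        have := (mem_powersetCard.1 S.2).2
        omega
      have := abs_le.1 (hv u huB)
      exact (inf'_le v hu).trans (by linarith)
    linarith
  · obtain ⟨S, hS, hScard⟩ := exists_subset_card_eq (s := Bᶜ) (n := d + 1) (by
      rw [card_compl, Fintype.card_fin]; omega)
    have : y - e ≤ F.attach.sup' hFa fun S => S.1.inf' (hne S) v := by
      refine le_trans ?_ (le_sup' (f := fun S : F => S.1.inf' (hne S) v)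
        (mem_attach F ⟨S, mem_powersetCard.2 ⟨subset_univ _, hScard⟩⟩))
      refine le_inf' _ _ fun u hu => ?_
      have := abs_le.1 (hv u (mem_compl.1 (hS hu)))
      linarith
    linarith

lemma good_or_good {K K' : ℕ} (h : K.Coprime K') (hK : 0 < K) (hK' : 0 < K') {δ y : ℝ}
    (hδ : δ * (K * K') ≤ 1) (h0 : 0 ≤ y) (h1 : y < 1) : Good K δ y ∨ Good K' δ y := by
  by_contra! hcon
  obtain ⟨m, hm0, hmK, hm1, hm2⟩ : ∃ m : ℕ, 0 < m ∧ m < K ∧ K * y < m ∧ m - K * δ < K * y := by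
    have := hcon.1
    simp only [Good, h0, h1, true_and, not_forall, not_or, not_le, exists_prop] at this
    exact this
  obtain ⟨n, hn0, hnK, hn1, hn2⟩ : ∃ m : ℕ, 0 < m ∧ m < K' ∧ K' * y < m ∧
      m - K' * δ < K' * y := by
    have := hcon.2
    simp only [Good, h0, h1, true_and, not_forall, not_or, not_le, exists_prop] at this
    exact this
  have hne : m * K' ≠ n * K := by
    intro he
    have h2 : K ∣ m * K' := he ▸ Dvd.intro_left n rfl
    exact absurd (Nat.le_of_dvd hm0 (h.dvd_of_dvd_mul_right h2)) (by omega)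
  have hKr : (0 : ℝ) < K := by exact_mod_cast hK
  have hKr' : (0 : ℝ) < K' := by exact_mod_cast hK'
  have a1 : (m : ℝ) * K' - n * K < 1 := by nlinarith
  have a2 : (n : ℝ) * K - m * K' < 1 := by nlinarith
  have a3 : m * K' < n * K + 1 := by
    have : (m : ℝ) * K' < n * K + 1 := by linarith
    exact_mod_cast this
  have a4 : n * K < m * K' + 1 := by
    have : (n : ℝ) * K < m * K' + 1 := by linarith
    exact_mod_cast this
  omega

/-- Networks which are accurate away from the grid points of pairwise coprime meshes combine to a
network which is accurate everywhere. -/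
theorem exists_combined_network (d : ℕ) (hd : 1 ≤ d) : ∃ C₁ : ℕ, ∀ (b : Fin (2 * d + 1) → ℕ)
    (W L : ℕ) (G : Fin (2 * d + 1) → (Fin d → ℝ) → ℝ) (ε : ℝ),
    (∀ u, 0 < b u) → (∀ u v, u ≠ v → (b u).Coprime (b v)) → 0 ≤ ε →
    (∀ u, ∃ Jg : ℕ, ∀ δ : ℝ, 0 < δ → ∃ g ∈ NN d 1 W L, ∀ x : Fin d → ℝ,
        (∀ i, Good (b u ^ Jg) δ (x i)) → |g x 0 - G u x| ≤ ε) →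
    ∃ g ∈ NN d 1 (C₁ * (W + 1)) (L + C₁), ∀ (x : Fin d → ℝ) (y : ℝ), (∀ i, 0 ≤ x i ∧ x i < 1) →
      |y - g x 0| ≤ ∑ u, |y - G u x| + ε := by
  classical
  obtain ⟨w, l, m, hm, hmed⟩ := exists_median d
  refine ⟨2 * d + 2 + w + l, fun b W L G ε hb hcop hε hex => ?_⟩
  choose Jg hJg using hex
  set D : ℝ := ∏ u, ((b u ^ Jg u : ℕ) : ℝ) with hD
  have hbp : ∀ u, (1 : ℝ) ≤ ((b u ^ Jg u : ℕ) : ℝ) := fun u => by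
    have : 1 ≤ b u ^ Jg u := Nat.one_le_pow _ _ (hb u)
    exact_mod_cast this
  have hbD : ∀ u, ((b u ^ Jg u : ℕ) : ℝ) ≤ D := fun u => by
    rw [hD, ← mul_prod_erase univ _ (mem_univ u)]
    refine le_mul_of_one_le_right (by linarith [hbp u]) ?_
    exact one_le_prod (fun v _ => hbp v)
  have hD0 : 0 < D := prod_pos fun u _ => by linarith [hbp u]
  choose g hg hgG using fun u => hJg u (1 / (D * D)) (by positivity)
  have h1 : ∀ u : Fin (2 * d + 1), Net W L (aff (Set.range fun i (x : Fin d → ℝ) => x i))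
      (aff (Set.range fun (i : Fin 1) (x : Fin d → ℝ) => g u x i)) :=
    fun u => Net.of_NNaux (fun x => x) (g u) (hg u)
  have h2 := Net.parFin univ (one_mem_aff _) _ fun u _ => h1 u
  have h3 := Net.of_NNaux (fun (x : Fin d → ℝ) u => g u x 0) m hm
  have h4 : Net ((2 * d + 2 + w + l) * (W + 1)) (L + l)
      (aff (Set.range fun i (x : Fin d → ℝ) => x i))
      (aff (Set.range fun (i : Fin 1) (x : Fin d → ℝ) => m (fun u => g u x 0) i)) := by
    refine Net.trans (h2.mono ?_ le_rfl ?_) (h3.mono ?_ le_rfl le_rfl)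
    · rw [card_univ, Fintype.card_fin]; exact Nat.mul_le_mul (by omega) (by omega)
    · refine aff_mono ?_
      rintro _ ⟨u, rfl⟩
      exact Set.mem_iUnion₂.2 ⟨u, mem_univ u, mem_aff ⟨0, rfl⟩⟩
    · nlinarith
  have h5 : Net ((2 * d + 2 + w + l) * (W + 1)) (L + (2 * d + 2 + w + l))
      (aff (Set.range fun i (x : Fin d → ℝ) => x i))
      (aff (({fun x => m (fun u => g u x 0) 0} : Finset ((Fin d → ℝ) → ℝ)) :
        Set ((Fin d → ℝ) → ℝ))) := by
    refine Net.pad (h4.mono le_rfl le_rfl (aff_mono ?_)) ?_ (by omega)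
    · rw [coe_singleton]; rintro _ rfl; exact ⟨0, rfl⟩
    · rw [card_singleton]; nlinarith
  obtain ⟨gg, hgg, hggx⟩ := Net.exists_NNaux (k := 1) (by nlinarith) (fun x : Fin d → ℝ => x) h5
    (fun _ x => m (fun u => g u x 0) 0) (fun _ => mem_aff (by simp))
  refine ⟨gg, hgg, fun x y hx => ?_⟩
  rw [hggx x 0]
  let B : Finset (Fin (2 * d + 1)) := {u | ¬ ∀ i, Good (b u ^ Jg u) (1 / (D * D)) (x i)}
  refine hmed _ y _ B ?_ ?_
  · have hB : ∀ u ∈ B, ∃ i, ¬ Good (b u ^ Jg u) (1 / (D * D)) (x i) := fun u hu =>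
      not_forall.1 (mem_filter.1 hu).2
    have : Nonempty (Fin d) := ⟨⟨0, hd⟩⟩
    choose! φ hφ using hB
    have := card_le_card_of_injOn (s := B) (t := univ) φ (fun _ _ => mem_univ _) (by
      intro u hu v hv he
      by_contra hne
      have := good_or_good (δ := 1 / (D * D)) (y := x (φ u))
        (((hcop u v hne).pow_left (Jg u)).pow_right (Jg v)) (pow_pos (hb u) _)
        (pow_pos (hb v) _) (by
          rw [div_mul_eq_mul_div, one_mul, div_le_one (by positivity)]
          exact mul_le_mul (hbD u) (hbD v) (by linarith [hbp v]) hD0.le) (hx _).1 (hx _).2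
      rcases this with h | h
      · exact hφ u hu h
      · rw [he] at h; exact hφ v hv h)
    simpa using this
  · intro u hu
    have hgood : ∀ i, Good (b u ^ Jg u) (1 / (D * D)) (x i) := by
      by_contra h
      exact hu (mem_filter.2 ⟨mem_univ _, h⟩)
    have a1 := hgG u x hgood
    have a2 := single_le_sum (f := fun u => |y - G u x|) (fun _ _ => abs_nonneg _) (mem_univ u)
    calc |y - g u x 0| = |(y - G u x) - (g u x 0 - G u x)| := by ring_nf
      _ ≤ |y - G u x| + |g u x 0 - G u x| := abs_sub _ _
      _ ≤ _ := add_le_add a2 a1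

end Median

section OneDimensionalDifferences

/-- The `k`-th difference with step `t` of a function of one variable. -/
def lineDiff (k : ℕ) (t : ℝ) (φ : ℝ → ℝ) (x : ℝ) : ℝ :=
  ∑ j ∈ range (k + 1), (-1 : ℝ) ^ j * (k.choose j : ℝ) * φ (x + j * t)

lemma lineDiff_eq_fwdDiff (k : ℕ) (t : ℝ) (φ : ℝ → ℝ) (x : ℝ) :
    lineDiff k t φ x = (-1) ^ k * (fwdDiff t)^[k] φ x := by
  rw [fwdDiff_iter_eq_sum_shift, lineDiff, mul_sum]
  refine sum_congr rfl fun j hj => ?_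
  have hj' : j ≤ k := by have := mem_range.1 hj; omega
  rw [zsmul_eq_mul, nsmul_eq_mul]
  push_cast
  have : (-1 : ℝ) ^ k * (-1) ^ (k - j) = (-1) ^ j := by
    obtain ⟨m, rfl⟩ := Nat.exists_eq_add_of_le hj'
    rw [Nat.add_sub_cancel_left, pow_add, mul_assoc, ← mul_pow]
    norm_num
  rw [← this]; ring

lemma lineDiff_succ (k : ℕ) (t : ℝ) (φ : ℝ → ℝ) (x : ℝ) :
    lineDiff (k + 1) t φ x = lineDiff k t φ x - lineDiff k t φ (x + t) := by
  rw [lineDiff_eq_fwdDiff, lineDiff_eq_fwdDiff, lineDiff_eq_fwdDiff, Function.iterate_succ_apply',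
    fwdDiff]
  ring

lemma lineDiff_inv (k : ℕ) (ρ u : ℝ) (h : ∀ i ≤ k, u + i * ρ ≠ 0) :
    lineDiff k ρ (fun u => u⁻¹) u * ∏ i ∈ range (k + 1), (u + i * ρ) = k.factorial * ρ ^ k := by
  induction k generalizing u with
  | zero => have := h 0 le_rfl; simp at this; simp [lineDiff, this]
  | succ k ih =>
    have h1 := ih u fun i hi => h i (by omega)
    have h2 := ih (u + ρ) fun i hi => by
      have := h (i + 1) (by omega)
      push_cast at this
      convert this using 1; ring
    have e1 : ∏ i ∈ range (k + 1 + 1), (u + i * ρ) =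
        (∏ i ∈ range (k + 1), (u + i * ρ)) * (u + ((k : ℝ) + 1) * ρ) := by
      rw [prod_range_succ]; push_cast; rfl
    have e2 : ∏ i ∈ range (k + 1 + 1), (u + i * ρ) =
        (∏ i ∈ range (k + 1), (u + ρ + i * ρ)) * u := by
      rw [prod_range_succ']
      congr 1
      · refine prod_congr rfl fun i _ => ?_
        push_cast; ring
      · simp
    rw [lineDiff_succ, sub_mul]
    nth_rewrite 1 [e1]
    rw [e2, ← mul_assoc, ← mul_assoc, h1, h2, Nat.factorial_succ]
    push_cast; ring

lemma lineDiff_comp_mul_add (k : ℕ) (t x : ℝ) (φ : ℝ → ℝ) :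
    lineDiff k t φ x = lineDiff k 1 (fun v => φ (x + v * t)) 0 := by
  simp only [lineDiff]
  refine sum_congr rfl fun j _ => ?_
  simp

lemma lineDiff_polynomial (k : ℕ) (t : ℝ) (P : Polynomial ℝ) (hP : P.natDegree < k) (x : ℝ) :
    lineDiff k t (fun x => P.eval x) x = 0 := by
  rw [lineDiff_comp_mul_add, lineDiff_eq_fwdDiff]
  have e : (fun v => P.eval (x + v * t)) =
      (P.comp (Polynomial.C t * Polynomial.X + Polynomial.C x)).eval := by
    ext v; simp [Polynomial.eval_comp]; ring_nf
  rw [e, Polynomial.fwdDiff_iter_eq_zero_of_degree_lt]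
  · simp
  · refine lt_of_le_of_lt Polynomial.natDegree_comp_le ?_
    refine lt_of_le_of_lt ?_ hP
    calc _ ≤ P.natDegree * 1 := Nat.mul_le_mul_left _ (by compute_degree)
      _ = _ := mul_one _

lemma lineDiff_sub (k : ℕ) (t : ℝ) (φ ψ : ℝ → ℝ) (x : ℝ) :
    lineDiff k t (fun x => φ x - ψ x) x = lineDiff k t φ x - lineDiff k t ψ x := by
  simp only [lineDiff, ← sum_sub_distrib, mul_sub]

lemma continuous_lineDiff {k : ℕ} {φ : ℝ → ℝ} (hφ : Continuous φ) {X : Type*} [TopologicalSpace X]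
    {t x : X → ℝ} (ht : Continuous t) (hx : Continuous x) :
    Continuous fun y => lineDiff k (t y) φ (x y) := by
  unfold lineDiff; fun_prop

/-- The derivatives of the Lagrange basis polynomials for the nodes `0, ρ, …, kρ`. -/
def lagd (k : ℕ) (ρ : ℝ) (a : ℕ) : Polynomial ℝ :=
  (Lagrange.basis (range (k + 1)) (fun i : ℕ => (i : ℝ) * ρ) a).derivative

/-- The polynomial with the same integrals as `φ` between the nodes `θ, θ + ρ, …, θ + kρ`. -/
def interp (k : ℕ) (ρ θ : ℝ) (φ : ℝ → ℝ) (x : ℝ) : ℝ :=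
  ∑ a ∈ range (k + 1), a * ρ * (∫ v in (0 : ℝ)..1, φ (θ + a * ρ * v)) * (lagd k ρ a).eval (x - θ)

lemma lagd_natDegree_lt {k : ℕ} (hk : 1 ≤ k) {ρ : ℝ} (hρ : ρ ≠ 0) {a : ℕ} (ha : a ∈ range (k + 1)) :
    (lagd k ρ a).natDegree < k := by
  have h1 : (Lagrange.basis (range (k + 1)) (fun i : ℕ => (i : ℝ) * ρ) a).natDegree = k := by
    rw [Lagrange.natDegree_basis _ ha, card_range, Nat.add_sub_cancel]
    intro i _ j _ h
    exact_mod_cast mul_right_cancel₀ hρ h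
  refine lt_of_lt_of_eq (Polynomial.natDegree_derivative_lt ?_) h1
  omega

lemma integral_lagd {k : ℕ} {ρ : ℝ} (hρ : ρ ≠ 0) (θ : ℝ) {a i : ℕ} (ha : a ∈ range (k + 1))
    (hi : i ∈ range (k + 1)) :
    ∫ x in θ..θ + i * ρ, (lagd k ρ a).eval (x - θ) =
      (if i = a then 1 else 0) - (if a = 0 then 1 else 0) := by
  set P := Lagrange.basis (range (k + 1)) (fun i : ℕ => (i : ℝ) * ρ) a with hP
  have hinj : Set.InjOn (fun i : ℕ => (i : ℝ) * ρ) (range (k + 1)) := by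
    intro i _ j _ h
    exact_mod_cast mul_right_cancel₀ hρ h
  have hev : ∀ i ∈ range (k + 1), P.eval ((i : ℝ) * ρ) = if i = a then 1 else 0 := by
    intro i hi
    split_ifs with h
    · rw [h]; exact Lagrange.eval_basis_self hinj ha
    · exact Lagrange.eval_basis_of_ne (v := fun i : ℕ => (i : ℝ) * ρ) (Ne.symm h) hi
  rw [intervalIntegral.integral_eq_sub_of_hasDerivAt (f := fun x => P.eval (x - θ))]
  · have h0 := hev 0 (by simp)
    simp only [Nat.cast_zero, zero_mul] at h0
    simp only [add_sub_cancel_left, sub_self, hev i hi, h0, eq_comm (a := 0)]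
  · intro x _
    have h1 := (P.hasDerivAt (x - θ)).comp x ((hasDerivAt_id x).sub_const θ)
    rw [mul_one] at h1
    exact h1
  · refine Continuous.intervalIntegrable ?_ _ _
    fun_prop

lemma continuous_interp (k : ℕ) (ρ : ℝ) {φ : ℝ → ℝ} (hφ : Continuous φ) :
    Continuous fun y : ℝ × ℝ => interp k ρ y.1 φ y.2 := by
  unfold interp
  refine continuous_finsetSum _ fun a _ => ?_
  refine Continuous.mul (continuous_const.mul ?_) (by fun_prop)
  refine intervalIntegral.continuous_parametric_intervalIntegral_of_continuous' ?_ 0 1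
  simp only [Function.uncurry_def]
  fun_prop

lemma integral_sub_interp {k : ℕ} {ρ : ℝ} (hρ : ρ ≠ 0) (θ : ℝ) {φ : ℝ → ℝ} (hφ : Continuous φ)
    {i : ℕ} (hi : i ≤ k) : ∫ x in θ..θ + i * ρ, (φ x - interp k ρ θ φ x) = 0 := by
  have hc : Continuous fun x => interp k ρ θ φ x :=
    (continuous_interp k ρ hφ).comp (continuous_const.prodMk continuous_id)
  rw [intervalIntegral.integral_sub (hφ.intervalIntegrable _ _) (hc.intervalIntegrable _ _)]
  have hF : ∀ a : ℕ, a * ρ * (∫ v in (0 : ℝ)..1, φ (θ + a * ρ * v)) =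
      ∫ v in θ..θ + a * ρ, φ v := by
    intro a
    simp
  have hi' : i ∈ range (k + 1) := mem_range.2 (by omega)
  have : ∫ x in θ..θ + i * ρ, interp k ρ θ φ x = ∫ v in θ..θ + i * ρ, φ v := by
    unfold interp
    rw [intervalIntegral.integral_finsetSum]
    · simp only [hF, intervalIntegral.integral_const_mul]
      rw [sum_congr rfl fun a ha => by rw [integral_lagd hρ θ ha hi']]
      simp only [mul_sub, sum_sub_distrib, mul_ite, mul_one, mul_zero]
      rw [sum_ite_eq, if_pos hi', sum_ite_eq', if_pos (by simp)]
      simp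
    · intro a _
      refine Continuous.intervalIntegrable ?_ _ _
      fun_prop
  rw [this, sub_self]

lemma lineDiff_sub_interp {k : ℕ} (hk : 1 ≤ k) {ρ : ℝ} (hρ : ρ ≠ 0) (θ t x : ℝ) (φ : ℝ → ℝ) :
    lineDiff k t (fun x => φ x - interp k ρ θ φ x) x = lineDiff k t φ x := by
  rw [lineDiff_sub, sub_eq_self]
  let P : Polynomial ℝ := ∑ a ∈ range (k + 1), Polynomial.C
    (a * ρ * (∫ v in (0 : ℝ)..1, φ (θ + a * ρ * v))) *
      (lagd k ρ a).comp (Polynomial.X - Polynomial.C θ)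
  have hP : (fun x => interp k ρ θ φ x) = fun x => P.eval x := by
    ext x
    simp [interp, P, Polynomial.eval_finsetSum, Polynomial.eval_comp]
  have := lineDiff_polynomial k t P ?_ x
  · rw [← hP] at this; exact this
  · refine lt_of_le_of_lt (Polynomial.natDegree_sum_le_of_forall_le (n := k - 1) _ _ ?_) (by omega)
    intro a ha
    refine (Polynomial.natDegree_C_mul_le _ _).trans (Polynomial.natDegree_comp_le.trans ?_)
    have := lagd_natDegree_lt hk hρ ha
    rw [Polynomial.natDegree_X_sub_C, mul_one]
    omega

lemma primitive_mul_eq {k : ℕ} {ρ θ : ℝ} {ψ : ℝ → ℝ} (hψ : Continuous ψ)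
    (h0 : ∀ i ≤ k, ∫ v in θ..θ + i * ρ, ψ v = 0) (x : ℝ) :
    (∫ v in θ..x, ψ v) * (k.factorial * ρ ^ k) =
      -(∏ i ∈ range (k + 1), (θ - x + i * ρ)) *
        ∫ t in (0 : ℝ)..1, lineDiff k ((1 - t) * ρ) ψ ((1 - t) * θ + t * x) := by
  by_cases hx : ∃ i ≤ k, θ - x + i * ρ = 0
  · obtain ⟨i, hi, hix⟩ := hx
    have e : x = θ + i * ρ := by linarith
    rw [prod_eq_zero (mem_range.2 (by omega : i < k + 1)) hix, e, h0 i hi]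
    simp
  push Not at hx
  have h1 := lineDiff_inv k ρ (θ - x) hx
  have h2 : ∫ t in (0 : ℝ)..1, lineDiff k ((1 - t) * ρ) ψ ((1 - t) * θ + t * x) =
      -(lineDiff k ρ (fun u => u⁻¹) (θ - x) * ∫ v in θ..x, ψ v) := by
    unfold lineDiff
    rw [intervalIntegral.integral_finsetSum, sum_mul, ← sum_neg_distrib]
    · refine sum_congr rfl fun i hi => ?_
      have hi' : i ≤ k := by have := mem_range.1 hi; omega
      have hne := hx i hi'
      rw [intervalIntegral.integral_const_mul]
      have e1 : (θ + i * ρ - x) * ∫ t in (0 : ℝ)..1,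
          ψ ((1 - t) * θ + t * x + i * ((1 - t) * ρ)) = -∫ v in θ..x, ψ v := by
        have h3 := intervalIntegral.smul_integral_comp_add_mul (a := 0) (b := 1) ψ
          (x - (θ + i * ρ)) (θ + i * ρ)
        have h4 : ∀ t : ℝ, (1 - t) * θ + t * x + i * ((1 - t) * ρ) =
            θ + i * ρ + (x - (θ + i * ρ)) * t := fun t => by ring
        simp only [h4]
        rw [smul_eq_mul, mul_zero, add_zero, mul_one, add_sub_cancel] at h3
        have h5 := intervalIntegral.integral_add_adjacent_intervals
          (hψ.intervalIntegrable (μ := volume) θ (θ + i * ρ)) (hψ.intervalIntegrable _ x)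
        rw [h0 i hi', zero_add] at h5
        rw [← h5, ← h3]; ring
      have e2 : ∫ t in (0 : ℝ)..1, ψ ((1 - t) * θ + t * x + i * ((1 - t) * ρ)) =
          -((θ - x + i * ρ)⁻¹ * ∫ v in θ..x, ψ v) := by
        rw [← mul_neg, ← e1, show θ + i * ρ - x = θ - x + i * ρ by ring,
          inv_mul_cancel_left₀ hne]
      rw [e2]; ring
    · intro i _
      refine Continuous.intervalIntegrable ?_ _ _
      fun_prop
  rw [h2, ← h1]
  ring

lemma mul_eq_integral_lineDiff_sub {k : ℕ} {ψ : ℝ → ℝ} (hψ : Continuous ψ) (θ η x : ℝ) :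
    η * ψ x = η * (∫ t in (0 : ℝ)..1, lineDiff k (η * t) ψ x) -
      ∑ l ∈ range k, (-1 : ℝ) ^ (l + 1) * (k.choose (l + 1)) / (l + 1) *
        ((∫ v in θ..x + (l + 1) * η, ψ v) - ∫ v in θ..x, ψ v) := by
  have h1 : ∫ t in (0 : ℝ)..1, lineDiff k (η * t) ψ x =
      ∑ j ∈ range (k + 1), (-1 : ℝ) ^ j * (k.choose j : ℝ) *
        ∫ t in (0 : ℝ)..1, ψ (x + j * (η * t)) := by
    unfold lineDiff
    rw [intervalIntegral.integral_finsetSum]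
    · simp only [intervalIntegral.integral_const_mul]
    · intro i _
      refine Continuous.intervalIntegrable ?_ _ _
      fun_prop
  rw [h1, sum_range_succ', mul_add, mul_sum]
  have h2 : ∀ l ∈ range k, η * ((-1 : ℝ) ^ (l + 1) * (k.choose (l + 1)) *
      ∫ t in (0 : ℝ)..1, ψ (x + ((l + 1 : ℕ) : ℝ) * (η * t))) =
      (-1 : ℝ) ^ (l + 1) * (k.choose (l + 1)) / (l + 1) *
        ((∫ v in θ..x + (l + 1) * η, ψ v) - ∫ v in θ..x, ψ v) := by
    intro l _
    have h3 := intervalIntegral.smul_integral_comp_add_mul (a := 0) (b := 1) ψ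
      (((l : ℝ) + 1) * η) x
    rw [smul_eq_mul, mul_zero, add_zero, mul_one] at h3
    have h5 := intervalIntegral.integral_add_adjacent_intervals
      (hψ.intervalIntegrable (μ := volume) θ x) (hψ.intervalIntegrable _ (x + (l + 1) * η))
    have h4 : ∀ t : ℝ, x + ((l + 1 : ℕ) : ℝ) * (η * t) = x + (l + 1) * η * t := fun t => by
      push_cast; ring
    simp only [h4]
    have hl : (l : ℝ) + 1 ≠ 0 := by positivity
    rw [← h5, add_sub_cancel_left, ← h3]
    field_simp
  rw [sum_congr rfl h2]
  simp

end OneDimensionalDifferences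

section OneDimensionalWhitney

lemma enorm_integral_rpow_le {q : ℝ} (hq : 1 ≤ q) {f : ℝ → ℝ} (hf : Continuous f) :
    ‖∫ t in (0 : ℝ)..1, f t‖ₑ ^ q ≤ ∫⁻ t in Set.Icc (0 : ℝ) 1, ‖f t‖ₑ ^ q := by
  have hq0 : 0 < q := by linarith
  rw [intervalIntegral.integral_of_le zero_le_one, ← integral_Icc_eq_integral_Ioc]
  have : IsProbabilityMeasure (volume.restrict (Set.Icc (0 : ℝ) 1)) := ⟨by simp⟩
  have h1 : eLpNorm f 1 (volume.restrict (Set.Icc (0 : ℝ) 1)) ≤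
      eLpNorm f (ENNReal.ofReal q) (volume.restrict (Set.Icc (0 : ℝ) 1)) :=
    eLpNorm_le_eLpNorm_of_exponent_le (by rw [← ENNReal.ofReal_one]; exact ofReal_le_ofReal hq)
      hf.aestronglyMeasurable
  rw [eLpNorm_one_eq_lintegral_enorm, eLpNorm_eq_lintegral_rpow_enorm_toReal (by simpa using hq0)
    (by simp),
    toReal_ofReal hq0.le] at h1
  calc _ ≤ (∫⁻ t in Set.Icc (0 : ℝ) 1, ‖f t‖ₑ) ^ q := by
        gcongr; exact enorm_integral_le_lintegral_enorm _
    _ ≤ ((∫⁻ t in Set.Icc (0 : ℝ) 1, ‖f t‖ₑ ^ q) ^ (1 / q)) ^ q := by gcongr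
    _ = _ := by rw [← ENNReal.rpow_mul, one_div_mul_cancel hq0.ne', ENNReal.rpow_one]

/-- The `q`-th power of a difference with step `τ * ρ`, where all nodes stay in `[0, 1]`. -/
def stepEnergy (k : ℕ) (ρ q : ℝ) (φ : ℝ → ℝ) (τ x : ℝ) : ℝ≥0∞ :=
  Set.indicator {z : ℝ × ℝ | z.2 ∈ Set.Icc (0 : ℝ) 1 ∧ z.2 + k * (z.1 * ρ) ∈ Set.Icc (0 : ℝ) 1}
    (fun z => ‖lineDiff k (z.1 * ρ) φ z.2‖ₑ ^ q) (τ, x)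

lemma measurable_stepEnergy (k : ℕ) (ρ q : ℝ) {φ : ℝ → ℝ} (hφ : Continuous φ) :
    Measurable (Function.uncurry (stepEnergy k ρ q φ)) := by
  have : Function.uncurry (stepEnergy k ρ q φ) = Set.indicator
      {z : ℝ × ℝ | z.2 ∈ Set.Icc (0 : ℝ) 1 ∧ z.2 + k * (z.1 * ρ) ∈ Set.Icc (0 : ℝ) 1}
      (fun z => ‖lineDiff k (z.1 * ρ) φ z.2‖ₑ ^ q) := rfl
  rw [this]
  refine Measurable.indicator ?_ ?_
  · exact ((continuous_lineDiff hφ (by fun_prop) continuous_snd).enorm.measurable).pow_const q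
  · refine IsClosed.measurableSet (IsClosed.inter ?_ ?_)
    · exact isClosed_Icc.preimage continuous_snd
    · exact isClosed_Icc.preimage (by fun_prop)

lemma stepEnergy_of_mem {k : ℕ} {ρ q : ℝ} {φ : ℝ → ℝ} {τ x : ℝ} (h0 : x ∈ Set.Icc (0 : ℝ) 1)
    (h1 : x + k * (τ * ρ) ∈ Set.Icc (0 : ℝ) 1) :
    stepEnergy k ρ q φ τ x = ‖lineDiff k (τ * ρ) φ x‖ₑ ^ q :=
  Set.indicator_of_mem (s := {z : ℝ × ℝ | z.2 ∈ Set.Icc (0 : ℝ) 1 ∧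
    z.2 + k * (z.1 * ρ) ∈ Set.Icc (0 : ℝ) 1}) (a := (τ, x)) ⟨h0, h1⟩ _

variable {k : ℕ} {ρ q : ℝ} {φ : ℝ → ℝ}

lemma enorm_primitive_rpow_le (hk : 1 ≤ k) (hρ : k * ρ = 1 / 2) (hq : 1 ≤ q) (hφ : Continuous φ)
    {θ x : ℝ} (hθ : θ ∈ Set.Icc (0 : ℝ) (1 / 2)) (hx : x ∈ Set.Icc (0 : ℝ) 1) :
    ‖∫ v in θ..x, (φ v - interp k ρ θ φ v)‖ₑ ^ q ≤
      ENNReal.ofReal ((2 ^ (k + 1) / (k.factorial * ρ ^ k)) ^ q) *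
        ∫⁻ t in Set.Icc (0 : ℝ) 1, stepEnergy k ρ q φ (1 - t) ((1 - t) * θ + t * x) := by
  have hk0 : (0 : ℝ) < k := by exact_mod_cast hk
  have hρ0 : 0 < ρ := by
    by_contra h
    push Not at h
    nlinarith
  have hc : Continuous fun x => φ x - interp k ρ θ φ x :=
    hφ.sub ((continuous_interp k ρ hφ).comp (continuous_const.prodMk continuous_id))
  have h1 := primitive_mul_eq (k := k) (ρ := ρ) hc
    (fun i hi => integral_sub_interp hρ0.ne' θ hφ hi) x
  simp only [lineDiff_sub_interp hk hρ0.ne'] at h1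
  set I := ∫ t in (0 : ℝ)..1, lineDiff k ((1 - t) * ρ) φ ((1 - t) * θ + t * x) with hI
  have h2 : ‖I‖ₑ ^ q ≤
      ∫⁻ t in Set.Icc (0 : ℝ) 1, stepEnergy k ρ q φ (1 - t) ((1 - t) * θ + t * x) := by
    refine (enorm_integral_rpow_le hq
      (continuous_lineDiff hφ (by fun_prop) (by fun_prop))).trans (le_of_eq ?_)
    refine setLIntegral_congr_fun measurableSet_Icc fun t ht => ?_
    obtain ⟨t0, t1⟩ := ht
    have e : (k : ℝ) * ((1 - t) * ρ) = (1 - t) * (1 / 2) := by rw [← hρ]; ring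
    refine (stepEnergy_of_mem ⟨?_, ?_⟩ ⟨?_, ?_⟩).symm <;> (try rw [e]) <;>
      nlinarith [hθ.1, hθ.2, hx.1, hx.2, mul_nonneg (sub_nonneg.2 t1) hθ.1,
        mul_nonneg t0 hx.1, mul_nonneg (sub_nonneg.2 t1) (sub_nonneg.2 hθ.2),
        mul_nonneg t0 (sub_nonneg.2 hx.2)]
  have h3 : |∏ i ∈ range (k + 1), (θ - x + i * ρ)| ≤ 2 ^ (k + 1) := by
    rw [abs_prod]
    calc _ ≤ ∏ i ∈ range (k + 1), (2 : ℝ) := by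
          refine prod_le_prod (fun _ _ => abs_nonneg _) fun i hi => ?_
          have hi' : (i : ℝ) ≤ k := by
            have := mem_range.1 hi; exact_mod_cast Nat.lt_succ_iff.1 this
          have : (i : ℝ) * ρ ≤ 1 / 2 := by rw [← hρ]; gcongr
          have : 0 ≤ (i : ℝ) * ρ := by positivity
          rw [abs_le]
          constructor <;> linarith [hθ.1, hθ.2, hx.1, hx.2]
      _ = _ := by simp
  have hD : 0 < k.factorial * ρ ^ k := by positivity
  have h4 : |∫ v in θ..x, (φ v - interp k ρ θ φ v)| ≤
      2 ^ (k + 1) / (k.factorial * ρ ^ k) * |I| := by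
    rw [div_mul_eq_mul_div, le_div_iff₀ hD]
    have := congrArg abs h1
    rw [abs_mul _ (_ * _), abs_of_pos hD, abs_mul, abs_neg] at this
    rw [this]
    gcongr
  rw [← ENNReal.ofReal_rpow_of_nonneg (by positivity) (by linarith)]
  calc _ ≤ (ENNReal.ofReal (2 ^ (k + 1) / (k.factorial * ρ ^ k)) * ‖I‖ₑ) ^ q := by
        gcongr
        rw [Real.enorm_eq_ofReal_abs, Real.enorm_eq_ofReal_abs, ← ofReal_mul (by positivity)]
        exact ofReal_le_ofReal h4
    _ ≤ _ := by
        rw [ENNReal.mul_rpow_of_nonneg _ _ (by linarith)]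
        gcongr

lemma abs_le_of_eq_sub_sum {k : ℕ} {η A : ℝ} {E : ℕ → ℝ} {y : ℝ} (hη : η ≠ 0)
    (h : η * y = η * A - ∑ l ∈ range k, (-1 : ℝ) ^ (l + 1) * (k.choose (l + 1)) / (l + 1) *
      (E (l + 1) - E 0)) :
    |y| ≤ |A| + 2 ^ k * k / |η| * ∑ l ∈ range (k + 1), |E l| := by
  have hη' : 0 < |η| := abs_pos.2 hη
  set S := ∑ l ∈ range (k + 1), |E l| with hS
  have hES : ∀ l ∈ range k, |(-1 : ℝ) ^ (l + 1) * (k.choose (l + 1)) / (l + 1) *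
      (E (l + 1) - E 0)| ≤ 2 ^ k * S := by
    intro l hl
    rw [abs_mul, abs_div, abs_mul, abs_pow, abs_neg, abs_one, one_pow, one_mul]
    have h1 : |E (l + 1) - E 0| ≤ S := by
      refine (abs_sub _ _).trans ?_
      rw [hS, sum_range_succ', add_comm]
      rw [add_comm]
      gcongr
      exact single_le_sum (f := fun l => |E (l + 1)|) (fun i _ => abs_nonneg _) hl
    have h2 : |(k.choose (l + 1) : ℝ)| / |(l : ℝ) + 1| ≤ 2 ^ k := by
      rw [abs_of_nonneg (by positivity), abs_of_nonneg (by positivity)]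
      refine (div_le_self (by positivity)
        (by linarith [(Nat.cast_nonneg l : (0 : ℝ) ≤ l)])).trans ?_
      exact_mod_cast Nat.choose_le_two_pow k (l + 1)
    gcongr
  have h3 : |η| * |y| ≤ |η| * |A| + k * (2 ^ k * S) := by
    rw [← abs_mul, h]
    refine (abs_sub _ _).trans ?_
    rw [abs_mul]
    gcongr
    refine (abs_sum_le_sum_abs _ _).trans ((sum_le_sum hES).trans ?_)
    simp
  have h4 : |y| ≤ (|η| * |A| + k * (2 ^ k * S)) / |η| := by
    rw [le_div_iff₀ hη']; linarith
  refine h4.trans (le_of_eq ?_)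
  field_simp

lemma enorm_sub_interp_rpow_le (hk : 1 ≤ k) (hρ : k * ρ = 1 / 2) (hq : 1 ≤ q) :
    ∃ C : ℝ, ∀ φ : ℝ → ℝ, Continuous φ → ∀ σ θ x : ℝ, |σ| = 1 → θ ∈ Set.Icc (0 : ℝ) (1 / 2) →
      x ∈ Set.Icc (0 : ℝ) 1 → x + σ / 2 ∈ Set.Icc (0 : ℝ) 1 →
      ‖φ x - interp k ρ θ φ x‖ₑ ^ q ≤ ENNReal.ofReal C *
        ((∫⁻ t in Set.Icc (0 : ℝ) 1, stepEnergy k ρ q φ (σ * t) x) +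
          ∑ l ∈ range (k + 1), ∫⁻ t in Set.Icc (0 : ℝ) 1,
            stepEnergy k ρ q φ (1 - t) ((1 - t) * θ + t * (x + l * (σ * ρ)))) := by
  have hk0 : (0 : ℝ) < k := by exact_mod_cast hk
  have hρ0 : 0 < ρ := by
    by_contra h
    push Not at h
    nlinarith
  have hq0 : 0 ≤ q := by linarith
  set A := (2 ^ (k + 1) / (k.factorial * ρ ^ k)) ^ q with hA
  have hA0 : 0 ≤ A := by positivity
  set B : ℝ := 2 ^ k * k / ρ with hB
  have hB0 : 0 ≤ B := by positivity
  have hconst : ∃ C : ℝ, 2 ^ (q - 1) * max 1 (ENNReal.ofReal (B ^ q) *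
      (((range (k + 1)).card : ℝ≥0∞) ^ (q - 1) * ENNReal.ofReal A)) = ENNReal.ofReal C := by
    refine ⟨_, (ofReal_toReal ?_).symm⟩
    refine mul_ne_top (by simp) (max_lt one_lt_top ?_).ne
    refine mul_lt_top ofReal_lt_top (mul_lt_top (rpow_lt_top_of_nonneg (by linarith) (by simp))
      ofReal_lt_top)
  obtain ⟨C, hC⟩ := hconst
  refine ⟨C, fun φ hφ σ θ x hσ hθ hx hxσ => ?_⟩
  have hσ0 : σ ≠ 0 := by rintro rfl; simp at hσ
  have hc : Continuous fun x => φ x - interp k ρ θ φ x :=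
    hφ.sub ((continuous_interp k ρ hφ).comp (continuous_const.prodMk continuous_id))
  have h1 := mul_eq_integral_lineDiff_sub (k := k) hc θ (σ * ρ) x
  simp only [lineDiff_sub_interp hk hρ0.ne'] at h1
  have h2 := abs_le_of_eq_sub_sum (k := k) (η := σ * ρ) (y := φ x - interp k ρ θ φ x)
    (A := ∫ t in (0 : ℝ)..1, lineDiff k (σ * ρ * t) φ x)
    (E := fun l => ∫ v in θ..x + l * (σ * ρ), (φ v - interp k ρ θ φ v))
    (mul_ne_zero hσ0 hρ0.ne') (by simpa using h1)
  rw [abs_mul, hσ, one_mul, abs_of_pos hρ0] at h2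
  set I := ∫ t in (0 : ℝ)..1, lineDiff k (σ * ρ * t) φ x with hI
  have h3 : ‖I‖ₑ ^ q ≤ ∫⁻ t in Set.Icc (0 : ℝ) 1, stepEnergy k ρ q φ (σ * t) x := by
    refine (enorm_integral_rpow_le hq
      (continuous_lineDiff hφ (by fun_prop) (by fun_prop))).trans (le_of_eq ?_)
    refine setLIntegral_congr_fun measurableSet_Icc fun t ht => ?_
    have e : x + (k : ℝ) * (σ * t * ρ) = (1 - t) * x + t * (x + σ / 2) := by
      linear_combination (σ * t) * hρ
    have ht1 := sub_nonneg.2 ht.2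
    have ht0 := ht.1
    rw [stepEnergy_of_mem hx]
    · rw [mul_right_comm]
    · rw [e]
      exact (convex_Icc (0 : ℝ) 1) hx hxσ ht1 ht0 (by ring)
  have h4 : ∀ l ∈ range (k + 1), ‖∫ v in θ..x + l * (σ * ρ), (φ v - interp k ρ θ φ v)‖ₑ ^ q ≤
      ENNReal.ofReal A * ∫⁻ t in Set.Icc (0 : ℝ) 1,
        stepEnergy k ρ q φ (1 - t) ((1 - t) * θ + t * (x + l * (σ * ρ))) := by
    intro l hl
    refine enorm_primitive_rpow_le hk hρ hq hφ hθ ?_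
    have hl' : (l : ℝ) ≤ k := by
      have := mem_range.1 hl; exact_mod_cast Nat.lt_succ_iff.1 this
    have hlk : (l : ℝ) / k ≤ 1 := (div_le_one hk0).2 hl'
    have e : x + l * (σ * ρ) = (1 - l / k) * x + (l / k) * (x + σ / 2) := by
      field_simp
      linear_combination (2 * l * σ) * hρ
    rw [e]
    exact (convex_Icc (0 : ℝ) 1) hx hxσ (sub_nonneg.2 hlk) (by positivity) (by ring)
  set J := ∑ l ∈ range (k + 1), ∫⁻ t in Set.Icc (0 : ℝ) 1,
    stepEnergy k ρ q φ (1 - t) ((1 - t) * θ + t * (x + l * (σ * ρ))) with hJ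
  have h5 : ‖φ x - interp k ρ θ φ x‖ₑ ≤ ‖I‖ₑ + ENNReal.ofReal B *
      ∑ l ∈ range (k + 1), ‖∫ v in θ..x + l * (σ * ρ), (φ v - interp k ρ θ φ v)‖ₑ := by
    simp only [Real.enorm_eq_ofReal_abs]
    rw [← ofReal_sum_of_nonneg (fun _ _ => abs_nonneg _), ← ofReal_mul hB0,
      ← ofReal_add (abs_nonneg _) (mul_nonneg hB0 (sum_nonneg fun _ _ => abs_nonneg _))]
    exact ofReal_le_ofReal h2
  have h6 : (∑ l ∈ range (k + 1), ‖∫ v in θ..x + l * (σ * ρ), (φ v - interp k ρ θ φ v)‖ₑ) ^ q ≤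
      ((range (k + 1)).card : ℝ≥0∞) ^ (q - 1) * (ENNReal.ofReal A * J) := by
    refine (ENNReal.rpow_sum_le_const_mul_sum_rpow _ _ hq).trans ?_
    refine mul_le_mul' le_rfl ?_
    rw [hJ, mul_sum]
    exact sum_le_sum h4
  calc _ ≤ (‖I‖ₑ + ENNReal.ofReal B * ∑ l ∈ range (k + 1),
          ‖∫ v in θ..x + l * (σ * ρ), (φ v - interp k ρ θ φ v)‖ₑ) ^ q := by gcongr
    _ ≤ 2 ^ (q - 1) * (‖I‖ₑ ^ q + (ENNReal.ofReal B * ∑ l ∈ range (k + 1),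
          ‖∫ v in θ..x + l * (σ * ρ), (φ v - interp k ρ θ φ v)‖ₑ) ^ q) :=
        ENNReal.rpow_add_le_mul_rpow_add_rpow _ _ hq
    _ ≤ 2 ^ (q - 1) * ((∫⁻ t in Set.Icc (0 : ℝ) 1, stepEnergy k ρ q φ (σ * t) x) +
          ENNReal.ofReal (B ^ q) * (((range (k + 1)).card : ℝ≥0∞) ^ (q - 1) *
            (ENNReal.ofReal A * J))) := by
        rw [ENNReal.mul_rpow_of_nonneg _ _ hq0, ENNReal.ofReal_rpow_of_nonneg hB0 hq0]
        gcongr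
    _ ≤ ENNReal.ofReal C *
        ((∫⁻ t in Set.Icc (0 : ℝ) 1, stepEnergy k ρ q φ (σ * t) x) + J) := by
        rw [← hC, mul_assoc, mul_add (max _ _)]
        refine mul_le_mul' le_rfl (add_le_add (le_mul_of_one_le_left' (le_max_left _ _)) ?_)
        rw [← mul_assoc (((range (k + 1)).card : ℝ≥0∞) ^ (q - 1)),
          ← mul_assoc (ENNReal.ofReal (B ^ q))]
        exact mul_le_mul' (le_max_right _ _) le_rfl

lemma lintegral_comp_mul_add {G : ℝ → ℝ≥0∞} (hG : Measurable G) {a : ℝ} (ha : a ≠ 0) (c : ℝ) :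
    ∫⁻ x, G (a * x + c) = ENNReal.ofReal |a⁻¹| * ∫⁻ x, G x := by
  rw [← lintegral_map (f := fun x => G (x + c)) (g := fun x => a * x)
    (hG.comp (measurable_add_const c)) (measurable_const_mul a),
    Real.map_volume_mul_left ha, lintegral_smul_measure, lintegral_add_right_eq_self, smul_eq_mul]

lemma lintegral_lintegral_convex_le {G : ℝ → ℝ≥0∞} (hG : Measurable G) {S T : Set ℝ} (c : ℝ)
    (hS : volume S ≤ 1) (hT : volume T ≤ 1) (t : ℝ) :
    ∫⁻ θ in S, ∫⁻ x in T, G ((1 - t) * θ + t * (x + c)) ≤ 2 * ∫⁻ x, G x := by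
  have h2 : ∀ a : ℝ, 1 / 2 ≤ a → ENNReal.ofReal |a⁻¹| ≤ 2 := by
    intro a ha
    rw [← ENNReal.ofReal_ofNat]
    refine ofReal_le_ofReal ?_
    rw [abs_of_pos (by positivity)]
    exact inv_le_of_inv_le₀ (by norm_num) (by linarith)
  have key : ∀ (U V : Set ℝ) (a : ℝ) (b : ℝ → ℝ), volume U ≤ 1 → 1 / 2 ≤ a →
      ∫⁻ u in U, ∫⁻ v in V, G (a * v + b u) ≤ 2 * ∫⁻ x, G x := by
    intro U V a b hU ha
    calc _ ≤ ∫⁻ _ in U, 2 * ∫⁻ x, G x := by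
          refine lintegral_mono fun u => (setLIntegral_le_lintegral _ _).trans ?_
          rw [lintegral_comp_mul_add hG (by linarith)]
          gcongr
          exact h2 a ha
      _ = 2 * (∫⁻ x, G x) * volume U := by simp
      _ ≤ _ := mul_le_of_le_one_right' hU
  rcases le_total (1 / 2) t with ht | ht
  · refine le_trans (le_of_eq ?_) (key S T t (fun θ => (1 - t) * θ + t * c) hS ht)
    refine lintegral_congr fun θ => lintegral_congr fun x => ?_
    congr 1; ring
  · rw [lintegral_lintegral_swap]
    · refine le_trans (le_of_eq ?_) (key T S (1 - t) (fun x => t * (x + c)) hT (by linarith))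
      rfl
    · refine (hG.comp ?_).aemeasurable
      fun_prop

lemma setLIntegral_comp_one_sub (G : ℝ → ℝ≥0∞) (hG : Measurable G) :
    ∫⁻ t in Set.Icc (0 : ℝ) 1, G (1 - t) = ∫⁻ t in Set.Icc (0 : ℝ) 1, G t := by
  have := (Measure.measurePreserving_sub_left volume (1 : ℝ)).setLIntegral_comp_preimage
    (measurableSet_Icc (a := (0 : ℝ)) (b := 1)) hG
  simpa using this

lemma setLIntegral_comp_neg (G : ℝ → ℝ≥0∞) (hG : Measurable G) :
    ∫⁻ t in Set.Icc (0 : ℝ) 1, G (-t) = ∫⁻ t in Set.Icc (-1 : ℝ) 0, G t := by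
  have := (Measure.measurePreserving_sub_left volume (0 : ℝ)).setLIntegral_comp_preimage
    (measurableSet_Icc (a := (-1 : ℝ)) (b := 0)) hG
  simpa using this

/-- An averaged Whitney inequality in one dimension. -/
lemma lintegral_sub_interp_le (hk : 1 ≤ k) (hρ : k * ρ = 1 / 2) (hq : 1 ≤ q) :
    ∃ C : ℝ, ∀ φ : ℝ → ℝ, Continuous φ →
      ∫⁻ θ in Set.Icc (0 : ℝ) (1 / 2), ∫⁻ x in Set.Icc (0 : ℝ) 1,
        ‖φ x - interp k ρ θ φ x‖ₑ ^ q ≤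
      ENNReal.ofReal C * ∫⁻ τ in Set.Icc (-1 : ℝ) 1, ∫⁻ x, stepEnergy k ρ q φ τ x := by
  obtain ⟨C, hC⟩ := enorm_sub_interp_rpow_le hk hρ hq
  have hconst : ∃ C' : ℝ, ENNReal.ofReal C' =
      2 * (ENNReal.ofReal C * (1 + ∑ l ∈ range (k + 1), 2)) := by
    refine ⟨_, ofReal_toReal ?_⟩
    refine mul_ne_top (by simp) (mul_ne_top (by simp) ?_)
    simp
    exact mul_ne_top (by exact_mod_cast natCast_ne_top (k + 1)) (by simp)
  obtain ⟨C', hC'⟩ := hconst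
  refine ⟨C', fun φ hφ => ?_⟩
  have hH := measurable_stepEnergy k ρ q hφ
  have hH' : ∀ {f g : ℝ × ℝ → ℝ}, Measurable f → Measurable g →
      Measurable fun z => stepEnergy k ρ q φ (f z) (g z) := fun hf hg => hH.comp (hf.prodMk hg)
  set D := ∫⁻ τ in Set.Icc (-1 : ℝ) 1, ∫⁻ x, stepEnergy k ρ q φ τ x with hD
  have hHi : Measurable fun τ => ∫⁻ x, stepEnergy k ρ q φ τ x := hH.lintegral_prod_right'
  have hsig : ∀ σ : ℝ, |σ| = 1 →
      ∫⁻ t in Set.Icc (0 : ℝ) 1, ∫⁻ x, stepEnergy k ρ q φ (σ * t) x ≤ D := by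
    intro σ hσ
    rcases eq_or_eq_neg_of_abs_eq hσ with rfl | rfl
    · simp only [one_mul]
      exact lintegral_mono_set (Set.Icc_subset_Icc (by norm_num) le_rfl)
    · simp only [neg_mul, one_mul]
      rw [setLIntegral_comp_neg _ hHi]
      exact lintegral_mono_set (Set.Icc_subset_Icc le_rfl (by norm_num))
  have half : ∀ (σ : ℝ) (T : Set ℝ), |σ| = 1 → MeasurableSet T → volume T ≤ 1 →
      (∀ x ∈ T, x ∈ Set.Icc (0 : ℝ) 1 ∧ x + σ / 2 ∈ Set.Icc (0 : ℝ) 1) →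
      ∫⁻ θ in Set.Icc (0 : ℝ) (1 / 2), ∫⁻ x in T, ‖φ x - interp k ρ θ φ x‖ₑ ^ q ≤
        ENNReal.ofReal C * (1 + ∑ l ∈ range (k + 1), 2) * D := by
    intro σ T hσ hT hT1 hTm
    have hS1 : volume (Set.Icc (0 : ℝ) (1 / 2)) ≤ 1 := by
      rw [Real.volume_Icc, ← ENNReal.ofReal_one]; exact ofReal_le_ofReal (by norm_num)
    have m1 : Measurable fun x => ∫⁻ t in Set.Icc (0 : ℝ) 1, stepEnergy k ρ q φ (σ * t) x :=
      (hH' (f := fun z => σ * z.2) (g := fun z => z.1) (by fun_prop)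
        (by fun_prop)).lintegral_prod_right'
    have m2 : ∀ l : ℕ, Measurable fun z : (ℝ × ℝ) => ∫⁻ t in Set.Icc (0 : ℝ) 1,
        stepEnergy k ρ q φ (1 - t) ((1 - t) * z.1 + t * (z.2 + l * (σ * ρ))) := by
      intro l
      have : Measurable fun z : (ℝ × ℝ) × ℝ => stepEnergy k ρ q φ (1 - z.2)
          ((1 - z.2) * z.1.1 + z.2 * (z.1.2 + l * (σ * ρ))) :=
        hH.comp ((by fun_prop : Measurable fun z : (ℝ × ℝ) × ℝ => 1 - z.2).prodMk (by fun_prop))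
      exact this.lintegral_prod_right'
    have m2' : ∀ (l : ℕ) (θ : ℝ), Measurable fun x => ∫⁻ t in Set.Icc (0 : ℝ) 1,
        stepEnergy k ρ q φ (1 - t) ((1 - t) * θ + t * (x + l * (σ * ρ))) :=
      fun l θ => (m2 l).comp measurable_prodMk_left
    have b1 : ∫⁻ x in T, ∫⁻ t in Set.Icc (0 : ℝ) 1, stepEnergy k ρ q φ (σ * t) x ≤ D := by
      rw [lintegral_lintegral_swap (hH' (f := fun z => σ * z.2) (g := fun z => z.1)
        (by fun_prop) (by fun_prop)).aemeasurable]
      exact (lintegral_mono fun t => setLIntegral_le_lintegral _ _).trans (hsig σ hσ)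
    have b2 : ∀ l : ℕ, ∫⁻ θ in Set.Icc (0 : ℝ) (1 / 2), ∫⁻ x in T, ∫⁻ t in Set.Icc (0 : ℝ) 1,
        stepEnergy k ρ q φ (1 - t) ((1 - t) * θ + t * (x + l * (σ * ρ))) ≤ 2 * D := by
      intro l
      have e1 : ∀ θ, ∫⁻ x in T, ∫⁻ t in Set.Icc (0 : ℝ) 1,
          stepEnergy k ρ q φ (1 - t) ((1 - t) * θ + t * (x + l * (σ * ρ))) =
          ∫⁻ t in Set.Icc (0 : ℝ) 1, ∫⁻ x in T,
          stepEnergy k ρ q φ (1 - t) ((1 - t) * θ + t * (x + l * (σ * ρ))) := fun θ =>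
        lintegral_lintegral_swap (hH' (f := fun z => 1 - z.2)
          (g := fun z => (1 - z.2) * θ + z.2 * (z.1 + l * (σ * ρ))) (by fun_prop)
          (by fun_prop)).aemeasurable
      simp only [e1]
      have m3 : Measurable fun z : ℝ × ℝ => ∫⁻ x in T,
          stepEnergy k ρ q φ (1 - z.2) ((1 - z.2) * z.1 + z.2 * (x + l * (σ * ρ))) := by
        have : Measurable fun z : (ℝ × ℝ) × ℝ => stepEnergy k ρ q φ (1 - z.1.2)
            ((1 - z.1.2) * z.1.1 + z.1.2 * (z.2 + l * (σ * ρ))) :=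
          hH.comp ((by fun_prop : Measurable fun z : (ℝ × ℝ) × ℝ => 1 - z.1.2).prodMk (by fun_prop))
        exact this.lintegral_prod_right'
      rw [lintegral_lintegral_swap m3.aemeasurable]
      calc _ ≤ ∫⁻ t in Set.Icc (0 : ℝ) 1, 2 * ∫⁻ x, stepEnergy k ρ q φ (1 - t) x := by
            refine lintegral_mono fun t => ?_
            exact lintegral_lintegral_convex_le (hH.comp measurable_prodMk_left) _ hS1 hT1 t
        _ = 2 * ∫⁻ t in Set.Icc (0 : ℝ) 1, ∫⁻ x, stepEnergy k ρ q φ t x := by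
            rw [lintegral_const_mul _ (by exact hHi.comp (f := fun t : ℝ => 1 - t) (by fun_prop)),
              setLIntegral_comp_one_sub _ hHi]
        _ ≤ 2 * D := by
            gcongr
            exact lintegral_mono_set (Set.Icc_subset_Icc (by norm_num) le_rfl)
    calc _ ≤ ∫⁻ θ in Set.Icc (0 : ℝ) (1 / 2), ENNReal.ofReal C *
          ((∫⁻ x in T, ∫⁻ t in Set.Icc (0 : ℝ) 1, stepEnergy k ρ q φ (σ * t) x) +
          ∑ l ∈ range (k + 1), ∫⁻ x in T, ∫⁻ t in Set.Icc (0 : ℝ) 1,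
            stepEnergy k ρ q φ (1 - t) ((1 - t) * θ + t * (x + l * (σ * ρ)))) := by
          refine setLIntegral_mono' measurableSet_Icc fun θ hθ => ?_
          rw [← lintegral_finsetSum _ fun l _ => m2' l θ, ← lintegral_add_left m1,
            ← lintegral_const_mul' _ _ ofReal_ne_top]
          exact setLIntegral_mono' hT fun x hx =>
            hC φ hφ σ θ x hσ hθ (hTm x hx).1 (hTm x hx).2
      _ = ENNReal.ofReal C * ((∫⁻ x in T, ∫⁻ t in Set.Icc (0 : ℝ) 1, stepEnergy k ρ q φ (σ * t) x) *
          volume (Set.Icc (0 : ℝ) (1 / 2)) +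
          ∑ l ∈ range (k + 1), ∫⁻ θ in Set.Icc (0 : ℝ) (1 / 2), ∫⁻ x in T,
            ∫⁻ t in Set.Icc (0 : ℝ) 1,
            stepEnergy k ρ q φ (1 - t) ((1 - t) * θ + t * (x + l * (σ * ρ)))) := by
          have m4 : ∀ l : ℕ, Measurable fun θ => ∫⁻ x in T, ∫⁻ t in Set.Icc (0 : ℝ) 1,
              stepEnergy k ρ q φ (1 - t) ((1 - t) * θ + t * (x + l * (σ * ρ))) :=
            fun l => (m2 l).lintegral_prod_right'
          rw [lintegral_const_mul' _ _ ofReal_ne_top,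
            lintegral_add_left measurable_const, lintegral_finsetSum _ fun l _ => m4 l]
          simp
      _ ≤ ENNReal.ofReal C * (D + ∑ l ∈ range (k + 1), 2 * D) := by
          gcongr with l hl
          · exact (mul_le_of_le_one_right' hS1).trans b1
          · exact b2 l
      _ = _ := by rw [← sum_mul, mul_assoc, add_mul, one_mul]
  have hu : Set.Icc (0 : ℝ) 1 = Set.Icc 0 (1 / 2) ∪ Set.Icc (1 / 2) 1 :=
    (Set.Icc_union_Icc_eq_Icc (by norm_num) (by norm_num)).symm
  have hvol : ∀ a b : ℝ, b - a ≤ 1 → volume (Set.Icc a b) ≤ 1 := by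
    intro a b hab
    rw [Real.volume_Icc, ← ENNReal.ofReal_one]; exact ofReal_le_ofReal hab
  have hm : ∀ T : Set ℝ, Measurable fun θ => ∫⁻ x in T, ‖φ x - interp k ρ θ φ x‖ₑ ^ q := by
    intro T
    have : Measurable fun z : ℝ × ℝ => ‖φ z.2 - interp k ρ z.1 φ z.2‖ₑ ^ q :=
      ((hφ.comp continuous_snd).sub (continuous_interp k ρ hφ)).enorm.measurable.pow_const q
    exact this.lintegral_prod_right'
  calc _ ≤ ∫⁻ θ in Set.Icc (0 : ℝ) (1 / 2),
        ((∫⁻ x in Set.Icc (0 : ℝ) (1 / 2), ‖φ x - interp k ρ θ φ x‖ₑ ^ q) +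
        ∫⁻ x in Set.Icc (1 / 2 : ℝ) 1, ‖φ x - interp k ρ θ φ x‖ₑ ^ q) := by
        refine lintegral_mono fun θ => ?_
        rw [hu]
        exact lintegral_union_le _ _ _
    _ ≤ ENNReal.ofReal C * (1 + ∑ l ∈ range (k + 1), 2) * D +
        ENNReal.ofReal C * (1 + ∑ l ∈ range (k + 1), 2) * D := by
        rw [lintegral_add_left (hm _)]
        gcongr
        · refine half 1 _ (by simp) measurableSet_Icc (hvol _ _ (by norm_num)) fun x hx => ?_
          simp only [Set.mem_Icc] at hx ⊢
          constructor <;> constructor <;> linarith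
        · refine half (-1) _ (by simp) measurableSet_Icc (hvol _ _ (by norm_num)) fun x hx => ?_
          simp only [Set.mem_Icc] at hx ⊢
          constructor <;> constructor <;> linarith
    _ = _ := by rw [hC', mul_assoc 2, two_mul]

end OneDimensionalWhitney

section Whitney

variable {d : ℕ}

lemma volume_restrict_unitCube (d : ℕ) :
    (volume : Measure (Fin d → ℝ)).restrict (unitCube d) =
      Measure.pi fun _ => (volume : Measure ℝ).restrict (Set.Icc 0 1) := by
  rw [unitCube, ← Set.pi_univ_Icc, volume_pi, Measure.restrict_pi_pi]
  rfl

lemma isProbabilityMeasure_Icc :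
    IsProbabilityMeasure ((volume : Measure ℝ).restrict (Set.Icc 0 1)) :=
  ⟨by simp⟩

lemma isProbabilityMeasure_unitCube (d : ℕ) :
    IsProbabilityMeasure ((volume : Measure (Fin d → ℝ)).restrict (unitCube d)) := by
  rw [volume_restrict_unitCube]
  have := isProbabilityMeasure_Icc
  infer_instance

lemma lintegral_unitCube_update {f : (Fin d → ℝ) → ℝ≥0∞} (hf : Measurable f) (i : Fin d) :
    ∫⁻ x in unitCube d, f x =
      ∫⁻ x in unitCube d, ∫⁻ s in Set.Icc (0 : ℝ) 1, f (Function.update x i s) := by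
  have := isProbabilityMeasure_Icc
  rw [volume_restrict_unitCube]
  set μ : Fin d → Measure ℝ := fun _ => (volume : Measure ℝ).restrict (Set.Icc 0 1) with hμ
  have hg : (fun x => ∫⁻ s in Set.Icc (0 : ℝ) 1, f (Function.update x i s)) =
      ∫⋯∫⁻_{i}, f ∂μ := by
    ext x; rw [lmarginal_singleton]
  rw [hg, lintegral_eq_lmarginal_univ 0, lintegral_eq_lmarginal_univ 0,
    ← Finset.insert_erase (mem_univ i), lmarginal_insert' _ hf (notMem_erase i univ),
    lmarginal_insert' _ (hf.lmarginal _) (notMem_erase i univ)]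
  congr 2
  ext x
  rw [lmarginal_singleton]
  simp [hμ]

/-- The interpolation operator acting on the `i`-th variable. -/
def coordInterp (k : ℕ) (ρ : ℝ) (i : Fin d) (θ : ℝ) (φ : (Fin d → ℝ) → ℝ) (x : Fin d → ℝ) : ℝ :=
  interp k ρ θ (fun s => φ (Function.update x i s)) (x i)

lemma continuous_coordInterp (k : ℕ) (ρ : ℝ) (i : Fin d) {φ : (Fin d → ℝ) → ℝ} (hφ : Continuous φ) :
    Continuous fun y : ℝ × (Fin d → ℝ) => coordInterp k ρ i y.1 φ y.2 := by
  unfold coordInterp interp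
  refine continuous_finsetSum _ fun a _ => ?_
  refine Continuous.mul (continuous_const.mul ?_) (by fun_prop)
  refine intervalIntegral.continuous_parametric_intervalIntegral_of_continuous' ?_ 0 1
  simp only [Function.uncurry_def]
  exact hφ.comp ((continuous_snd.comp continuous_fst).update i (by fun_prop))

lemma coordInterp_sub (k : ℕ) (ρ : ℝ) (i : Fin d) (θ : ℝ) {φ ψ : (Fin d → ℝ) → ℝ}
    (hφ : Continuous φ)
    (hψ : Continuous ψ) (x : Fin d → ℝ) :
    coordInterp k ρ i θ (fun x => φ x - ψ x) x =
      coordInterp k ρ i θ φ x - coordInterp k ρ i θ ψ x := by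
  unfold coordInterp interp
  rw [← sum_sub_distrib]
  refine sum_congr rfl fun a _ => ?_
  rw [intervalIntegral.integral_sub]
  · ring
  · exact (hφ.comp (continuous_const.update i (by fun_prop))).intervalIntegrable _ _
  · exact (hψ.comp (continuous_const.update i (by fun_prop))).intervalIntegrable _ _

lemma coordInterp_add (k : ℕ) (ρ : ℝ) (i : Fin d) (θ : ℝ) {φ ψ : (Fin d → ℝ) → ℝ}
    (hφ : Continuous φ)
    (hψ : Continuous ψ) (x : Fin d → ℝ) :
    coordInterp k ρ i θ (fun x => φ x + ψ x) x =
      coordInterp k ρ i θ φ x + coordInterp k ρ i θ ψ x := by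
  unfold coordInterp interp
  rw [← sum_add_distrib]
  refine sum_congr rfl fun a _ => ?_
  rw [intervalIntegral.integral_add]
  · ring
  · exact (hφ.comp (continuous_const.update i (by fun_prop))).intervalIntegrable _ _
  · exact (hψ.comp (continuous_const.update i (by fun_prop))).intervalIntegrable _ _

lemma coordInterp_smul (k : ℕ) (ρ : ℝ) (i : Fin d) (θ c : ℝ) (φ : (Fin d → ℝ) → ℝ) (x : Fin d → ℝ) :
    coordInterp k ρ i θ (fun x => c * φ x) x = c * coordInterp k ρ i θ φ x := by
  unfold coordInterp interp
  rw [mul_sum]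
  refine sum_congr rfl fun a _ => ?_
  rw [intervalIntegral.integral_const_mul]
  ring

/-- Functions which are polynomials of degree less than `k` in each variable from `S`, with
coefficients depending continuously on the other variables. -/
def partialPoly (k : ℕ) (S : Finset (Fin d)) : Submodule ℝ ((Fin d → ℝ) → ℝ) :=
  Submodule.span ℝ {g | ∃ (c : (Fin d → ℝ) → ℝ) (a : Fin d → Fin k), Continuous c ∧
    (∀ x y, (∀ j ∉ S, x j = y j) → c x = c y) ∧ g = fun x => c x * ∏ j ∈ S, x j ^ (a j : ℕ)}

lemma continuous_of_mem_partialPoly {k : ℕ} {S : Finset (Fin d)} {g : (Fin d → ℝ) → ℝ}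
    (hg : g ∈ partialPoly k S) : Continuous g := by
  induction hg using Submodule.span_induction with
  | mem g hg =>
    obtain ⟨c, a, hc, -, rfl⟩ := hg
    fun_prop
  | zero => exact continuous_const
  | add f g _ _ hf hg => exact hf.add hg
  | smul c g _ hg => exact hg.const_smul c

lemma exists_tpoly_of_mem_partialPoly {k : ℕ} {g : (Fin d → ℝ) → ℝ}
    (hg : g ∈ partialPoly k univ) : ∃ P : (Fin d → Fin k) → ℝ, ∀ x, g x = tpoly P x := by
  induction hg using Submodule.span_induction with
  | mem g hg =>
    obtain ⟨c, a, hc, h, rfl⟩ := hg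
    refine ⟨fun b => if b = a then c 0 else 0, fun x => ?_⟩
    simp only [tpoly, ite_mul, zero_mul, sum_ite_eq', mem_univ, if_true]
    rw [h x 0 fun j hj => absurd (mem_univ j) hj]
  | zero => exact ⟨0, fun x => by simp [tpoly]⟩
  | add f g _ _ hf hg =>
    obtain ⟨P, hP⟩ := hf
    obtain ⟨Q, hQ⟩ := hg
    exact ⟨P + Q, fun x => by simp [tpoly, hP, hQ, add_mul, sum_add_distrib]⟩
  | smul c g _ hg =>
    obtain ⟨P, hP⟩ := hg
    exact ⟨c • P, fun x => by simp [tpoly, hP, mul_sum, mul_assoc]⟩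

lemma coordInterp_mem_partialPoly {k : ℕ} (hk : 1 ≤ k) {ρ : ℝ} (hρ : ρ ≠ 0) (θ : ℝ)
    {S : Finset (Fin d)} {i : Fin d} (hi : i ∉ S) {g : (Fin d → ℝ) → ℝ} (hg : g ∈ partialPoly k S) :
    coordInterp k ρ i θ g ∈ partialPoly k (insert i S) := by
  induction hg using Submodule.span_induction with
  | mem g hg =>
    obtain ⟨c, a, hc, h, rfl⟩ := hg
    have e : coordInterp k ρ i θ (fun x => c x * ∏ j ∈ S, x j ^ (a j : ℕ)) =
        ∑ l ∈ range (k + 1), ∑ b : Fin k, fun x =>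
          (l * ρ * (∫ v in (0 : ℝ)..1, c (Function.update x i (θ + l * ρ * v))) *
            (((lagd k ρ l).comp (Polynomial.X - Polynomial.C θ)).coeff b)) *
            ∏ j ∈ insert i S, x j ^ (Function.update a i b j : ℕ) := by
      ext x
      simp only [coordInterp, interp, Finset.sum_apply]
      refine sum_congr rfl fun l hl => ?_
      have h1 : (lagd k ρ l).eval (x i - θ) = ∑ b : Fin k,
          ((lagd k ρ l).comp (Polynomial.X - Polynomial.C θ)).coeff b * x i ^ (b : ℕ) := by
        have : (lagd k ρ l).eval (x i - θ) =
            ((lagd k ρ l).comp (Polynomial.X - Polynomial.C θ)).eval (x i) := by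
          simp [Polynomial.eval_comp]
        rw [this, Polynomial.eval_eq_sum_range' (n := k), sum_range]
        refine lt_of_le_of_lt Polynomial.natDegree_comp_le ?_
        rw [Polynomial.natDegree_X_sub_C, mul_one]
        exact lagd_natDegree_lt hk hρ hl
      have h2 : ∀ s : ℝ, ∏ j ∈ S, Function.update x i s j ^ (a j : ℕ) =
          ∏ j ∈ S, x j ^ (a j : ℕ) := by
        intro s
        refine prod_congr rfl fun j hj => ?_
        rw [Function.update_of_ne (ne_of_mem_of_not_mem hj hi)]
      simp only [h2, intervalIntegral.integral_mul_const]
      rw [h1, mul_sum]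
      refine sum_congr rfl fun b _ => ?_
      rw [prod_insert hi, Function.update_self]
      have h3 : ∏ j ∈ S, x j ^ (Function.update a i b j : ℕ) = ∏ j ∈ S, x j ^ (a j : ℕ) := by
        refine prod_congr rfl fun j hj => ?_
        rw [Function.update_of_ne (ne_of_mem_of_not_mem hj hi)]
      rw [h3]; ring
    rw [e]
    refine Submodule.sum_mem _ fun l _ => Submodule.sum_mem _ fun b _ => Submodule.subset_span ?_
    refine ⟨_, Function.update a i b, ?_, ?_, rfl⟩
    · refine Continuous.mul (continuous_const.mul ?_) continuous_const
      refine intervalIntegral.continuous_parametric_intervalIntegral_of_continuous' ?_ 0 1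
      exact hc.comp (continuous_fst.update i (by fun_prop))
    · intro x y hxy
      congr 3
      ext v
      refine h _ _ fun j hj => ?_
      by_cases hji : j = i
      · subst hji; simp
      · rw [Function.update_of_ne hji, Function.update_of_ne hji]
        exact hxy j (by simp [hji, hj])
  | zero =>
    have : coordInterp k ρ i θ (0 : (Fin d → ℝ) → ℝ) = 0 := by
      ext x; simp [coordInterp, interp]
    rw [this]; exact Submodule.zero_mem _
  | add f g hf' hg' hf hg =>
    have : coordInterp k ρ i θ (f + g) = coordInterp k ρ i θ f + coordInterp k ρ i θ g := by
      ext x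
      exact coordInterp_add k ρ i θ (continuous_of_mem_partialPoly hf')
        (continuous_of_mem_partialPoly hg') x
    rw [this]; exact Submodule.add_mem _ hf hg
  | smul c g _ hg =>
    have : coordInterp k ρ i θ (c • g) = c • coordInterp k ρ i θ g := by
      ext x
      exact coordInterp_smul k ρ i θ c g x
    rw [this]; exact Submodule.smul_mem _ _ hg

lemma enorm_interp_rpow_le {k : ℕ} (hk : 1 ≤ k) {ρ q : ℝ} (hρ : k * ρ = 1 / 2) (hq : 1 ≤ q) :
    ∃ C : ℝ, ∀ φ : ℝ → ℝ, Continuous φ → ∀ θ x : ℝ, θ ∈ Set.Icc (0 : ℝ) (1 / 2) →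
      x ∈ Set.Icc (0 : ℝ) 1 → ‖interp k ρ θ φ x‖ₑ ^ q ≤
        ENNReal.ofReal C * ∫⁻ s in Set.Icc (0 : ℝ) 1, ‖φ s‖ₑ ^ q := by
  have hk0 : (0 : ℝ) < k := by exact_mod_cast hk
  have hρ0 : 0 < ρ := by
    by_contra h
    push Not at h
    nlinarith
  have hq0 : 0 < q := by linarith
  have hterm : ∀ a : ℕ, ∃ K : ℝ≥0∞, K ≠ ⊤ ∧
      (a ∈ range (k + 1) → ∀ φ : ℝ → ℝ, Continuous φ → ∀ θ x : ℝ,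
      θ ∈ Set.Icc (0 : ℝ) (1 / 2) → x ∈ Set.Icc (0 : ℝ) 1 →
      ‖a * ρ * (∫ v in (0 : ℝ)..1, φ (θ + a * ρ * v)) * (lagd k ρ a).eval (x - θ)‖ₑ ^ q ≤
        K * ∫⁻ s in Set.Icc (0 : ℝ) 1, ‖φ s‖ₑ ^ q) := by
    intro a
    obtain ⟨M, hM⟩ := (isCompact_Icc (a := (-1 : ℝ)) (b := 1)).exists_bound_of_continuousOn
      (f := fun u => a * ρ * (lagd k ρ a).eval u) (by fun_prop)
    refine ⟨ENNReal.ofReal M ^ q * ENNReal.ofReal |((a : ℝ) * ρ)⁻¹|, ?_, ?_⟩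
    · exact mul_ne_top (rpow_ne_top_of_nonneg hq0.le ofReal_ne_top) ofReal_ne_top
    intro ha φ hφ θ x hθ hx
    rcases Nat.eq_zero_or_pos a with rfl | ha0
    · simp [hq0]
    have haρ : (a : ℝ) * ρ ≠ 0 := by positivity
    have ha' : (a : ℝ) * ρ ≤ 1 / 2 := by
      rw [← hρ]
      have : (a : ℝ) ≤ k := by
        have := mem_range.1 ha; exact_mod_cast Nat.lt_succ_iff.1 this
      gcongr
    have h1 : ‖∫ v in (0 : ℝ)..1, φ (θ + a * ρ * v)‖ₑ ^ q ≤
        ENNReal.ofReal |((a : ℝ) * ρ)⁻¹| * ∫⁻ s in Set.Icc (0 : ℝ) 1, ‖φ s‖ₑ ^ q := by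
      refine (enorm_integral_rpow_le hq (by fun_prop)).trans ?_
      rw [← lintegral_indicator measurableSet_Icc (f := fun s => ‖φ s‖ₑ ^ q),
        ← lintegral_comp_mul_add _ haρ θ, ← lintegral_indicator measurableSet_Icc]
      · refine lintegral_mono fun v => ?_
        by_cases hv : v ∈ Set.Icc (0 : ℝ) 1
        · have hv' : a * ρ * v + θ ∈ Set.Icc (0 : ℝ) 1 := by
            have h0 : 0 ≤ a * ρ * v := mul_nonneg (by positivity) hv.1
            have h1 : a * ρ * v ≤ 1 / 2 := by
              calc _ ≤ a * ρ * 1 := by gcongr; exact hv.2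
                _ ≤ _ := by linarith
            constructor <;> linarith [hθ.1, hθ.2]
          rw [Set.indicator_of_mem hv, Set.indicator_of_mem hv', add_comm]
        · rw [Set.indicator_of_notMem hv]; exact zero_le
      · exact (hφ.enorm.measurable.pow_const q).indicator measurableSet_Icc
    have h2 : ‖a * ρ * (lagd k ρ a).eval (x - θ)‖ₑ ≤ ENNReal.ofReal M := by
      rw [Real.enorm_eq_ofReal_abs]
      refine ofReal_le_ofReal (hM _ ?_)
      constructor <;> linarith [hθ.1, hθ.2, hx.1, hx.2]
    rw [mul_right_comm, enorm_mul, ENNReal.mul_rpow_of_nonneg _ _ hq0.le,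
      mul_assoc (ENNReal.ofReal M ^ q)]
    exact mul_le_mul' (ENNReal.rpow_le_rpow h2 hq0.le) h1
  choose K hK hK' using hterm
  obtain ⟨C, hC⟩ : ∃ C : ℝ, ENNReal.ofReal C =
      ((range (k + 1)).card : ℝ≥0∞) ^ (q - 1) * ∑ a ∈ range (k + 1), K a := by
    refine ⟨_, ofReal_toReal (mul_ne_top
      (rpow_ne_top_of_nonneg (by linarith) (natCast_ne_top _)) ?_)⟩
    exact (sum_lt_top.2 fun a _ => (hK a).lt_top).ne
  refine ⟨C, fun φ hφ θ x hθ hx => ?_⟩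
  unfold interp
  calc _ ≤ (∑ a ∈ range (k + 1), ‖a * ρ * (∫ v in (0 : ℝ)..1, φ (θ + a * ρ * v)) *
        (lagd k ρ a).eval (x - θ)‖ₑ) ^ q := by
        gcongr; exact enorm_sum_le _ _
    _ ≤ _ := ENNReal.rpow_sum_le_const_mul_sum_rpow _ _ hq
    _ ≤ ((range (k + 1)).card : ℝ≥0∞) ^ (q - 1) *
        ∑ a ∈ range (k + 1), K a * ∫⁻ s in Set.Icc (0 : ℝ) 1, ‖φ s‖ₑ ^ q := by
        refine mul_le_mul' le_rfl (sum_le_sum fun a ha => hK' a ha φ hφ θ x hθ hx)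
    _ = _ := by rw [← sum_mul, hC, mul_assoc]

lemma mem_unitCube {x : Fin d → ℝ} : x ∈ unitCube d ↔ ∀ i, x i ∈ Set.Icc (0 : ℝ) 1 := by
  simp [unitCube, Set.mem_Icc, Pi.le_def, forall_and]

lemma measurableSet_unitCube (d : ℕ) : MeasurableSet (unitCube d) := measurableSet_Icc

lemma continuous_update_left (x : Fin d → ℝ) (i : Fin d) :
    Continuous fun s : ℝ => Function.update x i s :=
  continuous_const.update i continuous_id

lemma lintegral_coordInterp_rpow_le {k : ℕ} (hk : 1 ≤ k) {ρ q : ℝ} (hρ : k * ρ = 1 / 2)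
    (hq : 1 ≤ q) :
    ∃ C : ℝ, ∀ φ : (Fin d → ℝ) → ℝ, Continuous φ →
      ∀ (i : Fin d) (θ : ℝ), θ ∈ Set.Icc (0 : ℝ) (1 / 2) →
      ∫⁻ x in unitCube d, ‖coordInterp k ρ i θ φ x‖ₑ ^ q ≤
        ENNReal.ofReal C * ∫⁻ x in unitCube d, ‖φ x‖ₑ ^ q := by
  obtain ⟨C, hC⟩ := enorm_interp_rpow_le hk hρ hq
  refine ⟨C, fun φ hφ i θ hθ => ?_⟩
  rw [lintegral_unitCube_update (hφ.enorm.measurable.pow_const q) i,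
    ← lintegral_const_mul' _ _ ofReal_ne_top]
  refine setLIntegral_mono' (measurableSet_unitCube d) fun x hx => ?_
  exact hC _ (hφ.comp (continuous_update_left x i)) θ (x i) hθ (mem_unitCube.1 hx i)

lemma kthDiff_single (k : ℕ) (i : Fin d) (t : ℝ) (φ : (Fin d → ℝ) → ℝ) (x : Fin d → ℝ) :
    kthDiff d k (Pi.single i t) φ x = lineDiff k t (fun s => φ (Function.update x i s)) (x i) := by
  unfold kthDiff lineDiff
  refine sum_congr rfl fun j _ => ?_
  congr 2
  ext l
  by_cases h : l = i
  · subst h; simp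
  · simp [h]

lemma continuous_kthDiff (k : ℕ) (h : Fin d → ℝ) {φ : (Fin d → ℝ) → ℝ} (hφ : Continuous φ) :
    Continuous (kthDiff d k h φ) := by
  unfold kthDiff; fun_prop

/-- The part of the `k`-th order smoothness of `φ` that comes from differences with steps
`τ * ρ`, `|τ| ≤ 1`, in the `i`-th coordinate direction. -/
def coordEnergy (k : ℕ) (ρ q : ℝ) (φ : (Fin d → ℝ) → ℝ) (i : Fin d) : ℝ≥0∞ :=
  ∫⁻ τ in Set.Icc (-1 : ℝ) 1,
    ∫⁻ x in {x | x ∈ unitCube d ∧ x + (k : ℝ) • (Pi.single i (τ * ρ) : Fin d → ℝ) ∈ unitCube d},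
      ‖kthDiff d k (Pi.single i (τ * ρ)) φ x‖ₑ ^ q

lemma lintegral_stepEnergy_update (k : ℕ) (ρ q : ℝ) {φ : (Fin d → ℝ) → ℝ} (hφ : Continuous φ)
    (i : Fin d) (τ : ℝ) :
    ∫⁻ x in unitCube d, ∫⁻ s, stepEnergy k ρ q (fun s => φ (Function.update x i s)) τ s =
    ∫⁻ x in {x | x ∈ unitCube d ∧ x + (k : ℝ) • (Pi.single i (τ * ρ) : Fin d → ℝ) ∈ unitCube d},
      ‖kthDiff d k (Pi.single i (τ * ρ)) φ x‖ₑ ^ q := by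
  set S : Set (Fin d → ℝ) := {x | x i ∈ Set.Icc (0 : ℝ) 1 ∧ x i + k * (τ * ρ) ∈ Set.Icc (0 : ℝ) 1}
    with hS
  have hSm : MeasurableSet S := by
    refine IsClosed.measurableSet (IsClosed.inter ?_ ?_)
    · exact isClosed_Icc.preimage (continuous_apply i)
    · exact isClosed_Icc.preimage (by fun_prop)
  set K : (Fin d → ℝ) → ℝ≥0∞ := S.indicator fun x => ‖kthDiff d k (Pi.single i (τ * ρ)) φ x‖ₑ ^ q
    with hK
  have hKm : Measurable K :=
    ((continuous_kthDiff k _ hφ).enorm.measurable.pow_const q).indicator hSm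
  have h1 : ∀ x s, stepEnergy k ρ q (fun s => φ (Function.update x i s)) τ s =
      K (Function.update x i s) := by
    intro x s
    simp only [hK, stepEnergy, Set.indicator, hS, Set.mem_ofPred_eq, Function.update_self,
      kthDiff_single, Function.update_idem]
  have h2 : {x : Fin d → ℝ | x ∈ unitCube d ∧
      x + (k : ℝ) • (Pi.single i (τ * ρ) : Fin d → ℝ) ∈ unitCube d} = S ∩ unitCube d := by
    ext x
    simp only [hS, Set.mem_ofPred_eq, Set.mem_inter_iff, mem_unitCube]
    constructor
    · rintro ⟨hx, hx'⟩
      have := hx' i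
      simp only [Pi.add_apply, Pi.smul_apply, Pi.single_eq_same, smul_eq_mul] at this
      exact ⟨⟨hx i, this⟩, hx⟩
    · rintro ⟨⟨-, h⟩, hx⟩
      refine ⟨hx, fun j => ?_⟩
      by_cases hj : j = i
      · subst hj
        simpa using h
      · simpa [hj] using hx j
  rw [h2, ← Measure.restrict_restrict hSm, ← lintegral_indicator hSm,
    lintegral_unitCube_update hKm i]
  refine lintegral_congr fun x => ?_
  rw [← lintegral_indicator measurableSet_Icc]
  refine lintegral_congr fun s => ?_
  rw [h1]
  by_cases hs : s ∈ Set.Icc (0 : ℝ) 1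
  · rw [Set.indicator_of_mem hs]
  · rw [Set.indicator_of_notMem hs, hK, Set.indicator_of_notMem]
    simp only [hS, Set.mem_ofPred_eq, Function.update_self]
    exact fun h => hs h.1

lemma exists_coordInterp_close {k : ℕ} (hk : 1 ≤ k) {ρ q : ℝ} (hρ : k * ρ = 1 / 2) (hq : 1 ≤ q) :
    ∃ C : ℝ, ∀ φ : (Fin d → ℝ) → ℝ, Continuous φ → ∀ i : Fin d, ∃ θ ∈ Set.Icc (0 : ℝ) (1 / 2),
      ∫⁻ x in unitCube d, ‖φ x - coordInterp k ρ i θ φ x‖ₑ ^ q ≤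
        ENNReal.ofReal C * coordEnergy k ρ q φ i := by
  obtain ⟨C, hC⟩ := lintegral_sub_interp_le hk hρ hq
  obtain ⟨C', hC'⟩ : ∃ C' : ℝ, ENNReal.ofReal C' = 2 * ENNReal.ofReal C :=
    ⟨_, ofReal_toReal (by finiteness)⟩
  refine ⟨C', fun φ hφ i => ?_⟩
  have := isProbabilityMeasure_unitCube d
  have hcont : Continuous fun y : ℝ × (Fin d → ℝ) => φ y.2 - coordInterp k ρ i y.1 φ y.2 :=
    (hφ.comp continuous_snd).sub (continuous_coordInterp k ρ i hφ)
  have hF := hcont.enorm.measurable.pow_const q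
  have hmain : ∫⁻ θ in Set.Icc (0 : ℝ) (1 / 2), ∫⁻ x in unitCube d,
      ‖φ x - coordInterp k ρ i θ φ x‖ₑ ^ q ≤ ENNReal.ofReal C * coordEnergy k ρ q φ i := by
    have e1 : ∀ θ, ∫⁻ x in unitCube d, ‖φ x - coordInterp k ρ i θ φ x‖ₑ ^ q =
        ∫⁻ x in unitCube d, ∫⁻ s in Set.Icc (0 : ℝ) 1, ‖φ (Function.update x i s) -
          interp k ρ θ (fun s => φ (Function.update x i s)) s‖ₑ ^ q := by
      intro θ
      rw [lintegral_unitCube_update (f := fun x => ‖φ x - coordInterp k ρ i θ φ x‖ₑ ^ q)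
        (by exact hF.comp measurable_prodMk_left) i]
      simp [coordInterp]
    have hm : Measurable fun z : (ℝ × (Fin d → ℝ)) × ℝ => ‖φ (Function.update z.1.2 i z.2) -
          interp k ρ z.1.1 (fun s => φ (Function.update z.1.2 i s)) z.2‖ₑ ^ q := by
      have e : (fun z : (ℝ × (Fin d → ℝ)) × ℝ => ‖φ (Function.update z.1.2 i z.2) -
          interp k ρ z.1.1 (fun s => φ (Function.update z.1.2 i s)) z.2‖ₑ ^ q) =
          (fun y : ℝ × (Fin d → ℝ) => ‖φ y.2 - coordInterp k ρ i y.1 φ y.2‖ₑ ^ q) ∘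
          fun z : (ℝ × (Fin d → ℝ)) × ℝ => (z.1.1, Function.update z.1.2 i z.2) := by
        ext z; simp [coordInterp]
      rw [e]
      refine hF.comp (Continuous.measurable ?_)
      exact (continuous_fst.comp continuous_fst).prodMk
        ((continuous_snd.comp continuous_fst).update i continuous_snd)
    simp only [e1]
    rw [lintegral_lintegral_swap hm.lintegral_prod_right'.aemeasurable]
    calc _ ≤ ∫⁻ x in unitCube d, ENNReal.ofReal C * ∫⁻ τ in Set.Icc (-1 : ℝ) 1,
          ∫⁻ s, stepEnergy k ρ q (fun s => φ (Function.update x i s)) τ s :=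
        lintegral_mono fun x => hC _ (hφ.comp (continuous_update_left x i))
      _ = _ := by
        rw [lintegral_const_mul' _ _ ofReal_ne_top, lintegral_lintegral_swap, coordEnergy]
        · simp only [lintegral_stepEnergy_update k ρ q hφ i]
        · have : Measurable fun z : ((Fin d → ℝ) × ℝ) × ℝ =>
              stepEnergy k ρ q (fun s => φ (Function.update z.1.1 i s)) z.1.2 z.2 := by
            refine Measurable.indicator (f := fun z : ((Fin d → ℝ) × ℝ) × ℝ =>
              ‖lineDiff k (z.1.2 * ρ) (fun s => φ (Function.update z.1.1 i s)) z.2‖ₑ ^ q)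
              (s := {z | z.2 ∈ Set.Icc (0 : ℝ) 1 ∧ z.2 + k * (z.1.2 * ρ) ∈ Set.Icc (0 : ℝ) 1}) ?_ ?_
            · refine (Continuous.enorm ?_).measurable.pow_const q
              unfold lineDiff
              refine continuous_finsetSum _ fun j _ => continuous_const.mul (hφ.comp ?_)
              exact (continuous_fst.comp continuous_fst).update i (by fun_prop)
            · refine IsClosed.measurableSet (IsClosed.inter ?_ ?_)
              · exact isClosed_Icc.preimage continuous_snd
              · exact isClosed_Icc.preimage (by fun_prop)
          exact this.lintegral_prod_right'.aemeasurable
  have hv : volume (Set.Icc (0 : ℝ) (1 / 2)) = 2⁻¹ := by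
    rw [Real.volume_Icc, sub_zero, one_div, ENNReal.ofReal_inv_of_pos (by norm_num)]
    simp
  have hFm : Measurable fun θ => ∫⁻ x in unitCube d, ‖φ x - coordInterp k ρ i θ φ x‖ₑ ^ q :=
    hF.lintegral_prod_right'
  obtain ⟨θ, hθ, h⟩ := exists_le_setLAverage (μ := volume) (s := Set.Icc (0 : ℝ) (1 / 2))
    (by rw [hv]; simp) (by rw [hv]; simp) hFm.aemeasurable
  refine ⟨θ, hθ, h.trans ?_⟩
  rw [setLAverage_eq, hv, ENNReal.div_eq_inv_mul, inv_inv, hC', mul_assoc]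
  gcongr

/-- A Whitney inequality on the unit cube. -/
lemma exists_tpoly_close (d : ℕ) {k : ℕ} (hk : 1 ≤ k) {ρ q : ℝ} (hρ : k * ρ = 1 / 2) (hq : 1 ≤ q) :
    ∃ C : ℝ, ∀ φ : (Fin d → ℝ) → ℝ, Continuous φ → ∃ P : (Fin d → Fin k) → ℝ,
      ∫⁻ x in unitCube d, ‖φ x - tpoly P x‖ₑ ^ q ≤
        ENNReal.ofReal C * ∑ i, coordEnergy k ρ q φ i := by
  have hρ0 : ρ ≠ 0 := by rintro rfl; norm_num at hρ
  have hq0 : 0 ≤ q := by linarith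
  obtain ⟨C₁, hC₁⟩ := exists_coordInterp_close (d := d) hk hρ hq
  obtain ⟨C₂, hC₂⟩ := lintegral_coordInterp_rpow_le (d := d) hk hρ hq
  have key : ∀ S : Finset (Fin d), ∃ C : ℝ, ∀ φ : (Fin d → ℝ) → ℝ, Continuous φ →
      ∃ g ∈ partialPoly k S, ∫⁻ x in unitCube d, ‖φ x - g x‖ₑ ^ q ≤
        ENNReal.ofReal C * ∑ i, coordEnergy k ρ q φ i := by
    intro S
    induction S using Finset.induction_on with
    | empty =>
      refine ⟨0, fun φ hφ => ⟨φ, Submodule.subset_span ⟨φ, fun _ => ⟨0, hk⟩, hφ, ?_, ?_⟩, ?_⟩⟩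
      · intro x y h
        rw [show x = y from funext fun j => h j (notMem_empty j)]
      · simp
      · simp [show 0 < q by linarith]
    | insert i S hi ih =>
      obtain ⟨C, hC⟩ := ih
      obtain ⟨C', hC'⟩ : ∃ C' : ℝ, ENNReal.ofReal C' = 2 ^ (q - 1) * (ENNReal.ofReal C₁ +
          ENNReal.ofReal C₂ * ENNReal.ofReal C) :=
        ⟨_, ofReal_toReal (mul_ne_top (rpow_ne_top_of_nonneg (by linarith) (by simp))
          (by finiteness))⟩
      refine ⟨C', fun φ hφ => ?_⟩
      obtain ⟨g, hg, hgC⟩ := hC φ hφ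
      have hgc := continuous_of_mem_partialPoly hg
      obtain ⟨θ, hθ, hθC⟩ := hC₁ φ hφ i
      refine ⟨_, coordInterp_mem_partialPoly hk hρ0 θ hi hg, ?_⟩
      have h1 : ∀ x, ‖φ x - coordInterp k ρ i θ g x‖ₑ ^ q ≤ 2 ^ (q - 1) *
          (‖φ x - coordInterp k ρ i θ φ x‖ₑ ^ q +
            ‖coordInterp k ρ i θ (fun x => φ x - g x) x‖ₑ ^ q) := by
        intro x
        refine le_trans ?_ (ENNReal.rpow_add_le_mul_rpow_add_rpow _ _ hq)
        rw [coordInterp_sub k ρ i θ hφ hgc]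
        gcongr
        rw [show φ x - coordInterp k ρ i θ g x = (φ x - coordInterp k ρ i θ φ x) +
          (coordInterp k ρ i θ φ x - coordInterp k ρ i θ g x) by ring]
        exact enorm_add_le _ _
      have hTc : ∀ {ψ : (Fin d → ℝ) → ℝ}, Continuous ψ → Continuous (coordInterp k ρ i θ ψ) :=
        fun hψ => (continuous_coordInterp k ρ i hψ).comp (continuous_const.prodMk continuous_id)
      calc _ ≤ ∫⁻ x in unitCube d, 2 ^ (q - 1) * (‖φ x - coordInterp k ρ i θ φ x‖ₑ ^ q +
            ‖coordInterp k ρ i θ (fun x => φ x - g x) x‖ₑ ^ q) := lintegral_mono h1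
        _ = 2 ^ (q - 1) * ((∫⁻ x in unitCube d, ‖φ x - coordInterp k ρ i θ φ x‖ₑ ^ q) +
            ∫⁻ x in unitCube d, ‖coordInterp k ρ i θ (fun x => φ x - g x) x‖ₑ ^ q) := by
          rw [lintegral_const_mul' _ _ (rpow_ne_top_of_nonneg (by linarith) (by simp)),
            lintegral_add_left (f := fun x => ‖φ x - coordInterp k ρ i θ φ x‖ₑ ^ q)
              (by exact (hφ.sub (hTc hφ)).enorm.measurable.pow_const q)]
        _ ≤ 2 ^ (q - 1) * (ENNReal.ofReal C₁ * (∑ i, coordEnergy k ρ q φ i) +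
            ENNReal.ofReal C₂ * (ENNReal.ofReal C * ∑ i, coordEnergy k ρ q φ i)) := by
          gcongr
          · refine hθC.trans ?_
            gcongr
            exact single_le_sum (f := fun i => coordEnergy k ρ q φ i) (fun _ _ => zero_le)
              (mem_univ i)
          · exact (hC₂ _ (hφ.sub hgc) i θ hθ).trans (mul_le_mul' le_rfl hgC)
        _ = _ := by rw [hC']; ring
  obtain ⟨C, hC⟩ := key univ
  refine ⟨C, fun φ hφ => ?_⟩
  obtain ⟨g, hg, hgC⟩ := hC φ hφ
  obtain ⟨P, hP⟩ := exists_tpoly_of_mem_partialPoly hg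
  refine ⟨P, ?_⟩
  simpa only [hP] using hgC

end Whitney

section Tiling

variable {d : ℕ}

lemma lintegral_comp_smul_sub {c : ℝ} (hc : 0 < c) (v : Fin d → ℝ) (F : (Fin d → ℝ) → ℝ≥0∞) :
    ENNReal.ofReal (c ^ d) * ∫⁻ x, F (c • x - v) = ∫⁻ y, F y := by
  have h1 : ∫⁻ x, F (c • x - v) =
      ENNReal.ofReal (c ^ d)⁻¹ * ∫⁻ y, F (y - v) := by
    have e := lintegral_map_equiv (μ := (volume : Measure (Fin d → ℝ))) (fun y => F (y - v))
      (Homeomorph.smulOfNeZero c hc.ne').toMeasurableEquiv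
    have e2 : Measure.map (Homeomorph.smulOfNeZero c hc.ne').toMeasurableEquiv
        (volume : Measure (Fin d → ℝ)) = ENNReal.ofReal (c ^ d)⁻¹ • volume := by
      have := Measure.map_addHaar_smul (volume : Measure (Fin d → ℝ)) hc.ne'
      rw [Module.finrank_fin_fun, abs_of_pos (by positivity)] at this
      exact this
    rw [e2, lintegral_smul_measure] at e
    exact e.symm
  rw [h1, lintegral_sub_right_eq_self, ← mul_assoc, ← ofReal_mul (by positivity),
    mul_inv_cancel₀ (by positivity), ofReal_one, one_mul]

lemma ae_unitCube_mem_Ico (d : ℕ) :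
    ∀ᵐ x ∂(volume : Measure (Fin d → ℝ)).restrict (unitCube d), ∀ i, 0 ≤ x i ∧ x i < 1 := by
  have h : (Set.univ.pi fun _ : Fin d => Set.Ico (0 : ℝ) 1) =ᵐ[volume] unitCube d :=
    Measure.univ_pi_Ico_ae_eq_Icc (f := fun _ : Fin d => (0 : ℝ)) (g := fun _ => 1)
  rw [← Measure.restrict_congr_set h]
  filter_upwards [ae_restrict_mem (MeasurableSet.univ_pi fun _ => measurableSet_Ico)] with x hx i
  exact hx i trivial

lemma lintegral_unitCube_eq (F : (Fin d → ℝ) → ℝ≥0∞) :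
    ∫⁻ x in unitCube d, F x = ∫⁻ x in Set.univ.pi fun _ : Fin d => Set.Ico (0 : ℝ) 1, F x := by
  have h : (Set.univ.pi fun _ : Fin d => Set.Ico (0 : ℝ) 1) =ᵐ[volume] unitCube d :=
    Measure.univ_pi_Ico_ae_eq_Icc (f := fun _ : Fin d => (0 : ℝ)) (g := fun _ => 1)
  rw [Measure.restrict_congr_set h]

lemma localAt_lt_one {b : ℕ} (j : ℕ) (x : Fin d → ℝ) (i : Fin d) : localAt b j x i < 1 := by
  have := Nat.lt_floor_add_one ((b : ℝ) ^ j * x i)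
  unfold localAt cellAt cidx
  push_cast
  linarith

/-- Integration over the unit cube in the coordinates of the cells of level `j`. -/
lemma lintegral_cells {b : ℕ} (hb : 0 < b) (j : ℕ) (H : (Fin d → ℕ) → (Fin d → ℝ) → ℝ≥0∞) :
    ENNReal.ofReal (((b : ℝ) ^ j) ^ d) * ∫⁻ x in unitCube d, H (cellAt b j x) (localAt b j x) =
      ∑ n ∈ cells d b j, ∫⁻ y in unitCube d, H n y := by
  have hc : (0 : ℝ) < (b : ℝ) ^ j := by positivity
  set Q : Set (Fin d → ℝ) := Set.univ.pi fun _ : Fin d => Set.Ico (0 : ℝ) 1 with hQ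
  have hQm : MeasurableSet Q := MeasurableSet.univ_pi fun _ => measurableSet_Ico
  set B : (Fin d → ℕ) → Set (Fin d → ℝ) := fun n =>
    (fun x => (b : ℝ) ^ j • x - (fun i => (n i : ℝ))) ⁻¹' Q with hB
  have hBm : ∀ n, MeasurableSet (B n) := fun n =>
    (show Measurable fun x : Fin d → ℝ => (b : ℝ) ^ j • x - (fun i => (n i : ℝ)) by fun_prop) hQm
  have hcell : ∀ n x, x ∈ B n → cellAt b j x = n := by
    intro n x hx
    ext i
    have := hx i trivial
    simp only [Pi.sub_apply, Pi.smul_apply, smul_eq_mul, Set.mem_Ico] at this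
    unfold cellAt cidx
    push_cast
    rw [Nat.floor_eq_iff (by linarith [this.1, (n i).cast_nonneg (α := ℝ)])]
    constructor <;> linarith [this.1, this.2]
  have hun : Q = ⋃ n ∈ cells d b j, B n := by
    ext x
    simp only [Set.mem_iUnion, exists_prop]
    constructor
    · intro hx
      refine ⟨cellAt b j x, cellAt_mem hb j (fun i => (hx i trivial).1)
        (fun i => (hx i trivial).2), fun i _ => ⟨?_, ?_⟩⟩
      · exact localAt_nonneg j (fun i => (hx i trivial).1) i
      · exact localAt_lt_one j x i
    · rintro ⟨n, hn, hx⟩ i -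
      have h := hx i trivial
      simp only [Pi.sub_apply, Pi.smul_apply, smul_eq_mul, Set.mem_Ico] at h
      have hn' : (n i : ℝ) + 1 ≤ (b : ℝ) ^ j := by exact_mod_cast mem_cells.1 hn i
      have h0 : (0 : ℝ) ≤ n i := Nat.cast_nonneg _
      constructor
      · by_contra hneg
        push Not at hneg
        nlinarith
      · by_contra hneg
        push Not at hneg
        nlinarith
  rw [lintegral_unitCube_eq, ← hQ, hun, lintegral_biUnion_finset _ fun n _ => hBm n]
  · rw [mul_sum]
    refine sum_congr rfl fun n hn => ?_
    rw [setLIntegral_congr_fun (g := fun x => H n ((b : ℝ) ^ j • x - (fun i => (n i : ℝ)))) (hBm n),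
      ← lintegral_indicator (hBm n), lintegral_unitCube_eq, ← lintegral_indicator hQm,
      ← lintegral_comp_smul_sub hc (fun i => (n i : ℝ)) (Q.indicator (H n))]
    · rfl
    · intro x hx
      show H _ _ = _
      have := hcell n x hx
      rw [this]
      congr 1
      ext i
      simp [localAt, this]
  · intro n _ m _ hnm
    exact Set.disjoint_left.2 fun x hx hx' => hnm ((hcell n x hx).symm.trans (hcell m x hx'))

lemma eq_of_cellAt_localAt {b : ℕ} (hb : 0 < b) (j : ℕ) (x : Fin d → ℝ) :
    (fun i => (localAt b j x i + cellAt b j x i) / (b : ℝ) ^ j) = x := by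
  ext i
  have : (0 : ℝ) < (b : ℝ) ^ j := by positivity
  unfold localAt
  field_simp
  ring

lemma measurable_cellAt (b j : ℕ) : Measurable (cellAt b j : (Fin d → ℝ) → Fin d → ℕ) := by
  refine measurable_pi_lambda _ fun i => ?_
  unfold cellAt cidx
  exact Nat.measurable_floor.comp (by fun_prop)

lemma measurable_piecewise_tpoly {k : ℕ} (b j : ℕ) (P : (Fin d → ℕ) → (Fin d → Fin k) → ℝ) :
    Measurable fun x : Fin d → ℝ => tpoly (P (cellAt b j x)) (localAt b j x) := by
  unfold tpoly
  refine Finset.measurable_fun_sum _ fun a _ => Measurable.mul ?_ ?_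
  · exact (Measurable.of_discrete (f := fun n => P n a)).comp (measurable_cellAt b j)
  · refine Finset.measurable_fun_prod _ fun i _ => Measurable.pow_const ?_ _
    unfold localAt
    refine Measurable.sub (by fun_prop) ?_
    exact (Measurable.of_discrete (f := fun n : Fin d → ℕ => (n i : ℝ))).comp
      (measurable_cellAt b j)

lemma sum_lintegral_le_lintegral_sum {α ι : Type*} [MeasurableSpace α] (μ : Measure α)
    (s : Finset ι) (f : ι → α → ℝ≥0∞) :
    ∑ i ∈ s, ∫⁻ x, f i x ∂μ ≤ ∫⁻ x, ∑ i ∈ s, f i x ∂μ := by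
  classical
  induction s using Finset.induction_on with
  | empty => simp
  | insert i s hi ih =>
    simp only [sum_insert hi]
    exact (add_le_add le_rfl ih).trans (le_lintegral_add _ _)

/-- Rescaling of a function on the unit cube to the cell `n` of the grid with `c` cells per
direction. -/
def onCell (c : ℝ) (n : Fin d → ℕ) (φ : (Fin d → ℝ) → ℝ) (y : Fin d → ℝ) : ℝ :=
  φ fun i => (y i + n i) / c

lemma kthDiff_onCell (k : ℕ) (c : ℝ) (n : Fin d → ℕ) (h : Fin d → ℝ) (φ : (Fin d → ℝ) → ℝ)
    (y : Fin d → ℝ) :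
    kthDiff d k h (onCell c n φ) y = onCell c n (kthDiff d k (c⁻¹ • h) φ) y := by
  unfold kthDiff onCell
  refine sum_congr rfl fun j _ => ?_
  congr 2
  ext i
  simp only [Pi.add_apply, Pi.smul_apply, smul_eq_mul]
  ring

lemma sum_lintegral_kthDiff_onCell_le {b : ℕ} (hb : 0 < b) (j k : ℕ) (q : ℝ) (h : Fin d → ℝ)
    (φ : (Fin d → ℝ) → ℝ) :
    ∑ n ∈ cells d b j, ∫⁻ y in {y | y ∈ unitCube d ∧ y + (k : ℝ) • h ∈ unitCube d},
      ‖kthDiff d k h (onCell ((b : ℝ) ^ j) n φ) y‖ₑ ^ q ≤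
    ENNReal.ofReal (((b : ℝ) ^ j) ^ d) *
      ∫⁻ x in {x | x ∈ unitCube d ∧ x + (k : ℝ) • (((b : ℝ) ^ j)⁻¹ • h) ∈ unitCube d},
        ‖kthDiff d k (((b : ℝ) ^ j)⁻¹ • h) φ x‖ₑ ^ q := by
  have hc : (0 : ℝ) < (b : ℝ) ^ j := by positivity
  have hS : ∀ v : Fin d → ℝ, MeasurableSet {y : Fin d → ℝ | y + v ∈ unitCube d} := fun v =>
    (measurableSet_unitCube d).preimage (by fun_prop)
  have hinter : ∀ (v : Fin d → ℝ) (F : (Fin d → ℝ) → ℝ≥0∞),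
      ∫⁻ y in {y | y ∈ unitCube d ∧ y + v ∈ unitCube d}, F y =
      ∫⁻ y in unitCube d, {y : Fin d → ℝ | y + v ∈ unitCube d}.indicator F y := by
    intro v F
    rw [lintegral_indicator (hS v), Measure.restrict_restrict (hS v), Set.inter_comm]
    rfl
  simp only [hinter, kthDiff_onCell]
  rw [← lintegral_cells hb j (fun n y => {y : Fin d → ℝ | y + (k : ℝ) • h ∈ unitCube d}.indicator
    (fun y => ‖onCell ((b : ℝ) ^ j) n (kthDiff d k (((b : ℝ) ^ j)⁻¹ • h) φ) y‖ₑ ^ q) y)]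
  refine mul_le_mul' le_rfl (lintegral_mono_ae ?_)
  filter_upwards [ae_unitCube_mem_Ico d] with x hx
  by_cases hy : localAt b j x + (k : ℝ) • h ∈ unitCube d
  · have hy' : x + (k : ℝ) • (((b : ℝ) ^ j)⁻¹ • h) ∈ unitCube d := by
      rw [mem_unitCube] at hy ⊢
      intro i
      have h1 := hy i
      have hn := mem_cells.1 (cellAt_mem hb j (fun i => (hx i).1) (fun i => (hx i).2)) i
      have hn' : (cellAt b j x i : ℝ) + 1 ≤ (b : ℝ) ^ j := by exact_mod_cast hn
      have hn0 : (0 : ℝ) ≤ cellAt b j x i := Nat.cast_nonneg _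
      have e : (x + (k : ℝ) • (((b : ℝ) ^ j)⁻¹ • h)) i =
          ((localAt b j x + (k : ℝ) • h) i + cellAt b j x i) / (b : ℝ) ^ j := by
        conv_lhs => rw [← eq_of_cellAt_localAt hb j x]
        simp only [Pi.add_apply, Pi.smul_apply, smul_eq_mul]
        ring
      rw [e]
      constructor
      · exact div_nonneg (add_nonneg h1.1 hn0) hc.le
      · rw [div_le_one hc]; linarith [h1.2]
    rw [Set.indicator_of_mem (by exact hy), Set.indicator_of_mem (by exact hy')]
    unfold onCell
    rw [eq_of_cellAt_localAt hb j x]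
  · rw [Set.indicator_of_notMem (by exact hy)]
    exact zero_le

lemma sum_coordEnergy_onCell_le {b : ℕ} (hb : 0 < b) (j k : ℕ) (q : ℝ) {ρ : ℝ} (hρ : |ρ| < 1)
    (φ : (Fin d → ℝ) → ℝ) (i : Fin d) (M : ℝ≥0∞)
    (hM : ∀ h : Fin d → ℝ, √(∑ i, h i ^ 2) < ((b : ℝ) ^ j)⁻¹ →
      ∫⁻ x in {x | x ∈ unitCube d ∧ x + (k : ℝ) • h ∈ unitCube d}, ‖kthDiff d k h φ x‖ₑ ^ q ≤ M) :
    ∑ n ∈ cells d b j, coordEnergy k ρ q (onCell ((b : ℝ) ^ j) n φ) i ≤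
      ENNReal.ofReal (((b : ℝ) ^ j) ^ d) * (2 * M) := by
  have hc : (0 : ℝ) < (b : ℝ) ^ j := by positivity
  unfold coordEnergy
  refine (sum_lintegral_le_lintegral_sum _ _ _).trans ?_
  have h1 : ∀ τ ∈ Set.Icc (-1 : ℝ) 1, ∑ n ∈ cells d b j,
      ∫⁻ x in {x | x ∈ unitCube d ∧ x + (k : ℝ) • (Pi.single i (τ * ρ) : Fin d → ℝ) ∈ unitCube d},
        ‖kthDiff d k (Pi.single i (τ * ρ)) (onCell ((b : ℝ) ^ j) n φ) x‖ₑ ^ q ≤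
      ENNReal.ofReal (((b : ℝ) ^ j) ^ d) * M := by
    intro τ hτ
    refine (sum_lintegral_kthDiff_onCell_le hb j k q _ φ).trans (mul_le_mul' le_rfl (hM _ ?_))
    rw [← Pi.single_smul', Fintype.sum_eq_single i]
    · rw [Pi.single_eq_same, Real.sqrt_sq_eq_abs, smul_eq_mul, abs_mul, abs_mul,
        abs_of_pos (inv_pos.2 hc)]
      have : |τ| ≤ 1 := abs_le.2 hτ
      have h2 : |τ| * |ρ| < 1 := lt_of_le_of_lt (mul_le_of_le_one_left (abs_nonneg _) this) hρ
      exact mul_lt_of_lt_one_right (inv_pos.2 hc) h2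
    · intro l hl
      simp [hl]
  refine (setLIntegral_mono' measurableSet_Icc h1).trans ?_
  rw [setLIntegral_const, Real.volume_Icc]
  norm_num
  rw [mul_assoc, mul_comm M]

end Tiling

section LocalApprox

variable {d : ℕ}

lemma eLpNorm_comp_add_le {q : ℝ≥0∞} {ψ : (Fin d → ℝ) → ℝ} (hψ : Measurable ψ) (v : Fin d → ℝ)
    (S : Set (Fin d → ℝ)) (hS : ∀ x ∈ S, x + v ∈ unitCube d) :
    eLpNorm (fun x => ψ (x + v)) q (volume.restrict S) ≤
      eLpNorm ψ q (volume.restrict (unitCube d)) := by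
  have h := (measurePreserving_add_right (volume : Measure (Fin d → ℝ)) v).restrict_preimage
    (measurableSet_unitCube d)
  refine (eLpNorm_mono_measure _ (Measure.restrict_mono hS le_rfl)).trans ?_
  exact (eLpNorm_comp_measurePreserving hψ.aestronglyMeasurable h).le

lemma add_smul_mem_unitCube {k j : ℕ} (hj : j ≤ k) {x h : Fin d → ℝ} (hx : x ∈ unitCube d)
    (hx' : x + (k : ℝ) • h ∈ unitCube d) : x + (j : ℝ) • h ∈ unitCube d := by
  rw [mem_unitCube] at *
  intro i
  have h1 := hx i
  have h2 := hx' i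
  simp only [Pi.add_apply, Pi.smul_apply, smul_eq_mul, Set.mem_Icc] at h1 h2 ⊢
  have hj' : (j : ℝ) ≤ k := by exact_mod_cast hj
  have hj0 : (0 : ℝ) ≤ j := j.cast_nonneg
  constructor
  · rcases le_total 0 (h i) with hh | hh <;> nlinarith
  · rcases le_total 0 (h i) with hh | hh <;> nlinarith

lemma eLpNorm_kthDiff_le {q : ℝ≥0∞} (hq : 1 ≤ q) (k : ℕ) (h : Fin d → ℝ) {ψ : (Fin d → ℝ) → ℝ}
    (hψ : Measurable ψ) :
    eLpNorm (kthDiff d k h ψ) q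
      (volume.restrict {x | x ∈ unitCube d ∧ x + (k : ℝ) • h ∈ unitCube d}) ≤
      2 ^ k * eLpNorm ψ q (volume.restrict (unitCube d)) := by
  have e : kthDiff d k h ψ = ∑ j ∈ range (k + 1),
      fun x => ((-1 : ℝ) ^ j * (k.choose j : ℝ)) * ψ (x + (j : ℝ) • h) := by
    ext x; simp [kthDiff, Finset.sum_apply]
  rw [e]
  refine (eLpNorm_sum_le (fun j _ => ?_) hq).trans ?_
  · exact Measurable.aestronglyMeasurable (by fun_prop)
  calc _ ≤ ∑ j ∈ range (k + 1), (k.choose j : ℝ≥0∞) *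
        eLpNorm ψ q (volume.restrict (unitCube d)) := by
        refine sum_le_sum fun j hj => ?_
        refine (eLpNorm_const_smul_le (c := ((-1 : ℝ) ^ j * (k.choose j : ℝ)))).trans ?_
        refine mul_le_mul' ?_ (eLpNorm_comp_add_le hψ _ _ fun x hx =>
          add_smul_mem_unitCube (Nat.lt_succ_iff.1 (mem_range.1 hj)) hx.1 hx.2)
        rw [enorm_mul, enorm_pow]
        simp
    _ = _ := by
        rw [← sum_mul]
        congr 1
        exact_mod_cast congrArg (Nat.cast (R := ℝ≥0∞)) (Nat.sum_range_choose k)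

lemma kthDiff_sub' (k : ℕ) (h : Fin d → ℝ) (f g : (Fin d → ℝ) → ℝ) :
    kthDiff d k h (fun x => f x - g x) = kthDiff d k h f - kthDiff d k h g := by
  ext x
  simp only [kthDiff, mul_sub, sum_sub_distrib, Pi.sub_apply]

lemma lintegral_rpow_le_of_eLpNorm_le {α : Type*} [MeasurableSpace α] {μ : Measure α} {q : ℝ}
    (hq : 0 < q) {f : α → ℝ} {A : ℝ≥0∞} (h : eLpNorm f (ENNReal.ofReal q) μ ≤ A) :
    ∫⁻ x, ‖f x‖ₑ ^ q ∂μ ≤ A ^ q := by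
  rw [eLpNorm_eq_lintegral_rpow_enorm_toReal (by simpa using hq) ofReal_ne_top,
    toReal_ofReal hq.le] at h
  have := ENNReal.rpow_le_rpow h hq.le
  rwa [← ENNReal.rpow_mul, one_div, inv_mul_cancel₀ hq.ne', ENNReal.rpow_one] at this

lemma eLpNorm_le_of_lintegral_rpow_le {α : Type*} [MeasurableSpace α] {μ : Measure α} {q : ℝ}
    (hq : 0 < q) {f : α → ℝ} {A : ℝ≥0∞} (h : ∫⁻ x, ‖f x‖ₑ ^ q ∂μ ≤ A ^ q) :
    eLpNorm f (ENNReal.ofReal q) μ ≤ A := by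
  rw [eLpNorm_eq_lintegral_rpow_enorm_toReal (by simpa using hq) ofReal_ne_top,
    toReal_ofReal hq.le, one_div]
  have := ENNReal.rpow_le_rpow h (inv_nonneg.2 hq.le)
  rwa [← ENNReal.rpow_mul, mul_inv_cancel₀ hq.ne', ENNReal.rpow_one] at this

set_option maxHeartbeats 1000000 in
/-- Piecewise polynomial approximation on the cells of level `j`. -/
lemma exists_piecewise_tpoly_close (d : ℕ) {k : ℕ} (hk : 1 ≤ k) {q : ℝ} (hq : 1 ≤ q) :
    ∃ C : ℝ, 0 ≤ C ∧ ∀ (b j : ℕ) (_ : 0 < b) (f : (Fin d → ℝ) → ℝ) (A : ℝ≥0∞), Measurable f →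
      eLpNorm f (ENNReal.ofReal q) (volume.restrict (unitCube d)) < ⊤ →
      A ≠ 0 → modulus d k (ENNReal.ofReal q) f ((b : ℝ) ^ j)⁻¹ ≤ A →
      ∃ P : (Fin d → ℕ) → (Fin d → Fin k) → ℝ,
        eLpNorm (fun x => f x - tpoly (P (cellAt b j x)) (localAt b j x)) (ENNReal.ofReal q)
          (volume.restrict (unitCube d)) ≤ ENNReal.ofReal C * A := by
  have hq0 : 0 < q := by linarith
  have hq1 : (1 : ℝ≥0∞) ≤ ENNReal.ofReal q := by rwa [one_le_ofReal]
  have hk0 : (0 : ℝ) < k := by exact_mod_cast hk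
  set ρ : ℝ := 1 / (2 * k) with hρd
  have hρ : k * ρ = 1 / 2 := by rw [hρd]; field_simp
  have hρ1 : |ρ| < 1 := by
    rw [abs_of_pos (by positivity), hρd, div_lt_one (by positivity)]
    have : (1 : ℝ) ≤ k := by exact_mod_cast hk
    linarith
  have := isProbabilityMeasure_unitCube d
  obtain ⟨C₁, hC₁⟩ := exists_tpoly_close d hk hρ hq
  set K : ℝ≥0∞ := 1 + (ENNReal.ofReal C₁ * (d * 2)) ^ q⁻¹ * (2 * 2 ^ k) with hK
  have hKt : K ≠ ⊤ := by
    refine add_ne_top.2 ⟨by simp, mul_ne_top (rpow_ne_top_of_nonneg (by positivity) ?_) ?_⟩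
    · exact mul_ne_top ofReal_ne_top (mul_ne_top (by simp) (by simp))
    · finiteness
  refine ⟨K.toReal, toReal_nonneg, fun b j hb f A hf hfq hA hmod => ?_⟩
  rw [ofReal_toReal hKt]
  have hc : (0 : ℝ) < (b : ℝ) ^ j := by positivity
  obtain ⟨φ, hφc, hφA⟩ : ∃ φ : (Fin d → ℝ) → ℝ, Continuous φ ∧
      eLpNorm (f - φ) (ENNReal.ofReal q) (volume.restrict (unitCube d)) ≤ A := by
    obtain ⟨φ, hφA, -⟩ := MemLp.exists_boundedContinuous_eLpNorm_sub_le (p := ENNReal.ofReal q)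
      (f := f) (μ := volume.restrict (unitCube d)) ofReal_ne_top ⟨hf.aestronglyMeasurable, hfq⟩ hA
    exact ⟨φ, φ.continuous, hφA⟩
  have hdiff : ∀ h : Fin d → ℝ, √(∑ i, h i ^ 2) < ((b : ℝ) ^ j)⁻¹ →
      ∫⁻ x in {x | x ∈ unitCube d ∧ x + (k : ℝ) • h ∈ unitCube d}, ‖kthDiff d k h φ x‖ₑ ^ q ≤
        (2 * 2 ^ k * A) ^ q := by
    intro h hh
    refine lintegral_rpow_le_of_eLpNorm_le hq0 ?_
    have e : kthDiff d k h φ = kthDiff d k h f - kthDiff d k h (fun x => f x - φ x) := by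
      rw [kthDiff_sub']; simp
    have hm : ∀ {ψ : (Fin d → ℝ) → ℝ}, Measurable ψ → Measurable (kthDiff d k h ψ) := by
      intro ψ hψ
      unfold kthDiff
      fun_prop
    rw [e]
    refine (eLpNorm_sub_le (hm hf).aestronglyMeasurable
      (hm (hf.sub hφc.measurable)).aestronglyMeasurable hq1).trans ?_
    calc _ ≤ A + 2 ^ k * A := by
          refine add_le_add (le_trans ?_ hmod) ((eLpNorm_kthDiff_le hq1 k h
            (hf.sub hφc.measurable)).trans (mul_le_mul' le_rfl hφA))
          exact le_iSup₂_of_le (f := fun h _ => eLpNorm (kthDiff d k h f) _ _) h hh le_rfl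
      _ ≤ 2 ^ k * A + 2 ^ k * A := by
          refine add_le_add ?_ le_rfl
          calc A = 1 * A := (one_mul A).symm
            _ ≤ 2 ^ k * A := mul_le_mul' (one_le_pow₀ (by norm_num)) le_rfl
      _ = _ := by ring
  have hcells : ∀ n : Fin d → ℕ, Continuous (onCell ((b : ℝ) ^ j) n φ) := by
    intro n
    unfold onCell
    exact hφc.comp (by fun_prop)
  choose P hP using fun n => hC₁ _ (hcells n)
  refine ⟨P, ?_⟩
  have hφf : eLpNorm (fun x => φ x - tpoly (P (cellAt b j x)) (localAt b j x)) (ENNReal.ofReal q)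
      (volume.restrict (unitCube d)) ≤
      (ENNReal.ofReal C₁ * (d * 2)) ^ q⁻¹ * (2 * 2 ^ k * A) := by
    refine eLpNorm_le_of_lintegral_rpow_le hq0 ?_
    have hT := lintegral_cells hb j fun n y =>
      ‖onCell ((b : ℝ) ^ j) n φ y - tpoly (P n) y‖ₑ ^ q
    have e : ∀ x : Fin d → ℝ, onCell ((b : ℝ) ^ j) (cellAt b j x) φ (localAt b j x) = φ x := by
      intro x
      unfold onCell
      rw [eq_of_cellAt_localAt hb j x]
    simp only [e] at hT
    have hN0 : ENNReal.ofReal (((b : ℝ) ^ j) ^ d) ≠ 0 := by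
      rw [Ne, ofReal_eq_zero]; push Not; positivity
    rw [← ENNReal.mul_le_mul_iff_right hN0 ofReal_ne_top, hT]
    calc _ ≤ ∑ n ∈ cells d b j, ENNReal.ofReal C₁ *
          ∑ i, coordEnergy k ρ q (onCell ((b : ℝ) ^ j) n φ) i := sum_le_sum fun n _ => hP n
      _ = ENNReal.ofReal C₁ * ∑ i, ∑ n ∈ cells d b j,
          coordEnergy k ρ q (onCell ((b : ℝ) ^ j) n φ) i := by rw [← mul_sum, sum_comm]
      _ ≤ ENNReal.ofReal C₁ * ∑ i : Fin d, ENNReal.ofReal (((b : ℝ) ^ j) ^ d) *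
          (2 * (2 * 2 ^ k * A) ^ q) := by
        refine mul_le_mul' le_rfl (sum_le_sum fun i _ => ?_)
        exact sum_coordEnergy_onCell_le hb j k q hρ1 φ i _ hdiff
      _ = _ := by
        rw [ENNReal.mul_rpow_of_nonneg ((ENNReal.ofReal C₁ * (d * 2)) ^ q⁻¹) _ hq0.le,
          ← ENNReal.rpow_mul, inv_mul_cancel₀ hq0.ne',
          ENNReal.rpow_one, sum_const, card_univ, Fintype.card_fin, nsmul_eq_mul]
        ring
  have hpm := measurable_piecewise_tpoly b j P
  calc _ ≤ eLpNorm (f - φ) (ENNReal.ofReal q) (volume.restrict (unitCube d)) +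
        eLpNorm (fun x => φ x - tpoly (P (cellAt b j x)) (localAt b j x)) (ENNReal.ofReal q)
          (volume.restrict (unitCube d)) := by
        have e : (fun x => f x - tpoly (P (cellAt b j x)) (localAt b j x)) =
            (f - φ) + fun x => φ x - tpoly (P (cellAt b j x)) (localAt b j x) := by
          ext x; simp
        rw [e]
        exact eLpNorm_add_le (hf.sub hφc.measurable).aestronglyMeasurable
          (hφc.measurable.sub hpm).aestronglyMeasurable hq1
    _ ≤ A + (ENNReal.ofReal C₁ * (d * 2)) ^ q⁻¹ * (2 * 2 ^ k * A) := add_le_add hφA hφf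
    _ = _ := by rw [hK]; ring

end LocalApprox

section Besov

variable {d : ℕ}

lemma modulus_mono (k : ℕ) (q : ℝ≥0∞) (f : (Fin d → ℝ) → ℝ) {t t' : ℝ} (h : t ≤ t') :
    modulus d k q f t ≤ modulus d k q f t' :=
  iSup_mono fun _ => iSup_le fun hh => le_iSup_of_le (hh.trans_le h) le_rfl

lemma modulus_le_besovNorm (s : ℝ) {q r : ℝ≥0∞} (hr : 1 ≤ r) (f : (Fin d → ℝ) → ℝ)
    {t : ℝ} (ht : 0 < t) :
    modulus d (⌊s⌋₊ + 1) q f t ≤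
      ENNReal.ofReal (2 * 2 ^ |s|) * besovNorm d s q r f * ENNReal.ofReal (t ^ s) := by
  set ω := modulus d (⌊s⌋₊ + 1) q f with hω
  have hts : 0 < t ^ s := by positivity
  by_cases hr' : r = ⊤
  · have h1 : ENNReal.ofReal (t ^ (-s)) * ω t ≤ besovNorm d s q r f := by
      unfold besovNorm
      rw [if_pos hr']
      refine le_trans ?_ le_add_self
      exact le_iSup₂_of_le (f := fun (t : ℝ) (_ : 0 < t) =>
        ENNReal.ofReal (t ^ (-s)) * ω t) t ht le_rfl
    have h2 : ω t = ENNReal.ofReal (t ^ s) * (ENNReal.ofReal (t ^ (-s)) * ω t) := by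
      rw [← mul_assoc, ← ofReal_mul hts.le, ← Real.rpow_add ht, add_neg_cancel, Real.rpow_zero,
        ofReal_one, one_mul]
    have h3 : (1 : ℝ) ≤ 2 * 2 ^ |s| := by
      have := Real.one_le_rpow (x := 2) (by norm_num) (abs_nonneg s)
      linarith
    calc ω t ≤ ENNReal.ofReal (t ^ s) * besovNorm d s q r f := by
          rw [h2]; exact mul_le_mul' le_rfl h1
      _ = 1 * besovNorm d s q r f * ENNReal.ofReal (t ^ s) := by ring
      _ ≤ _ := mul_le_mul' (mul_le_mul' (by rwa [one_le_ofReal]) le_rfl) le_rfl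
  · have hr1 : 1 ≤ r.toReal := by
      rw [← toReal_one]; exact toReal_mono hr' hr
    have hr0 : 0 < r.toReal := by linarith
    set m : ℝ := min (t ^ (-s)) ((2 * t) ^ (-s)) with hm
    have hm0 : 0 < m := lt_min (by positivity) (by positivity)
    have hlow : ∀ u ∈ Set.Ioc t (2 * t), m ≤ u ^ (-s) := by
      intro u hu
      have hu0 : 0 < u := ht.trans hu.1
      rcases le_total 0 s with h | h
      · exact (min_le_right _ _).trans (Real.rpow_le_rpow_of_nonpos hu0 hu.2 (by linarith))
      · exact (min_le_left _ _).trans (Real.rpow_le_rpow ht.le hu.1.le (by linarith))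
    have h1 : (ENNReal.ofReal m * ω t) ^ r.toReal * ENNReal.ofReal (1 / 2) ≤
        ∫⁻ u in Set.Ioi (0 : ℝ),
          (ENNReal.ofReal (u ^ (-s)) * ω u) ^ r.toReal * ENNReal.ofReal u⁻¹ := by
      calc _ = ∫⁻ u in Set.Ioc t (2 * t),
            (ENNReal.ofReal m * ω t) ^ r.toReal * ENNReal.ofReal (2 * t)⁻¹ := by
            rw [setLIntegral_const, Real.volume_Ioc, mul_assoc, ← ofReal_mul (by positivity)]
            congr 2
            field_simp
            ring
        _ ≤ ∫⁻ u in Set.Ioc t (2 * t),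
            (ENNReal.ofReal (u ^ (-s)) * ω u) ^ r.toReal * ENNReal.ofReal u⁻¹ := by
            refine setLIntegral_mono' measurableSet_Ioc fun u hu => ?_
            refine mul_le_mul' (ENNReal.rpow_le_rpow (mul_le_mul' (ofReal_le_ofReal (hlow u hu))
              (modulus_mono _ _ _ hu.1.le)) hr0.le) (ofReal_le_ofReal ?_)
            exact inv_anti₀ (ht.trans hu.1) hu.2
        _ ≤ _ := lintegral_mono_set fun u hu => ht.trans hu.1
    have h2 : ENNReal.ofReal m * ω t * ENNReal.ofReal (1 / 2) ≤ besovNorm d s q r f := by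
      unfold besovNorm
      rw [if_neg hr']
      refine le_trans ?_ le_add_self
      refine le_trans ?_ (ENNReal.rpow_le_rpow h1 (one_div_nonneg.2 hr0.le))
      rw [ENNReal.mul_rpow_of_nonneg _ _ (one_div_nonneg.2 hr0.le), ← ENNReal.rpow_mul,
        mul_one_div_cancel hr0.ne', ENNReal.rpow_one, ofReal_rpow_of_pos (by norm_num)]
      refine mul_le_mul' le_rfl (ofReal_le_ofReal ?_)
      calc (1 / 2 : ℝ) = (1 / 2) ^ (1 : ℝ) := (Real.rpow_one _).symm
        _ ≤ _ := Real.rpow_le_rpow_of_exponent_ge (by norm_num) (by norm_num)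
          (by rwa [div_le_one hr0])
    have h3 : ω t = ENNReal.ofReal (2 * m⁻¹) *
        (ENNReal.ofReal m * ω t * ENNReal.ofReal (1 / 2)) := by
      have : ENNReal.ofReal (2 * m⁻¹) * (ENNReal.ofReal m * ω t * ENNReal.ofReal (1 / 2)) =
          ENNReal.ofReal (2 * m⁻¹) * ENNReal.ofReal m * ENNReal.ofReal (1 / 2) * ω t := by ring
      rw [this, ← ofReal_mul (by positivity), ← ofReal_mul (by positivity)]
      rw [show 2 * m⁻¹ * m * (1 / 2) = 1 by field_simp, ofReal_one, one_mul]
    have h4 : m⁻¹ ≤ 2 ^ |s| * t ^ s := by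
      rw [inv_le_comm₀ hm0 (by positivity), mul_inv, ← Real.rpow_neg ht.le,
        ← Real.rpow_neg (by norm_num)]
      refine le_min ?_ ?_
      · have : (2 : ℝ) ^ (-|s|) ≤ 1 := Real.rpow_le_one_of_one_le_of_nonpos (by norm_num)
          (by simp)
        exact mul_le_of_le_one_left (by positivity) this
      · rw [Real.mul_rpow (by norm_num) ht.le]
        refine mul_le_mul_of_nonneg_right ?_ (by positivity)
        exact Real.rpow_le_rpow_of_exponent_le (by norm_num) (neg_le_neg (le_abs_self s))
    rw [h3]
    calc _ ≤ ENNReal.ofReal (2 * 2 ^ |s| * t ^ s) * besovNorm d s q r f := by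
          refine mul_le_mul' (ofReal_le_ofReal ?_) h2
          linarith
      _ = _ := by rw [ofReal_mul (by positivity)]; ring

lemma modulus_le_modulus_of_exponent_le {k : ℕ} {q q' : ℝ≥0∞} (hq : q' ≤ q) (hq0 : q' ≠ 0)
    {f : (Fin d → ℝ) → ℝ} (hf : Measurable f) (t : ℝ) :
    modulus d k q' f t ≤ modulus d k q f t := by
  refine iSup_mono fun h => iSup_mono fun hh => ?_
  refine (eLpNorm_le_eLpNorm_mul_rpow_measure_univ hq ?_).trans ?_
  · refine Measurable.aestronglyMeasurable ?_
    unfold kthDiff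
    fun_prop
  · refine mul_le_of_le_one_right zero_le ?_
    refine ENNReal.rpow_le_one ?_ ?_
    · rw [Measure.restrict_apply_univ]
      have := isProbabilityMeasure_unitCube d
      have h1 : volume (unitCube d) = 1 := by
        rw [← Measure.restrict_apply_univ, measure_univ]
      rw [← h1]
      exact measure_mono fun x hx => hx.1
    · rcases eq_or_ne q ⊤ with rfl | hqt
      · simp
      · have h1 : q'.toReal ≤ q.toReal := toReal_mono hqt hq
        have h0 : 0 < q'.toReal := toReal_pos hq0 (ne_top_of_le_ne_top hqt hq)
        have := one_div_le_one_div_of_le h0 h1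
        linarith

end Besov

section PolynomialCoefficients

variable {d k : ℕ}

lemma continuous_tpoly (P : (Fin d → Fin k) → ℝ) : Continuous (tpoly P) := by
  unfold tpoly; fun_prop

lemma eq_zero_of_tpoly_ae_eq_zero {P : (Fin d → Fin k) → ℝ}
    (h : tpoly P =ᵐ[volume.restrict (unitCube d)] 0) : P = 0 := by
  set V : Set (Fin d → ℝ) := Set.univ.pi fun _ : Fin d => Set.Ioo (0 : ℝ) 1 with hV
  have hVo : IsOpen V := isOpen_set_pi Set.finite_univ fun _ _ => isOpen_Ioo
  have hVU : V ⊆ unitCube d := fun x hx => mem_unitCube.2 fun i =>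
    ⟨(hx i trivial).1.le, (hx i trivial).2.le⟩
  have h1 : tpoly P =ᵐ[volume.restrict V] 0 := ae_restrict_of_ae_restrict_of_subset hVU h
  have h2 : Set.EqOn (tpoly P) 0 V := Measure.eqOn_open_of_ae_eq h1 hVo
    (continuous_tpoly P).continuousOn continuousOn_const
  set F : MvPolynomial (Fin d) ℝ :=
    ∑ a, MvPolynomial.monomial (Finsupp.equivFunOnFinite.symm fun i => (a i : ℕ)) (P a) with hF
  have hF0 : F = 0 := by
    refine MvPolynomial.funext_set (fun _ => Set.Ioo (0 : ℝ) 1)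
      (fun _ => Set.Ioo_infinite one_pos) fun x hx => ?_
    have h3 := h2 hx
    simp only [tpoly, Pi.zero_apply] at h3
    rw [map_zero, ← h3, hF, map_sum]
    refine sum_congr rfl fun a _ => ?_
    rw [MvPolynomial.eval_monomial, Finsupp.prod_fintype _ _ (by simp)]
    rfl
  ext a
  have h4 := congrArg (MvPolynomial.coeff (Finsupp.equivFunOnFinite.symm fun i => (a i : ℕ))) hF0
  rw [hF, MvPolynomial.coeff_sum, MvPolynomial.coeff_zero, sum_eq_single a] at h4
  · simpa using h4
  · intro a' _ ha
    rw [MvPolynomial.coeff_monomial, if_neg]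
    intro e
    refine ha (funext fun i => Fin.ext ?_)
    exact congrFun (Finsupp.equivFunOnFinite.symm.injective e) i
  · simp

lemma exists_coeff_le_eLpNorm (d k : ℕ) {q : ℝ≥0∞} (hq : 1 ≤ q) :
    ∃ K : ℝ, 0 ≤ K ∧ ∀ (P : (Fin d → Fin k) → ℝ) a,
      ‖P a‖ₑ ≤ ENNReal.ofReal K * eLpNorm (tpoly P) q (volume.restrict (unitCube d)) := by
  have := isProbabilityMeasure_unitCube d
  have : Fact (1 ≤ q) := ⟨hq⟩
  have hmem : ∀ P : (Fin d → Fin k) → ℝ, MemLp (tpoly P) q (volume.restrict (unitCube d)) := by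
    intro P
    obtain ⟨C, hC⟩ := (isCompact_Icc (a := (0 : Fin d → ℝ)) (b := 1)).exists_bound_of_continuousOn
      (continuous_tpoly P).continuousOn
    exact MemLp.of_bound (continuous_tpoly P).aestronglyMeasurable C
      (ae_restrict_of_forall_mem (measurableSet_unitCube d) hC)
  let T : ((Fin d → Fin k) → ℝ) →ₗ[ℝ] Lp ℝ q (volume.restrict (unitCube d)) :=
    { toFun := fun P => (hmem P).toLp
      map_add' := fun P Q => by
        rw [← MemLp.toLp_add]
        congr 1
        ext y
        simp [tpoly, add_mul, sum_add_distrib]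
      map_smul' := fun c P => by
        rw [RingHom.id_apply, ← MemLp.toLp_const_smul]
        congr 1
        ext y
        simp [tpoly, mul_sum, mul_assoc] }
  have hker : LinearMap.ker T = ⊥ := by
    rw [LinearMap.ker_eq_bot']
    intro P hP
    refine eq_zero_of_tpoly_ae_eq_zero ?_
    have h1 := (hmem P).coeFn_toLp
    have h2 : (hmem P).toLp = 0 := hP
    rw [h2] at h1
    exact h1.symm.trans (Lp.coeFn_zero _ _ _)
  obtain ⟨K, -, hK⟩ := T.exists_antilipschitzWith hker
  refine ⟨K, K.2, fun P a => ?_⟩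
  have h1 := hK P 0
  rw [map_zero, edist_zero_right, edist_zero_right] at h1
  have h2 : ‖T P‖ₑ = eLpNorm (tpoly P) q (volume.restrict (unitCube d)) :=
    Lp.enorm_toLp (hmem P)
  rw [h2] at h1
  rw [ofReal_coe_nnreal]
  refine le_trans ?_ h1
  rw [← ofReal_norm, ← ofReal_norm]
  exact ofReal_le_ofReal (norm_le_pi_norm P a)

end PolynomialCoefficients

section Coefficients

variable {d k : ℕ}

lemma exists_refine_tpoly {b : ℕ} (hb : 0 < b) (j : ℕ) (P : (Fin d → ℕ) → (Fin d → Fin k) → ℝ) :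
    ∃ P' : (Fin d → ℕ) → (Fin d → Fin k) → ℝ, ∀ x : Fin d → ℝ,
      tpoly (P (cellAt b j x)) (localAt b j x) =
        tpoly (P' (cellAt b (j + 1) x)) (localAt b (j + 1) x) := by
  have hb0 : (0 : ℝ) < b := by exact_mod_cast hb
  have h1 : ∀ n : Fin d → ℕ, ∃ P' : (Fin d → Fin k) → ℝ, ∀ y,
      tpoly P' y = tpoly (P fun i => n i / b) fun i => (b : ℝ)⁻¹ * y i + (n i % b : ℕ) / b := by
    intro n
    have hα : |(b : ℝ)⁻¹| ≤ 1 := by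
      rw [abs_of_nonneg (by positivity)]
      exact inv_le_one_of_one_le₀ (by exact_mod_cast hb)
    have hβ : ∀ i, |((n i % b : ℕ) : ℝ) / b| ≤ 1 := by
      intro i
      rw [abs_of_nonneg (by positivity), div_le_one hb0]
      exact_mod_cast (Nat.mod_lt _ hb).le
    obtain ⟨P', h, -⟩ := tpoly_affine (P fun i => n i / b) (b : ℝ)⁻¹
      (fun i => ((n i % b : ℕ) : ℝ) / b) le_rfl hα hβ
    exact ⟨P', h⟩
  choose P' hP' using h1
  refine ⟨P', fun x => ?_⟩
  rw [hP']
  have h2 : (fun i => cellAt b (j + 1) x i / b) = cellAt b j x := by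
    ext i
    unfold cellAt cidx
    rw [← Nat.floor_div_natCast]
    congr 1
    push_cast
    rw [pow_succ]
    field_simp
  rw [h2]
  congr 1
  ext i
  have h3 : cellAt b j x i = cellAt b (j + 1) x i / b := (congrFun h2 i).symm
  have h4 := Nat.div_add_mod (cellAt b (j + 1) x i) b
  have h5 : (b : ℝ) * (cellAt b (j + 1) x i / b : ℕ) + (cellAt b (j + 1) x i % b : ℕ) =
      cellAt b (j + 1) x i := by exact_mod_cast h4
  unfold localAt
  rw [h3, ← h5, pow_succ]
  field_simp
  ring

lemma tpoly_sub (P Q : (Fin d → Fin k) → ℝ) (y : Fin d → ℝ) :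
    tpoly (fun a => P a - Q a) y = tpoly P y - tpoly Q y := by
  simp [tpoly, sub_mul, sum_sub_distrib]

/-- Multiscale coefficients of a function whose modulus of smoothness decays like `t ^ s`. -/
lemma exists_multiscale_coeffs (d : ℕ) {s : ℝ} {k : ℕ} (hk : 1 ≤ k) {q : ℝ} (hq : 1 ≤ q)
    {b : ℕ} (hb : 2 ≤ b) :
    ∃ M : ℝ, 1 ≤ M ∧ ∀ f : (Fin d → ℝ) → ℝ, Measurable f →
      eLpNorm f (ENNReal.ofReal q) (volume.restrict (unitCube d)) ≤ 1 →
      (∀ t : ℝ, 0 < t → modulus d k (ENNReal.ofReal q) f t ≤ ENNReal.ofReal (t ^ s)) →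
      ∃ c : ℕ → (Fin d → Fin k) → (Fin d → ℕ) → ℝ,
        (∀ j a, ∑ n ∈ cells d b j, |c j a n| ^ q ≤
          M * ((b : ℝ) ^ j) ^ d * (((b : ℝ) ^ j) ^ (-s)) ^ q) ∧
        ∀ j, eLpNorm (fun x => f x - ∑ i ∈ range (j + 1),
            tpoly (fun a => c i a (cellAt b i x)) (localAt b i x)) (ENNReal.ofReal q)
          (volume.restrict (unitCube d)) ≤ ENNReal.ofReal (M * ((b : ℝ) ^ j) ^ (-s)) := by
  have hb' : 0 < b := by omega
  have hb0 : (0 : ℝ) < b := by exact_mod_cast hb'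
  have hq0 : 0 < q := by linarith
  have hq1 : (1 : ℝ≥0∞) ≤ ENNReal.ofReal q := by rwa [one_le_ofReal]
  obtain ⟨C, hC0, hC⟩ := exists_piecewise_tpoly_close d hk hq
  obtain ⟨K, hK0, hK⟩ := exists_coeff_le_eLpNorm d k hq1
  set D : ℝ := C * (1 + (b : ℝ) ^ s) + 1 with hD
  have hD0 : 0 ≤ D := by positivity
  refine ⟨max 1 (max C ((K * D) ^ q)), le_max_left _ _, fun f hf hf1 hfm => ?_⟩
  set X : ℕ → ℝ := fun j => ((b : ℝ) ^ j) ^ (-s) with hX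
  have hX0 : ∀ j, 0 < X j := fun j => by positivity
  have hX1 : ∀ j, X j = (b : ℝ) ^ s * X (j + 1) := by
    intro j
    simp only [hX]
    rw [pow_succ, Real.mul_rpow (by positivity) hb0.le, mul_comm _ ((b : ℝ) ^ (-s)), ← mul_assoc,
      ← Real.rpow_add hb0, add_neg_cancel, Real.rpow_zero, one_mul]
  have hP : ∀ j, ∃ P : (Fin d → ℕ) → (Fin d → Fin k) → ℝ,
      eLpNorm (fun x => f x - tpoly (P (cellAt b j x)) (localAt b j x)) (ENNReal.ofReal q)
          (volume.restrict (unitCube d)) ≤ ENNReal.ofReal (C * X j) := by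
    intro j
    rw [ofReal_mul hC0]
    refine hC b j hb' f _ hf (hf1.trans_lt one_lt_top) ?_ ?_
    · rw [Ne, ofReal_eq_zero]; push Not; exact hX0 j
    · refine (hfm _ (by positivity)).trans_eq ?_
      rw [Real.inv_rpow (by positivity), ← Real.rpow_neg (by positivity)]
  choose P hP using hP
  choose R hR using fun j => exists_refine_tpoly hb' j (P j)
  set c : ℕ → (Fin d → ℕ) → (Fin d → Fin k) → ℝ := fun j n =>
    match j with
    | 0 => P 0 n
    | j + 1 => fun a => P (j + 1) n a - R j n a with hc
  have hsum : ∀ j x, ∑ i ∈ range (j + 1), tpoly (c i (cellAt b i x)) (localAt b i x) =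
      tpoly (P j (cellAt b j x)) (localAt b j x) := by
    intro j x
    induction j with
    | zero => simp [hc]
    | succ j ih =>
      rw [sum_range_succ, ih, hR]
      show _ + tpoly (fun a => P (j + 1) _ a - R j _ a) _ = _
      rw [tpoly_sub]
      ring
  have hm := fun j => measurable_piecewise_tpoly (d := d) b j (P j)
  have hcq : ∀ j, eLpNorm (fun x => tpoly (c j (cellAt b j x)) (localAt b j x)) (ENNReal.ofReal q)
      (volume.restrict (unitCube d)) ≤ ENNReal.ofReal (D * X j) := by
    intro j
    cases j with
    | zero =>
      have e : (fun x => tpoly (c 0 (cellAt b 0 x)) (localAt b 0 x)) =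
          f - fun x => f x - tpoly (P 0 (cellAt b 0 x)) (localAt b 0 x) := by
        ext x; simp [hc]
      rw [e]
      refine (eLpNorm_sub_le hf.aestronglyMeasurable
        (hf.sub (hm 0)).aestronglyMeasurable hq1).trans ?_
      refine (add_le_add hf1 (hP 0)).trans ?_
      have hX00 : X 0 = 1 := by simp [hX]
      rw [hX00, ← ofReal_one, ← ofReal_add (by norm_num) (by positivity)]
      refine ofReal_le_ofReal ?_
      have : 0 ≤ C * (b : ℝ) ^ s := by positivity
      rw [hD]; linarith
    | succ j =>
      have e : (fun x => tpoly (c (j + 1) (cellAt b (j + 1) x)) (localAt b (j + 1) x)) =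
          (fun x => f x - tpoly (P j (cellAt b j x)) (localAt b j x)) -
          fun x => f x - tpoly (P (j + 1) (cellAt b (j + 1) x)) (localAt b (j + 1) x) := by
        ext x
        rw [Pi.sub_apply, hR]
        show tpoly (fun a => P (j + 1) _ a - R j _ a) _ = _
        rw [tpoly_sub]
        ring
      rw [e]
      refine (eLpNorm_sub_le (hf.sub (hm j)).aestronglyMeasurable
        (hf.sub (hm (j + 1))).aestronglyMeasurable hq1).trans ?_
      refine (add_le_add (hP j) (hP (j + 1))).trans ?_
      rw [← ofReal_add (by have := hX0 j; positivity) (by have := hX0 (j + 1); positivity), hX1 j]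
      refine ofReal_le_ofReal ?_
      have := hX0 (j + 1)
      rw [hD]; nlinarith
  refine ⟨fun j a n => c j n a, fun j a => ?_, fun j => ?_⟩
  · have h1 := lintegral_rpow_le_of_eLpNorm_le hq0 (hcq j)
    have h2 := lintegral_cells hb' j fun n y => ‖tpoly (c j n) y‖ₑ ^ q
    have h3 : ∀ n, ‖c j n a‖ₑ ^ q ≤
        ENNReal.ofReal K ^ q * ∫⁻ y in unitCube d, ‖tpoly (c j n) y‖ₑ ^ q := by
      intro n
      refine (ENNReal.rpow_le_rpow (hK (c j n) a) hq0.le).trans_eq ?_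
      rw [ENNReal.mul_rpow_of_nonneg _ _ hq0.le]
      congr 1
      rw [eLpNorm_eq_lintegral_rpow_enorm_toReal (by simpa using hq0) ofReal_ne_top,
        toReal_ofReal hq0.le, ← ENNReal.rpow_mul, one_div, inv_mul_cancel₀ hq0.ne',
          ENNReal.rpow_one]
    have h4 : ∑ n ∈ cells d b j, ‖c j n a‖ₑ ^ q ≤
        ENNReal.ofReal ((K * D) ^ q * ((b : ℝ) ^ j) ^ d * X j ^ q) := by
      calc _ ≤ ∑ n ∈ cells d b j,
            ENNReal.ofReal K ^ q * ∫⁻ y in unitCube d, ‖tpoly (c j n) y‖ₑ ^ q :=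
            sum_le_sum fun n _ => h3 n
        _ = ENNReal.ofReal K ^ q * (ENNReal.ofReal (((b : ℝ) ^ j) ^ d) *
            ∫⁻ x in unitCube d, ‖tpoly (c j (cellAt b j x)) (localAt b j x)‖ₑ ^ q) := by
            rw [h2, mul_sum]
        _ ≤ ENNReal.ofReal K ^ q * (ENNReal.ofReal (((b : ℝ) ^ j) ^ d) *
            ENNReal.ofReal (D * X j) ^ q) := mul_le_mul' le_rfl (mul_le_mul' le_rfl h1)
        _ = _ := by
            have := hX0 j
            rw [ofReal_rpow_of_nonneg hK0 hq0.le, ofReal_rpow_of_nonneg (by positivity) hq0.le,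
              ← ofReal_mul (by positivity), ← ofReal_mul (by positivity),
              Real.mul_rpow hD0 this.le, Real.mul_rpow hK0 hD0]
            congr 1
            ring
    have h5 : ∑ n ∈ cells d b j, ‖c j n a‖ₑ ^ q =
        ENNReal.ofReal (∑ n ∈ cells d b j, |c j n a| ^ q) := by
      rw [ofReal_sum_of_nonneg fun n _ => by positivity]
      refine sum_congr rfl fun n _ => ?_
      rw [Real.enorm_eq_ofReal_abs, ofReal_rpow_of_nonneg (abs_nonneg _) hq0.le]
    rw [h5] at h4
    have := hX0 j
    refine ((ofReal_le_ofReal_iff (by positivity)).1 h4).trans ?_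
    refine mul_le_mul_of_nonneg_right (mul_le_mul_of_nonneg_right ?_ (by positivity))
      (by positivity)
    exact (le_max_right _ _).trans (le_max_right _ _)
  · have := hX0 j
    have e : ∀ x, ∑ i ∈ range (j + 1), tpoly (fun a => c i (cellAt b i x) a) (localAt b i x) =
      tpoly (P j (cellAt b j x)) (localAt b j x) := hsum j
    simp only [e]
    refine (hP j).trans (ofReal_le_ofReal ?_)
    exact mul_le_mul_of_nonneg_right ((le_max_left _ _).trans (le_max_right _ _)) this.le

end Coefficients

section Quantization

lemma exists_int_trunc (x : ℝ) : ∃ z : ℤ, |(z : ℝ)| ≤ |x| ∧ |x - z| ≤ 1 ∧ |x - z| ≤ |x| := by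
  rcases le_total 0 x with hx | hx
  · refine ⟨⌊x⌋, ?_⟩
    have h1 := Int.floor_le x
    have h2 := Int.lt_floor_add_one x
    have h3 : (0 : ℝ) ≤ ⌊x⌋ := by exact_mod_cast Int.floor_nonneg.2 hx
    rw [abs_of_nonneg h3, abs_of_nonneg hx, abs_of_nonneg (sub_nonneg.2 h1)]
    exact ⟨h1, by linarith, by linarith⟩
  · refine ⟨⌈x⌉, ?_⟩
    have h1 := Int.le_ceil x
    have h2 := Int.ceil_lt_add_one x
    have h3 : (⌈x⌉ : ℝ) ≤ 0 := by exact_mod_cast Int.ceil_nonpos.2 hx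
    rw [abs_of_nonpos h3, abs_of_nonpos hx, abs_of_nonpos (sub_nonpos.2 h1)]
    exact ⟨by linarith, by linarith, by linarith⟩

lemma card_cells (d b j : ℕ) : ((cells d b j).card : ℝ) = ((b : ℝ) ^ j) ^ d := by
  simp [cells]

lemma eLpNorm_cellAt_le {d b : ℕ} (hb : 0 < b) (j : ℕ) (e : (Fin d → ℕ) → ℝ) {q : ℝ} (hq : 0 < q)
    {p : ℝ≥0∞} (hqp : ENNReal.ofReal q ≤ p) {S T : ℝ} (hS : 0 < S) (hT : 0 ≤ T)
    (h1 : ∀ n ∈ cells d b j, |e n| ≤ S)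
    (h2 : ∑ n ∈ cells d b j, |e n| ^ q ≤ T * ((b : ℝ) ^ j) ^ d) :
    eLpNorm (fun x => e (cellAt b j x)) p (volume.restrict (unitCube d)) ≤
      ENNReal.ofReal (S ^ (1 - q * (1 / p.toReal)) * T ^ (1 / p.toReal)) := by
  by_cases hp : p = ⊤
  · subst hp
    have e1 : S ^ (1 - q * (1 / (⊤ : ℝ≥0∞).toReal)) * T ^ (1 / (⊤ : ℝ≥0∞).toReal) = S := by simp
    rw [e1]
    rw [eLpNorm_exponent_top]
    refine eLpNormEssSup_le_of_ae_bound (C := S) ?_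
    filter_upwards [ae_unitCube_mem_Ico d] with x hx
    exact h1 _ (cellAt_mem hb j (fun i => (hx i).1) fun i => (hx i).2)
  have hp0 : 0 < p.toReal := by
    refine toReal_pos (fun h => ?_) hp
    rw [h] at hqp
    exact absurd (ENNReal.ofReal_eq_zero.1 (le_antisymm hqp zero_le)) (not_le.2 hq)
  have hqp' : q ≤ p.toReal := (ENNReal.ofReal_le_iff_le_toReal hp).1 hqp
  obtain ⟨r, hr⟩ : ∃ r, p.toReal = r := ⟨_, rfl⟩
  rw [← ENNReal.ofReal_toReal hp]
  rw [hr] at hp0 hqp' ⊢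
  rw [toReal_ofReal hp0.le]
  refine eLpNorm_le_of_lintegral_rpow_le hp0 ?_
  have e1 : (S ^ (1 - q * (1 / r)) * T ^ (1 / r)) ^ r = S ^ (r - q) * T := by
    rw [Real.mul_rpow (by positivity) (by positivity), ← Real.rpow_mul hS.le, ← Real.rpow_mul hT,
      one_div_mul_cancel hp0.ne', Real.rpow_one]
    congr 2
    field_simp
  rw [ENNReal.ofReal_rpow_of_nonneg (by positivity) hp0.le, e1]
  have hB : (0 : ℝ) < ((b : ℝ) ^ j) ^ d := by positivity
  have h3 := lintegral_cells (d := d) hb j fun n _ => ‖e n‖ₑ ^ r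
  have hprob := isProbabilityMeasure_unitCube d
  simp only [lintegral_const, measure_univ, mul_one] at h3
  have h4 : ∑ n ∈ cells d b j, ‖e n‖ₑ ^ r ≤
      ENNReal.ofReal (((b : ℝ) ^ j) ^ d) * ENNReal.ofReal (S ^ (r - q) * T) := by
    have : ∀ n, ‖e n‖ₑ ^ r = ENNReal.ofReal (|e n| ^ r) := fun n => by
      rw [Real.enorm_eq_ofReal_abs, ENNReal.ofReal_rpow_of_nonneg (abs_nonneg _) hp0.le]
    rw [sum_congr rfl fun n _ => this n, ← ENNReal.ofReal_sum_of_nonneg fun n _ => by positivity,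
      ← ENNReal.ofReal_mul hB.le]
    refine ENNReal.ofReal_le_ofReal ?_
    calc ∑ n ∈ cells d b j, |e n| ^ r ≤ ∑ n ∈ cells d b j, S ^ (r - q) * |e n| ^ q := by
          refine sum_le_sum fun n hn => ?_
          rcases (abs_nonneg (e n)).eq_or_lt with h0 | h0
          · rw [← h0, Real.zero_rpow hp0.ne']
            positivity
          · calc |e n| ^ r = |e n| ^ (r - q) * |e n| ^ q := by
                  rw [← Real.rpow_add h0, sub_add_cancel]
              _ ≤ _ := by
                  gcongr
                  exact h1 n hn
      _ = S ^ (r - q) * ∑ n ∈ cells d b j, |e n| ^ q := by rw [mul_sum]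
      _ ≤ S ^ (r - q) * (T * ((b : ℝ) ^ j) ^ d) := by gcongr
      _ = _ := by ring
  rw [← h3] at h4
  exact (ENNReal.mul_le_mul_iff_right (ENNReal.ofReal_pos.2 hB).ne' ofReal_ne_top).1 h4

lemma eLpNorm_piecewise_tpoly_le {d k b : ℕ} (hb : 0 < b) (j : ℕ)
    (e : (Fin d → Fin k) → (Fin d → ℕ) → ℝ) {q : ℝ} (hq : 0 < q) {p : ℝ≥0∞} (hp : 1 ≤ p)
    (hqp : ENNReal.ofReal q ≤ p) {S T : ℝ} (hS : 0 < S) (hT : 0 ≤ T)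
    (h1 : ∀ a, ∀ n ∈ cells d b j, |e a n| ≤ S)
    (h2 : ∀ a, ∑ n ∈ cells d b j, |e a n| ^ q ≤ T * ((b : ℝ) ^ j) ^ d) :
    eLpNorm (fun x => tpoly (fun a => e a (cellAt b j x)) (localAt b j x)) p
        (volume.restrict (unitCube d)) ≤
      ENNReal.ofReal ((k : ℝ) ^ d * (S ^ (1 - q * (1 / p.toReal)) * T ^ (1 / p.toReal))) := by
  have h3 : eLpNorm (fun x => tpoly (fun a => e a (cellAt b j x)) (localAt b j x)) p
        (volume.restrict (unitCube d)) ≤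
      eLpNorm (∑ a, fun x => |e a (cellAt b j x)|) p (volume.restrict (unitCube d)) := by
    refine eLpNorm_mono_ae ?_
    filter_upwards [ae_unitCube_mem_Ico d] with x hx
    rw [Finset.sum_apply]
    refine le_trans ?_ (Real.le_norm_self _)
    unfold tpoly
    refine (norm_sum_le _ _).trans (sum_le_sum fun a _ => ?_)
    rw [norm_mul, Real.norm_eq_abs]
    refine mul_le_of_le_one_right (abs_nonneg _) ?_
    rw [norm_prod]
    refine prod_le_one (fun i _ => norm_nonneg _) fun i _ => ?_
    have l0 := localAt_nonneg (b := b) j (fun i => (hx i).1) i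
    rw [norm_pow, Real.norm_of_nonneg l0]
    exact pow_le_one₀ l0 (localAt_le_one j x i)
  refine h3.trans ((eLpNorm_sum_le (fun a _ => ?_) hp).trans ?_)
  · have : Measurable fun x : Fin d → ℝ => |e a (cellAt b j x)| :=
      (measurable_of_countable fun n => |e a n|).comp (measurable_cellAt b j)
    exact this.aestronglyMeasurable
  calc _ ≤ ∑ a : Fin d → Fin k,
        ENNReal.ofReal (S ^ (1 - q * (1 / p.toReal)) * T ^ (1 / p.toReal)) := by
        refine sum_le_sum fun a _ => ?_
        refine eLpNorm_cellAt_le hb j (fun n => |e a n|) hq hqp hS hT ?_ ?_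
        · simpa only [abs_abs] using h1 a
        · simpa only [abs_abs] using h2 a
    _ = _ := by
        rw [sum_const, card_univ, Fintype.card_fun, Fintype.card_fin, Fintype.card_fin,
          nsmul_eq_mul, ENNReal.ofReal_mul (by positivity : (0 : ℝ) ≤ (k : ℝ) ^ d), ← Nat.cast_pow,
          ENNReal.ofReal_natCast]

open Filter Topology in
lemma eLpNorm_sub_le_of_tendsto {α : Type*} [MeasurableSpace α] {μ : Measure α} {f G : α → ℝ}
    {F : ℕ → α → ℝ} (hF : ∀ n, AEStronglyMeasurable (F n) μ) (hf : AEStronglyMeasurable f μ)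
    (hG : AEStronglyMeasurable G μ) {q p A : ℝ≥0∞} (hq : q ≠ 0)
    (h1 : Tendsto (fun n => eLpNorm (fun x => f x - F n x) q μ) atTop (𝓝 0))
    (h2 : ∀ᶠ n in atTop, eLpNorm (fun x => F n x - G x) p μ ≤ A) :
    eLpNorm (fun x => f x - G x) p μ ≤ A := by
  have h3 : TendstoInMeasure μ F atTop f := by
    refine tendstoInMeasure_of_tendsto_eLpNorm hq hF hf ?_
    refine h1.congr fun n => ?_
    exact eLpNorm_sub_comm f (F n) q μ
  obtain ⟨ns, hns, hae⟩ := h3.exists_seq_tendsto_ae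
  refine (Lp.eLpNorm_lim_le_liminf_eLpNorm (f := fun n x => F (ns n) x - G x)
    (fun n => (hF _).sub hG) _ ?_).trans ?_
  · filter_upwards [hae] with x hx
    exact hx.sub_const _
  · have h4 : ∀ᶠ n in atTop, eLpNorm (fun x => F (ns n) x - G x) p μ ≤ A :=
      hns.tendsto_atTop.eventually h2
    refine (liminf_le_liminf h4).trans ?_
    simp

end Quantization

section QuantizationNumerics

variable {B M d s q π η J j : ℝ}

lemma rpow_le_self_of_le_one {x y : ℝ} (hx : 1 ≤ x) (hy : y ≤ 1) : x ^ y ≤ x := by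
  simpa using Real.rpow_le_rpow_of_exponent_le hx hy

lemma fine_error_le (hB : 1 ≤ B) (hM : 1 ≤ M) (hq : 1 ≤ q) (hπ : 0 ≤ π) (hqπ : q * π ≤ 1)
    (hη0 : 0 ≤ η) (hη : 2 * η ≤ s - d * (1 / q - π)) (hj : J ≤ j) :
    (B ^ (-(J * s) - (j - J) * (s - d / q) + η * (j - J))) ^ (1 - q * π) *
      (M * B ^ (-(j * s * q))) ^ π ≤ M * B ^ (-(J * s) - η * (j - J)) := by
  have hB0 : 0 < B := by linarith
  have hq0 : 0 < q := by linarith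
  rw [Real.mul_rpow (by linarith) (by positivity), ← Real.rpow_mul hB0.le, ← Real.rpow_mul hB0.le,
    mul_left_comm, ← Real.rpow_add hB0]
  refine mul_le_mul (rpow_le_self_of_le_one hM (by nlinarith))
    (Real.rpow_le_rpow_of_exponent_le hB ?_) (by positivity) (by linarith)
  have e1 : (-(J * s) - (j - J) * (s - d / q) + η * (j - J)) * (1 - q * π) + -(j * s * q) * π =
      -(J * s) - (j - J) * (s - d * (1 / q - π)) + η * (j - J) - (j - J) * (η * (q * π)) := by
    field_simp
    ring
  have h1 : 0 ≤ (j - J) * (η * (q * π)) :=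
    mul_nonneg (by linarith) (by positivity)
  have h2 : (j - J) * (2 * η) ≤ (j - J) * (s - d * (1 / q - π)) :=
    mul_le_mul_of_nonneg_left hη (by linarith)
  linarith

lemma tail_error_le (hB : 1 ≤ B) (hM : 1 ≤ M) (hq : 1 ≤ q) (hπ : 0 ≤ π)
    (hη0 : 0 ≤ η) (hη : 2 * η ≤ s - d * (1 / q - π)) (hJ : 0 ≤ J) (hj : J ≤ j)
    (hJj : 2 * (J * s) ≤ j * (s - d * (1 / q - π))) :
    (M * B ^ (j * (d / q - s))) ^ (1 - q * π) *
      (M * B ^ (-(j * s * q))) ^ π ≤ M * B ^ (-(J * s) - η * (j - J)) := by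
  have hB0 : 0 < B := by linarith
  have hM0 : 0 < M := by linarith
  have hq0 : 0 < q := by linarith
  rw [Real.mul_rpow hM0.le (by positivity), Real.mul_rpow hM0.le (by positivity),
    ← Real.rpow_mul hB0.le, ← Real.rpow_mul hB0.le, mul_mul_mul_comm, ← Real.rpow_add hM0,
    ← Real.rpow_add hB0]
  refine mul_le_mul (rpow_le_self_of_le_one hM (by nlinarith))
    (Real.rpow_le_rpow_of_exponent_le hB ?_) (by positivity) (by linarith)
  have e1 : j * (d / q - s) * (1 - q * π) + -(j * s * q) * π = -(j * (s - d * (1 / q - π))) := by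
    field_simp
    ring
  have h2 : j * (2 * η) ≤ j * (s - d * (1 / q - π)) :=
    mul_le_mul_of_nonneg_left hη (by linarith)
  have h3 : 0 ≤ η * J := by positivity
  linarith

lemma abs_le_of_rpow_le {x : ℝ} (hB : 1 ≤ B) (hM : 1 ≤ M) (hq : 1 ≤ q)
    (h : |x| ^ q ≤ M * B ^ (-(j * s * q)) * B ^ (j * d)) : |x| ≤ M * B ^ (j * (d / q - s)) := by
  have hB0 : 0 < B := by linarith
  have hM0 : 0 < M := by linarith
  have hq0 : 0 < q := by linarith
  rw [← Real.rpow_le_rpow_iff (abs_nonneg _) (by positivity) hq0]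
  refine h.trans ?_
  rw [Real.mul_rpow hM0.le (by positivity), mul_assoc, ← Real.rpow_add hB0, ← Real.rpow_mul hB0.le]
  have e1 : -(j * s * q) + j * d = j * (d / q - s) * q := by
    field_simp
    ring
  rw [e1]
  gcongr
  exact Real.self_le_rpow_of_one_le hM hq

lemma fine_cost_le (hB : 1 ≤ B) (hM : 0 ≤ M) (hq : 1 ≤ q) (hη0 : 0 ≤ η) (hj : J ≤ j) :
    (M * B ^ (-(j * s * q)) * B ^ (j * d)) /
      (B ^ (-(J * s) - (j - J) * (s - d / q) + η * (j - J))) ^ q ≤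
      M * (B ^ (J * d) * B ^ (-(η * (j - J)))) := by
  have hB0 : 0 < B := by linarith
  have hq0 : 0 < q := by linarith
  rw [div_le_iff₀ (by positivity), mul_assoc M, mul_assoc M]
  refine mul_le_mul_of_nonneg_left ?_ hM
  rw [← Real.rpow_mul hB0.le, ← Real.rpow_add hB0, ← Real.rpow_add hB0, ← Real.rpow_add hB0]
  refine Real.rpow_le_rpow_of_exponent_le hB ?_
  have e1 : (-(J * s) - (j - J) * (s - d / q) + η * (j - J)) * q =
      -(J * s * q) - (j - J) * (s * q - d) + (j - J) * (η * q) := by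
    field_simp
  have h1 : (j - J) * η ≤ (j - J) * (η * q) :=
    mul_le_mul_of_nonneg_left (by nlinarith) (by linarith)
  rw [e1]
  linarith

lemma sum_abs_le_of_sum_rpow_le {ι : Type*} (S : Finset ι) (c : ι → ℝ) {t A : ℝ} (ht : 0 < t)
    (hq : 1 ≤ q) (h : ∑ i ∈ S, |c i| ^ q ≤ A * t ^ q * S.card) :
    ∑ i ∈ S, |c i| ≤ (1 + A) * t * S.card := by
  have h1 : ∀ i ∈ S, |c i| ≤ t + t / t ^ q * |c i| ^ q := by
    intro i _
    have hy : 0 ≤ |c i| / t := by positivity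
    have h2 : |c i| / t ≤ 1 + (|c i| / t) ^ q := by
      rcases le_total (|c i| / t) 1 with h | h
      · have : 0 ≤ (|c i| / t) ^ q := by positivity
        linarith
      · have := Real.self_le_rpow_of_one_le h hq
        linarith
    rw [Real.div_rpow (abs_nonneg _) ht.le, div_le_iff₀ ht] at h2
    refine h2.trans (le_of_eq ?_)
    ring
  calc _ ≤ ∑ i ∈ S, (t + t / t ^ q * |c i| ^ q) := sum_le_sum h1
    _ = S.card * t + t / t ^ q * ∑ i ∈ S, |c i| ^ q := by
      rw [sum_add_distrib, ← mul_sum, sum_const, nsmul_eq_mul]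
    _ ≤ S.card * t + t / t ^ q * (A * t ^ q * S.card) := by gcongr
    _ = _ := by
      have : 0 < t ^ q := by positivity
      field_simp

lemma coarse_cost_le (hB : 1 ≤ B) (hη1 : η ≤ 1) (hd : 0 ≤ d) (hj : j ≤ J) :
    B ^ (-(j * s)) * B ^ (j * d) / B ^ (-(J * s) - η * (J - j)) ≤
      B ^ ((d + s + 2) * (J - j)) * (B ^ (J * d) * B ^ (-(η * (J - j)))) := by
  have hB0 : 0 < B := by linarith
  rw [div_le_iff₀ (by positivity), ← Real.rpow_add hB0, ← Real.rpow_add hB0, ← Real.rpow_add hB0,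
    ← Real.rpow_add hB0]
  refine Real.rpow_le_rpow_of_exponent_le hB ?_
  have h1 : 0 ≤ (J - j) * (1 - η) := mul_nonneg (by linarith) (by linarith)
  have h2 : 0 ≤ (J - j) * d := mul_nonneg (by linarith) hd
  linarith

lemma sum_ceil_div_le {ι : Type*} (S : Finset ι) (x : ι → ℕ) {V : ℕ} (hV : 1 ≤ V) :
    ∑ i ∈ S, (x i + (V - 1)) / V ≤ ∑ i ∈ S, x i := by
  refine sum_le_sum fun i _ => ?_
  rcases Nat.eq_zero_or_pos (x i) with h | h
  · rw [h, zero_add, Nat.div_eq_of_lt (by omega)]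
  · refine Nat.div_le_of_le_mul ?_
    obtain ⟨y, hy⟩ := Nat.exists_eq_add_of_le h
    obtain ⟨v, hv⟩ := Nat.exists_eq_add_of_le hV
    rw [hy, hv]
    have : 0 ≤ v * y := Nat.zero_le _
    have e : (1 + v) * (1 + y) = 1 + y + v + v * y := by ring
    rw [e]
    omega

lemma mul_sum_ceil_div_le {ι : Type*} (S : Finset ι) (x : ι → ℕ) {V : ℕ} :
    V * ∑ i ∈ S, (x i + (V - 1)) / V ≤ ∑ i ∈ S, x i + V * S.card := by
  rw [mul_sum, card_eq_sum_ones, mul_sum, ← sum_add_distrib]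
  refine sum_le_sum fun i _ => ?_
  have := Nat.mul_div_le (x i + (V - 1)) V
  omega

lemma sum_natAbs_le_sum_rpow {ι : Type*} (S : Finset ι) (z : ι → ℤ) (hq : 1 ≤ q) :
    ((∑ i ∈ S, (z i).natAbs : ℕ) : ℝ) ≤ ∑ i ∈ S, |(z i : ℝ)| ^ q := by
  push_cast
  refine sum_le_sum fun i _ => ?_
  rw [Nat.cast_natAbs, Int.cast_abs]
  rcases eq_or_ne (z i) 0 with h | h
  · rw [h]
    simp only [Int.cast_zero, abs_zero]
    positivity
  · refine Real.self_le_rpow_of_one_le ?_ hq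
    exact_mod_cast Int.one_le_abs h

end QuantizationNumerics

section QuantizedLevels

lemma tail_level_le {d k b : ℕ} (hb : 2 ≤ b) {s q M η : ℝ} {p : ℝ≥0∞} (hq : 1 ≤ q) (hM : 1 ≤ M)
    (hp : 1 ≤ p) (hqp : ENNReal.ofReal q ≤ p)
    (hη0 : 0 ≤ η) (hη : 2 * η ≤ s - d * (1 / q - 1 / p.toReal)) {J j : ℕ} (hj : J ≤ j)
    (hJj : 2 * ((J : ℝ) * s) ≤ j * (s - d * (1 / q - 1 / p.toReal)))
    (c : (Fin d → Fin k) → (Fin d → ℕ) → ℝ)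
    (hc : ∀ a, ∑ n ∈ cells d b j, |c a n| ^ q ≤
      M * (b : ℝ) ^ (-((j : ℝ) * s * q)) * ((b : ℝ) ^ j) ^ d) :
    eLpNorm (fun x => tpoly (fun a => c a (cellAt b j x)) (localAt b j x)) p
        (volume.restrict (unitCube d)) ≤
      ENNReal.ofReal ((k : ℝ) ^ d * (M * (b : ℝ) ^ (-((J : ℝ) * s) - η * (ndist J j : ℝ)))) := by
  have hB : (1 : ℝ) ≤ b := by exact_mod_cast (by omega : 1 ≤ b)
  have hB0 : (0 : ℝ) < b := by linarith
  have hM0 : 0 < M := by linarith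
  have hq0 : 0 < q := by linarith
  have hjd : ((b : ℝ) ^ j) ^ d = (b : ℝ) ^ ((j : ℝ) * d) := by
    rw [← pow_mul, ← Real.rpow_natCast, Nat.cast_mul]
  refine (eLpNorm_piecewise_tpoly_le (by omega) j c hq0 hp hqp
    (S := M * (b : ℝ) ^ ((j : ℝ) * (d / q - s))) (T := M * (b : ℝ) ^ (-((j : ℝ) * s * q)))
    (by positivity) (by positivity) (fun a n hn => ?_) hc).trans ?_
  · refine abs_le_of_rpow_le hB hM hq ?_
    rw [← hjd]
    refine le_trans ?_ (hc a)
    exact single_le_sum (f := fun n => |c a n| ^ q) (fun n _ => by positivity) hn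
  · have e : (ndist J j : ℝ) = j - J := by
      rw [ndist, Nat.sub_eq_zero_of_le hj, add_zero, Nat.cast_sub hj]
    rw [e]
    refine ENNReal.ofReal_le_ofReal (mul_le_mul_of_nonneg_left ?_ (by positivity))
    exact tail_error_le hB hM hq (by positivity) hη0 hη (by positivity) (by exact_mod_cast hj) hJj

lemma le_two_pow_sub_one {b c₁ m : ℕ} (hc₁ : 1 ≤ c₁) {e : ℝ} (hb : 0 < b)
    (h : (b : ℝ) ^ e ≤ 2 ^ c₁) : (b : ℝ) ^ (e * m) ≤ ((2 ^ (c₁ * (m + 1)) - 1 : ℕ) : ℝ) := by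
  have h1 : (b : ℝ) ^ (e * m) ≤ ((2 ^ (c₁ * m) : ℕ) : ℝ) := by
    rw [Real.rpow_mul (by positivity), Real.rpow_natCast, pow_mul]
    push_cast
    gcongr
  refine h1.trans ?_
  have h2 : 2 ^ (c₁ * m) + 1 ≤ 2 ^ (c₁ * (m + 1)) := by
    have : 2 ^ (c₁ * m + 1) ≤ 2 ^ (c₁ * (m + 1)) :=
      Nat.pow_le_pow_right (by norm_num) (by rw [mul_add]; omega)
    have h3 : 1 ≤ 2 ^ (c₁ * m) := Nat.one_le_two_pow
    rw [pow_succ] at this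
    omega
  exact_mod_cast Nat.le_sub_of_add_le h2

set_option maxHeartbeats 1000000 in
lemma exists_quantized_level {d k b c₁ : ℕ} (hb : 2 ≤ b) (hc₁ : 1 ≤ c₁) {s q M η : ℝ} {p : ℝ≥0∞}
    (hd : 1 ≤ d) (hs : 0 < s) (hq : 1 ≤ q) (hM : 1 ≤ M) (hp : 1 ≤ p) (hqp : ENNReal.ofReal q ≤ p)
    (hV : (b : ℝ) ^ ((d : ℝ) + s + 2) ≤ 2 ^ c₁)
    (hη0 : 0 ≤ η) (hη1 : η ≤ 1) (hη : 2 * η ≤ s - d * (1 / q - 1 / p.toReal)) (J j : ℕ)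
    (c : (Fin d → Fin k) → (Fin d → ℕ) → ℝ)
    (hc : ∀ a, ∑ n ∈ cells d b j, |c a n| ^ q ≤
      M * (b : ℝ) ^ (-((j : ℝ) * s * q)) * ((b : ℝ) ^ j) ^ d) :
    ∃ (τ : ℝ) (z : (Fin d → Fin k) → (Fin d → ℕ) → ℤ),
      (∀ a, ∀ n ∈ cells d b j, |τ * z a n| ≤ M * ((b : ℝ) ^ j) ^ d) ∧
      (∀ a, ((((2 ^ (c₁ * (ndist J j + 1)) - 1) * (∑ n ∈ cells d b j,
          ((z a n).natAbs + ((2 ^ (c₁ * (ndist J j + 1)) - 1) - 1)) /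
            (2 ^ (c₁ * (ndist J j + 1)) - 1)) + b ^ (d * j) : ℕ) : ℝ) ≤
        ((2 ^ (c₁ * (ndist J j + 1)) - 1 : ℕ) : ℝ) *
          ((M + 3) * ((b : ℝ) ^ ((J : ℝ) * d) * (b : ℝ) ^ (-(η * (ndist J j : ℝ))))))) ∧
      eLpNorm (fun x => tpoly (fun a => c a (cellAt b j x) - τ * z a (cellAt b j x))
          (localAt b j x)) p (volume.restrict (unitCube d)) ≤
        ENNReal.ofReal ((k : ℝ) ^ d *
          (M * (b : ℝ) ^ (-((J : ℝ) * s) - η * (ndist J j : ℝ)))) := by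
  have hB : (1 : ℝ) ≤ b := by exact_mod_cast (by omega : 1 ≤ b)
  have hB0 : (0 : ℝ) < b := by linarith
  have hM0 : 0 < M := by linarith
  have hq0 : 0 < q := by linarith
  have hd1 : (1 : ℝ) ≤ d := by exact_mod_cast hd
  have hjd : ((b : ℝ) ^ j) ^ d = (b : ℝ) ^ ((j : ℝ) * d) := by
    rw [← pow_mul, ← Real.rpow_natCast, Nat.cast_mul]
  have hbd : ((b ^ (d * j) : ℕ) : ℝ) = (b : ℝ) ^ ((j : ℝ) * d) := by
    rw [← hjd, mul_comm d j, pow_mul]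
    push_cast
    rfl
  have hca : ∀ a, ∀ n ∈ cells d b j, |c a n| ≤ M * ((b : ℝ) ^ j) ^ d := by
    intro a n hn
    refine (abs_le_of_rpow_le (s := s) (j := j) (d := d) hB hM hq ?_).trans ?_
    · rw [← hjd]
      refine le_trans ?_ (hc a)
      exact single_le_sum (f := fun n => |c a n| ^ q) (fun n _ => by positivity) hn
    · rw [hjd]
      refine mul_le_mul_of_nonneg_left (Real.rpow_le_rpow_of_exponent_le hB ?_) hM0.le
      refine mul_le_mul_of_nonneg_left ?_ (by positivity)
      have : (d : ℝ) / q ≤ d := div_le_self (by positivity) hq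
      linarith
  have hVm := le_two_pow_sub_one (m := ndist J j) hc₁ (by omega) hV
  have hV1 : 1 ≤ 2 ^ (c₁ * (ndist J j + 1)) - 1 := by
    have : 2 ^ 1 ≤ 2 ^ (c₁ * (ndist J j + 1)) :=
      Nat.pow_le_pow_right (by norm_num) (Nat.mul_pos hc₁ (by omega))
    omega
  generalize 2 ^ (c₁ * (ndist J j + 1)) - 1 = V at hVm hV1 ⊢
  have hV1' : (1 : ℝ) ≤ V := by exact_mod_cast hV1
  obtain ⟨m, hm⟩ : ∃ m : ℝ, (ndist J j : ℝ) = m := ⟨_, rfl⟩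
  have hm0 : 0 ≤ m := by rw [← hm]; positivity
  rw [hm] at hVm ⊢
  obtain ⟨N, hN⟩ : ∃ N : ℝ, (b : ℝ) ^ ((J : ℝ) * d) * (b : ℝ) ^ (-(η * m)) = N := ⟨_, rfl⟩
  have hN0 : 0 < N := by rw [← hN]; positivity
  -- Lattice points of a fixed step.
  have key : ∀ τ : ℝ, 0 < τ → ∃ z : (Fin d → Fin k) → (Fin d → ℕ) → ℤ,
      ∀ a n, |(z a n : ℝ)| ≤ |c a n| / τ ∧ |c a n - τ * z a n| ≤ τ ∧
        |c a n - τ * z a n| ≤ |c a n| ∧ |τ * z a n| ≤ |c a n| := by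
    intro τ hτ
    choose z h1 h2 h3 using fun (a : Fin d → Fin k) (n : Fin d → ℕ) => exists_int_trunc (c a n / τ)
    refine ⟨z, fun a n => ?_⟩
    have e1 : c a n - τ * z a n = τ * (c a n / τ - z a n) := by field_simp
    have e2 : |c a n / τ| = |c a n| / τ := by rw [abs_div, abs_of_pos hτ]
    have e3 : τ * (|c a n| / τ) = |c a n| := by field_simp
    rw [e1, abs_mul, abs_mul, abs_of_pos hτ]
    refine ⟨(h1 a n).trans_eq e2, ?_, ?_, ?_⟩
    · exact mul_le_of_le_one_right hτ.le (h2 a n)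
    · calc _ ≤ τ * |c a n / τ| := mul_le_mul_of_nonneg_left (h3 a n) hτ.le
        _ = _ := by rw [e2, e3]
    · calc _ ≤ τ * |c a n / τ| := mul_le_mul_of_nonneg_left (h1 a n) hτ.le
        _ = _ := by rw [e2, e3]
  rcases le_total J j with hj | hj
  · have hmj : m = j - J := by
      rw [← hm, ndist, Nat.sub_eq_zero_of_le hj, add_zero, Nat.cast_sub hj]
    have hjR : (J : ℝ) ≤ j := by exact_mod_cast hj
    obtain ⟨τ, hτ⟩ : ∃ τ : ℝ,
        (b : ℝ) ^ (-((J : ℝ) * s) - (j - J) * (s - d / q) + η * (j - J)) = τ :=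
      ⟨_, rfl⟩
    have hτ0 : 0 < τ := by rw [← hτ]; positivity
    obtain ⟨z, hz⟩ := key τ hτ0
    refine ⟨τ, z, fun a n hn => (hz a n).2.2.2.trans (hca a n hn), fun a => ?_, ?_⟩
    · have h1 := sum_ceil_div_le (cells d b j) (fun n => (z a n).natAbs) hV1
      have h2 := sum_natAbs_le_sum_rpow (cells d b j) (z a) hq
      have h3 : ∑ n ∈ cells d b j, |(z a n : ℝ)| ^ q ≤ M * N := by
        calc _ ≤ ∑ n ∈ cells d b j, |c a n| ^ q / τ ^ q := by
              refine sum_le_sum fun n _ => ?_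
              rw [← Real.div_rpow (abs_nonneg _) hτ0.le]
              exact Real.rpow_le_rpow (abs_nonneg _) (hz a n).1 hq0.le
          _ = (∑ n ∈ cells d b j, |c a n| ^ q) / τ ^ q := by rw [sum_div]
          _ ≤ (M * (b : ℝ) ^ (-((j : ℝ) * s * q)) * (b : ℝ) ^ ((j : ℝ) * d)) / τ ^ q := by
              rw [← hjd]
              exact div_le_div_of_nonneg_right (hc a) (by positivity)
          _ ≤ M * N := by
              rw [← hτ, ← hN, hmj]
              exact fine_cost_le hB hM0.le hq hη0 hjR
      have h4 : (b : ℝ) ^ ((j : ℝ) * d) ≤ V * N := by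
        calc _ ≤ (b : ℝ) ^ (((d : ℝ) + s + 2) * m) * N := by
              rw [← hN, ← Real.rpow_add hB0, ← Real.rpow_add hB0]
              refine Real.rpow_le_rpow_of_exponent_le hB ?_
              have : 0 ≤ m * (s + 2 - η) := mul_nonneg hm0 (by linarith)
              have : (j : ℝ) * d = J * d + m * d := by rw [hmj]; ring
              linarith
          _ ≤ _ := by gcongr
      have h5 : ((∑ n ∈ cells d b j, ((z a n).natAbs + (V - 1)) / V : ℕ) : ℝ) ≤ M * N :=
        le_trans (by exact_mod_cast h1) (h2.trans h3)
      rw [Nat.cast_add, hbd, Nat.cast_mul, hN]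
      calc _ ≤ (V : ℝ) * (M * N) + V * N := by gcongr
        _ ≤ _ := by
          have : 0 ≤ (V : ℝ) * N := by positivity
          nlinarith
    · refine (eLpNorm_piecewise_tpoly_le (by omega) j (fun a n => c a n - τ * z a n) hq0 hp hqp
        (S := τ) (T := M * (b : ℝ) ^ (-((j : ℝ) * s * q))) hτ0 (by positivity)
        (fun a n _ => (hz a n).2.1) (fun a => le_trans (sum_le_sum fun n _ => ?_) (hc a))).trans ?_
      · exact Real.rpow_le_rpow (abs_nonneg _) (hz a n).2.2.1 hq0.le
      · refine ENNReal.ofReal_le_ofReal (mul_le_mul_of_nonneg_left ?_ (by positivity))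
        rw [← hτ, hmj]
        refine fine_error_le hB hM hq (by positivity) ?_ hη0 hη hjR
        rcases eq_or_ne p ⊤ with h | h
        · rw [h]; simp
        · have h6 := (ENNReal.ofReal_le_iff_le_toReal h).1 hqp
          rw [mul_one_div, div_le_one (by linarith)]
          exact h6
  · have hmj : m = J - j := by
      rw [← hm, ndist, Nat.sub_eq_zero_of_le hj, zero_add, Nat.cast_sub hj]
    have hjR : (j : ℝ) ≤ J := by exact_mod_cast hj
    obtain ⟨τ, hτ⟩ : ∃ τ : ℝ, (b : ℝ) ^ (-((J : ℝ) * s) - η * (J - j)) = τ := ⟨_, rfl⟩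
    have hτ0 : 0 < τ := by rw [← hτ]; positivity
    obtain ⟨z, hz⟩ := key τ hτ0
    refine ⟨τ, z, fun a n hn => (hz a n).2.2.2.trans (hca a n hn), fun a => ?_, ?_⟩
    · have h1 := mul_sum_ceil_div_le (cells d b j) (fun n => (z a n).natAbs) (V := V)
      have h2 : ((∑ n ∈ cells d b j, (z a n).natAbs : ℕ) : ℝ) ≤ (1 + M) * (V * N) := by
        have h3 : ∑ n ∈ cells d b j, |c a n| ≤
            (1 + M) * (b : ℝ) ^ (-((j : ℝ) * s)) * (cells d b j).card := by
          refine sum_abs_le_of_sum_rpow_le _ _ (by positivity) hq ?_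
          rw [card_cells, ← Real.rpow_mul hB0.le, neg_mul]
          exact hc a
        calc ((∑ n ∈ cells d b j, (z a n).natAbs : ℕ) : ℝ)
            = ∑ n ∈ cells d b j, |(z a n : ℝ)| := by
              push_cast
              exact sum_congr rfl fun n _ => by rw [Nat.cast_natAbs, Int.cast_abs]
          _ ≤ ∑ n ∈ cells d b j, |c a n| / τ := sum_le_sum fun n _ => (hz a n).1
          _ = (∑ n ∈ cells d b j, |c a n|) / τ := by rw [sum_div]
          _ ≤ (1 + M) * (b : ℝ) ^ (-((j : ℝ) * s)) * (cells d b j).card / τ := by gcongr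
          _ = (1 + M) * ((b : ℝ) ^ (-((j : ℝ) * s)) * (b : ℝ) ^ ((j : ℝ) * d) / τ) := by
              rw [card_cells, hjd]
              ring
          _ ≤ (1 + M) * ((b : ℝ) ^ (((d : ℝ) + s + 2) * m) * N) := by
              refine mul_le_mul_of_nonneg_left ?_ (by linarith)
              rw [← hτ, ← hN, hmj]
              exact coarse_cost_le hB hη1 (by positivity) hjR
          _ ≤ _ := by gcongr
      have h4 : (b : ℝ) ^ ((j : ℝ) * d) ≤ N := by
        rw [← hN, ← Real.rpow_add hB0]
        refine Real.rpow_le_rpow_of_exponent_le hB ?_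
        have : 0 ≤ m * (d - η) := mul_nonneg hm0 (by linarith)
        have : (j : ℝ) * d = J * d - m * d := by rw [hmj]; ring
        linarith
      have h5 : ((V * ∑ n ∈ cells d b j, ((z a n).natAbs + (V - 1)) / V : ℕ) : ℝ) ≤
          (1 + M) * (V * N) + V * N := by
        refine (Nat.cast_le.2 h1).trans ?_
        rw [Nat.cast_add, Nat.cast_mul V, card_cells, hjd]
        gcongr
      rw [Nat.cast_add, hbd, hN]
      have h6 : N ≤ V * N := le_mul_of_one_le_left hN0.le hV1'
      calc _ ≤ (1 + M) * (V * N) + V * N + V * N := by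
            refine add_le_add h5 (h4.trans h6)
        _ = _ := by ring
    · refine (eLpNorm_piecewise_tpoly_le (by omega) j (fun a n => c a n - τ * z a n) hq0 hp hqp
        (S := τ) (T := τ ^ q) hτ0 (by positivity)
        (fun a n _ => (hz a n).2.1) (fun a => ?_)).trans ?_
      · calc _ ≤ ∑ n ∈ cells d b j, τ ^ q :=
              sum_le_sum fun n _ => Real.rpow_le_rpow (abs_nonneg _) (hz a n).2.1 hq0.le
          _ = _ := by rw [sum_const, nsmul_eq_mul, card_cells, mul_comm]
      · refine ENNReal.ofReal_le_ofReal (mul_le_mul_of_nonneg_left ?_ (by positivity))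
        have e : τ ^ (1 - q * (1 / p.toReal)) * (τ ^ q) ^ (1 / p.toReal) = τ := by
          rw [← Real.rpow_mul hτ0.le, ← Real.rpow_add hτ0, sub_add_cancel, Real.rpow_one]
        rw [e, hmj, hτ]
        exact le_mul_of_one_le_left hτ0.le hM

end QuantizedLevels

section QuantizedApproximation

lemma tpoly_zero {d k : ℕ} (y : Fin d → ℝ) : tpoly (fun _ : Fin d → Fin k => (0 : ℝ)) y = 0 := by
  simp [tpoly]

set_option maxHeartbeats 1000000 in
open Filter Topology in
theorem exists_quantized_approximation {d k b : ℕ} (hd : 1 ≤ d) (hk : 1 ≤ k) (hb : 2 ≤ b)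
    {s q : ℝ} {p : ℝ≥0∞} (hs : 0 < s) (hq : 1 ≤ q) (hp : 1 ≤ p) (hqp : ENNReal.ofReal q ≤ p)
    (hemb : d * (1 / q - 1 / p.toReal) < s) :
    ∃ (c₁ A₀ κ : ℕ) (ρ C : ℝ), 1 ≤ c₁ ∧ 0 < ρ ∧ ρ < 1 ∧ 0 ≤ C ∧ ∀ N : ℕ, b ≤ N →
      ∀ f : (Fin d → ℝ) → ℝ, Measurable f →
      eLpNorm f (ENNReal.ofReal q) (volume.restrict (unitCube d)) ≤ 1 →
      (∀ t, 0 < t → modulus d k (ENNReal.ofReal q) f t ≤ ENNReal.ofReal (t ^ s)) →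
      ∃ (J Jm : ℕ) (z : ℕ → (Fin d → Fin k) → (Fin d → ℕ) → ℤ) (τ : ℕ → ℝ),
        b ^ Jm ≤ N ^ κ ∧
        (∀ j ≤ Jm, ∀ a, ∀ n ∈ cells d b j, |τ j * z j a n| ≤ (N : ℝ) ^ κ) ∧
        (∀ j ≤ Jm, ∀ a, (((2 ^ (c₁ * (ndist J j + 1)) - 1) * (∑ n ∈ cells d b j,
            ((z j a n).natAbs + ((2 ^ (c₁ * (ndist J j + 1)) - 1) - 1)) /
              (2 ^ (c₁ * (ndist J j + 1)) - 1)) + b ^ (d * j) : ℕ) : ℝ) ≤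
          ((2 ^ (c₁ * (ndist J j + 1)) - 1 : ℕ) : ℝ) *
            (A₀ * (N : ℝ) ^ 2 * ρ ^ (2 * ndist J j))) ∧
        eLpNorm (fun x => f x - ∑ j ∈ range (Jm + 1),
          tpoly (fun a => τ j * z j a (cellAt b j x)) (localAt b j x)) p
          (volume.restrict (unitCube d)) ≤ ENNReal.ofReal (C * (N : ℝ) ^ (-(2 * s) / d)) := by
  obtain ⟨M, hM, hMf⟩ := exists_multiscale_coeffs d (s := s) hk hq hb
  have hB1 : (1 : ℝ) < b := by exact_mod_cast (by omega : 1 < b)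
  have hB : (1 : ℝ) ≤ b := hB1.le
  have hB0 : (0 : ℝ) < b := by linarith
  have hM0 : 0 < M := by linarith
  have hq0 : 0 < q := by linarith
  have hd0 : (0 : ℝ) < d := by exact_mod_cast hd
  obtain ⟨ε, hε⟩ : ∃ ε, ε = s - d * (1 / q - 1 / p.toReal) := ⟨_, rfl⟩
  have hε0 : 0 < ε := by rw [hε]; linarith
  obtain ⟨η, hη⟩ : ∃ η, η = min (ε / 2) 1 := ⟨_, rfl⟩
  have hη0 : 0 < η := by rw [hη]; exact lt_min (by linarith) one_pos
  have hη1 : η ≤ 1 := by rw [hη]; exact min_le_right _ _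
  have hηε : 2 * η ≤ ε := by
    have : η ≤ ε / 2 := by rw [hη]; exact min_le_left _ _
    linarith
  obtain ⟨w, hw⟩ : ∃ w, w = (b : ℝ) ^ (-η) := ⟨_, rfl⟩
  have hw0 : 0 < w := by rw [hw]; positivity
  have hw1 : w < 1 := by
    rw [hw]
    exact Real.rpow_lt_one_of_one_lt_of_neg hB1 (by linarith)
  have hwm : ∀ m : ℕ, (b : ℝ) ^ (-(η * (m : ℝ))) = w ^ m := fun m => by
    rw [hw, ← Real.rpow_natCast, ← Real.rpow_mul hB0.le, neg_mul]
  obtain ⟨E, hE⟩ : ∃ E : ℕ, E = ⌈2 * s / ε⌉₊ + 1 := ⟨_, rfl⟩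
  have hEs : 2 * s ≤ E * ε := by
    have := Nat.le_ceil (2 * s / ε)
    rw [div_le_iff₀ hε0] at this
    rw [hE]
    push_cast
    linarith
  have hV : (b : ℝ) ^ ((d : ℝ) + s + 2) ≤ 2 ^ (b * (d + ⌈s⌉₊ + 2)) := by
    calc (b : ℝ) ^ ((d : ℝ) + s + 2) ≤ (b : ℝ) ^ (((d + ⌈s⌉₊ + 2 : ℕ) : ℝ)) := by
          refine Real.rpow_le_rpow_of_exponent_le hB ?_
          push_cast
          have := Nat.le_ceil s
          linarith
      _ ≤ (2 ^ b) ^ (d + ⌈s⌉₊ + 2) := by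
          rw [Real.rpow_natCast]
          have : (b : ℝ) ≤ 2 ^ b := by exact_mod_cast Nat.lt_two_pow_self.le
          gcongr
      _ = _ := by rw [← pow_mul]
  obtain ⟨D, hD⟩ : ∃ D : ℝ, D = (k : ℝ) ^ d * M * (2 * (1 - w)⁻¹) := ⟨_, rfl⟩
  have hD0 : 0 ≤ D := by
    have : 0 < 1 - w := by linarith
    rw [hD]; positivity
  refine ⟨b * (d + ⌈s⌉₊ + 2), ⌈M⌉₊ + 3, ⌈M⌉₊ + 3 * E * d, (b : ℝ) ^ (-(η / 2)),
    D * (b : ℝ) ^ s, Nat.mul_pos (by omega) (by omega), by positivity,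
    Real.rpow_lt_one_of_one_lt_of_neg hB1 (by linarith), by positivity, ?_⟩
  intro N hN f hf hf1 hf2
  obtain ⟨c, hc, hclose⟩ := hMf f hf hf1 hf2
  have hc' : ∀ j a, ∑ n ∈ cells d b j, |c j a n| ^ q ≤
      M * (b : ℝ) ^ (-((j : ℝ) * s * q)) * ((b : ℝ) ^ j) ^ d := by
    intro j a
    refine (hc j a).trans (le_of_eq ?_)
    rw [← Real.rpow_mul (by positivity), ← Real.rpow_natCast (b : ℝ) j, ← Real.rpow_mul hB0.le,
      mul_right_comm]
    congr 3
    ring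
  obtain ⟨J, hJ⟩ : ∃ J, J = Nat.log (b ^ d) (N ^ 2) := ⟨_, rfl⟩
  have hN0 : 0 < N := by omega
  have hNR : (0 : ℝ) < N := by exact_mod_cast hN0
  have hJ1 : (b ^ d) ^ J ≤ N ^ 2 := by rw [hJ]; exact Nat.pow_log_le_self _ (by positivity)
  have hJ2 : N ^ 2 < (b ^ d) ^ (J + 1) := by
    rw [hJ]
    exact Nat.lt_pow_succ_log_self (Nat.one_lt_pow (by omega) (by omega)) _
  have hJ1' : (b : ℝ) ^ ((J : ℝ) * d) ≤ (N : ℝ) ^ 2 := by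
    have e : (b : ℝ) ^ ((J : ℝ) * d) = (((b ^ d) ^ J : ℕ) : ℝ) := by
      rw [mul_comm, ← Nat.cast_mul, Real.rpow_natCast, pow_mul]
      push_cast
      rfl
    rw [e]
    exact_mod_cast hJ1
  obtain ⟨Jm, hJm⟩ : ∃ Jm, Jm = E * (J + 1) := ⟨_, rfl⟩
  have hbJ : b ^ (J + 1) ≤ N ^ 3 := by
    rw [pow_succ, pow_succ N 2]
    refine Nat.mul_le_mul (le_trans ?_ hJ1) hN
    rw [← pow_mul]
    exact Nat.pow_le_pow_right (by omega) (Nat.le_mul_of_pos_left J hd)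
  have hbJm : b ^ Jm ≤ N ^ (3 * E) := by
    rw [hJm, mul_comm E, pow_mul, pow_mul]
    exact Nat.pow_le_pow_left hbJ E
  have hMN : M ≤ (N : ℝ) ^ ⌈M⌉₊ := by
    calc M ≤ ⌈M⌉₊ := Nat.le_ceil M
      _ ≤ (2 : ℝ) ^ ⌈M⌉₊ := by exact_mod_cast Nat.lt_two_pow_self.le
      _ ≤ _ := by
        have : (2 : ℝ) ≤ N := by exact_mod_cast hb.trans hN
        gcongr
  choose τ z h1 h2 h3 using fun j => exists_quantized_level hb
    (Nat.mul_pos (by omega) (by omega)) hd hs hq hM hp hqp hV hη0.le hη1 (hηε.trans_eq hε) J j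
    (c j) (hc' j)
  refine ⟨J, Jm, fun j a n => if j ≤ Jm then z j a n else 0, τ, ?_, ?_, ?_, ?_⟩
  · exact hbJm.trans (Nat.pow_le_pow_right hN0 ((Nat.le_mul_of_pos_right _ hd).trans
      (Nat.le_add_left _ _)))
  · intro j hj a n hn
    simp only [hj, if_true]
    refine (h1 j a n hn).trans ?_
    rw [pow_add, pow_mul]
    refine mul_le_mul hMN ?_ (by positivity) (by positivity)
    refine pow_le_pow_left₀ (by positivity) ?_ _
    exact_mod_cast (Nat.pow_le_pow_right (by omega) hj).trans hbJm
  · intro j hj a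
    simp only [hj, if_true]
    refine (h2 j a).trans (mul_le_mul_of_nonneg_left ?_ (by positivity))
    rw [hwm]
    have e : ((b : ℝ) ^ (-(η / 2))) ^ (2 * ndist J j) = w ^ ndist J j := by
      rw [pow_mul, hw, ← Real.rpow_natCast _ 2, ← Real.rpow_mul hB0.le]
      congr 2
      push_cast
      ring
    rw [e, ← mul_assoc]
    have : M + 3 ≤ ((⌈M⌉₊ + 3 : ℕ) : ℝ) := by
      push_cast
      have := Nat.le_ceil M
      linarith
    gcongr
  · set z' : ℕ → (Fin d → Fin k) → (Fin d → ℕ) → ℤ :=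
      fun j a n => if j ≤ Jm then z j a n else 0 with hz'
    have hlevel : ∀ j, eLpNorm (fun x => tpoly (fun a => c j a (cellAt b j x) -
        τ j * z' j a (cellAt b j x)) (localAt b j x)) p (volume.restrict (unitCube d)) ≤
        ENNReal.ofReal ((k : ℝ) ^ d * M * (b : ℝ) ^ (-((J : ℝ) * s)) * w ^ ndist J j) := by
      intro j
      have e : (k : ℝ) ^ d * M * (b : ℝ) ^ (-((J : ℝ) * s)) * w ^ ndist J j =
          (k : ℝ) ^ d * (M * (b : ℝ) ^ (-((J : ℝ) * s) - η * (ndist J j : ℝ))) := by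
        rw [← hwm, sub_eq_add_neg, Real.rpow_add hB0]
        ring
      rw [e]
      by_cases hj : j ≤ Jm
      · simp only [hz', hj, if_true]
        exact h3 j
      · simp only [hz', hj, if_false, Int.cast_zero, mul_zero, sub_zero]
        have hJJ : J ≤ j := by
          have : J + 1 ≤ Jm := by
            rw [hJm]
            exact Nat.le_mul_of_pos_left _ (by omega)
          omega
        refine tail_level_le hb hq hM hp hqp hη0.le (hηε.trans_eq hε) hJJ ?_ (c j) (hc' j)
        rw [← hε]
        have h5 : ((E : ℝ) * (J + 1)) ≤ j := by
          have : E * (J + 1) ≤ j := by omega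
          exact_mod_cast this
        calc 2 * ((J : ℝ) * s) = J * (2 * s) := by ring
          _ ≤ J * (E * ε) := by gcongr
          _ = E * J * ε := by ring
          _ ≤ (E * (J + 1)) * ε := by gcongr; linarith
          _ ≤ _ := by gcongr
    set u : ℕ → (Fin d → ℝ) → ℝ :=
      fun j x => tpoly (fun a => c j a (cellAt b j x)) (localAt b j x) with hu
    set v : ℕ → (Fin d → ℝ) → ℝ :=
      fun j x => tpoly (fun a => τ j * z' j a (cellAt b j x)) (localAt b j x) with hv
    have hum : ∀ j, Measurable (u j) := fun j =>
      measurable_piecewise_tpoly b j fun n a => c j a n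
    have hvm : ∀ j, Measurable (v j) := fun j =>
      measurable_piecewise_tpoly b j fun n a => τ j * z' j a n
    have huv : ∀ j, (fun x => tpoly (fun a => c j a (cellAt b j x) -
        τ j * z' j a (cellAt b j x)) (localAt b j x)) = fun x => u j x - v j x := fun j => by
      funext x
      exact tpoly_sub _ _ _
    refine eLpNorm_sub_le_of_tendsto (F := fun n x => ∑ i ∈ range (n + 1), u i x)
      (q := ENNReal.ofReal q) (fun n => ?_) hf.aestronglyMeasurable ?_
      (by simpa using hq0) ?_ ?_
    · exact (Finset.measurable_sum _ fun i _ => hum i).aestronglyMeasurable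
    · exact (Finset.measurable_sum _ fun i _ => hvm i).aestronglyMeasurable
    · have hlim : Tendsto (fun j : ℕ => ENNReal.ofReal (M * ((b : ℝ) ^ j) ^ (-s))) atTop (𝓝 0) := by
        rw [← ENNReal.ofReal_zero]
        refine (ENNReal.continuous_ofReal.tendsto 0).comp ?_
        have : ∀ j : ℕ, ((b : ℝ) ^ j) ^ (-s) = ((b : ℝ) ^ (-s)) ^ j := fun j => by
          rw [← Real.rpow_natCast, ← Real.rpow_mul hB0.le, ← Real.rpow_natCast,
            ← Real.rpow_mul hB0.le, mul_comm]
        simp only [this]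
        rw [← mul_zero M]
        exact (_root_.tendsto_pow_atTop_nhds_zero_of_lt_one (by positivity)
          (Real.rpow_lt_one_of_one_lt_of_neg hB1 (by linarith))).const_mul M
      exact tendsto_of_tendsto_of_tendsto_of_le_of_le tendsto_const_nhds hlim
        (fun _ => zero_le) hclose
    · filter_upwards [eventually_ge_atTop Jm] with n hn
      have hG : ∀ x, ∑ j ∈ range (Jm + 1), v j x = ∑ j ∈ range (n + 1), v j x := by
        intro x
        refine sum_subset (range_subset_range.2 (by omega)) fun j _ hj => ?_
        have hj' : ¬ j ≤ Jm := by
          rw [mem_range] at hj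
          omega
        simp only [hv, hz', hj', if_false, Int.cast_zero, mul_zero]
        exact tpoly_zero _
      have e1 : (fun x => ∑ i ∈ range (n + 1), u i x - ∑ j ∈ range (Jm + 1), v j x) =
          ∑ j ∈ range (n + 1), fun x => u j x - v j x := by
        funext x
        rw [hG, Finset.sum_apply, ← sum_sub_distrib]
      rw [e1]
      refine (eLpNorm_sum_le (fun j _ => ((hum j).sub (hvm j)).aestronglyMeasurable) hp).trans ?_
      have h6 : ∀ j ∈ range (n + 1), eLpNorm (fun x => u j x - v j x) p
          (volume.restrict (unitCube d)) ≤
          ENNReal.ofReal ((k : ℝ) ^ d * M * (b : ℝ) ^ (-((J : ℝ) * s)) * w ^ ndist J j) :=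
        fun j _ => by rw [← huv]; exact hlevel j
      refine (sum_le_sum h6).trans ?_
      rw [← ENNReal.ofReal_sum_of_nonneg fun j _ => by positivity]
      refine ENNReal.ofReal_le_ofReal ?_
      rw [← mul_sum]
      have h7 : ∑ j ∈ range (n + 1), w ^ ndist J j ≤ 2 * (1 - w)⁻¹ := by
        refine (sum_ndist_le (range (n + 1)) J (n + J + 1) (fun j hj => ?_) (fun m => w ^ m)
          fun m => by positivity).trans ?_
        · rw [mem_range] at hj
          unfold ndist
          omega
        · rw [nsmul_eq_mul]
          refine mul_le_mul_of_nonneg_left ?_ (by positivity)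
          rw [← tsum_geometric_of_lt_one hw0.le hw1]
          exact (summable_geometric_of_lt_one hw0.le hw1).sum_le_tsum _ fun m _ => by positivity
      have h8 : (b : ℝ) ^ (-((J : ℝ) * s)) ≤ (b : ℝ) ^ s * (N : ℝ) ^ (-(2 * s) / d) := by
        have h9 : (N : ℝ) ^ (2 * s / d) ≤ (b : ℝ) ^ (((J : ℝ) + 1) * s) := by
          calc (N : ℝ) ^ (2 * s / d) = ((N : ℝ) ^ 2) ^ (s / d) := by
                rw [← Real.rpow_natCast, ← Real.rpow_mul hNR.le]
                congr 1
                push_cast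
                ring
            _ ≤ (((b ^ d) ^ (J + 1) : ℕ) : ℝ) ^ (s / d) := by
                refine Real.rpow_le_rpow (by positivity) ?_ (by positivity)
                exact_mod_cast hJ2.le
            _ = _ := by
                push_cast
                rw [← pow_mul, ← Real.rpow_natCast, ← Real.rpow_mul hB0.le]
                congr 1
                push_cast
                field_simp
        rw [neg_div, Real.rpow_neg hNR.le, ← div_eq_mul_inv, le_div_iff₀ (by positivity)]
        calc _ ≤ (b : ℝ) ^ (-((J : ℝ) * s)) * (b : ℝ) ^ (((J : ℝ) + 1) * s) := by gcongr
          _ = _ := by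
            rw [← Real.rpow_add hB0]
            congr 1
            ring
      calc _ ≤ (k : ℝ) ^ d * M * ((b : ℝ) ^ s * (N : ℝ) ^ (-(2 * s) / d)) * (2 * (1 - w)⁻¹) := by
            gcongr
        _ = _ := by
            rw [hD]
            ring

end QuantizedApproximation

section Assembly

lemma IsAffineMap.measurable {n m : ℕ} {A : (Fin n → ℝ) → Fin m → ℝ} (hA : IsAffineMap A) :
    Measurable A := by
  obtain ⟨M, c, h⟩ := hA
  refine measurable_pi_lambda _ fun i => ?_
  simp only [h]
  exact (Finset.measurable_sum _ fun j _ => (measurable_pi_apply j).const_mul _).add_const _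

lemma measurable_of_mem_NN {d k W L : ℕ} {g : (Fin d → ℝ) → Fin k → ℝ} (hg : g ∈ NN d k W L) :
    Measurable g := by
  unfold NN at hg
  induction L generalizing d with
  | zero => exact IsAffineMap.measurable hg
  | succ L ih =>
    obtain ⟨N, -, -, A, h, hA, hh, rfl⟩ := hg
    refine (ih hh).comp (measurable_pi_lambda _ fun i => ?_)
    exact ((measurable_pi_apply i).comp hA.measurable).max measurable_const

lemma exists_NN_smul {d W W' L L' : ℕ} {g : (Fin d → ℝ) → Fin 1 → ℝ} (hg : g ∈ NN d 1 W L)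
    (hW : W ≤ W') (hW' : 2 ≤ W') (hL : L ≤ L') (c : ℝ) :
    ∃ g' ∈ NN d 1 W' L', ∀ x i, g' x i = c * g x i := by
  classical
  have h1 := (Net.of_NNaux (X := Fin d → ℝ) id g hg).mono hW le_rfl le_rfl
  have e : Set.range (fun (i : Fin 1) (x : Fin d → ℝ) => g (id x) i) =
      ((univ.image fun (i : Fin 1) (x : Fin d → ℝ) => g x i : Finset _) :
        Set ((Fin d → ℝ) → ℝ)) := by
    simp
  rw [e] at h1
  have hcard : (univ.image fun (i : Fin 1) (x : Fin d → ℝ) => g x i).card ≤ 1 := by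
    refine card_image_le.trans ?_
    simp
  have h2 := h1.pad (by omega) hL
  refine Net.exists_NNaux (by omega) id h2 (fun i x => c * g x i) fun i => ?_
  refine Submodule.smul_mem _ c (mem_aff (f := fun x => g x i) ?_)
  exact mem_coe.2 (mem_image_of_mem (fun (i : Fin 1) (x : Fin d → ℝ) => g x i) (mem_univ i))

lemma exists_zero_mem_NN {d W L : ℕ} (hW : 2 ≤ W) :
    ∃ g ∈ NN d 1 W L, ∀ x i, g x i = 0 := by
  have h : (fun _ _ => 0 : (Fin d → ℝ) → Fin 1 → ℝ) ∈ NN d 1 1 0 := ⟨0, 0, fun x i => by simp⟩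
  obtain ⟨g, hg, hg'⟩ := exists_NN_smul h (by omega) hW (Nat.zero_le L) 0
  exact ⟨g, hg, fun x i => by rw [hg', zero_mul]⟩

lemma exists_base_approximation {d k b : ℕ} (hd : 1 ≤ d) (hk : 1 ≤ k) (hb : 2 ≤ b)
    {s q : ℝ} {p : ℝ≥0∞} (hs : 0 < s) (hq : 1 ≤ q) (hp : 1 ≤ p) (hqp : ENNReal.ofReal q ≤ p)
    (hemb : d * (1 / q - 1 / p.toReal) < s) :
    ∃ (C₀ : ℕ) (C : ℝ), 1 ≤ C₀ ∧ 0 ≤ C ∧ ∀ β L : ℕ, 1 ≤ β → 1 ≤ L →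
      ∀ f : (Fin d → ℝ) → ℝ, Measurable f →
      eLpNorm f (ENNReal.ofReal q) (volume.restrict (unitCube d)) ≤ 1 →
      (∀ t, 0 < t → modulus d k (ENNReal.ofReal q) f t ≤ ENNReal.ofReal (t ^ s)) →
      ∃ G : (Fin d → ℝ) → ℝ, Measurable G ∧
        (∃ Jg : ℕ, ∀ δ : ℝ, 0 < δ → ∃ g ∈ NN d 1 (C₀ * b ^ β) (C₀ * L), ∀ x : Fin d → ℝ,
          (∀ i, Good (b ^ Jg) δ (x i)) →
          |g x 0 - G x| ≤ ((b ^ β * L : ℕ) : ℝ) ^ (-(2 * s) / d)) ∧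
        eLpNorm (fun x => f x - G x) p (volume.restrict (unitCube d)) ≤
          ENNReal.ofReal (C * ((b ^ β * L : ℕ) : ℝ) ^ (-(2 * s) / d)) := by
  obtain ⟨c₁, A₀, κ, ρ, C, hc₁, hρ0, hρ1, hC, H⟩ :=
    exists_quantized_approximation hd hk hb hs hq hp hqp hemb
  obtain ⟨C₀, hC₀, HR⟩ :=
    exists_realization d k b c₁ A₀ hk hb hc₁ hρ0 hρ1 κ ⌈2 * s / d⌉₊
  refine ⟨C₀, C, hC₀, hC, fun β L hβ hL f hf hf1 hf2 => ?_⟩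
  have hbN : b ≤ b ^ β * L :=
    (Nat.le_self_pow (by omega) b).trans (Nat.le_mul_of_pos_right _ hL)
  obtain ⟨J, Jm, z, τ, h1, h2, h3, h4⟩ := H _ hbN f hf hf1 hf2
  obtain ⟨Jg, hJg⟩ := HR β L hβ hL J Jm z τ h1 h2 h3
  refine ⟨_, ?_, ⟨Jg, fun δ hδ => ?_⟩, h4⟩
  · exact Finset.measurable_sum _ fun j _ =>
      measurable_piecewise_tpoly b j fun n a => τ j * z j a n
  · obtain ⟨g, hg, hgx⟩ := hJg δ hδ
    refine ⟨g, hg, fun x hx => (hgx x hx).trans ?_⟩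
    have hN1 : (1 : ℝ) ≤ ((b ^ β * L : ℕ) : ℝ) := by
      exact_mod_cast (by omega : 1 ≤ b ^ β * L)
    rw [one_div, neg_div, Real.rpow_neg (by linarith), ← Real.rpow_natCast]
    refine inv_anti₀ (by positivity) (Real.rpow_le_rpow_of_exponent_le hN1 (Nat.le_ceil _))

lemma le_two_mul_mul_div {n a : ℕ} (ha : 0 < a) (h : a ≤ n) : n ≤ 2 * a * (n / a) := by
  have h1 := Nat.div_add_mod n a
  have h2 := Nat.mod_lt n ha
  have h3 : 1 ≤ n / a := (Nat.one_le_div_iff ha).2 h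
  nlinarith

set_option maxHeartbeats 1000000 in
theorem exists_normalized_approximation {d k : ℕ} (hd : 1 ≤ d) (hk : 1 ≤ k)
    {s q : ℝ} {p : ℝ≥0∞} (hs : 0 < s) (hq : 1 ≤ q) (hp : 1 ≤ p) (hqp : ENNReal.ofReal q ≤ p)
    (hemb : d * (1 / q - 1 / p.toReal) < s) :
    ∃ (C : ℝ) (W₀ L₀ : ℕ), 0 ≤ C ∧ 2 ≤ W₀ ∧ 1 ≤ L₀ ∧ ∀ W L : ℕ, W₀ ≤ W → L₀ ≤ L →
      ∀ f : (Fin d → ℝ) → ℝ, Measurable f →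
      eLpNorm f (ENNReal.ofReal q) (volume.restrict (unitCube d)) ≤ 1 →
      (∀ t, 0 < t → modulus d k (ENNReal.ofReal q) f t ≤ ENNReal.ofReal (t ^ s)) →
      ∃ g ∈ NN d 1 W L, eLpNorm (fun x => f x - g x 0) p (volume.restrict (unitCube d)) ≤
        ENNReal.ofReal (C * ((W : ℝ) * L) ^ (-(2 * s) / d)) := by
  obtain ⟨b, hb⟩ : ∃ b : Fin (2 * d + 1) → ℕ,
      b = fun u : Fin (2 * d + 1) => Nat.nth Nat.Prime (u : ℕ) :=
    ⟨_, rfl⟩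
  have hbp : ∀ u, (b u).Prime := fun u => by rw [hb]; exact Nat.prime_nth_prime u
  have hcop : ∀ u v, u ≠ v → (b u).Coprime (b v) := by
    intro u v huv
    refine (Nat.coprime_primes (hbp u) (hbp v)).2 fun h => huv ?_
    rw [hb] at h
    exact Fin.ext (Nat.nth_injective Nat.infinite_setOfPred_prime h)
  choose C₀ C hC₀ hC H using fun u =>
    exists_base_approximation hd hk (hbp u).two_le hs hq hp hqp hemb
  obtain ⟨C₁, hcomb⟩ := exists_combined_network d hd
  obtain ⟨S, hS⟩ : ∃ S, S = ∑ u, C₀ u := ⟨_, rfl⟩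
  obtain ⟨bs, hbs⟩ : ∃ bs, bs = ∑ u, b u := ⟨_, rfl⟩
  have hSu : ∀ u, C₀ u ≤ S := fun u => by
    rw [hS]; exact single_le_sum (fun _ _ => Nat.zero_le _) (mem_univ u)
  have hbu : ∀ u, b u ≤ bs := fun u => by
    rw [hbs]; exact single_le_sum (fun _ _ => Nat.zero_le _) (mem_univ u)
  have hS1 : 1 ≤ S := (hC₀ 0).trans (hSu 0)
  have hbs2 : 2 ≤ bs := (hbp 0).two_le.trans (hbu 0)
  obtain ⟨K, hK⟩ : ∃ K : ℕ, K = 32 * (C₁ + 1) * S ^ 2 * bs := ⟨_, rfl⟩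
  have hK0 : 0 < K := by rw [hK]; positivity
  have hKR : (0 : ℝ) < K := by exact_mod_cast hK0
  refine ⟨(∑ u, C u + 1) * (K : ℝ) ^ (2 * s / d), (C₁ + 1) * (S * bs + 2),
    2 * C₁ + S + 1, ?_, ?_, ?_,
    fun W L hW hL f hf hf1 hf2 => ?_⟩
  · have : 0 ≤ ∑ u, C u := sum_nonneg fun u _ => hC u
    positivity
  · calc 2 ≤ 1 * (S * bs + 2) := by omega
      _ ≤ _ := Nat.mul_le_mul_right _ (by omega)
  · omega
  obtain ⟨Y, hY⟩ : ∃ Y, Y = W / (C₁ + 1) := ⟨_, rfl⟩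
  have hY1 : S * bs + 2 ≤ Y := by
    rw [hY, Nat.le_div_iff_mul_le (by omega), mul_comm]
    exact hW
  have hSbs : 2 ≤ S * bs := hbs2.trans (Nat.le_mul_of_pos_left _ hS1)
  obtain ⟨W₁, rfl⟩ : ∃ W₁, Y = W₁ + 1 := ⟨Y - 1, by omega⟩
  obtain ⟨L₁, rfl⟩ : ∃ L₁, L = L₁ + C₁ := ⟨L - C₁, by omega⟩
  have hWW : W ≤ 2 * (C₁ + 1) * (W₁ + 1) := by
    rw [hY]
    refine le_two_mul_mul_div (by omega) (le_trans ?_ hW)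
    exact Nat.le_mul_of_pos_right _ (by omega)
  have hWW' : (C₁ + 1) * (W₁ + 1) ≤ W := by
    rw [hY]
    exact Nat.mul_div_le _ _
  obtain ⟨x, hx⟩ : ∃ x, x = W₁ / S := ⟨_, rfl⟩
  have hxb : bs ≤ x := by
    rw [hx, Nat.le_div_iff_mul_le hS1, mul_comm]
    omega
  have hxW : W₁ ≤ 2 * S * x := by
    rw [hx]
    refine le_two_mul_mul_div hS1 ?_
    have : S ≤ S * bs := Nat.le_mul_of_pos_right _ (by omega)
    omega
  have hxW' : S * x ≤ W₁ := by
    rw [hx]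
    exact Nat.mul_div_le _ _
  obtain ⟨l, hl⟩ : ∃ l, l = L₁ / S := ⟨_, rfl⟩
  have hl1 : 1 ≤ l := by
    rw [hl]
    exact (Nat.one_le_div_iff hS1).2 (by omega)
  have hlL : L₁ ≤ 2 * S * l := by
    rw [hl]
    exact le_two_mul_mul_div hS1 (by omega)
  have hlL' : S * l ≤ L₁ := by
    rw [hl]
    exact Nat.mul_div_le _ _
  have hWL : W * (L₁ + C₁) ≤ 32 * (C₁ + 1) * S ^ 2 * (x * l) := by
    calc W * (L₁ + C₁) ≤ (2 * (C₁ + 1) * (2 * (2 * S * x))) * (2 * (2 * S * l)) := by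
          refine Nat.mul_le_mul (hWW.trans (Nat.mul_le_mul_left _ ?_)) ?_
          · omega
          · omega
      _ = _ := by ring
  set β : Fin (2 * d + 1) → ℕ := fun u => Nat.log (b u) x with hβ
  have hβ1 : ∀ u, 1 ≤ β u := fun u => Nat.log_pos (hbp u).one_lt ((hbu u).trans hxb)
  have hβx : ∀ u, b u ^ β u ≤ x := fun u => Nat.pow_log_le_self _ (by omega)
  have hxβ : ∀ u, x ≤ bs * b u ^ β u := fun u => by
    have h := (Nat.lt_pow_succ_log_self (hbp u).one_lt x).le
    rw [Nat.succ_eq_add_one, pow_succ, mul_comm] at h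
    exact h.trans (Nat.mul_le_mul_right _ (hbu u))
  obtain ⟨ε, hε⟩ : ∃ ε : ℝ, ε = (K : ℝ) ^ (2 * s / d) *
    ((W : ℝ) * ((L₁ + C₁ : ℕ) : ℝ)) ^ (-(2 * s) / d) := ⟨_, rfl⟩
  have hW0 : 0 < W := by
    refine lt_of_lt_of_le ?_ hWW'
    positivity
  have hWLR : (0 : ℝ) < (W : ℝ) * ((L₁ + C₁ : ℕ) : ℝ) := by
    have : 0 < W * (L₁ + C₁) := Nat.mul_pos hW0 (by omega)
    exact_mod_cast this
  have hε0 : 0 ≤ ε := by rw [hε]; positivity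
  have hd0 : (0 : ℝ) < d := by exact_mod_cast hd
  have hNε : ∀ u, ((b u ^ β u * l : ℕ) : ℝ) ^ (-(2 * s) / d) ≤ ε := by
    intro u
    have h1 : W * (L₁ + C₁) ≤ K * (b u ^ β u * l) := by
      refine hWL.trans ?_
      rw [hK, mul_assoc _ bs, ← mul_assoc bs]
      exact Nat.mul_le_mul_left _ (Nat.mul_le_mul_right _ (hxβ u))
    have h2 : (W : ℝ) * ((L₁ + C₁ : ℕ) : ℝ) ≤ K * ((b u ^ β u * l : ℕ) : ℝ) := by
      exact_mod_cast h1
    have h3 : (0 : ℝ) < ((b u ^ β u * l : ℕ) : ℝ) := by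
      have : 0 < b u ^ β u * l := Nat.mul_pos (pow_pos (hbp u).pos _) hl1
      exact_mod_cast this
    have h4 : ((W : ℝ) * ((L₁ + C₁ : ℕ) : ℝ)) ^ (2 * s / d) ≤
        (K : ℝ) ^ (2 * s / d) * ((b u ^ β u * l : ℕ) : ℝ) ^ (2 * s / d) := by
      rw [← Real.mul_rpow hKR.le h3.le]
      exact Real.rpow_le_rpow hWLR.le h2 (by positivity)
    rw [hε, neg_div, Real.rpow_neg h3.le, Real.rpow_neg hWLR.le, ← div_eq_mul_inv,
      le_div_iff₀ (by positivity), inv_mul_le_iff₀ (by positivity)]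
    exact h4.trans_eq (mul_comm _ _)
  choose G hGm hGnet hGclose using fun u => H u (β u) l (hβ1 u) hl1 f hf hf1 hf2
  have hW₁ : 2 ≤ W₁ := by omega
  obtain ⟨g, hg, hgx⟩ := hcomb b W₁ L₁ G ε (fun u => (hbp u).pos) hcop hε0 (fun u => by
    obtain ⟨Jg, hJg⟩ := hGnet u
    refine ⟨Jg, fun δ hδ => ?_⟩
    obtain ⟨g, hg, hgx⟩ := hJg δ hδ
    obtain ⟨g', hg', hgg⟩ := exists_NN_smul hg
      ((Nat.mul_le_mul (hSu u) (hβx u)).trans hxW') hW₁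
      ((Nat.mul_le_mul_right l (hSu u)).trans hlL') 1
    refine ⟨g', hg', fun x hx => ?_⟩
    rw [hgg, one_mul]
    exact (hgx x hx).trans (hNε u))
  obtain ⟨g', hg', hgg⟩ := exists_NN_smul hg
    ((Nat.mul_le_mul_right (W₁ + 1) (Nat.le_succ C₁)).trans hWW')
    (le_trans (by
      calc 2 ≤ 1 * (W₁ + 1) := by omega
        _ ≤ _ := Nat.mul_le_mul_right _ (by omega)) hWW') le_rfl 1
  refine ⟨g', hg', ?_⟩
  have hprob := isProbabilityMeasure_unitCube d
  have hsub : ∀ u, AEStronglyMeasurable (fun x => |f x - G u x|) (volume.restrict (unitCube d)) :=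
    fun u => (hf.sub (hGm u)).abs.aestronglyMeasurable
  calc eLpNorm (fun x => f x - g' x 0) p (volume.restrict (unitCube d))
      ≤ eLpNorm ((∑ u, fun x => |f x - G u x|) + fun _ => ε) p (volume.restrict (unitCube d)) := by
        refine eLpNorm_mono_ae ?_
        filter_upwards [ae_unitCube_mem_Ico d] with x hx
        rw [hgg, one_mul, Pi.add_apply, Finset.sum_apply]
        exact (hgx x (f x) hx).trans (Real.le_norm_self _)
    _ ≤ ∑ u, eLpNorm (fun x => |f x - G u x|) p (volume.restrict (unitCube d)) +
          eLpNorm (fun _ => ε) p (volume.restrict (unitCube d)) := by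
        refine (eLpNorm_add_le (Finset.aestronglyMeasurable_sum _ fun u _ => hsub u)
          aestronglyMeasurable_const hp).trans ?_
        gcongr
        exact eLpNorm_sum_le (fun u _ => hsub u) hp
    _ ≤ ∑ u, ENNReal.ofReal (C u * ε) + ENNReal.ofReal ε := by
        refine add_le_add (sum_le_sum fun u _ => ?_) ?_
        · have e : eLpNorm (fun x => |f x - G u x|) p (volume.restrict (unitCube d)) =
              eLpNorm (fun x => f x - G u x) p (volume.restrict (unitCube d)) :=
            eLpNorm_norm (fun x => f x - G u x)
          rw [e]
          exact (hGclose u).trans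
            (ENNReal.ofReal_le_ofReal (mul_le_mul_of_nonneg_left (hNε u) (hC u)))
        · rw [eLpNorm_const _ (by positivity) (NeZero.ne _)]
          simp [Real.enorm_eq_ofReal hε0]
    _ = _ := by
        rw [← ENNReal.ofReal_sum_of_nonneg fun u _ => mul_nonneg (hC u) hε0,
          ← ENNReal.ofReal_add (sum_nonneg fun u _ => mul_nonneg (hC u) hε0) hε0, ← sum_mul, hε]
        congr 1
        ring

end Assembly

section Main

variable {d : ℕ}

lemma kthDiff_const_mul (k : ℕ) (h : Fin d → ℝ) (c : ℝ) (f : (Fin d → ℝ) → ℝ) :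
    kthDiff d k h (fun x => c * f x) = c • kthDiff d k h f := by
  funext x
  rw [Pi.smul_apply, smul_eq_mul, kthDiff, kthDiff, mul_sum]
  exact sum_congr rfl fun j _ => by ring

lemma modulus_const_mul_le (k : ℕ) (q : ℝ≥0∞) (c : ℝ) (f : (Fin d → ℝ) → ℝ) (t : ℝ) :
    modulus d k q (fun x => c * f x) t ≤ ‖c‖ₑ * modulus d k q f t := by
  refine iSup₂_le fun h hh => ?_
  rw [kthDiff_const_mul, eLpNorm_const_smul]
  exact mul_le_mul' le_rfl
    (le_iSup₂ (f := fun (h : Fin d → ℝ) (_ : Real.sqrt (∑ j, h j ^ 2) < t) =>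
      eLpNorm (kthDiff d k h f) q
        (volume.restrict {x | x ∈ unitCube d ∧ x + (k : ℝ) • h ∈ unitCube d})) h hh)

lemma exists_real_exponent_le {q p : ℝ≥0∞} {τ : ℝ} (hq : 1 ≤ q) (hτ : 0 < τ)
    (h : 1 / q.toReal - 1 / p.toReal < τ) :
    ∃ q' : ℝ, 1 ≤ q' ∧ ENNReal.ofReal q' ≤ q ∧ 1 / q' - 1 / p.toReal < τ := by
  by_cases hqt : q = ⊤
  · refine ⟨max 1 (2 / τ), le_max_left _ _, by simp [hqt], ?_⟩
    have h1 : 1 / max 1 (2 / τ) ≤ 1 / (2 / τ) :=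
      one_div_le_one_div_of_le (by positivity) (le_max_right _ _)
    have h2 : 1 / (2 / τ) = τ / 2 := by field_simp
    have h3 : 0 ≤ 1 / p.toReal := by positivity
    linarith
  · refine ⟨q.toReal, ?_, (ENNReal.ofReal_toReal hqt).le, h⟩
    rw [← ENNReal.toReal_one]
    exact ENNReal.toReal_mono hqt hq

end Main

set_option maxHeartbeats 1000000 in
theorem besov_approximation (d : ℕ) (hd : 1 ≤ d) (s : ℝ) (q r p : ℝ≥0∞)
    (hs : 0 < s) (hq : 1 ≤ q) (hr : 1 ≤ r) (hp : 1 ≤ p)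
    (hemb : 1 / q.toReal - 1 / p.toReal < s / d) :
    ∃ (C : ℝ) (W₀ L₀ : ℕ), 0 < C ∧ 1 ≤ W₀ ∧ 1 ≤ L₀ ∧
      ∀ W L : ℕ, W₀ ≤ W → L₀ ≤ L →
        ∀ f : (Fin d → ℝ) → ℝ, Measurable f → besovNorm d s q r f < ⊤ →
          ∃ g ∈ NN d 1 W L,
            eLpNorm (fun x => f x - g x 0) p (volume.restrict (unitCube d)) ≤
              ENNReal.ofReal C * besovNorm d s q r f *
                ENNReal.ofReal (((W : ℝ) * (L : ℝ)) ^ (-(2 * s) / d)) := by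
  have hd0 : (0 : ℝ) < d := by exact_mod_cast hd
  have hprob := isProbabilityMeasure_unitCube d
  obtain ⟨q', hq'1, hq'q, hq'⟩ := exists_real_exponent_le hq (by positivity : 0 < s / d) hemb
  have hemb' : d * (1 / q' - 1 / (max p (ENNReal.ofReal q')).toReal) < s := by
    rw [mul_comm, ← lt_div_iff₀ hd0]
    rcases le_total p (ENNReal.ofReal q') with h | h
    · rw [max_eq_right h, ENNReal.toReal_ofReal (by linarith), _root_.sub_self]
      positivity
    · rwa [max_eq_left h]
  obtain ⟨C, W₀, L₀, hC, hW₀, hL₀, H⟩ := exists_normalized_approximation hd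
    (Nat.le_add_left 1 ⌊s⌋₊) hs hq'1 (hp.trans (le_max_left _ _)) (le_max_right _ _) hemb'
  obtain ⟨K, hK⟩ : ∃ K : ℝ, K = 1 + 2 * 2 ^ |s| := ⟨_, rfl⟩
  have h2s : (0 : ℝ) < 2 * 2 ^ |s| := by positivity
  have hK1 : 1 ≤ K := by linarith
  refine ⟨C * K + 1, W₀, L₀, by nlinarith, by omega, hL₀, fun W L hW hL f hf hB => ?_⟩
  have hq'0 : ENNReal.ofReal q' ≠ 0 := by
    rw [Ne, ENNReal.ofReal_eq_zero]
    linarith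
  have hfB : eLpNorm f q (volume.restrict (unitCube d)) ≤ besovNorm d s q r f := le_self_add
  by_cases hB0 : besovNorm d s q r f = 0
  · obtain ⟨g, hg, hg0⟩ := exists_zero_mem_NN (d := d) (L := L) (hW₀.trans hW)
    refine ⟨g, hg, ?_⟩
    have hf0 : f =ᵐ[volume.restrict (unitCube d)] 0 := by
      rw [hB0] at hfB
      exact (eLpNorm_eq_zero_iff hf.aestronglyMeasurable (by positivity)).1 (le_zero_iff.1 hfB)
    have : (fun x => f x - g x 0) =ᵐ[volume.restrict (unitCube d)] 0 := by
      filter_upwards [hf0] with x hx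
      simp [hx, hg0]
    rw [eLpNorm_congr_ae this, eLpNorm_zero]
    exact zero_le
  obtain ⟨B, hBdef⟩ : ∃ B, B = (besovNorm d s q r f).toReal := ⟨_, rfl⟩
  have hBpos : 0 < B := by
    rw [hBdef]
    exact ENNReal.toReal_pos hB0 hB.ne
  have hBe : besovNorm d s q r f = ENNReal.ofReal B := by
    rw [hBdef, ENNReal.ofReal_toReal hB.ne]
  rw [hBe] at hfB ⊢
  have hKB : 0 < K * B := by positivity
  have hnorm : ‖(K * B)⁻¹‖ₑ = ENNReal.ofReal (K * B)⁻¹ := Real.enorm_eq_ofReal (by positivity)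
  obtain ⟨g, hg, hgf⟩ := H W L hW hL (fun x => (K * B)⁻¹ * f x) (hf.const_mul _) (by
    have e : (fun x => (K * B)⁻¹ * f x) = (K * B)⁻¹ • f := rfl
    have h1 : eLpNorm f (ENNReal.ofReal q') (volume.restrict (unitCube d)) ≤ ENNReal.ofReal B :=
      (eLpNorm_le_eLpNorm_of_exponent_le hq'q hf.aestronglyMeasurable).trans hfB
    rw [e, eLpNorm_const_smul, hnorm]
    refine (mul_le_mul' le_rfl h1).trans ?_
    rw [← ENNReal.ofReal_mul (by positivity), ← ENNReal.ofReal_one]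
    refine ENNReal.ofReal_le_ofReal ?_
    rw [inv_mul_le_iff₀ hKB]
    nlinarith) (fun t ht => by
    refine (modulus_const_mul_le _ _ _ _ _).trans ?_
    have h1 := (modulus_le_modulus_of_exponent_le (k := ⌊s⌋₊ + 1) hq'q hq'0 hf t).trans
      (modulus_le_besovNorm s hr f ht)
    rw [hBe] at h1
    rw [hnorm]
    refine (mul_le_mul' le_rfl h1).trans ?_
    rw [← ENNReal.ofReal_mul (by positivity), ← ENNReal.ofReal_mul (by positivity),
      ← ENNReal.ofReal_mul (by positivity)]
    refine ENNReal.ofReal_le_ofReal ?_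
    have hts : 0 < t ^ s := Real.rpow_pos_of_pos ht s
    rw [inv_mul_le_iff₀ hKB]
    refine mul_le_mul_of_nonneg_right (mul_le_mul_of_nonneg_right ?_ hBpos.le) hts.le
    linarith)
  obtain ⟨g', hg', hgg⟩ := exists_NN_smul hg le_rfl (hW₀.trans hW) le_rfl (K * B)
  refine ⟨g', hg', ?_⟩
  have e : (fun x => f x - g' x 0) = (K * B) • fun x => (K * B)⁻¹ * f x - g x 0 := by
    funext x
    rw [Pi.smul_apply, smul_eq_mul, hgg]
    field_simp
  have hmeas : Measurable fun x => (K * B)⁻¹ * f x - g x 0 :=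
    (hf.const_mul _).sub ((measurable_pi_apply 0).comp (measurable_of_mem_NN hg))
  have hR : 0 ≤ ((W : ℝ) * (L : ℝ)) ^ (-(2 * s) / d) := by positivity
  rw [e, eLpNorm_const_smul, Real.enorm_eq_ofReal hKB.le]
  refine (mul_le_mul' le_rfl ((eLpNorm_le_eLpNorm_of_exponent_le (le_max_left p _)
    hmeas.aestronglyMeasurable).trans hgf)).trans ?_
  rw [← ENNReal.ofReal_mul hKB.le, ← ENNReal.ofReal_mul (by positivity),
    ← ENNReal.ofReal_mul (by positivity)]
  refine ENNReal.ofReal_le_ofReal ?_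
  nlinarith [mul_nonneg hBpos.le hR]
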